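/- Let X be an irreducible smooth projective variety of dimension d >= 2 over an algebraically closed field of characteristic 0, and let D be an ample divisor on X. Then there exists an integer n0 > 0 such that for all n >= n0 and for any closed point P0 on X, a general member of the linear system |nD|_{P0} is irreducible and smooth, where |nD|_{P0} is the linear system of effective divisors in |nD| passing through the point P0. -/

import Mathlib

open MvPolynomial

/-- Points of projective `n`-space over `k`. -/
abbrev ProjPt (k : Type) [Field k] (n : ℕ) : Type := Projectivization k (Fin (n+1) → k)

variable {k : Type} [Field k] {n : ℕ}

/-- A polynomial vanishes at a projective point if it vanishes on every
representative vector of the point. -/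
def VanishesAt (h : MvPolynomial (Fin (n+1)) k) (x : ProjPt k n) : Prop :=
  ∀ (v : Fin (n+1) → k) (hv : v ≠ 0), Projectivization.mk k v hv = x → eval v h = 0

/-- Common projective zero locus of a family of polynomials. -/
def projZeroLocus (I : Set (MvPolynomial (Fin (n+1)) k)) : Set (ProjPt k n) :=
  {x | ∀ h ∈ I, VanishesAt h x}

/-- Zariski-closed subsets of projective space: common zero loci of families of
homogeneous polynomials. -/
def IsClosedSub (S : Set (ProjPt k n)) : Prop :=
  ∃ I : Set (MvPolynomial (Fin (n+1)) k),
    (∀ h ∈ I, ∃ m : ℕ, h.IsHomogeneous m) ∧ S = projZeroLocus I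

/-- A subset is irreducible if it is nonempty and is not covered by two closed sets
unless it is contained in one of them. -/
def IsIrredSub (S : Set (ProjPt k n)) : Prop :=
  S.Nonempty ∧ ∀ C₁ C₂ : Set (ProjPt k n),
    IsClosedSub C₁ → IsClosedSub C₂ → S ⊆ C₁ ∪ C₂ → S ⊆ C₁ ∨ S ⊆ C₂

/-- `T` is an irreducible closed subset of `S` (in the subspace Zariski topology). -/
def IsClosedIrredIn (S T : Set (ProjPt k n)) : Prop :=
  T ⊆ S ∧ (∃ C, IsClosedSub C ∧ T = C ∩ S) ∧ IsIrredSub T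

/-- `S` has dimension at least `m` : there is a strictly increasing chain of `m+1`
irreducible closed subsets of `S`. -/
def DimGE (S : Set (ProjPt k n)) (m : ℕ) : Prop :=
  ∃ c : Fin (m+1) → Set (ProjPt k n), StrictMono c ∧ ∀ i, IsClosedIrredIn S (c i)

/-- `S` has (Krull) dimension exactly `d`. -/
def HasDim (S : Set (ProjPt k n)) (d : ℕ) : Prop :=
  DimGE S d ∧ ¬ DimGE S (d+1)

/-- The gradient vector of a polynomial at a vector. -/
noncomputable def gradientAt (h : MvPolynomial (Fin (n+1)) k) (v : Fin (n+1) → k) :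
    Fin (n+1) → k :=
  fun j => eval v (pderiv j h)

/-- The homogeneous polynomials vanishing identically on `S`. -/
def homVanishingPolys (S : Set (ProjPt k n)) : Set (MvPolynomial (Fin (n+1)) k) :=
  {h | (∃ m : ℕ, h.IsHomogeneous m) ∧ ∀ x ∈ S, VanishesAt h x}

/-- Jacobian criterion: `S` (of dimension `d`) is smooth at `x` if the span of the
gradients at `x` of the homogeneous polynomials vanishing on `S` has rank `n - d`. -/
def SmoothPtAt (S : Set (ProjPt k n)) (d : ℕ) (x : ProjPt k n) : Prop :=
  ∀ (v : Fin (n+1) → k) (hv : v ≠ 0), Projectivization.mk k v hv = x →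
    Module.finrank k
      ↥(Submodule.span k {w | ∃ h ∈ homVanishingPolys S, w = gradientAt h v}) = n - d

/-- `S` is an irreducible smooth projective variety of dimension `d`. -/
def IsSmoothVariety (S : Set (ProjPt k n)) (d : ℕ) : Prop :=
  IsClosedSub S ∧ IsIrredSub S ∧ HasDim S d ∧ ∀ x ∈ S, SmoothPtAt S d x

/-- Polynomial function on a `k`-vector space `W`. -/
def IsPolyFun (k : Type) [Field k] {W : Type} [AddCommGroup W] [Module k W] (F : W → k) : Prop :=
  ∃ (r : ℕ) (lam : Fin r → (W →ₗ[k] k)) (p : MvPolynomial (Fin r) k),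
    F = fun w => eval (fun i => lam i w) p

/-- Zariski-closed subsets of a `k`-vector space `W` : common zero loci of families
of polynomial functions. -/
def IsZClosed (k : Type) [Field k] {W : Type} [AddCommGroup W] [Module k W] (Z : Set W) : Prop :=
  ∃ ℱ : Set (W → k), (∀ F ∈ ℱ, IsPolyFun k F) ∧ Z = {w | ∀ F ∈ ℱ, F w = 0}

/-- `Z` is a cone: stable under scalar multiplication. -/
def IsCone (k : Type) [Field k] {W : Type} [AddCommGroup W] [Module k W] (Z : Set W) : Prop :=
  ∀ (c : k) (w : W), w ∈ Z → c • w ∈ Z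

/-- `q` points of projective space are in general position: if `q < n+1` their
representative vectors are linearly independent; if `q = n+1` any `n` of them are
linearly independent. -/
def InGeneralPosition {q : ℕ} (P : Fin q → ProjPt k n) : Prop :=
  if q < n + 1 then LinearIndependent k (fun s => (P s).rep)
  else ∀ s : Fin q, LinearIndependent k (fun t : {t : Fin q // t ≠ s} => (P t.1).rep)
/-- The ideal of polynomials vanishing identically on `S ⊆ ℙⁿ`. -/
def vanishingIdeal (S : Set (ProjPt k n)) : Ideal (MvPolynomial (Fin (n+1)) k) where
  carrier := {f | ∀ x ∈ S, VanishesAt f x}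
  zero_mem' := by intro x hx v hv hvx; simp
  add_mem' := by
    intro a b ha hb x hx v hv hvx
    simp [map_add, ha x hx v hv hvx, hb x hx v hv hvx]
  smul_mem' := by
    intro c a ha x hx v hv hvx
    simp [smul_eq_mul, map_mul, ha x hx v hv hvx]

/-- A prime divisor on the `d`-dimensional variety `X`: a closed irreducible subset
of `X` of dimension `d - 1` (codimension one). -/
def IsPrimeDivisorOn (X : Set (ProjPt k n)) (d : ℕ) (Y : Set (ProjPt k n)) : Prop :=
  Y ⊆ X ∧ IsClosedSub Y ∧ IsIrredSub Y ∧ HasDim Y (d - 1)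

/-- The order of vanishing of the polynomial `g` along the prime divisor `Y` of `X`,
defined via symbolic powers of the vanishing ideal of `Y` in the coordinate ring of `X`. -/
noncomputable def ordAlong (X Y : Set (ProjPt k n)) (g : MvPolynomial (Fin (n+1)) k) : ℕ :=
  sSup {r : ℕ | ∃ s : MvPolynomial (Fin (n+1)) k, s ∉ vanishingIdeal Y ∧
    s * g ∈ (vanishingIdeal Y) ^ r ⊔ vanishingIdeal X}

/-- A (Weil) divisor on `X` (of dimension `d`): an integer-valued function on the
prime divisors of `X`. -/
def DivisorOn (X : Set (ProjPt k n)) (d : ℕ) : Type :=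
  {Y : Set (ProjPt k n) // IsPrimeDivisorOn X d Y} → ℤ

/-- A divisor proper has finite support. -/
def HasFiniteSupport {X : Set (ProjPt k n)} {d : ℕ} (D : DivisorOn X d) : Prop :=
  {Y | D Y ≠ 0}.Finite

/-- An effective divisor. -/
def EffectiveDiv {X : Set (ProjPt k n)} {d : ℕ} (D : DivisorOn X d) : Prop :=
  ∀ Y, 0 ≤ D Y

/-- Linear equivalence of divisors on `X`: the difference is the divisor of a rational
function on `X`, i.e. of a ratio of two homogeneous polynomials of equal degree not
vanishing identically on `X`. -/
def LinEquivDiv {X : Set (ProjPt k n)} {d : ℕ} (D D' : DivisorOn X d) : Prop :=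
  ∃ (e : ℕ) (g h : MvPolynomial (Fin (n+1)) k),
    g.IsHomogeneous e ∧ h.IsHomogeneous e ∧
    g ∉ vanishingIdeal X ∧ h ∉ vanishingIdeal X ∧
    ∀ Y, D Y - D' Y = (ordAlong X Y.1 g : ℤ) - (ordAlong X Y.1 h : ℤ)

/-- A divisor passes through the point `P` if `P` lies on a component appearing in it. -/
def DivThrough {X : Set (ProjPt k n)} {d : ℕ} (D : DivisorOn X d) (P : ProjPt k n) : Prop :=
  ∃ Y, D Y ≠ 0 ∧ P ∈ Y.1

/-- `φ : ℙⁿ → ℙᵐ` restricts to a morphism on `X`: at every point of `X` it admits a local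
presentation by homogeneous forms of a common degree, valid wherever the forms do not all
vanish. -/
def IsMorphismOn {m : ℕ} (X : Set (ProjPt k n)) (φ : ProjPt k n → ProjPt k m) : Prop :=
  ∀ x ∈ X, ∃ (e : ℕ) (g : Fin (m+1) → MvPolynomial (Fin (n+1)) k),
    (∀ j, (g j).IsHomogeneous e) ∧ (∃ j, ¬ VanishesAt (g j) x) ∧
    ∀ y ∈ X, ∀ (v : Fin (n+1) → k) (hv : v ≠ 0), Projectivization.mk k v hv = y →
      ∀ hgv : (fun j => MvPolynomial.eval v (g j)) ≠ 0,
        Projectivization.mk k (fun j => MvPolynomial.eval v (g j)) hgv = φ y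

/-- `φ` is an isomorphism from `X` onto the closed subvariety `X'` of `ℙᵐ`, with inverse
morphism `ψ`. -/
def IsIsoOnto {m : ℕ} (X : Set (ProjPt k n)) (φ : ProjPt k n → ProjPt k m)
    (X' : Set (ProjPt k m)) (ψ : ProjPt k m → ProjPt k n) : Prop :=
  IsMorphismOn X φ ∧ X' = φ '' X ∧ IsClosedSub X' ∧ Set.InjOn φ X ∧
  IsMorphismOn X' ψ ∧ ∀ x ∈ X, ψ (φ x) = x

/-- `D'` is the pullback under `φ` of the hyperplane `ℓ = 0` of `ℙᵐ`: on each prime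
divisor `Y` its multiplicity is computed, via any presentation `g` of `φ` generically
valid along `Y`, as `ord_Y ℓ(g) − ord_Y gⱼ`. -/
def IsHyperplanePullback {m : ℕ} (X : Set (ProjPt k n)) (d : ℕ)
    (φ : ProjPt k n → ProjPt k m) (ℓ : MvPolynomial (Fin (m+1)) k)
    (D' : DivisorOn X d) : Prop :=
  ∀ (Y : {Y : Set (ProjPt k n) // IsPrimeDivisorOn X d Y})
    (e : ℕ) (g : Fin (m+1) → MvPolynomial (Fin (n+1)) k) (j : Fin (m+1)),
    (∀ j', (g j').IsHomogeneous e) →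
    (∀ y ∈ X, ∀ (v : Fin (n+1) → k) (hv : v ≠ 0), Projectivization.mk k v hv = y →
      ∀ hgv : (fun j' => MvPolynomial.eval v (g j')) ≠ 0,
        Projectivization.mk k (fun j' => MvPolynomial.eval v (g j')) hgv = φ y) →
    g j ∉ vanishingIdeal Y.1 →
    D' Y = (ordAlong X Y.1 (MvPolynomial.aeval g ℓ) : ℤ) - (ordAlong X Y.1 (g j) : ℤ)

/-- `D` is an ample divisor on `X`: some positive multiple `m₀ • D` is linearly equivalent
to the pullback of a hyperplane under an isomorphism of `X` onto a closed subvariety of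
some projective space. -/
def IsAmpleDiv (X : Set (ProjPt k n)) (d : ℕ) (D : DivisorOn X d) : Prop :=
  ∃ (m₀ : ℕ), 0 < m₀ ∧ ∃ (m : ℕ) (φ : ProjPt k n → ProjPt k m) (X' : Set (ProjPt k m))
    (ψ : ProjPt k m → ProjPt k n), IsIsoOnto X φ X' ψ ∧
    ∃ ℓ : MvPolynomial (Fin (m+1)) k, ℓ.IsHomogeneous 1 ∧
      (ℓ ∉ vanishingIdeal X') ∧
      ∃ D' : DivisorOn X d, IsHyperplanePullback X d φ ℓ D' ∧
        LinEquivDiv (fun Y => (m₀ : ℤ) * D Y) D'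

section Part1
open MvPolynomial
namespace Bt
variable {k : Type} [Field k] {n : ℕ}
attribute [local instance] MvPolynomial.gradedAlgebra

/-- the homogeneous vanishing ideal -/
abbrev IX (S : Set (ProjPt k n)) : Ideal (MvPolynomial (Fin (n+1)) k) := _root_.vanishingIdeal S

/-- nonzero vectors of the affine cone -/
def cone (S : Set (ProjPt k n)) : Set (Fin (n+1) → k) :=
  {v | ∃ hv : v ≠ 0, Projectivization.mk k v hv ∈ S}

/-- homogeneous ideals -/
def HomI (I : Ideal (MvPolynomial (Fin (n+1)) k)) : Prop :=
  ∀ f ∈ I, ∀ i, homogeneousComponent i f ∈ I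

/-- projective zero locus of an ideal -/
def ZP (I : Ideal (MvPolynomial (Fin (n+1)) k)) : Set (ProjPt k n) :=
  {x | ∀ f ∈ I, VanishesAt f x}

lemma mem_cone_mk {S : Set (ProjPt k n)} {v : Fin (n+1) → k} (hv : v ≠ 0) :
    v ∈ cone S ↔ Projectivization.mk k v hv ∈ S :=
  ⟨fun ⟨_, h⟩ => h, fun h => ⟨hv, h⟩⟩

lemma cone_ne_zero {S : Set (ProjPt k n)} {v : Fin (n+1) → k} (hv : v ∈ cone S) : v ≠ 0 := hv.1

lemma cone_smul {S : Set (ProjPt k n)} {v : Fin (n+1) → k} (hv : v ∈ cone S) {c : k} (hc : c ≠ 0) :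
    c • v ∈ cone S := by
  obtain ⟨h0, h⟩ := hv
  refine ⟨smul_ne_zero hc h0, ?_⟩
  have : Projectivization.mk k (c • v) (smul_ne_zero hc h0) = Projectivization.mk k v h0 := by
    rw [Projectivization.mk_eq_mk_iff']
    exact ⟨c, rfl⟩
  rwa [this]

lemma cone_rep {S : Set (ProjPt k n)} {x : ProjPt k n} (hx : x ∈ S) : x.rep ∈ cone S :=
  ⟨x.rep_nonzero, by rwa [Projectivization.mk_rep]⟩

lemma mem_IX {S : Set (ProjPt k n)} {f : MvPolynomial (Fin (n+1)) k} :
    f ∈ IX S ↔ ∀ v ∈ cone S, eval v f = 0 := by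
  constructor
  · rintro h v ⟨hv, hS⟩
    exact h _ hS v hv rfl
  · intro h x hx v hv hvx
    exact h v ⟨hv, hvx ▸ hx⟩

lemma aeval_mul_hom {σ A : Type*} [CommRing A] [Algebra k A] {f : MvPolynomial σ k} {m : ℕ}
    (hf : f.IsHomogeneous m) (w : σ → A) (c : A) :
    aeval (fun i => c * w i) f = c ^ m * aeval w f := by
  rw [aeval_def, aeval_def, eval₂_eq, eval₂_eq, Finset.mul_sum]
  refine Finset.sum_congr rfl fun d hd => ?_
  have hdm : ∑ i ∈ d.support, d i = m := by
    have := hf (mem_support_iff.mp hd)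
    simpa [Finsupp.weight_apply, Finsupp.sum] using this
  simp only [mul_pow, Finset.prod_mul_distrib, Finset.prod_pow_eq_pow_sum, hdm]
  ring

lemma eval_smul_hom {f : MvPolynomial (Fin (n+1)) k} {m : ℕ}
    (hf : f.IsHomogeneous m) (v : Fin (n+1) → k) (c : k) :
    eval (c • v) f = c ^ m * eval v f := by
  have := aeval_mul_hom hf v c
  simp only [aeval_def, Algebra.algebraMap_self] at this
  exact this

lemma vanishesAt_mk {f : MvPolynomial (Fin (n+1)) k} {m : ℕ} (hf : f.IsHomogeneous m)
    {v : Fin (n+1) → k} (hv : v ≠ 0) :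
    VanishesAt f (Projectivization.mk k v hv) ↔ eval v f = 0 := by
  constructor
  · intro h; exact h v hv rfl
  · intro h w hw hwv
    rw [Projectivization.mk_eq_mk_iff'] at hwv
    obtain ⟨c, rfl⟩ := hwv
    rw [eval_smul_hom hf, h, mul_zero]

lemma sum_comp_eval [Infinite k] {f : MvPolynomial (Fin (n+1)) k} {v : Fin (n+1) → k}
    (h : ∀ c : k, c ≠ 0 → eval (c • v) f = 0) (i : ℕ) :
    eval v (homogeneousComponent i f) = 0 := by
  set N := f.totalDegree + 1
  let q : Polynomial k := ∑ j ∈ Finset.range N,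
    Polynomial.monomial j (eval v (homogeneousComponent j f))
  have hq : ∀ c, q.eval c = eval (c • v) f := by
    intro c
    conv_rhs => rw [← sum_homogeneousComponent f]
    simp only [q, Polynomial.eval_finsetSum, Polynomial.eval_monomial, map_sum]
    refine Finset.sum_congr rfl fun j _ => ?_
    rw [eval_smul_hom (homogeneousComponent_isHomogeneous j f), mul_comm]
  have h0 : q * Polynomial.X = 0 := by
    apply Polynomial.funext
    intro c
    by_cases hc : c = 0
    · simp [hc]
    · simp [hq, h c hc]
  have h1 : q = 0 := by
    rcases mul_eq_zero.mp h0 with h | h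
    · exact h
    · exact absurd h Polynomial.X_ne_zero
  by_cases hi : i < N
  · have := congrArg (fun p => Polynomial.coeff p i) h1
    simpa [q, Polynomial.finsetSum_coeff, Polynomial.coeff_monomial, hi] using this
  · rw [homogeneousComponent_eq_zero _ _ (by omega)]; simp

lemma IX_hom [Infinite k] (S : Set (ProjPt k n)) : HomI (IX S) := by
  intro f hf i
  rw [mem_IX] at hf ⊢
  intro v hv
  exact sum_comp_eval (fun c hc => hf _ (cone_smul hv hc)) i

lemma HomI.mem_iff {I : Ideal (MvPolynomial (Fin (n+1)) k)} (hI : HomI I)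
    {f : MvPolynomial (Fin (n+1)) k} : f ∈ I ↔ ∀ i, homogeneousComponent i f ∈ I := by
  refine ⟨hI f, fun h => ?_⟩
  rw [← sum_homogeneousComponent f]
  exact Ideal.sum_mem _ fun i _ => h i

lemma HomI.iff {I : Ideal (MvPolynomial (Fin (n+1)) k)} :
    HomI I ↔ I.IsHomogeneous (homogeneousSubmodule (Fin (n+1)) k) := by
  constructor
  · intro h i f hf
    have := h f hf i
    rwa [← decomposition.decompose'_apply] at this
  · intro h f hf i
    exact homogeneousComponent_mem_of_mem h hf i

lemma mem_cone_ZP {I : Ideal (MvPolynomial (Fin (n+1)) k)} (hI : HomI I) {v : Fin (n+1) → k} :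
    v ∈ cone (ZP I) ↔ v ≠ 0 ∧ ∀ f ∈ I, eval v f = 0 := by
  constructor
  · rintro ⟨hv, h⟩
    exact ⟨hv, fun f hf => h f hf v hv rfl⟩
  · rintro ⟨hv, h⟩
    refine ⟨hv, fun f hf w hw hwv => ?_⟩
    rw [← sum_homogeneousComponent f, map_sum]
    refine Finset.sum_eq_zero fun i _ => ?_
    have := (vanishesAt_mk (homogeneousComponent_isHomogeneous i f) hv).mpr (h _ (hI f hf i))
    exact this w hw hwv

lemma isClosed_ZP {I : Ideal (MvPolynomial (Fin (n+1)) k)} (hI : HomI I) : IsClosedSub (ZP I) := by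
  refine ⟨{f | f ∈ I ∧ ∃ m : ℕ, f.IsHomogeneous m}, fun h hh => hh.2, ?_⟩
  ext x
  induction x using Projectivization.ind with
  | h v hv =>
    constructor
    · intro h f hf; exact h f hf.1
    · intro h
      rw [← mem_cone_mk hv, mem_cone_ZP hI]
      refine ⟨hv, fun f hf => ?_⟩
      rw [← sum_homogeneousComponent f, map_sum]
      refine Finset.sum_eq_zero fun i _ => ?_
      exact h _ ⟨hI f hf i, i, homogeneousComponent_isHomogeneous i f⟩ v hv rfl

lemma subset_ZP_IX (S : Set (ProjPt k n)) : S ⊆ ZP (IX S) := fun x hx f hf => hf x hx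

lemma closed_eq {S : Set (ProjPt k n)} (hS : IsClosedSub S) : ZP (IX S) = S := by
  refine Set.Subset.antisymm ?_ (subset_ZP_IX S)
  obtain ⟨I, hI, rfl⟩ := hS
  intro x hx f hf
  exact hx f (fun y hy => hy f hf)

lemma IX_anti {S T : Set (ProjPt k n)} (h : S ⊆ T) : IX T ≤ IX S := fun _ hf x hx => hf x (h hx)

lemma ZP_anti {I J : Ideal (MvPolynomial (Fin (n+1)) k)} (h : I ≤ J) : ZP J ⊆ ZP I :=
  fun _ hx f hf => hx f (h hf)

/-- membership of a vector in the cone of a closed set -/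
lemma mem_cone_closed [Infinite k] {S : Set (ProjPt k n)} (hS : IsClosedSub S) {v : Fin (n+1) → k} :
    v ∈ cone S ↔ v ≠ 0 ∧ ∀ f ∈ IX S, eval v f = 0 := by
  conv_lhs => rw [← closed_eq hS]
  exact mem_cone_ZP (IX_hom S)

lemma exists_sep [Infinite k] {S : Set (ProjPt k n)} (hS : IsClosedSub S) {v : Fin (n+1) → k}
    (hv : v ≠ 0) (h : v ∉ cone S) :
    ∃ f ∈ IX S, (∃ m, f.IsHomogeneous m) ∧ eval v f ≠ 0 := by
  rw [mem_cone_closed hS] at h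
  push Not at h
  obtain ⟨f, hf, hfv⟩ := h hv
  by_contra hc
  push Not at hc
  apply hfv
  rw [← sum_homogeneousComponent f, map_sum]
  refine Finset.sum_eq_zero fun i _ => ?_
  exact hc _ (IX_hom S f hf i) ⟨i, homogeneousComponent_isHomogeneous i f⟩

lemma IX_prime [Infinite k] {S : Set (ProjPt k n)} (hS : IsIrredSub S) : (IX S).IsPrime := by
  have hne := hS.1
  have hI := HomI.iff.mp (IX_hom S)
  have hunion : ∀ f g : MvPolynomial (Fin (n+1)) k, f * g ∈ IX S → (∃ m, f.IsHomogeneous m) →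
      (∃ m, g.IsHomogeneous m) → f ∈ IX S ∨ g ∈ IX S := by
    intro f g hfg hf hg
    have hc : ∀ f : MvPolynomial (Fin (n+1)) k, (∃ m, f.IsHomogeneous m) →
      IsClosedSub (projZeroLocus {f}) := fun f hf => ⟨{f}, by simpa using hf, rfl⟩
    obtain ⟨mf, hmf⟩ := hf
    obtain ⟨mg, hmg⟩ := hg
    have := hS.2 _ _ (hc f ⟨_, hmf⟩) (hc g ⟨_, hmg⟩) (by
      intro x hx
      induction x using Projectivization.ind with
      | h v hv =>
        have := mem_IX.mp hfg v ((mem_cone_mk hv).mpr hx)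
        rw [map_mul, mul_eq_zero] at this
        rcases this with h | h
        · left; intro q hq; rw [Set.mem_singleton_iff.mp hq]; exact (vanishesAt_mk hmf hv).mpr h
        · right; intro q hq; rw [Set.mem_singleton_iff.mp hq]; exact (vanishesAt_mk hmg hv).mpr h)
    rcases this with h | h
    · left; intro x hx; exact h hx f rfl
    · right; intro x hx; exact h hx g rfl
  refine hI.isPrime_of_homogeneous_mem_or_mem ?_ ?_
  · intro h
    obtain ⟨x, hx⟩ := hne
    have h1 : (1 : MvPolynomial (Fin (n+1)) k) ∈ IX S := by rw [h]; trivial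
    have := mem_IX.mp h1 _ (cone_rep hx)
    simp at this
  · rintro f g ⟨i, hf⟩ ⟨j, hg⟩ hfg
    exact hunion f g hfg ⟨i, hf⟩ ⟨j, hg⟩

lemma irred_of_prime [Infinite k] {S : Set (ProjPt k n)} (hne : S.Nonempty) (hS : (IX S).IsPrime) :
    IsIrredSub S := by
  refine ⟨hne, fun C₁ C₂ h1 h2 hSC => ?_⟩
  by_contra hc
  push Not at hc
  obtain ⟨⟨x, hx, hx1⟩, ⟨y, hy, hy1⟩⟩ := And.imp Set.not_subset.mp Set.not_subset.mp hc
  have hx1' : x.rep ∉ cone C₁ := by rwa [mem_cone_mk x.rep_nonzero, Projectivization.mk_rep]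
  have hy1' : y.rep ∉ cone C₂ := by rwa [mem_cone_mk y.rep_nonzero, Projectivization.mk_rep]
  obtain ⟨f, hf, -, hfx⟩ := exists_sep h1 x.rep_nonzero hx1'
  obtain ⟨g, hg, -, hgx⟩ := exists_sep h2 y.rep_nonzero hy1'
  have : f * g ∈ IX S := by
    rw [mem_IX]
    rintro v ⟨hv, hvS⟩
    rcases hSC hvS with h | h
    · rw [map_mul, mem_IX.mp hf v ⟨hv, h⟩, zero_mul]
    · rw [map_mul, mem_IX.mp hg v ⟨hv, h⟩, mul_zero]
  rcases hS.mem_or_mem this with h | h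
  · exact hfx (mem_IX.mp h _ (cone_rep hx))
  · exact hgx (mem_IX.mp h _ (cone_rep hy))

/-- projective Nullstellensatz -/
lemma nullst [IsAlgClosed k] {I : Ideal (MvPolynomial (Fin (n+1)) k)}
    {f : MvPolynomial (Fin (n+1)) k} (h : ∀ v, v ≠ 0 → (∀ g ∈ I, eval v g = 0) → eval v f = 0)
    (i : Fin (n+1)) : X i * f ∈ I.radical := by
  rw [← MvPolynomial.vanishingIdeal_zeroLocus_eq_radical (K := k)]
  rw [mem_vanishingIdeal_iff]
  intro v hv
  by_cases h0 : v = 0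
  · simp [h0]
  · have := h v h0 (fun g hg => by simpa [aeval_def, eval₂_id] using hv g hg)
    simp [aeval_def, this]

lemma IX_ZP [IsAlgClosed k] {P : Ideal (MvPolynomial (Fin (n+1)) k)} (hP : P.IsPrime) (hh : HomI P)
    {i : Fin (n+1)} (hi : X i ∉ P) : IX (ZP P) = P := by
  apply le_antisymm
  · intro f hf
    rw [mem_IX] at hf
    have := nullst (I := P) (f := f) (fun v hv hg => hf v ((mem_cone_ZP hh).mpr ⟨hv, hg⟩)) i
    rw [hP.radical] at this
    exact (hP.mem_or_mem this).resolve_left hi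
  · intro f hf
    rw [mem_IX]
    intro v hv
    exact ((mem_cone_ZP hh).mp hv).2 f hf

lemma ZP_nonempty [IsAlgClosed k] {P : Ideal (MvPolynomial (Fin (n+1)) k)} (hP : P.IsPrime) (hh : HomI P)
    {i : Fin (n+1)} (hi : X i ∉ P) : (ZP P).Nonempty := by
  by_contra hc
  rw [Set.not_nonempty_iff_eq_empty] at hc
  have h1 := IX_ZP hP hh hi
  apply hP.ne_top
  rw [← h1, Ideal.eq_top_iff_one, mem_IX]
  rintro v ⟨hv, h⟩
  rw [hc] at h; exact h.elim

lemma irred_ZP [IsAlgClosed k] {P : Ideal (MvPolynomial (Fin (n+1)) k)} (hP : P.IsPrime) (hh : HomI P)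
    {i : Fin (n+1)} (hi : X i ∉ P) : IsIrredSub (ZP P) := by
  have : Infinite k := IsAlgClosed.instInfinite
  exact irred_of_prime (ZP_nonempty hP hh hi) (by rw [IX_ZP hP hh hi]; exact hP)

lemma exists_X_notMem {S : Set (ProjPt k n)} (hS : S.Nonempty) : ∃ i, X i ∉ IX S := by
  obtain ⟨x, hx⟩ := hS
  by_contra hc
  push Not at hc
  apply x.rep_nonzero
  funext i
  have := mem_IX.mp (hc i) _ (cone_rep hx)
  simpa using this

lemma minimalPrimes_hom {I P : Ideal (MvPolynomial (Fin (n+1)) k)} (hI : HomI I)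
    (hP : P ∈ I.minimalPrimes) : HomI P := by
  rw [HomI.iff] at hI ⊢
  have hp : P.IsPrime := hP.1.1
  have h1 := hp.homogeneousCore (𝒜 := homogeneousSubmodule (Fin (n+1)) k)
  have h2 : I ≤ (P.homogeneousCore (homogeneousSubmodule (Fin (n+1)) k)).toIdeal := by
    rw [← hI.toIdeal_homogeneousCore_eq_self]
    exact Ideal.homogeneousCore_mono _ hP.1.2
  have h3 := hP.2 ⟨h1, h2⟩ (Ideal.toIdeal_homogeneousCore_le _ P)
  rw [Ideal.IsHomogeneous.iff_eq]
  exact le_antisymm (Ideal.toIdeal_homogeneousCore_le _ P) h3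

end Bt
end Part1

section Part2
open MvPolynomial
namespace Bt
set_option linter.unusedSectionVars false
set_option linter.unusedVariables false
variable {k : Type} [Field k] {n : ℕ}

/-- linear form with coefficient vector `a` -/
noncomputable def lin (a : Fin (n+1) → k) : MvPolynomial (Fin (n+1)) k := ∑ i, C (a i) * X i

lemma eval_lin (a v : Fin (n+1) → k) : eval v (lin a) = a ⬝ᵥ v := by
  simp [lin, dotProduct]

lemma lin_hom (a : Fin (n+1) → k) : (lin a).IsHomogeneous 1 := by
  apply IsHomogeneous.sum
  intro i _
  simpa using (isHomogeneous_C (Fin (n+1)) (a i)).mul (isHomogeneous_X k i)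

/-- hyperplane -/
def hyp (a : Fin (n+1) → k) : Set (ProjPt k n) := {x | VanishesAt (lin a) x}

lemma mem_hyp_mk {a v : Fin (n+1) → k} (hv : v ≠ 0) :
    Projectivization.mk k v hv ∈ hyp a ↔ a ⬝ᵥ v = 0 := by
  rw [← eval_lin]; exact vanishesAt_mk (lin_hom a) hv

lemma mem_cone_hyp {a v : Fin (n+1) → k} : v ∈ cone (hyp a) ↔ v ≠ 0 ∧ a ⬝ᵥ v = 0 := by
  constructor
  · rintro ⟨hv, h⟩; exact ⟨hv, (mem_hyp_mk hv).mp h⟩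
  · rintro ⟨hv, h⟩; exact ⟨hv, (mem_hyp_mk hv).mpr h⟩

lemma isClosed_hyp (a : Fin (n+1) → k) : IsClosedSub (hyp a) :=
  ⟨{lin a}, by simpa using ⟨1, lin_hom a⟩, by ext x; simp [hyp, projZeroLocus]⟩

lemma isClosed_iInter {ι : Type*} {S : ι → Set (ProjPt k n)} (h : ∀ i, IsClosedSub (S i)) :
    IsClosedSub (⋂ i, S i) := by
  choose I hI hS using h
  refine ⟨⋃ i, I i, ?_, ?_⟩
  · intro f hf
    obtain ⟨i, hi⟩ := Set.mem_iUnion.mp hf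
    exact hI i f hi
  · ext x
    simp only [Set.mem_iInter, hS, projZeroLocus, Set.mem_ofPred_eq, Set.mem_iUnion]
    constructor
    · rintro h f ⟨i, hi⟩; exact h i f hi
    · intro h i f hf; exact h f ⟨i, hf⟩

lemma isClosed_inter {S T : Set (ProjPt k n)} (h : IsClosedSub S) (h' : IsClosedSub T) :
    IsClosedSub (S ∩ T) := by
  rw [Set.inter_eq_iInter]
  apply isClosed_iInter
  rintro (_ | _) <;> simpa

lemma isClosed_empty : IsClosedSub (∅ : Set (ProjPt k n)) := by
  refine ⟨{1}, by simpa using ⟨0, isHomogeneous_one _ _⟩, ?_⟩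
  ext x
  simp only [Set.mem_empty_iff_false, projZeroLocus, Set.mem_singleton_iff, forall_eq,
    Set.mem_ofPred_eq, false_iff]
  intro h
  have := h x.rep x.rep_nonzero x.mk_rep
  simp at this

lemma closedIrredIn_iff {S T : Set (ProjPt k n)} (hS : IsClosedSub S) :
    IsClosedIrredIn S T ↔ T ⊆ S ∧ IsClosedSub T ∧ IsIrredSub T := by
  constructor
  · rintro ⟨h1, ⟨C, hC, rfl⟩, h3⟩
    exact ⟨h1, isClosed_inter hC hS, h3⟩
  · rintro ⟨h1, h2, h3⟩
    exact ⟨h1, ⟨T, h2, (Set.inter_eq_left.mpr h1).symm⟩, h3⟩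

variable [IsAlgClosed k]

lemma components {T : Set (ProjPt k n)} (hT : IsClosedSub T) :
    ∃ F : Set (Set (ProjPt k n)), F.Finite ∧
      (∀ W ∈ F, IsClosedSub W ∧ IsIrredSub W ∧ W ⊆ T) ∧
      ∀ D, IsIrredSub D → D ⊆ T → ∃ W ∈ F, D ⊆ W := by
  have : Infinite k := IsAlgClosed.instInfinite
  let F : Set (Set (ProjPt k n)) := ZP '' {P | P ∈ (IX T).minimalPrimes ∧ ∃ i, X i ∉ P}
  refine ⟨F, Set.Finite.image _ ((Ideal.finite_minimalPrimes_of_isNoetherianRing _ (IX T)).subset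
    (fun P hP => hP.1)), ?_, ?_⟩
  · rintro _ ⟨P, ⟨hP, i, hi⟩, rfl⟩
    have hh := minimalPrimes_hom (IX_hom T) hP
    refine ⟨isClosed_ZP hh, irred_ZP hP.1.1 hh hi, ?_⟩
    have := ZP_anti hP.1.2
    rwa [closed_eq hT] at this
  · intro D hD hDT
    have hp := IX_prime hD
    obtain ⟨P, hP, hPD⟩ := Ideal.exists_minimalPrimes_le (J := IX D) (IX_anti hDT)
    obtain ⟨i, hi⟩ := exists_X_notMem hD.1
    exact ⟨ZP P, ⟨P, ⟨hP, i, fun h => hi (hPD h)⟩, rfl⟩,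
      (subset_ZP_IX D).trans (ZP_anti hPD)⟩

/-- avoiding finitely many subspaces -/
lemma avoid (U : Submodule k (Fin (n+1) → k)) (s : Set (Submodule k (Fin (n+1) → k)))
    (hs : s.Finite) (h : ∀ p ∈ s, ¬ U ≤ p) : ∃ a ∈ U, ∀ p ∈ s, a ∉ p := by
  have : Infinite k := IsAlgClosed.instInfinite
  classical
  let t : Set (Subspace k U) := (fun p => Submodule.comap U.subtype p) '' s
  have ht : t.Finite := hs.image _
  have h1 := Subspace.biUnion_ne_univ_of_top_notMem (s := ht.toFinset) (by
    rw [Set.Finite.mem_toFinset]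
    rintro ⟨p, hp, hpt⟩
    apply h p hp
    intro x hx
    have : (⟨x, hx⟩ : U) ∈ Submodule.comap U.subtype p := by
      change (⟨x, hx⟩ : U) ∈ (fun p => Submodule.comap U.subtype p) p
      rw [hpt]; trivial
    simpa using this)
  rw [Ne, Set.eq_univ_iff_forall, not_forall] at h1
  obtain ⟨a, ha⟩ := h1
  refine ⟨a, a.2, fun p hp hap => ha ?_⟩
  simp only [Set.mem_iUnion]
  exact ⟨_, ht.mem_toFinset.mpr ⟨p, hp, rfl⟩, by simpa using hap⟩

/-- annihilator of a set of points -/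
def ann (W : Set (ProjPt k n)) : Submodule k (Fin (n+1) → k) where
  carrier := {a | ∀ v ∈ cone W, a ⬝ᵥ v = 0}
  zero_mem' := by intro v _; simp
  add_mem' := by intro a b ha hb v hv; simp [add_dotProduct, ha v hv, hb v hv]
  smul_mem' := by intro c a ha v hv; simp [smul_dotProduct, ha v hv]

lemma mem_ann {W : Set (ProjPt k n)} {a : Fin (n+1) → k} : a ∈ ann W ↔ W ⊆ hyp a := by
  constructor
  · intro h x hx
    induction x using Projectivization.ind with
    | h v hv => exact (mem_hyp_mk hv).mpr (h v ((mem_cone_mk hv).mpr hx))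
  · rintro h v ⟨hv, hx⟩
    exact (mem_hyp_mk hv).mp (h hx)

lemma dimGE_zero {T : Set (ProjPt k n)} (hT : IsClosedSub T) (hne : T.Nonempty) : DimGE T 0 := by
  have : Infinite k := IsAlgClosed.instInfinite
  have hI : IX T ≠ ⊤ := by
    intro h
    obtain ⟨x, hx⟩ := hne
    have h1 : (1 : MvPolynomial (Fin (n+1)) k) ∈ IX T := by rw [h]; trivial
    have := mem_IX.mp h1 _ (cone_rep hx)
    simp at this
  -- a point's closure
  obtain ⟨x, hx⟩ := hne
  have hp : (IX ({x} : Set (ProjPt k n))).IsPrime := by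
    have key : ∀ f, f ∈ IX ({x} : Set (ProjPt k n)) ↔ VanishesAt f x := by
      intro f; exact ⟨fun h => h x rfl, fun h y hy => by rw [Set.mem_singleton_iff.mp hy]; exact h⟩
    apply IX_prime
    refine ⟨⟨x, rfl⟩, fun C₁ C₂ _ _ h => ?_⟩
    rcases h (Set.mem_singleton x) with h | h
    · left; simpa using h
    · right; simpa using h
  obtain ⟨i, hi⟩ := exists_X_notMem (Set.singleton_nonempty x)
  refine ⟨fun _ => ZP (IX {x}), ?_, fun _ => ?_⟩
  · intro i j hij; exfalso; have h1 := i.2; have h2 := j.2; rw [Fin.lt_def] at hij; omega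
  · rw [closedIrredIn_iff hT]
    refine ⟨?_, isClosed_ZP (IX_hom _), irred_ZP hp (IX_hom _) hi⟩
    have := ZP_anti (IX_anti (Set.singleton_subset_iff.mpr hx))
    rwa [closed_eq hT] at this

/-- extend chain at the top -/
lemma dimGE_succ {S T : Set (ProjPt k n)} (hT : IsClosedSub T) (hS : IsClosedSub S) {j : ℕ}
    {c : Fin (j+1) → Set (ProjPt k n)} (hc : StrictMono c) (hc' : ∀ i, IsClosedIrredIn S (c i))
    {W : Set (ProjPt k n)} (hW : IsClosedSub W) (hW' : IsIrredSub W) (hWT : W ⊆ T)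
    (h : c (Fin.last j) ⊂ W) : DimGE T (j+1) := by
  refine ⟨Fin.snoc c W, ?_, ?_⟩
  · rw [Fin.strictMono_iff_lt_succ]
    intro i
    refine Fin.lastCases ?_ (fun i => ?_) i
    · simpa using h
    · rw [Fin.snoc_castSucc, Fin.succ_castSucc, Fin.snoc_castSucc]
      exact hc (Fin.castSucc_lt_succ)
  · intro i
    rw [closedIrredIn_iff hT]
    refine Fin.lastCases ?_ (fun i => ?_) i
    · simpa using ⟨hWT, hW, hW'⟩
    · simp only [Fin.snoc_castSucc]
      obtain ⟨h1, h2, h3⟩ := (closedIrredIn_iff hS).mp (hc' i)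
      exact ⟨((hc.monotone (Fin.le_last i)).trans h.1).trans hWT, h2, h3⟩

lemma dimGE_cut {T : Set (ProjPt k n)} (hT : IsClosedSub T) {a : Fin (n+1) → k} {j : ℕ}
    (B : Set (Set (ProjPt k n)))
    (ha : ∀ D, IsIrredSub D → D ⊆ T → ∃ W, IsClosedSub W ∧ IsIrredSub W ∧ W ⊆ T ∧ D ⊆ W ∧
      (W ∈ B ∨ a ∉ ann W)) (hB : ∀ W ∈ B, ∀ i, j = i + 1 → W.Subsingleton)
    (hB' : j = 0 → B = ∅)
    (h : DimGE (T ∩ hyp a) j) : DimGE T (j+1) := by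
  obtain ⟨c, hc, hc'⟩ := h
  have hTa := isClosed_inter hT (isClosed_hyp a)
  obtain ⟨h1, h2, h3⟩ := (closedIrredIn_iff hTa).mp (hc' (Fin.last j))
  obtain ⟨W, hW, hW', hWT, hDW, hh⟩ := ha _ h3 (h1.trans Set.inter_subset_left)
  rcases hh with hh | hh
  · exfalso
    rcases j with _ | j
    · simp [hB' rfl] at hh
    · have hs := hB W hh j rfl
      have h4 : c 0 ⊂ c (Fin.last _) := hc (by simp [Fin.lt_def])
      obtain ⟨y, hy, hy'⟩ := Set.exists_of_ssubset h4
      obtain ⟨z, hz⟩ := ((closedIrredIn_iff hTa).mp (hc' 0)).2.2.1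
      exact hy' (by rw [hs (hDW hy) (hDW (h4.1 hz))]; exact hz)
  · refine dimGE_succ hT hTa hc hc' hW hW' hWT ⟨hDW, fun h5 => hh ?_⟩
    rw [mem_ann]
    exact h5.trans (h1.trans Set.inter_subset_right)

/-- generic linear form -/
lemma exists_generic {ι : Type} [Finite ι] (T : ι → Set (ProjPt k n)) (hT : ∀ i, IsClosedSub (T i))
    (U : Submodule k (Fin (n+1) → k)) (B : Set (Set (ProjPt k n)))
    (hU : ∀ W, IsIrredSub W → W ∉ B → ¬ U ≤ ann W)
    (s : Set (Submodule k (Fin (n+1) → k))) (hs : s.Finite) (h : ∀ p ∈ s, ¬ U ≤ p) :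
    ∃ a ∈ U, (∀ p ∈ s, a ∉ p) ∧ ∀ i, ∀ D, IsIrredSub D → D ⊆ T i →
      ∃ W, IsClosedSub W ∧ IsIrredSub W ∧ W ⊆ T i ∧ D ⊆ W ∧ (W ∈ B ∨ a ∉ ann W) := by
  choose F hF1 hF2 hF3 using fun i => components (hT i)
  obtain ⟨a, haU, ha⟩ := avoid U (s ∪ ⋃ i, ann '' {W ∈ F i | W ∉ B})
    (hs.union (Set.finite_iUnion fun i => ((hF1 i).subset (fun W h => h.1)).image _)) (by
      rintro p (hp | hp)
      · exact h p hp
      · obtain ⟨i, W, ⟨hW, hWB⟩, rfl⟩ := Set.mem_iUnion.mp hp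
        exact hU W (hF2 i W hW).2.1 hWB)
  refine ⟨a, haU, fun p hp => ha p (Or.inl hp), fun i D hD hDT => ?_⟩
  obtain ⟨W, hW, hDW⟩ := hF3 i D hD hDT
  refine ⟨W, (hF2 i W hW).1, (hF2 i W hW).2.1, (hF2 i W hW).2.2, hDW, ?_⟩
  by_cases hWB : W ∈ B
  · exact Or.inl hWB
  · exact Or.inr (ha _ (Or.inr (Set.mem_iUnion.mpr ⟨i, W, ⟨hW, hWB⟩, rfl⟩)))

/-- common zeros of linear forms -/
def zer {e : ℕ} (l : Fin e → Fin (n+1) → k) : Set (ProjPt k n) := ⋂ i, hyp (l i)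


lemma zer_snoc {e : ℕ} (l : Fin e → Fin (n+1) → k) (a : Fin (n+1) → k) :
    zer (Fin.snoc l a : Fin (e+1) → Fin (n+1) → k) = zer l ∩ hyp a := by
  ext x
  simp only [zer, Set.mem_iInter, Set.mem_inter_iff]
  rw [Fin.forall_fin_succ']
  simp


lemma isClosed_zer {e : ℕ} (l : Fin e → Fin (n+1) → k) : IsClosedSub (zer l) :=
  isClosed_iInter fun i => isClosed_hyp _

lemma top_not_le_ann {W : Set (ProjPt k n)} (hW : W.Nonempty) : ¬ (⊤ : Submodule k _) ≤ ann W := by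
  obtain ⟨x, hx⟩ := hW
  intro h
  apply x.rep_nonzero
  funext i
  have := h (Submodule.mem_top (x := Pi.single i 1)) _ (cone_rep hx)
  simpa using this

/-- Lemma B -/
lemma exists_linear_system {T : Set (ProjPt k n)} (hT : IsClosedSub T) {e : ℕ}
    (h : ¬ DimGE T e) : ∃ l : Fin e → Fin (n+1) → k, T ∩ zer l = ∅ := by
  suffices H : ∀ i, i ≤ e → ∃ l : Fin i → Fin (n+1) → k, ¬ DimGE (T ∩ zer l) (e - i) by
    obtain ⟨l, hl⟩ := H e le_rfl
    refine ⟨l, ?_⟩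
    by_contra hne
    rw [Nat.sub_self] at hl
    exact hl (dimGE_zero (isClosed_inter hT (isClosed_zer l)) (Set.nonempty_iff_ne_empty.mpr hne))
  intro i
  induction i with
  | zero =>
    intro _
    refine ⟨Fin.elim0, ?_⟩
    have : zer (Fin.elim0 : Fin 0 → Fin (n+1) → k) = Set.univ := by simp [zer]
    simpa [this] using h
  | succ i ih =>
    intro hi
    obtain ⟨l, hl⟩ := ih (by omega)
    obtain ⟨a, -, -, ha⟩ := exists_generic (ι := Unit) (fun _ => T ∩ zer l)
      (fun _ => isClosed_inter hT (isClosed_zer l)) ⊤ ∅ (fun W hW _ => top_not_le_ann hW.1) ∅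
      Set.finite_empty (by simp)
    refine ⟨Fin.snoc l a, fun hd => hl ?_⟩
    rw [zer_snoc, ← Set.inter_assoc] at hd
    have := dimGE_cut (isClosed_inter hT (isClosed_zer l)) ∅ (ha ()) (by simp) (by simp) hd
    rwa [show e - (i+1) + 1 = e - i by omega] at this

end Bt
end Part2

section Part3
open MvPolynomial
namespace Bt
set_option linter.unusedSectionVars false
set_option linter.unusedVariables false
variable {k : Type} [Field k] {n : ℕ}
attribute [local instance] MvPolynomial.gradedAlgebra

lemma comp_mul_hom {σ : Type} {g h : MvPolynomial σ k} {j : ℕ} (hh : h.IsHomogeneous j) (i : ℕ) :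
    homogeneousComponent (i+j) (g * h) = homogeneousComponent i g * h := by
  conv_lhs => rw [← sum_homogeneousComponent g, Finset.sum_mul, map_sum]
  have : ∀ x ∈ Finset.range (g.totalDegree + 1),
      homogeneousComponent (i+j) (homogeneousComponent x g * h) =
      if x = i then homogeneousComponent i g * h else 0 := by
    intro x _
    have hm := (homogeneousComponent_isHomogeneous x g).mul hh
    rw [homogeneousComponent_of_mem ((mem_homogeneousSubmodule _ _).mpr hm)]
    by_cases hx : x = i
    · simp [hx]
    · rw [if_neg (by omega), if_neg hx]
  rw [Finset.sum_congr rfl this, Finset.sum_ite_eq']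
  split_ifs with hi
  · rfl
  · rw [homogeneousComponent_eq_zero _ _ (by simpa using hi), zero_mul]

lemma comp_mul_hom_lt {σ : Type} {g h : MvPolynomial σ k} {j : ℕ} (hh : h.IsHomogeneous j) {i : ℕ}
    (hi : i < j) : homogeneousComponent i (g * h) = 0 := by
  conv_lhs => rw [← sum_homogeneousComponent g, Finset.sum_mul, map_sum]
  refine Finset.sum_eq_zero fun x _ => ?_
  have hm := (homogeneousComponent_isHomogeneous x g).mul hh
  rw [homogeneousComponent_of_mem ((mem_homogeneousSubmodule _ _).mpr hm), if_neg (by omega)]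

lemma comp_self {σ : Type} {h : MvPolynomial σ k} {j : ℕ} (hh : h.IsHomogeneous j) :
    homogeneousComponent j h = h := by
  rw [homogeneousComponent_of_mem ((mem_homogeneousSubmodule _ _).mpr hh), if_pos rfl]

/-- an ideal without projective zeros contains all forms of large degree -/
lemma irr_pow [IsAlgClosed k] {J : Ideal (MvPolynomial (Fin (n+1)) k)}
    (h : ∀ v, v ≠ 0 → (∀ g ∈ J, eval v g = 0) → False) :
    ∃ M, ∀ m, M ≤ m → ∀ f : MvPolynomial (Fin (n+1)) k, f.IsHomogeneous m → f ∈ J := by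
  have h1 : ∀ i, (X i : MvPolynomial (Fin (n+1)) k) ∈ J.radical := by
    intro i
    have := nullst (I := J) (f := 1) (fun v hv hg => (h v hv hg).elim) i
    simpa using this
  have h2 : idealOfVars (Fin (n+1)) k ≤ J.radical := by
    rw [idealOfVars, Ideal.span_le]
    rintro _ ⟨i, rfl⟩; exact h1 i
  obtain ⟨M, hM⟩ := Ideal.exists_radical_pow_le_of_fg J (IsNoetherian.noetherian _)
  refine ⟨M, fun m hm f hf => hM (Ideal.pow_right_mono h2 M ?_)⟩
  rw [mem_pow_idealOfVars_iff]
  intro x hx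
  have := hf (mem_support_iff.mp hx)
  rw [Finsupp.degree_eq_weight_one]
  rw [← this] at hm
  exact hm

/-- projection to linear forms -/
noncomputable def prj {Q : Type} [CommRing Q] [Algebra k Q] (q : MvPolynomial (Fin (n+1)) k →ₐ[k] Q)
    {e : ℕ} (l : Fin e → Fin (n+1) → k) : MvPolynomial (Fin e) k →ₐ[k] Q :=
  aeval fun i => q (lin (l i))

lemma prj_apply {Q : Type} [CommRing Q] [Algebra k Q] (q : MvPolynomial (Fin (n+1)) k →ₐ[k] Q)
    {e : ℕ} (l : Fin e → Fin (n+1) → k) (F : MvPolynomial (Fin e) k) :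
    prj q l F = q (aeval (fun i => lin (l i)) F) := by
  have : prj q l = q.comp (aeval (fun i => lin (l i))) := by
    apply algHom_ext; intro i; simp [prj]
  rw [this]; rfl

lemma finite_of_empty [IsAlgClosed k] {Q : Type} [CommRing Q] [Algebra k Q]
    (q : MvPolynomial (Fin (n+1)) k →ₐ[k] Q) (hq : Function.Surjective q)
    {I : Ideal (MvPolynomial (Fin (n+1)) k)} (hqI : ∀ f, q f = 0 ↔ f ∈ I) (hI : HomI I) {e : ℕ}
    (l : Fin e → Fin (n+1) → k)
    (h : ∀ v, v ≠ 0 → (∀ f ∈ I, eval v f = 0) → (∀ i, l i ⬝ᵥ v = 0) → False) :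
    (prj q l).toRingHom.Finite := by
  let J := I ⊔ Ideal.span (Set.range fun i => lin (l i))
  obtain ⟨M, hM⟩ := irr_pow (J := J) (fun v hv hg => h v hv (fun f hf => hg f (Ideal.mem_sup_left hf))
    (fun i => by rw [← eval_lin]; exact hg _ (Ideal.mem_sup_right (Ideal.subset_span ⟨i, rfl⟩))))
  let _ : Algebra (MvPolynomial (Fin e) k) Q := (prj q l).toRingHom.toAlgebra
  have hsm : ∀ (a : MvPolynomial (Fin e) k) (b : Q),
    a • b = prj q l a * b := fun a b => rfl
  let N : Submodule (MvPolynomial (Fin e) k) Q :=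
    Submodule.span _ ((fun s => q (monomial s 1)) '' {s : Fin (n+1) →₀ ℕ | s.degree < M})
  have key : ∀ m, ∀ f : MvPolynomial (Fin (n+1)) k, f.IsHomogeneous m → q f ∈ N := by
    intro m
    induction m using Nat.strong_induction_on with
    | _ m ih =>
      intro f hf
      by_cases hm : m < M
      · rw [f.as_sum, map_sum]
        refine Submodule.sum_mem _ fun s hs => ?_
        have : q (monomial s (coeff s f)) = (C (coeff s f) : MvPolynomial (Fin e) k) • q (monomial s 1) := by
          rw [hsm, prj_apply]
          rw [algHom_C, AlgHom.commutes, ← Algebra.smul_def, ← map_smul, smul_monomial, smul_eq_mul, mul_one]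
        rw [this]
        refine Submodule.smul_mem _ _ (Submodule.subset_span ⟨s, ?_, rfl⟩)
        have := hf (mem_support_iff.mp hs)
        rw [Set.mem_ofPred_eq, Finsupp.degree_eq_weight_one]
        rw [← this] at hm
        exact hm
      · push Not at hm
        rcases Nat.eq_zero_or_pos m with h0 | h0
        · have hMm : ∀ g, q g = 0 := by
            intro g
            have : (1 : MvPolynomial (Fin (n+1)) k) ∈ J := hM 0 (by omega) 1 (isHomogeneous_one _ _)
            obtain ⟨a, ha, b, hb, hab⟩ := Submodule.mem_sup.mp this
            obtain ⟨c, hc⟩ := (Ideal.mem_span_range_iff_exists_fun).mp hb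
            have h1 := congrArg (homogeneousComponent 0) hab
            rw [map_add, comp_self (isHomogeneous_one _ _), ← hc, map_sum,
              Finset.sum_eq_zero (fun i _ => comp_mul_hom_lt (lin_hom (l i)) Nat.zero_lt_one),
              add_zero] at h1
            have : (1 : MvPolynomial (Fin (n+1)) k) ∈ I := by rw [← h1]; exact hI a ha 0
            rw [hqI]
            simpa using I.mul_mem_left g this
          rw [hMm]; exact N.zero_mem
        · obtain ⟨m', rfl⟩ : ∃ m', m = m' + 1 := ⟨m - 1, by omega⟩
          obtain ⟨a, ha, b, hb, hab⟩ := Submodule.mem_sup.mp (hM _ hm f hf)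
          obtain ⟨c, hc⟩ := (Ideal.mem_span_range_iff_exists_fun).mp hb
          have h1 := congrArg (homogeneousComponent (m'+1)) hab
          rw [map_add, comp_self hf, ← hc, map_sum,
              Finset.sum_congr rfl (fun i _ => comp_mul_hom (lin_hom (l i)) m')] at h1
          rw [← h1, map_add, show q (homogeneousComponent (m'+1) a) = 0 from
            (hqI _).mpr (hI a ha _), zero_add, map_sum]
          refine Submodule.sum_mem _ fun i _ => ?_
          have : q (homogeneousComponent m' (c i) * lin (l i)) =
              (X i : MvPolynomial (Fin e) k) • q (homogeneousComponent m' (c i)) := by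
            rw [hsm, prj_apply]; simp [mul_comm]
          rw [this]
          exact Submodule.smul_mem _ _ (ih m' (by omega) _ (homogeneousComponent_isHomogeneous _ _))
  have hfin : {s : Fin (n+1) →₀ ℕ | s.degree < M}.Finite := by
    have : {s : Fin (n+1) →₀ ℕ | s.degree < M} ⊆ Set.Iic (Finsupp.equivFunOnFinite.symm (fun _ => M)) := by
      intro s hs i
      have := Finsupp.le_degree i s
      have hs' : s.degree < M := hs
      simp; omega
    exact (Set.finite_Iic _).subset this
  have : Module.Finite (MvPolynomial (Fin e) k) Q := by
    refine ⟨⟨(hfin.image fun s => q (monomial s 1)).toFinset, ?_⟩⟩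
    rw [Set.Finite.coe_toFinset, eq_top_iff]
    rintro x -
    obtain ⟨f, rfl⟩ := hq x
    change q f ∈ N
    rw [← sum_homogeneousComponent f, map_sum]
    exact Submodule.sum_mem _ fun i _ => key i _ (homogeneousComponent_isHomogeneous _ _)
  exact this

end Bt
end Part3

section Part4
open MvPolynomial
namespace Bt
set_option linter.unusedSectionVars false
set_option linter.unusedVariables false
variable {k : Type} [Field k] {n : ℕ}
attribute [local instance] MvPolynomial.gradedAlgebra

lemma comap_strict {A R : Type} [CommRing A] [CommRing R] (φ : A →+* R) (hφ : φ.IsIntegral)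
    {P P' : Ideal R} (hP : P.IsPrime) (h : P < P') : P.comap φ < P'.comap φ := by
  let _ : Algebra A R := φ.toAlgebra
  obtain ⟨x, hx, hx'⟩ := SetLike.exists_of_lt h
  exact Ideal.comap_lt_comap_of_integral_mem_sdiff (R := A) h.le ⟨hx, hx'⟩ (hφ x)

lemma inj_of_chain {A R : Type} [CommRing A] [IsDomain A] [CommRing R] (φ : A →+* R) (hφ : φ.IsIntegral)
    {m : ℕ} (hA : ringKrullDim A ≤ m) (c : Fin (m+1) → Ideal R) (hc : StrictMono c)
    (hp : ∀ i, (c i).IsPrime) (a : A) (ha : φ a = 0) : a = 0 := by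
  by_contra h0
  let b : PrimeSpectrum A := ⟨⊥, Ideal.isPrime_bot⟩
  let c' : Fin (m+1) → PrimeSpectrum A := fun i => ⟨(c i).comap φ, Ideal.IsPrime.comap φ (hK := hp i)⟩
  have hc' : StrictMono c' := fun i j hij => comap_strict φ hφ (hp i) (hc hij)
  have hb : b < c' 0 := by
    change (⊥ : Ideal A) < (c 0).comap φ
    rw [bot_lt_iff_ne_bot]
    intro h
    have : a ∈ (c 0).comap φ := by rw [Ideal.mem_comap, ha]; exact zero_mem _
    rw [h] at this
    exact h0 (by simpa using this)
  let s : LTSeries (PrimeSpectrum A) := LTSeries.mk (m+1) (Fin.cons b c') (by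
    rw [Fin.strictMono_iff_lt_succ]
    intro i
    refine Fin.cases ?_ (fun j => ?_) i
    · simpa using hb
    · rw [Fin.castSucc_succ]; simpa using hc' (Fin.castSucc_lt_succ (i := j)))
  have := Order.LTSeries.length_le_krullDim s
  have h2 : (s.length : WithBot ℕ∞) ≤ m := this.trans hA
  have h3 : s.length = m + 1 := rfl
  rw [h3] at h2
  have h4 : ((m+1 : ℕ) : WithBot ℕ∞) ≤ ((m:ℕ) : WithBot ℕ∞) := h2
  have : m + 1 ≤ m := by exact_mod_cast h4
  omega

lemma dim_mv (m : ℕ) : ringKrullDim (MvPolynomial (Fin m) k) ≤ m := by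
  rw [MvPolynomial.ringKrullDim_of_isNoetherianRing, ringKrullDim_eq_zero_of_field]; simp

lemma principal_comap {A R : Type} [CommRing A] [IsDomain A] [UniqueFactorizationMonoid A]
    [CommRing R] [IsDomain R] (φ : A →+* R) (hφ : φ.IsIntegral) (hi : Function.Injective φ)
    {P : Ideal R} (hP : P.IsPrime) (h0 : P ≠ ⊥) (h1 : ∀ P' : Ideal R, P'.IsPrime → P' < P → P' = ⊥) :
    ∃ F, Prime F ∧ P.comap φ = Ideal.span {F} := by
  let _ : Algebra A R := φ.toAlgebra
  have : Algebra.IsIntegral A R := ⟨hφ⟩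
  have : FaithfulSMul A R := (faithfulSMul_iff_algebraMap_injective A R).mpr hi
  have hc : (P.comap φ).IsPrime := inferInstance
  obtain ⟨x, hx, hx0⟩ := Submodule.exists_mem_ne_zero_of_ne_bot h0
  have hne : P.comap φ ≠ ⊥ := Ideal.comap_ne_bot_of_integral_mem (R := A) hx0 hx (hφ x)
  obtain ⟨F, hF, hFp⟩ := Ideal.IsPrime.exists_mem_prime_of_ne_bot hc hne
  refine ⟨F, hFp, ?_⟩
  by_contra hcon
  have hlt : Ideal.span {F} < P.comap φ := lt_of_le_of_ne
    ((Ideal.span_singleton_le_iff_mem _).mpr hF) (Ne.symm hcon)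
  have : (Ideal.span {F}).IsPrime := (Ideal.span_singleton_prime hFp.ne_zero).mpr hFp
  have : P.LiesOver (P.comap φ) := ⟨rfl⟩
  obtain ⟨P', h1', h2, h3⟩ := Ideal.exists_ideal_lt_liesOver_of_lt (S := R) P hlt
  have := h1 P' h2 h1'
  have h4 := h3.over
  rw [this] at h4
  have h5 : F ∈ Ideal.span {F} := Ideal.mem_span_singleton_self F
  rw [h4] at h5
  exact hFp.ne_zero (hi (by rw [map_zero]; exact h5))

lemma no_between {S : Type} [CommRing S] [IsNoetherianRing S] {I P P' : Ideal S} {f : S}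
    (hI : I.IsPrime) (hP : P ∈ (I ⊔ Ideal.span {f}).minimalPrimes) (hP' : P'.IsPrime)
    (h1 : I ≤ P') (h2 : P' < P) : P' = I := by
  by_contra hne
  have hPp : P.IsPrime := hP.1.1
  have h := Ideal.map_height_le_one_of_mem_minimalPrimes hP
  have hIP : I ≤ P := h1.trans h2.le
  have key : ∀ J J' : Ideal S, I ≤ J → I ≤ J' → J < J' →
     J.map (Ideal.Quotient.mk I) < J'.map (Ideal.Quotient.mk I) := by
    intro J J' hJ hJ' hlt
    have e : ∀ J : Ideal S, I ≤ J → (J.map (Ideal.Quotient.mk I)).comap (Ideal.Quotient.mk I) = J := by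
      intro J hJ
      rw [Ideal.comap_map_of_surjective _ Ideal.Quotient.mk_surjective, ← RingHom.ker, Ideal.mk_ker,
        sup_eq_left.mpr hJ]
    refine lt_of_le_of_ne (Ideal.map_mono hlt.le) fun heq => hlt.ne ?_
    rw [← e J hJ, ← e J' hJ', heq]
  have pr : ∀ J : Ideal S, I ≤ J → J.IsPrime → (J.map (Ideal.Quotient.mk I)).IsPrime := by
    intro J hJ hp
    exact Ideal.map_isPrime_of_surjective Ideal.Quotient.mk_surjective (by rwa [Ideal.mk_ker])
  have := pr _ le_rfl hI
  have := pr _ h1 hP'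
  have := pr _ hIP hPp
  have a1 := Ideal.height_add_one_le_of_lt_of_isPrime (key _ _ le_rfl h1 (lt_of_le_of_ne h1 (Ne.symm hne)))
  have a2 := Ideal.height_add_one_le_of_lt_of_isPrime (key _ _ h1 hIP h2)
  have a3 : (0 : ℕ∞) + 1 + 1 ≤ 1 := by
    calc (0:ℕ∞)+1+1 ≤ (I.map (Ideal.Quotient.mk I)).height + 1 + 1 := by gcongr; exact zero_le
      _ ≤ _ := by gcongr
      _ ≤ _ := a2
      _ ≤ 1 := h
  exact absurd a3 (by decide)

lemma exists_degreeOf_pos {m : ℕ} {F : MvPolynomial (Fin m) k} (hF : Prime F) :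
    ∃ i, 0 < degreeOf i F := by
  by_contra hc
  push Not at hc
  have h0 : F.totalDegree = 0 := by
    rw [totalDegree_eq_zero_iff]
    intro s hs i
    have := (degreeOf_le_iff.mp (hc i)) s hs
    omega
  have h1 := totalDegree_eq_zero_iff_eq_C.mp h0
  have h2 : coeff 0 F ≠ 0 := by
    intro h; rw [h, map_zero] at h1; exact hF.ne_zero h1
  apply hF.not_isUnit
  rw [h1]
  exact (IsUnit.mk0 _ h2).map C

lemma algInd_of_ker {d : ℕ} {B : Type} [CommRing B] [Algebra k B]
    (ψ : MvPolynomial (Fin (d+1)) k →ₐ[k] B) {F : MvPolynomial (Fin (d+1)) k} (hF : Prime F)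
    (hψ : ∀ G, ψ G = 0 → F ∣ G) : (d : Cardinal) ≤ Algebra.trdeg k B := by
  obtain ⟨i, hi⟩ := exists_degreeOf_pos hF
  have : AlgebraicIndependent k (fun j : {j // j ≠ i} => ψ (X j.1)) := by
    rw [algebraicIndependent_iff]
    intro G hG
    have e : (aeval fun j : {j // j ≠ i} => ψ (X j.1)) = ψ.comp (rename Subtype.val) := by
      apply algHom_ext; intro j; simp
    rw [e] at hG
    obtain ⟨H, hH⟩ : F ∣ rename Subtype.val G := hψ _ hG
    by_contra hG0
    have hr : rename Subtype.val G ≠ 0 := fun h => hG0 (rename_injective _ Subtype.val_injective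
      (by rw [h, map_zero]))
    have hH0 : H ≠ 0 := by rintro rfl; simp at hH; exact hG0 hH
    have h1 := degreeOf_mul_eq (n := i) hF.ne_zero hH0
    rw [← hH] at h1
    have h2 : degreeOf i (rename Subtype.val G) = 0 := by
      rw [← Nat.le_zero, degreeOf_le_iff]
      intro s hs
      by_contra hsi
      have : i ∈ (rename Subtype.val G).vars := (mem_vars i).mpr ⟨s, hs, by simp; omega⟩
      have := vars_rename Subtype.val G this
      simp at this
    omega
  have h := this.cardinalMk_le_trdeg
  have h2 : Cardinal.mk {j : Fin (d+1) // j ≠ i} = d := by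
    rw [Cardinal.mk_fintype, Fintype.card_subtype_compl]; simp
  rwa [h2] at h

lemma trdeg_le_of_integral {e : ℕ} {B : Type} [CommRing B] [IsDomain B] [Algebra k B]
    (ψ : MvPolynomial (Fin e) k →ₐ[k] B) (h : ψ.toRingHom.IsIntegral) :
    Algebra.trdeg k B ≤ e := by
  let s : Set B := Set.range fun i => ψ (X i)
  have hs : ∀ a, ψ a ∈ Algebra.adjoin k s := by
    intro a
    induction a using MvPolynomial.induction_on with
    | C a => rw [← algebraMap_eq, AlgHom.commutes]; exact Subalgebra.algebraMap_mem _ _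
    | add p q hp hq => rw [map_add]; exact add_mem hp hq
    | mul_X p i hp => rw [map_mul]; exact mul_mem hp (Algebra.subset_adjoin ⟨i, rfl⟩)
  have : Algebra.IsAlgebraic (Algebra.adjoin k s) B := by
    refine ⟨fun x => IsIntegral.isAlgebraic ?_⟩
    obtain ⟨p, hp, hpx⟩ := h x
    let ψ' : MvPolynomial (Fin e) k →+* Algebra.adjoin k s := ψ.toRingHom.codRestrict _ hs
    refine ⟨p.map ψ', hp.map _, ?_⟩
    rw [Polynomial.eval₂_map]
    exact hpx
  have h1 := Algebra.IsAlgebraic.trdeg_le_cardinalMk k s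
  refine h1.trans ?_
  have := Cardinal.mk_range_le (f := fun i : Fin e => ψ (X i))
  simpa using this
end Bt
end Part4

section Part5
open MvPolynomial
namespace Bt
set_option linter.unusedSectionVars false
set_option linter.unusedVariables false
variable {k : Type} [Field k] {n : ℕ}
attribute [local instance] MvPolynomial.gradedAlgebra


lemma mem_map_q {S Q : Type} [CommRing S] [CommRing Q] (q : S →+* Q) (hq : Function.Surjective q)
  {I : Ideal S} (hqI : ∀ f, q f = 0 ↔ f ∈ I) {J : Ideal S} (h : I ≤ J) {f : S} : q f ∈ J.map q ↔ f ∈ J := by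
  refine ⟨fun hf => ?_, Ideal.mem_map_of_mem q⟩
  obtain ⟨g, hg, hgf⟩ := (Ideal.mem_map_iff_of_surjective q hq).mp hf
  have : f - g ∈ I := by rw [← hqI, map_sub, hgf, sub_self]
  simpa using J.add_mem (h this) hg

lemma map_q_lt {S Q : Type} [CommRing S] [CommRing Q] (q : S →+* Q) (hq : Function.Surjective q)
  {I : Ideal S} (hqI : ∀ f, q f = 0 ↔ f ∈ I) {J J' : Ideal S} (h : I ≤ J) (hlt : J < J') : J.map q < J'.map q := by
  refine lt_of_le_of_ne (Ideal.map_mono hlt.le) fun heq => ?_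
  obtain ⟨x, hx, hx'⟩ := SetLike.exists_of_lt hlt
  apply hx'
  rw [← mem_map_q q hq hqI h, heq]
  exact Ideal.mem_map_of_mem q hx

lemma map_q_prime {S Q : Type} [CommRing S] [CommRing Q] (q : S →+* Q) (hq : Function.Surjective q)
  {I : Ideal S} (hqI : ∀ f, q f = 0 ↔ f ∈ I) {J : Ideal S} (h : I ≤ J) (hJ : J.IsPrime) : (J.map q).IsPrime := by
  refine Ideal.map_isPrime_of_surjective hq fun f hf => h ((hqI f).mp hf)

lemma q_domain {S Q : Type} [CommRing S] [CommRing Q] (q : S →+* Q) (hq : Function.Surjective q)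
  {I : Ideal S} (hqI : ∀ f, q f = 0 ↔ f ∈ I) (hI : I.IsPrime) : IsDomain Q := by
  have h1 : (⊥ : Ideal Q).IsPrime := by
    have := map_q_prime q hq hqI le_rfl hI
    have e : I.map q = ⊥ := by
      rw [Ideal.map_eq_bot_iff_le_ker]
      exact fun f hf => (hqI f).mpr hf
    rwa [e] at this
  exact (IsDomain.of_bot_isPrime Q)

variable [IsAlgClosed k]

lemma ssubset_IX {S T : Set (ProjPt k n)} (hS : IsClosedSub S) (hT : IsClosedSub T) (h : S ⊂ T) :
    IX T < IX S := by
  refine lt_of_le_of_ne (IX_anti h.1) fun heq => ?_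
  apply h.ne
  rw [← closed_eq hS, ← closed_eq hT, heq]

lemma prj_inj {X : Set (ProjPt k n)} {d : ℕ} (hXc : IsClosedSub X) (hXd : DimGE X d)
    {Q : Type} [CommRing Q] [Algebra k Q]
    (q : MvPolynomial (Fin (n+1)) k →ₐ[k] Q) (hq : Function.Surjective q)
    (hqI : ∀ f, q f = 0 ↔ f ∈ IX X) (l : Fin (d+1) → Fin (n+1) → k)
    (hfin : (prj q l).toRingHom.Finite) : Function.Injective (prj q l) := by
  have : Infinite k := IsAlgClosed.instInfinite
  obtain ⟨c, hc, hc'⟩ := hXd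
  have hcl : ∀ i, IsClosedSub (c i) := fun i => ((closedIrredIn_iff hXc).mp (hc' i)).2.1
  let m0 : Ideal (MvPolynomial (Fin (n+1)) k) := RingHom.ker (constantCoeff (R := k) (σ := Fin (n+1)))
  let C : Fin (d+2) → Ideal (MvPolynomial (Fin (n+1)) k) :=
    Fin.snoc (α := fun _ => Ideal (MvPolynomial (Fin (n+1)) k)) (fun i : Fin (d+1) => IX (c i.rev)) m0
  have hCp : ∀ i, (C i).IsPrime := by
    intro i
    refine Fin.lastCases ?_ (fun j => ?_) i
    · simp only [C, Fin.snoc_last]; exact RingHom.ker_isPrime _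
    · simp only [C, Fin.snoc_castSucc]; exact IX_prime (hc' _).2.2
  have hm0 : ∀ i, IX (c i) < m0 := by
    intro i
    obtain ⟨j, hj⟩ := exists_X_notMem (hc' i).2.2.1
    refine lt_of_le_of_ne ?_ ?_
    · intro f hf
      have h1 := IX_hom (c i) f hf 0
      rw [homogeneousComponent_zero] at h1
      by_contra h2
      have h3 : IsUnit (MvPolynomial.C (coeff 0 f) : MvPolynomial (Fin (n+1)) k) :=
        (IsUnit.mk0 _ h2).map MvPolynomial.C
      exact (IX_prime (hc' i).2.2).ne_top (Ideal.eq_top_of_isUnit_mem _ h1 h3)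
    · intro h
      apply hj
      rw [h]
      simp [m0, RingHom.mem_ker]
  have hCm : StrictMono C := by
    rw [Fin.strictMono_iff_lt_succ]
    intro i
    refine Fin.lastCases ?_ (fun j => ?_) i
    · rw [Fin.succ_last]; simp only [C, Fin.snoc_last, Fin.snoc_castSucc]; exact hm0 _
    · rw [Fin.succ_castSucc]; simp only [C, Fin.snoc_castSucc]
      refine ssubset_IX (hcl _) (hcl _) (hc ?_)
      rw [Fin.rev_lt_rev]; exact Fin.castSucc_lt_succ
  have hle : ∀ i, IX X ≤ C i := by
    intro i
    refine Fin.lastCases ?_ (fun j => ?_) i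
    · simp only [C, Fin.snoc_last]; exact (IX_anti (hc' 0).1).trans (hm0 0).le
    · simp only [C, Fin.snoc_castSucc]; exact IX_anti (hc' _).1
  rw [injective_iff_map_eq_zero]
  intro a ha
  exact inj_of_chain (prj q l).toRingHom hfin.to_isIntegral (m := d+1) (dim_mv (d+1)) (fun i => (C i).map q.toRingHom)
    (fun i j hij => map_q_lt q.toRingHom hq hqI (hle i) (hCm hij))
    (fun i => map_q_prime q.toRingHom hq hqI (hle i) (hCp i)) a ha

lemma ne_of_not_dimGE {X Y : Set (ProjPt k n)} {d : ℕ} (hXc : IsClosedSub X) (hXi : IsIrredSub X) (hXd : HasDim X d)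
    (hd : 1 ≤ d) (hY : IsPrimeDivisorOn X d Y) : Y ⊂ X := by
  refine lt_of_le_of_ne hY.1 ?_
  rintro rfl
  apply hY.2.2.2.2
  rw [Nat.sub_add_cancel hd]; exact hXd.1

/-- a prime divisor is minimal over every form it contains -/
lemma divisor_minimal {X Y : Set (ProjPt k n)} {d : ℕ} (hXc : IsClosedSub X) (hXi : IsIrredSub X) (hXd : HasDim X d)
    (hd : 1 ≤ d) (hY : IsPrimeDivisorOn X d Y) {f : MvPolynomial (Fin (n+1)) k} {m : ℕ}
    (hf : f.IsHomogeneous m) (hfX : f ∉ IX X) (hfY : f ∈ IX Y) :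
    IX Y ∈ (IX X ⊔ Ideal.span {f}).minimalPrimes := by
  have : Infinite k := IsAlgClosed.instInfinite
  have hYp := IX_prime hY.2.2.1
  have hle : IX X ⊔ Ideal.span {f} ≤ IX Y := sup_le (IX_anti hY.1) ((Ideal.span_singleton_le_iff_mem _).mpr hfY)
  obtain ⟨P, hP, hPY⟩ := Ideal.exists_minimalPrimes_le hle
  have hJ : HomI (IX X ⊔ Ideal.span {f}) := by
    rw [HomI.iff]
    refine Ideal.IsHomogeneous.sup (HomI.iff.mp (IX_hom X)) (Ideal.homogeneous_span _ _ ?_)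
    rintro x rfl
    exact ⟨m, (mem_homogeneousSubmodule _ _).mpr hf⟩
  have hPh := minimalPrimes_hom hJ hP
  obtain ⟨i, hi⟩ := exists_X_notMem hY.2.2.1.1
  have hiP : MvPolynomial.X i ∉ P := fun h => hi (hPY h)
  have hPp : P.IsPrime := hP.1.1
  have hZ := IX_ZP hPp hPh hiP
  have hYZ : Y ⊆ ZP P := by rw [← closed_eq hY.2.1]; exact ZP_anti hPY
  have hIXP : IX X ≤ P := le_sup_left.trans hP.1.2
  have hZX : ZP P ⊆ X := by rw [← closed_eq hXc]; exact ZP_anti hIXP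
  have hZX' : ZP P ⊂ X := by
    refine lt_of_le_of_ne hZX fun h => hfX ?_
    rw [← h, hZ]
    exact hP.1.2 (Ideal.mem_sup_right (Ideal.mem_span_singleton_self f))
  rcases eq_or_ne Y (ZP P) with h | h
  · rw [h, hZ]; exact hP
  · exfalso
    obtain ⟨d, rfl⟩ : ∃ d', d = d' + 1 := ⟨d - 1, by omega⟩
    have hYd : DimGE Y d := hY.2.2.2.1
    obtain ⟨c, hc, hc'⟩ := hYd
    have hZc := isClosed_ZP hPh
    have hZi := irred_ZP hPp hPh hiP
    have hcY := fun i => ((closedIrredIn_iff hY.2.1).mp (hc' i))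
    apply hXd.2
    have hlast : c (Fin.last d) ⊂ ZP P :=
      lt_of_le_of_lt (hcY (Fin.last d)).1 (lt_of_le_of_ne hYZ h)
    refine dimGE_succ hXc hXc (c := Fin.snoc (α := fun _ => Set (ProjPt k n)) c (ZP P)) ?_ ?_ hXc hXi subset_rfl ?_
    · rw [Fin.strictMono_iff_lt_succ]
      intro i
      refine Fin.lastCases ?_ (fun j => ?_) i
      · rw [Fin.succ_last]; simp only [Fin.snoc_last, Fin.snoc_castSucc]; exact hlast
      · rw [Fin.succ_castSucc]; simp only [Fin.snoc_castSucc]; exact hc Fin.castSucc_lt_succ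
    · intro i
      rw [closedIrredIn_iff hXc]
      refine Fin.lastCases ?_ (fun j => ?_) i
      · simp only [Fin.snoc_last]; exact ⟨hZX, hZc, hZi⟩
      · simp only [Fin.snoc_castSucc]; exact ⟨(hcY j).1.trans hY.1, (hcY j).2⟩
    · simp only [Fin.snoc_last]; exact hZX'

lemma form_sup_hom {X : Set (ProjPt k n)} {f : MvPolynomial (Fin (n+1)) k} {m : ℕ}
    (hf : f.IsHomogeneous m) : HomI (IX X ⊔ Ideal.span {f}) := by
  have : Infinite k := IsAlgClosed.instInfinite
  rw [HomI.iff]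
  refine Ideal.IsHomogeneous.sup (HomI.iff.mp (IX_hom X)) (Ideal.homogeneous_span _ _ ?_)
  rintro x rfl
  exact ⟨m, (mem_homogeneousSubmodule _ _).mpr hf⟩

lemma disjoint_zer {X : Set (ProjPt k n)} (hXc : IsClosedSub X) {e : ℕ} {l : Fin e → Fin (n+1) → k}
    (h : X ∩ zer l = ∅) : ∀ v, v ≠ 0 → (∀ f ∈ IX X, eval v f = 0) → (∀ i, l i ⬝ᵥ v = 0) → False := by
  have : Infinite k := IsAlgClosed.instInfinite
  intro v hv h1 h2
  have : Projectivization.mk k v hv ∈ X ∩ zer l := by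
    refine ⟨(mem_cone_mk hv).mp ((mem_cone_closed hXc).mpr ⟨hv, h1⟩), ?_⟩
    rw [zer, Set.mem_iInter]
    exact fun i => (mem_hyp_mk hv).mpr (h2 i)
  rw [h] at this; exact this

lemma min_principal {X : Set (ProjPt k n)} {d : ℕ} (hXc : IsClosedSub X) (hXi : IsIrredSub X) (hXd : HasDim X d)
    {f : MvPolynomial (Fin (n+1)) k} (hfX : f ∉ IX X) {P : Ideal (MvPolynomial (Fin (n+1)) k)}
    (hP : P ∈ (IX X ⊔ Ideal.span {f}).minimalPrimes) {l : Fin (d+1) → Fin (n+1) → k}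
    (hl : X ∩ zer l = ∅) : ∃ F : MvPolynomial (Fin (d+1)) k, Prime F ∧
      ∀ G, aeval (fun i => lin (l i)) G ∈ P ↔ F ∣ G := by
  have : Infinite k := IsAlgClosed.instInfinite
  let q := Ideal.Quotient.mkₐ k (IX X)
  have hq : Function.Surjective q := Ideal.Quotient.mkₐ_surjective k _
  have hqI : ∀ f, q f = 0 ↔ f ∈ IX X := fun f => Ideal.Quotient.eq_zero_iff_mem
  have hXp := IX_prime hXi
  have hdom : IsDomain (MvPolynomial (Fin (n+1)) k ⧸ IX X) := q_domain q.toRingHom hq hqI hXp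
  have hfin := finite_of_empty q hq hqI (IX_hom X) l (disjoint_zer hXc hl)
  have hinj := prj_inj hXc hXd.1 q hq hqI l hfin
  have hPp : P.IsPrime := hP.1.1
  have hIXP : IX X ≤ P := le_sup_left.trans hP.1.2
  have hfP : f ∈ P := hP.1.2 (Ideal.mem_sup_right (Ideal.mem_span_singleton_self f))
  obtain ⟨F, hF, hFc⟩ := principal_comap (prj q l).toRingHom hfin.to_isIntegral hinj
    (P := P.map q.toRingHom) (map_q_prime q.toRingHom hq hqI hIXP hPp) (by
      intro h
      have := Ideal.mem_map_of_mem q.toRingHom hfP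
      rw [h] at this
      exact hfX ((hqI f).mp this)) (by
      intro P' hP' hlt
      have h1 : (P'.comap q.toRingHom).IsPrime := Ideal.IsPrime.comap q.toRingHom
      have h2 : IX X ≤ P'.comap q.toRingHom := by
        intro g hg
        rw [Ideal.mem_comap]
        have : q.toRingHom g = 0 := (hqI g).mpr hg
        rw [this]; exact zero_mem _
      have h3 : P'.comap q.toRingHom < P := by
        obtain ⟨x, hx, hx'⟩ := SetLike.exists_of_lt hlt
        obtain ⟨y, rfl⟩ := hq x
        refine lt_of_le_of_ne ?_ ?_
        · intro g hg
          exact (mem_map_q q.toRingHom hq hqI hIXP).mp (hlt.le hg)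
        · intro h
          apply hx'
          have : y ∈ P := (mem_map_q q.toRingHom hq hqI hIXP).mp hx
          rw [← h] at this
          exact this
      have h4 := no_between hXp hP h1 h2 h3
      rw [eq_bot_iff]
      intro x hx
      obtain ⟨y, rfl⟩ := hq x
      have : y ∈ P'.comap q.toRingHom := hx
      rw [h4] at this
      exact (hqI y).mpr this)
  refine ⟨F, hF, fun G => ?_⟩
  rw [← Ideal.mem_span_singleton, ← hFc, Ideal.mem_comap, ← mem_map_q q.toRingHom hq hqI hIXP]
  have := prj_apply q l G
  change _ ↔ prj q l G ∈ _
  rw [this]; rfl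

lemma min_divisor {X : Set (ProjPt k n)} {d : ℕ} (hXc : IsClosedSub X) (hXi : IsIrredSub X) (hXd : HasDim X d)
    (hd : 1 ≤ d) {f : MvPolynomial (Fin (n+1)) k} {m : ℕ} (hf : f.IsHomogeneous m)
    (hfX : f ∉ IX X) {P : Ideal (MvPolynomial (Fin (n+1)) k)}
    (hP : P ∈ (IX X ⊔ Ideal.span {f}).minimalPrimes) {i : Fin (n+1)} (hi : MvPolynomial.X i ∉ P) :
    IsPrimeDivisorOn X d (ZP P) ∧ IX (ZP P) = P := by
  have : Infinite k := IsAlgClosed.instInfinite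
  have hPh := minimalPrimes_hom (form_sup_hom hf) hP
  have hPp : P.IsPrime := hP.1.1
  have hZ := IX_ZP hPp hPh hi
  have hIXP : IX X ≤ P := le_sup_left.trans hP.1.2
  have hZX : ZP P ⊆ X := by rw [← closed_eq hXc]; exact ZP_anti hIXP
  have hZX' : ZP P ⊂ X := by
    refine lt_of_le_of_ne hZX fun h => hfX ?_
    rw [← h, hZ]
    exact hP.1.2 (Ideal.mem_sup_right (Ideal.mem_span_singleton_self f))
  have hZc := isClosed_ZP hPh
  have hZi := irred_ZP hPp hPh hi
  refine ⟨⟨hZX, hZc, hZi, ?_, ?_⟩, hZ⟩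
  · by_contra hc
    obtain ⟨l', hl'⟩ := exists_linear_system hZc hc
    obtain ⟨l, hl⟩ := exists_linear_system hXc hXd.2
    obtain ⟨F, hF, hFG⟩ := min_principal hXc hXi hXd hfX hP hl
    let q := Ideal.Quotient.mkₐ k P
    have hq : Function.Surjective q := Ideal.Quotient.mkₐ_surjective k _
    have hqI : ∀ f, q f = 0 ↔ f ∈ P := fun f => Ideal.Quotient.eq_zero_iff_mem
    have hdom : IsDomain (MvPolynomial (Fin (n+1)) k ⧸ P) := q_domain q.toRingHom hq hqI hPp
    have hqI' : ∀ f, q f = 0 ↔ f ∈ IX (ZP P) := fun f => by rw [hZ]; exact hqI f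
    have hfin := finite_of_empty q hq hqI' (IX_hom _) l' (disjoint_zer hZc hl')
    have h1 := trdeg_le_of_integral (prj q l') hfin.to_isIntegral
    have h2 := algInd_of_ker (prj q l) hF (fun G hG => by
      rw [← hFG, ← hqI, ← prj_apply]; exact hG)
    have h3 := h2.trans h1
    have h4 : d ≤ d - 1 := by exact_mod_cast h3
    omega
  · rw [Nat.sub_add_cancel hd]
    rintro ⟨c, hc, hc'⟩
    apply hXd.2
    refine dimGE_succ hXc hZc hc hc' hXc hXi subset_rfl ?_
    exact lt_of_le_of_lt (hc' _).1 hZX'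
end Bt
end Part5

section Part6
open MvPolynomial
namespace Bt
set_option linter.unusedSectionVars false
set_option linter.unusedVariables false
variable {k : Type} [Field k] {n : ℕ}
attribute [local instance] MvPolynomial.gradedAlgebra

/-- vectors orthogonal to v -/
def vperp (v : Fin (n+1) → k) : Submodule k (Fin (n+1) → k) where
  carrier := {a | a ⬝ᵥ v = 0}
  zero_mem' := by simp
  add_mem' := by intro a b ha hb; simp only [Set.mem_ofPred_eq] at *; rw [add_dotProduct, ha, hb, add_zero]
  smul_mem' := by intro c a ha; simp only [Set.mem_ofPred_eq] at *; rw [smul_dotProduct, ha, smul_zero]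

lemma mem_vperp {v a : Fin (n+1) → k} : a ∈ vperp v ↔ a ⬝ᵥ v = 0 := Iff.rfl

lemma vperp_ne_top {v : Fin (n+1) → k} (hv : v ≠ 0) : vperp v ≠ ⊤ := by
  intro h
  apply hv
  funext i
  have : Pi.single i 1 ∈ vperp v := by rw [h]; trivial
  simpa [mem_vperp] using this

lemma finrank_vperp {v : Fin (n+1) → k} (hv : v ≠ 0) : Module.finrank k (vperp v) ≤ n := by
  have := Submodule.finrank_lt (vperp_ne_top hv)
  rw [Module.finrank_fin_fun] at this
  omega

lemma prop_of_vperp {v w : Fin (n+1) → k} (hv : v ≠ 0) (h : ∀ a ∈ vperp v, a ⬝ᵥ w = 0) :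
    ∃ c : k, w = c • v := by
  obtain ⟨j, hj⟩ := Function.ne_iff.mp hv
  rw [Pi.zero_apply] at hj
  refine ⟨w j / v j, ?_⟩
  funext i
  have := h (v j • Pi.single i 1 - v i • Pi.single j 1) (by
    rw [mem_vperp, sub_dotProduct, smul_dotProduct, smul_dotProduct]; simp; ring)
  rw [sub_dotProduct, smul_dotProduct, smul_dotProduct] at this
  simp at this
  rw [Pi.smul_apply, smul_eq_mul]
  field_simp
  linear_combination this

/-- conormal space -/
def Nv (X : Set (ProjPt k n)) (v : Fin (n+1) → k) : Submodule k (Fin (n+1) → k) :=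
  Submodule.span k {w | ∃ h ∈ homVanishingPolys X, w = gradientAt h v}

lemma mem_homV {X : Set (ProjPt k n)} {h : MvPolynomial (Fin (n+1)) k} :
    h ∈ homVanishingPolys X ↔ (∃ m, h.IsHomogeneous m) ∧ h ∈ IX X := Iff.rfl

lemma euler {f : MvPolynomial (Fin (n+1)) k} {m : ℕ} (hf : f.IsHomogeneous m) (v : Fin (n+1) → k) :
    gradientAt f v ⬝ᵥ v = m * eval v f := by
  have := congrArg (eval v) hf.sum_X_mul_pderiv
  rw [map_sum] at this
  simp only [map_mul, eval_X, nsmul_eq_mul, map_natCast] at this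
  rw [← this, dotProduct]
  exact Finset.sum_congr rfl fun i _ => mul_comm _ _

lemma Nv_le {X : Set (ProjPt k n)} {v : Fin (n+1) → k} (hv : v ∈ cone X) : Nv X v ≤ vperp v := by
  rw [Nv, Submodule.span_le]
  rintro w ⟨h, ⟨⟨m, hm⟩, hh⟩, rfl⟩
  change _ = _
  rw [euler hm, mem_IX.mp hh v hv, mul_zero]

lemma finrank_Nv {X : Set (ProjPt k n)} {d : ℕ} (hX : ∀ x ∈ X, SmoothPtAt X d x) {v : Fin (n+1) → k} (hv : v ∈ cone X) :
    Module.finrank k (Nv X v) = n - d := by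
  obtain ⟨h0, h⟩ := hv
  exact hX _ h v h0 rfl

lemma dimGE_mono {S T : Set (ProjPt k n)} (hS : IsClosedSub S) (hT : IsClosedSub T) (h : S ⊆ T) {j : ℕ}
    (hj : DimGE S j) : DimGE T j := by
  obtain ⟨c, hc, hc'⟩ := hj
  refine ⟨c, hc, fun i => ?_⟩
  have := (closedIrredIn_iff hS).mp (hc' i)
  exact (closedIrredIn_iff hT).mpr ⟨this.1.trans h, this.2⟩

lemma irred_singleton (x : ProjPt k n) : IsIrredSub ({x} : Set (ProjPt k n)) := by
  refine ⟨⟨x, rfl⟩, fun C₁ C₂ _ _ h => ?_⟩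
  rcases h rfl with h | h
  · left; rintro _ rfl; exact h
  · right; rintro _ rfl; exact h

variable [IsAlgClosed k]

lemma dim_le_n {X : Set (ProjPt k n)} {d : ℕ} (hXc : IsClosedSub X) (hXi : IsIrredSub X) (hXd : HasDim X d) :
    d ≤ n := by
  have : Infinite k := IsAlgClosed.instInfinite
  let q := Ideal.Quotient.mkₐ k (IX X)
  have hq : Function.Surjective q := Ideal.Quotient.mkₐ_surjective k _
  have hqI : ∀ f, q f = 0 ↔ f ∈ IX X := fun f => Ideal.Quotient.eq_zero_iff_mem
  have hXp := IX_prime hXi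
  have hdom : IsDomain (MvPolynomial (Fin (n+1)) k ⧸ IX X) := q_domain q.toRingHom hq hqI hXp
  obtain ⟨l, hl⟩ := exists_linear_system hXc hXd.2
  have hfin := finite_of_empty q hq hqI (IX_hom X) l (disjoint_zer hXc hl)
  have hinj := prj_inj hXc hXd.1 q hq hqI l hfin
  have h1 := trdeg_le_of_injective (prj q l) hinj
  have h2 := trdeg_le_of_surjective q hq
  have h3 := h1.trans h2
  rw [MvPolynomial.trdeg_of_isDomain, MvPolynomial.trdeg_of_isDomain] at h3
  simp only [Cardinal.mk_fin] at h3
  have h4 : d + 1 ≤ n + 1 := by simpa using h3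
  omega

lemma choose_l {X Y : Set (ProjPt k n)} {d : ℕ} (hX : IsSmoothVariety X d) (hd : 1 ≤ d)
    (hY : IsPrimeDivisorOn X d Y) {v : Fin (n+1) → k} (hv : v ∈ cone X) :
    ∃ l : Fin d → Fin (n+1) → k, (∀ i, l i ∈ vperp v) ∧
      (∀ w ∈ cone Y, (∀ i, l i ⬝ᵥ w = 0) → ∃ c : k, w = c • v) ∧ ¬ DimGE (X ∩ zer l) 1 ∧
      vperp v ≤ Nv X v ⊔ Submodule.span k (Set.range l) := by
  obtain ⟨hXc, hXi, hXd, hXs⟩ := hX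
  have hdn := dim_le_n hXc hXi hXd
  have hv0 := cone_ne_zero hv
  let pv : ProjPt k n := Projectivization.mk k v hv0
  have hpv : ∀ w (hw : w ≠ 0), Projectivization.mk k w hw = pv → ∃ c : k, w = c • v := by
    intro w hw h
    obtain ⟨c, hc⟩ := (Projectivization.mk_eq_mk_iff' k w v hw hv0).mp h
    exact ⟨c, hc.symm⟩
  have hpv' : ∀ w (hw : w ≠ 0), (∃ c : k, w = c • v) → Projectivization.mk k w hw = pv := by
    rintro w hw ⟨c, hc⟩
    exact (Projectivization.mk_eq_mk_iff' k w v hw hv0).mpr ⟨c, hc.symm⟩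
  have hB : ∀ W : Set (ProjPt k n), IsIrredSub W → W ∉ ({{pv}} : Set (Set (ProjPt k n))) → ¬ vperp v ≤ ann W := by
    intro W hW hWB hle
    apply hWB
    rw [Set.mem_singleton_iff, Set.eq_singleton_iff_nonempty_unique_mem]
    refine ⟨hW.1, fun x hx => ?_⟩
    have := prop_of_vperp (w := x.rep) hv0 (fun a ha => hle ha _ (cone_rep hx))
    rw [← x.mk_rep]
    exact hpv' _ _ this
  suffices H : ∀ i, i ≤ d → ∃ l : Fin i → Fin (n+1) → k, (∀ i, l i ∈ vperp v) ∧
      (i < d → ¬ DimGE (Y ∩ zer l) (d - i)) ∧ (i = d → Y ∩ zer l ⊆ {pv}) ∧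
      ¬ DimGE (X ∩ zer l) (d + 1 - i) ∧
      (n - d + i ≤ Module.finrank k ↥(Nv X v ⊔ Submodule.span k (Set.range l)) ∨
      vperp v ≤ Nv X v ⊔ Submodule.span k (Set.range l)) by
    obtain ⟨l, h1, -, h2, h3, h4⟩ := H d le_rfl
    refine ⟨l, h1, ?_, by simpa using h3, ?_⟩
    · rintro w ⟨hw0, hw⟩ hlw
      have : Projectivization.mk k w hw0 ∈ Y ∩ zer l :=
        ⟨hw, Set.mem_iInter.mpr fun i => (mem_hyp_mk hw0).mpr (hlw i)⟩
      exact hpv w hw0 (h2 rfl this)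
    · rcases h4 with h4 | h4
      · have hle : Nv X v ⊔ Submodule.span k (Set.range l) ≤ vperp v :=
          sup_le (Nv_le hv) (Submodule.span_le.mpr (by rintro _ ⟨i, rfl⟩; exact h1 i))
        refine (Submodule.eq_of_le_of_finrank_le hle ?_).ge
        have := finrank_vperp hv0
        omega
      · exact h4
  intro i
  induction i with
  | zero =>
    intro _
    have hz : zer (Fin.elim0 : Fin 0 → Fin (n+1) → k) = Set.univ := by simp [zer]
    refine ⟨Fin.elim0, fun i => i.elim0, fun _ => ?_, fun h => by omega, ?_, ?_⟩
    · rw [hz, Set.inter_univ]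
      have := hY.2.2.2.2
      rwa [Nat.sub_add_cancel hd] at this
    · rw [hz, Set.inter_univ]; exact hXd.2
    · left
      rw [add_zero, ← finrank_Nv hXs hv]
      exact Submodule.finrank_mono le_sup_left
  | succ i ih =>
    intro hi
    obtain ⟨l, h1, h2, -, h3, h4⟩ := ih (by omega)
    classical
    let p := Nv X v ⊔ Submodule.span k (Set.range l)
    obtain ⟨a, haU, has, haT⟩ := exists_generic (fun b : Bool => bif b then X ∩ zer l else Y ∩ zer l)
      (by rintro (_ | _)
          · exact isClosed_inter hY.2.1 (isClosed_zer l)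
          · exact isClosed_inter hXc (isClosed_zer l)) (vperp v) {{pv}} hB
      (if vperp v ≤ p then ∅ else {p}) (by split_ifs <;> simp)
      (by split_ifs with h
          · simp
          · intro p' hp'; rw [Set.mem_singleton_iff] at hp'; rwa [hp'])
    have haX := haT true
    have haY := haT false
    simp only [cond_true, cond_false] at haX haY
    have hsub : ∀ W ∈ ({{pv}} : Set (Set (ProjPt k n))), W.Subsingleton := by
      rintro W hW; rw [Set.mem_singleton_iff] at hW; rw [hW]; exact Set.subsingleton_singleton
    have hYc := isClosed_inter hY.2.1 (isClosed_zer l)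
    refine ⟨Fin.snoc l a, ?_, ?_, ?_, ?_, ?_⟩
    · intro j
      refine Fin.lastCases ?_ (fun j => ?_) j
      · simpa using haU
      · simpa using h1 j
    · intro hid hdim
      rw [zer_snoc, ← Set.inter_assoc] at hdim
      apply h2 (by omega)
      rw [show d - i = d - (i+1) + 1 by omega]
      exact dimGE_cut hYc {{pv}} haY (fun W hW _ _ => hsub W hW) (fun h => by omega) hdim
    · intro hid x hx
      rw [zer_snoc, ← Set.inter_assoc] at hx
      by_contra hxv
      obtain ⟨W, hWc, hWi, hWT, hxW, hWB⟩ := haY {x} (irred_singleton x) (by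
        rintro _ rfl; exact hx.1)
      rcases hWB with hWB | hWB
      · rw [Set.mem_singleton_iff] at hWB
        rw [hWB] at hxW
        exact hxv (hxW rfl)
      · apply h2 (by omega)
        rw [show d - i = 0 + 1 by omega]
        refine dimGE_mono hWc hYc hWT (dimGE_cut hWc ∅ (a := a) ?_ (by simp) (by simp) ?_)
        · intro D hD hDW
          exact ⟨W, hWc, hWi, subset_rfl, hDW, Or.inr hWB⟩
        · exact dimGE_zero (isClosed_inter hWc (isClosed_hyp a)) ⟨x, hxW rfl, hx.2⟩
    · intro hdim
      rw [zer_snoc, ← Set.inter_assoc] at hdim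
      apply h3
      rw [show d + 1 - i = d + 1 - (i+1) + 1 by omega]
      exact dimGE_cut (isClosed_inter hXc (isClosed_zer l)) {{pv}} haX (fun W hW _ _ => hsub W hW) (fun h => by omega) hdim
    · have hr : p ≤ Nv X v ⊔ Submodule.span k (Set.range (Fin.snoc l a : Fin (i+1) → Fin (n+1) → k)) := by
        refine sup_le_sup_left (Submodule.span_mono ?_) _
        rintro _ ⟨j, rfl⟩
        exact ⟨j.castSucc, by simp⟩
      by_cases hp : vperp v ≤ p
      · right; exact hp.trans hr
      · rw [if_neg hp] at has
        have hap := has p rfl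
        left
        have h5 : n - d + i ≤ Module.finrank k p := h4.resolve_right hp
        have hlt : p < Nv X v ⊔ Submodule.span k (Set.range (Fin.snoc l a : Fin (i+1) → Fin (n+1) → k)) := by
          refine lt_of_le_of_ne hr fun h => hap ?_
          rw [h]
          exact Submodule.mem_sup_right (Submodule.subset_span ⟨Fin.last i, by simp⟩)
        have := Submodule.finrank_lt_finrank_of_lt hlt
        omega

lemma choose_l' {X Y : Set (ProjPt k n)} {d : ℕ} (hX : IsSmoothVariety X d) (hd : 1 ≤ d)
    (hY : IsPrimeDivisorOn X d Y) {v : Fin (n+1) → k} (hv : v ∈ cone X) :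
    ∃ l : Fin (d+1) → Fin (n+1) → k, X ∩ zer l = ∅ ∧
      (∀ w ∈ cone Y, (∀ i, l i ⬝ᵥ w = l i ⬝ᵥ v) → w = v) ∧
      ⊤ ≤ Nv X v ⊔ Submodule.span k (Set.range l) := by
  obtain ⟨l, h1, h2, h3, h4⟩ := choose_l hX hd hY hv
  obtain ⟨hXc, hXi, hXd, hXs⟩ := hX
  have hv0 := cone_ne_zero hv
  have hc := isClosed_inter hXc (isClosed_zer l)
  obtain ⟨a, -, hav, ha⟩ := exists_generic (fun _ : Unit => X ∩ zer l) (fun _ => hc) ⊤ ∅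
    (fun W hW _ => top_not_le_ann hW.1) {vperp v} (Set.finite_singleton _) (by
      rintro p rfl h; exact vperp_ne_top hv0 (top_le_iff.mp h))
  have hav := hav _ rfl
  rw [mem_vperp] at hav
  refine ⟨Fin.snoc l a, ?_, ?_, ?_⟩
  · rw [zer_snoc, ← Set.inter_assoc]
    by_contra hne
    apply h3
    exact dimGE_cut hc ∅ (ha ()) (by simp) (by simp)
      (dimGE_zero (isClosed_inter hc (isClosed_hyp a)) (Set.nonempty_iff_ne_empty.mpr hne))
  · intro w hw h
    obtain ⟨c, rfl⟩ := h2 w hw (fun i => by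
      have := h i.castSucc
      rw [Fin.snoc_castSucc] at this
      rw [this]; exact h1 i)
    have := h (Fin.last d)
    rw [Fin.snoc_last, dotProduct_smul, smul_eq_mul] at this
    have hc : c = 1 := mul_right_cancel₀ hav (by rw [this, one_mul])
    rw [hc, one_smul]
  · intro b _
    have hr : Nv X v ⊔ Submodule.span k (Set.range l) ≤
        Nv X v ⊔ Submodule.span k (Set.range (Fin.snoc l a : Fin (d+1) → Fin (n+1) → k)) := by
      refine sup_le_sup_left (Submodule.span_mono ?_) _
      rintro _ ⟨j, rfl⟩
      exact ⟨j.castSucc, by simp⟩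
    have : b = (b - ((b ⬝ᵥ v) / (a ⬝ᵥ v)) • a) + ((b ⬝ᵥ v) / (a ⬝ᵥ v)) • a := by abel
    rw [this]
    refine add_mem (hr (h4 ?_)) (Submodule.smul_mem _ _ (Submodule.mem_sup_right
      (Submodule.subset_span ⟨Fin.last d, by simp⟩)))
    rw [mem_vperp, sub_dotProduct, smul_dotProduct, smul_eq_mul, div_mul_cancel₀ _ hav, sub_self]
end Bt
end Part6

section Part7
open MvPolynomial
namespace Bt
set_option linter.unusedSectionVars false
set_option linter.unusedVariables false
variable {k : Type} [Field k] {n : ℕ}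
attribute [local instance] MvPolynomial.gradedAlgebra

/-- The maximal ideal of a vector. -/
noncomputable def mv (v : Fin (n+1) → k) : Ideal (MvPolynomial (Fin (n+1)) k) := RingHom.ker (eval v)

lemma mem_mv {v : Fin (n+1) → k} {f : MvPolynomial (Fin (n+1)) k} : f ∈ mv v ↔ eval v f = 0 := Iff.rfl

lemma lin_single (i : Fin (n+1)) : lin (Pi.single i (1:k)) = X i := by
  unfold lin
  rw [Finset.sum_eq_single i]
  · simp
  · intro j _ hj; simp [Pi.single_apply, hj]
  · simp

lemma lin_add (a b : Fin (n+1) → k) : lin (a + b) = lin a + lin b := by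
  simp [lin, add_mul, Finset.sum_add_distrib]

lemma lin_smul (c : k) (a : Fin (n+1) → k) : lin (c • a) = C c * lin a := by
  simp [lin, Finset.mul_sum, mul_assoc]

/-- linear affine part -/
noncomputable def laff (v a : Fin (n+1) → k) : MvPolynomial (Fin (n+1)) k := lin a - C (a ⬝ᵥ v)

lemma laff_add (v a b : Fin (n+1) → k) : laff v (a + b) = laff v a + laff v b := by
  simp [laff, lin_add, add_dotProduct]; ring

lemma laff_smul (v : Fin (n+1) → k) (c : k) (a : Fin (n+1) → k) : laff v (c • a) = C c * laff v a := by
  simp [laff, lin_smul, mul_sub]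

lemma laff_mem (v a : Fin (n+1) → k) : laff v a ∈ mv v := by
  rw [mem_mv]; simp [laff, eval_lin]

lemma grad_mul_X (f : MvPolynomial (Fin (n+1)) k) (j : Fin (n+1)) (v : Fin (n+1) → k) :
    gradientAt (f * X j) v = v j • gradientAt f v + eval v f • Pi.single j 1 := by
  funext i
  simp [gradientAt, Derivation.leibniz, pderiv_X, Pi.single_apply]
  by_cases h : j = i
  · simp [h]; ring
  · simp [h, Ne.symm h]

lemma grad_add (f g : MvPolynomial (Fin (n+1)) k) (v : Fin (n+1) → k) :
    gradientAt (f + g) v = gradientAt f v + gradientAt g v := by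
  funext i; simp [gradientAt]

lemma grad_mul (f g : MvPolynomial (Fin (n+1)) k) (v : Fin (n+1) → k) :
    gradientAt (f * g) v = eval v f • gradientAt g v + eval v g • gradientAt f v := by
  funext i; simp [gradientAt, Derivation.leibniz]

lemma grad_C (c : k) (v : Fin (n+1) → k) : gradientAt (C c) v = 0 := by
  funext i; simp [gradientAt]

lemma grad_lin (a v : Fin (n+1) → k) : gradientAt (lin a) v = a := by
  funext i
  simp [gradientAt, lin, Derivation.leibniz, pderiv_X, Pi.single_apply]

lemma taylor (v : Fin (n+1) → k) (f : MvPolynomial (Fin (n+1)) k) :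
    f - C (eval v f) - laff v (gradientAt f v) ∈ mv v ^ 2 := by
  induction f using MvPolynomial.induction_on with
  | C a =>
    rw [grad_C]; simp [laff, lin]
  | add p q hp hq =>
    rw [grad_add, laff_add, map_add, map_add]
    have := Ideal.add_mem _ hp hq
    convert this using 1; ring
  | mul_X p j hp =>
    rw [grad_mul_X, laff_add, laff_smul, laff_smul, map_mul, eval_X, map_mul]
    have h1 := Ideal.mul_mem_left _ (C (v j)) hp
    have h2 : (p - C (eval v p)) * (X j - C (v j)) ∈ mv v ^ 2 := by
      rw [pow_two]
      exact Ideal.mul_mem_mul (by simp [mem_mv]) (by simp [mem_mv])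
    have := Ideal.add_mem _ h1 h2
    convert this using 1
    have : laff v (Pi.single j 1) = X j - C (v j) := by
      rw [laff, lin_single]; simp
    rw [this]; ring

variable [IsAlgClosed k]

lemma mv_le {X : Set (ProjPt k n)} {d : ℕ} {v : Fin (n+1) → k} {l : Fin d → Fin (n+1) → k}
    (h : ⊤ ≤ Nv X v ⊔ Submodule.span k (Set.range l)) (hv : v ∈ cone X) :
    mv v ≤ (IX X ⊔ Ideal.span (Set.range fun i => laff v (l i))) ⊔ mv v ^ 2 := by
  set J := (IX X ⊔ Ideal.span (Set.range fun i => laff v (l i))) ⊔ mv v ^ 2 with hJ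
  let T : Submodule k (Fin (n+1) → k) :=
    { carrier := {a | laff v a ∈ J}
      zero_mem' := by simp [laff, lin]
      add_mem' := by
        intro a b ha hb
        rw [Set.mem_ofPred_eq, laff_add]; exact J.add_mem ha hb
      smul_mem' := by
        intro c a ha
        rw [Set.mem_ofPred_eq, laff_smul]; exact J.mul_mem_left _ ha }
  have hT : ⊤ ≤ T := by
    refine h.trans (sup_le ?_ ?_)
    · unfold Nv
      rw [Submodule.span_le]
      rintro w ⟨f, hf, rfl⟩
      change laff v (gradientAt f v) ∈ J
      have hfI : f ∈ IX X := (mem_homV.1 hf).2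
      have h1 := taylor v f
      rw [mem_IX.1 hfI v hv, map_zero, sub_zero] at h1
      have : laff v (gradientAt f v) = f - (f - laff v (gradientAt f v)) := by ring
      rw [this]
      exact J.sub_mem (hJ ▸ Ideal.mem_sup_left (Ideal.mem_sup_left hfI)) (hJ ▸ Ideal.mem_sup_right h1)
    · rw [Submodule.span_le]
      rintro _ ⟨i, rfl⟩
      exact Ideal.mem_sup_left (Ideal.mem_sup_right (Ideal.subset_span ⟨i, rfl⟩))
  intro f hf
  have h1 := taylor v f
  rw [mem_mv.1 hf, map_zero, sub_zero] at h1
  have : f = laff v (gradientAt f v) + (f - laff v (gradientAt f v)) := by ring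
  rw [this]
  exact J.add_mem (hT (Submodule.mem_top)) (hJ ▸ Ideal.mem_sup_right h1)

lemma le_of_pow_le {S : Type} [CommRing S] {M J : Ideal S} (h : M ≤ J ⊔ M ^ 2) {N : ℕ} (hN : M ^ N ≤ J) :
    M ≤ J := by
  have : ∀ r, M ≤ J ⊔ M ^ (r+1) := by
    intro r
    induction r with
    | zero => simp
    | succ r ih =>
      refine h.trans (sup_le le_sup_left ?_)
      rw [pow_two]
      calc M * M ≤ M * (J ⊔ M ^ (r+1)) := Ideal.mul_mono_right ih
        _ = M * J ⊔ M * M ^ (r+1) := Ideal.mul_sup _ _ _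
        _ ≤ J ⊔ M ^ (r+1+1) := sup_le_sup Ideal.mul_le_right (by rw [← pow_succ'])
  exact (this N).trans (sup_le le_rfl ((Ideal.pow_le_pow_right (Nat.le_succ N)).trans hN))

lemma mv_le' {X Y : Set (ProjPt k n)} {d : ℕ} {v : Fin (n+1) → k} {l : Fin d → Fin (n+1) → k}
    (hYc : IsClosedSub Y) (hXc : IsClosedSub X) (hY : Y ⊆ X)
    (h : ⊤ ≤ Nv X v ⊔ Submodule.span k (Set.range l)) (hv : v ∈ cone X)
    (h' : ∀ w ∈ cone Y, (∀ i, l i ⬝ᵥ w = l i ⬝ᵥ v) → w = v) (h0 : X ∩ zer l = ∅):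
    mv v ≤ IX Y ⊔ Ideal.span (Set.range fun i => laff v (l i)) := by
  set J := IX Y ⊔ Ideal.span (Set.range fun i => laff v (l i)) with hJ
  have h1 : mv v ≤ J ⊔ mv v ^ 2 :=
    (mv_le h hv).trans (sup_le_sup (sup_le_sup (IX_anti hY) le_rfl) le_rfl)
  have hrad : mv v ≤ J.radical := by
    rw [← vanishingIdeal_zeroLocus_eq_radical (K := k)]
    intro f hf
    rw [mem_vanishingIdeal_iff]
    intro w hw
    have hw0 : ∀ g ∈ J, eval w g = 0 := by
      intro g hg
      simpa [aeval_def, eval₂_id] using hw g hg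
    have hl : ∀ i, l i ⬝ᵥ w = l i ⬝ᵥ v := by
      intro i
      have := hw0 (laff v (l i)) (Ideal.mem_sup_right (Ideal.subset_span ⟨i, rfl⟩))
      simpa [laff, eval_lin, sub_eq_zero] using this
    have hwne : w ≠ 0 := by
      rintro rfl
      refine disjoint_zer hXc h0 v hv.1 (fun f hf => mem_IX.1 hf v hv) (fun i => ?_)
      rw [← hl i]; simp
    have hwY : w ∈ cone Y := (mem_cone_closed hYc).2 ⟨hwne, fun f hf => hw0 f (Ideal.mem_sup_left hf)⟩
    have hwv := h' w hwY hl
    rw [hwv]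
    simpa [aeval_def, eval₂_id] using mem_mv.1 hf
  obtain ⟨N, hN⟩ := Ideal.exists_pow_le_of_le_radical_of_fg hrad (IsNoetherian.noetherian _)
  exact le_of_pow_le h1 hN

lemma step3 {P : Ideal (MvPolynomial (Fin (n+1)) k)} (hP : HomI P) {d : ℕ} {v : Fin (n+1) → k}
    {l : Fin d → Fin (n+1) → k}
    (h : ∀ v, v ≠ 0 → (∀ f ∈ P, eval v f = 0) → (∀ i, l i ⬝ᵥ v = 0) → False)
    (hm : mv v ≤ P ⊔ Ideal.span (Set.range fun i => laff v (l i)))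
    {Q : Type} [CommRing Q] [Algebra k Q]
    (q : MvPolynomial (Fin (n+1)) k →ₐ[k] Q) (hq : Function.Surjective q)
    (hqI : ∀ f, q f = 0 ↔ f ∈ P) :
    ∃ s : MvPolynomial (Fin (n+1)) k, eval v s = 1 ∧ ∀ g, ∃ α : MvPolynomial (Fin d) k,
      s * g - aeval (fun i => lin (l i)) α ∈ P := by
  have hfin := finite_of_empty q hq hqI hP l h
  let _ := (prj q l).toRingHom.toAlgebra
  have : Module.Finite (MvPolynomial (Fin d) k) Q := hfin
  have hsm : ∀ (a : MvPolynomial (Fin d) k) (x : Q), a • x = q (aeval (fun i => lin (l i)) a) * x := by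
    intro a x
    rw [Algebra.smul_def, ← prj_apply]; rfl
  let M : Ideal (MvPolynomial (Fin d) k) := RingHom.ker (eval fun i => l i ⬝ᵥ v)
  have hle : (⊤ : Submodule (MvPolynomial (Fin d) k) Q) ≤
      Submodule.span (MvPolynomial (Fin d) k) {(1:Q)} ⊔ M • (⊤ : Submodule (MvPolynomial (Fin d) k) Q) := by
    intro x _
    obtain ⟨g, rfl⟩ := hq x
    have h1 : g - C (eval v g) ∈ mv v := by simp [mem_mv]
    obtain ⟨p, hp, z, hz, hpz⟩ := Submodule.mem_sup.1 (hm h1)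
    have hgz : q g = (C (eval v g) : MvPolynomial (Fin d) k) • (1:Q) + q z := by
      have : g = C (eval v g) + p + z := by rw [add_assoc, hpz]; ring
      rw [hsm]
      conv_lhs => rw [this]
      simp [(hqI p).2 hp]
    rw [hgz]
    refine Submodule.add_mem_sup (Submodule.smul_mem _ _ (Submodule.mem_span_singleton_self _)) ?_
    rw [← Ideal.submodule_span_eq] at hz
    clear hpz hgz
    induction hz using Submodule.span_induction with
    | mem z hz =>
      obtain ⟨i, rfl⟩ := hz
      have : q (laff v (l i)) = (X i - C (l i ⬝ᵥ v) : MvPolynomial (Fin d) k) • (1:Q) := by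
        rw [hsm]; simp [laff]
      simp only [this]
      refine Submodule.smul_mem_smul ?_ Submodule.mem_top
      simp [M, RingHom.mem_ker]
    | zero => simp
    | add a b _ _ ha hb => rw [map_add]; exact Submodule.add_mem _ ha hb
    | smul a b _ hb =>
      rw [smul_eq_mul, map_mul]
      refine Submodule.smul_induction_on hb ?_ ?_
      · intro r hr y _
        have : q a * (r • y) = r • (q a * y) := by rw [hsm, hsm]; ring
        rw [this]
        exact Submodule.smul_mem_smul hr Submodule.mem_top
      · intro x y hx hy
        rw [mul_add]; exact Submodule.add_mem _ hx hy
  obtain ⟨r, hr, hr'⟩ := Submodule.exists_sub_one_mem_and_smul_le_of_fg_of_le_sup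
    (Module.Finite.fg_top) le_rfl hle
  refine ⟨aeval (fun i => lin (l i)) r, ?_, fun g => ?_⟩
  · have h1 : eval (fun i => l i ⬝ᵥ v) r = 1 := by
      have : eval (fun i => l i ⬝ᵥ v) (r - 1) = 0 := hr
      simpa [sub_eq_zero] using this
    rw [← h1]
    have : (eval v).comp (aeval (R := k) (fun i => lin (l i))).toRingHom = eval (fun i => l i ⬝ᵥ v) := by
      ext i <;> simp [eval_lin]
    exact congrArg (fun f => f r) this
  · have h1 : r • q g ∈ Submodule.span (MvPolynomial (Fin d) k) {(1:Q)} :=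
      hr' (Submodule.smul_mem_pointwise_smul _ _ _ Submodule.mem_top)
    obtain ⟨α, hα⟩ := Submodule.mem_span_singleton.1 h1
    refine ⟨α, (hqI _).1 ?_⟩
    rw [map_sub, map_mul, ← hsm, ← hα, hsm, mul_one, sub_self]

/-- unit trick plus Nakayama -/
lemma nak {v : Fin (n+1) → k} {P J : Ideal (MvPolynomial (Fin (n+1)) k)}
    (u : MvPolynomial (Fin (n+1)) k) (hu : eval v u ≠ 0)
    (h : ∀ p ∈ P, u * p ∈ J ⊔ mv v * P) :
    ∃ s, eval v s ≠ 0 ∧ ∀ p ∈ P, s * p ∈ J := by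
  have hle : P ≤ J ⊔ mv v • P := by
    intro p hp
    have : p = C (eval v u)⁻¹ * (u * p) + (1 - C (eval v u)⁻¹ * u) * p := by ring
    rw [this]
    refine Ideal.add_mem _ (Ideal.mul_mem_left _ _ (h p hp)) (Ideal.mem_sup_right ?_)
    refine Ideal.mul_mem_mul ?_ hp
    rw [mem_mv]; simp [hu]
  obtain ⟨r, hr, hr'⟩ := Submodule.exists_sub_one_mem_and_smul_le_of_fg_of_le_sup
    (IsNoetherian.noetherian P) le_rfl hle
  refine ⟨r, ?_, fun p hp => hr' (Submodule.smul_mem_pointwise_smul _ _ _ hp)⟩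
  have : eval v (r - 1) = 0 := hr
  rw [map_sub, map_one, sub_eq_zero] at this
  rw [this]; exact one_ne_zero

/-- homogenization of the unit. -/
lemma hom_unit {v : Fin (n+1) → k} {J P : Ideal (MvPolynomial (Fin (n+1)) k)} (hJ : HomI J) (hP : HomI P)
    {u : MvPolynomial (Fin (n+1)) k} (hu : eval v u ≠ 0) (h : ∀ p ∈ P, u * p ∈ J) :
    ∃ e u', MvPolynomial.IsHomogeneous u' e ∧ eval v u' ≠ 0 ∧ ∀ p ∈ P, u' * p ∈ J := by
  have : ∃ e, eval v (homogeneousComponent e u) ≠ 0 := by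
    by_contra hc
    push Not at hc
    apply hu
    rw [← sum_homogeneousComponent u, map_sum]
    exact Finset.sum_eq_zero fun i _ => hc i
  obtain ⟨e, he⟩ := this
  refine ⟨e, _, homogeneousComponent_isHomogeneous e u, he, fun p hp => ?_⟩
  rw [← sum_homogeneousComponent p, Finset.mul_sum]
  refine Ideal.sum_mem _ fun i _ => ?_
  rw [← comp_mul_hom (homogeneousComponent_isHomogeneous i p)]
  exact (HomI.mem_iff hJ).1 (h _ ((HomI.mem_iff hP).1 hp i)) _

lemma mem_span_range {S : Type} [CommRing S] {d : ℕ} {f : Fin d → S} {x : S}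
    (h : x ∈ Ideal.span (Set.range f)) : ∃ b : Fin d → S, x = ∑ i, b i * f i := by
  rw [Ideal.mem_span_range_iff_exists_fun] at h
  obtain ⟨c, hc⟩ := h
  exact ⟨c, hc.symm⟩

set_option maxHeartbeats 1000000 in
lemma local_gen {X Y : Set (ProjPt k n)} {d : ℕ} (hX : IsSmoothVariety X d) (hd : 1 ≤ d)
    (hY : IsPrimeDivisorOn X d Y) {v : Fin (n+1) → k} (hv : v ∈ cone X) :
    ∃ (e e' : ℕ) (f u : MvPolynomial (Fin (n+1)) k), f.IsHomogeneous e ∧ u.IsHomogeneous e' ∧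
      f ∈ IX Y ∧ eval v u ≠ 0 ∧ ∀ p ∈ IX Y, u * p ∈ Ideal.span {f} ⊔ IX X := by
  by_cases hvY : v ∉ cone Y
  · obtain ⟨f, hf, ⟨m, hm⟩, hfv⟩ := exists_sep hY.2.1 hv.1 hvY
    exact ⟨m, m, f, f, hm, hm, hf, hfv, fun p _ => Ideal.mem_sup_left
      (Ideal.mul_mem_right _ _ (Ideal.mem_span_singleton_self f))⟩
  push Not at hvY
  obtain ⟨hXc, hXi, hXd, hXs⟩ := hX
  obtain ⟨l, hl0, hlY, hlt⟩ := choose_l' ⟨hXc, hXi, hXd, hXs⟩ hd hY hv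
  have hss := ne_of_not_dimGE hXc hXi hXd hd hY
  have hlt' := ssubset_IX hY.2.1 hXc hss
  have hIP : IX X ≤ IX Y := hlt'.le
  have hXp := IX_prime hXi
  have hYp := IX_prime hY.2.2.1
  -- s'
  obtain ⟨s', hs', hs'm⟩ := nak (v := v) (P := mv v)
    (J := IX X ⊔ Ideal.span (Set.range fun i => laff v (l i))) 1 (by simp)
    (fun p hp => by rw [one_mul, ← pow_two]; exact mv_le hlt hv hp)
  have hYl : ∀ v, v ≠ 0 → (∀ f ∈ IX Y, eval v f = 0) → (∀ i, l i ⬝ᵥ v = 0) → False :=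
    disjoint_zer hY.2.1 (by
      apply Set.eq_empty_of_subset_empty; rw [← hl0]
      exact Set.inter_subset_inter_left _ hY.1)
  obtain ⟨s, hs, hsg⟩ := step3 (IX_hom Y) hYl (mv_le' hY.2.1 hXc hY.1 hlt hv hlY hl0)
    (Ideal.Quotient.mkₐ k (IX Y)) (Ideal.Quotient.mkₐ_surjective k _)
    (fun f => Ideal.Quotient.eq_zero_iff_mem)
  -- a form in IX Y not in IX X
  have : ∃ f ∈ IX Y, (∃ m, f.IsHomogeneous m) ∧ f ∉ IX X := by
    obtain ⟨x, hx, hxY⟩ := Set.exists_of_ssubset hss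
    obtain ⟨f, hf, hm, hfv⟩ := exists_sep hY.2.1 (cone_rep hx).1 (v := x.rep)
      (by intro h; apply hxY; rw [mem_cone_mk (cone_rep hx).1] at h; simpa using h)
    exact ⟨f, hf, hm, fun h => hfv (mem_IX.1 h _ (cone_rep hx))⟩
  obtain ⟨g, hgY, ⟨m, hgm⟩, hgX⟩ := this
  obtain ⟨F, hF, hFG⟩ := min_principal hXc hXi hXd hgX (divisor_minimal hXc hXi hXd hd hY hgm hgX hgY) hl0
  set f := aeval (fun i => lin (l i)) F with hf
  have hfY : f ∈ IX Y := (hFG F).2 dvd_rfl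
  obtain ⟨u, hu, hup⟩ := nak (v := v) (P := IX Y) (J := Ideal.span {f} ⊔ IX X) (s * s')
    (by rw [map_mul, hs, one_mul]; exact hs') (by
    intro p hp
    obtain ⟨i, hi, z, hz, hiz⟩ := Submodule.mem_sup.1 (hs'm p (mem_mv.2 (mem_IX.1 hp v hvY)))
    obtain ⟨b, rfl⟩ := mem_span_range hz
    choose α hα using fun j => hsg (b j)
    have e1 : s * s' * p = aeval (fun i => lin (l i)) (∑ j, α j * (MvPolynomial.X j - C (l j ⬝ᵥ v)))
        + s * i + ∑ j, laff v (l j) * (s * b j - aeval (fun i => lin (l i)) (α j)) := by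
      have : s * s' * p = s * (s' * p) := by ring
      rw [this, ← hiz, map_sum, mul_add, Finset.mul_sum]
      have : ∀ j, aeval (fun i => lin (l i)) (α j * (MvPolynomial.X j - C (l j ⬝ᵥ v))) =
          aeval (fun i => lin (l i)) (α j) * laff v (l j) := by
        intro j; simp [laff]
      simp only [this]
      rw [add_comm (s * i), add_right_comm, ← Finset.sum_add_distrib]
      congr 1
      refine Finset.sum_congr rfl fun j _ => ?_
      ring
    have hm2 : ∑ j, laff v (l j) * (s * b j - aeval (fun i => lin (l i)) (α j)) ∈ mv v * IX Y :=
      Ideal.sum_mem _ fun j _ => Ideal.mul_mem_mul (laff_mem _ _) (hα j)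
    have h3 : aeval (fun i => lin (l i)) (∑ j, α j * (MvPolynomial.X j - C (l j ⬝ᵥ v))) ∈ IX Y := by
      have : aeval (fun i => lin (l i)) (∑ j, α j * (MvPolynomial.X j - C (l j ⬝ᵥ v))) =
        s * s' * p - s * i - ∑ j, laff v (l j) * (s * b j - aeval (fun i => lin (l i)) (α j)) := by
        rw [e1]; ring
      rw [this]
      exact Ideal.sub_mem _ (Ideal.sub_mem _ (Ideal.mul_mem_left _ _ hp)
        (Ideal.mul_mem_left _ _ (hIP hi))) (Ideal.mul_le_right hm2)
    obtain ⟨t, ht⟩ := (hFG _).1 h3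
    rw [e1]
    refine Ideal.add_mem _ (Ideal.add_mem _ ?_ ?_) (Ideal.mem_sup_right hm2)
    · rw [ht, map_mul]
      exact Ideal.mem_sup_left (Ideal.mem_sup_left (Ideal.mul_mem_right _ _ (Ideal.mem_span_singleton_self _)))
    · exact Ideal.mem_sup_left (Ideal.mem_sup_right (Ideal.mul_mem_left _ _ hi)))
  have huX : u ∉ IX X := fun h => hu (mem_IX.1 h v hv)
  have hfX : f ∉ IX X := by
    intro h
    refine hlt'.not_ge fun p hp => ?_
    have h1 := hup p hp
    have : Ideal.span {f} ⊔ IX X = IX X := by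
      rw [sup_eq_right, Ideal.span_singleton_le_iff_mem]; exact h
    rw [this] at h1
    exact (hXp.mem_or_mem h1).resolve_left huX
  -- components
  have hc : ∀ j, ∃ c, u * homogeneousComponent j f - c * f ∈ IX X := by
    intro j
    obtain ⟨z, hz, i, hi, hzi⟩ := Submodule.mem_sup.1 (hup _ ((HomI.mem_iff (IX_hom Y)).1 hfY j))
    obtain ⟨c, rfl⟩ := Ideal.mem_span_singleton'.1 hz
    exact ⟨c, by rw [← hzi, add_sub_cancel_left]; exact hi⟩
  choose c hc using hc
  have hcv : ∃ j, eval v (c j) ≠ 0 := by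
    by_contra hcon
    push Not at hcon
    have h1 : (u - ∑ j ∈ Finset.range (f.totalDegree + 1), c j) * f ∈ IX X := by
      have : (u - ∑ j ∈ Finset.range (f.totalDegree + 1), c j) * f =
          ∑ j ∈ Finset.range (f.totalDegree + 1), (u * homogeneousComponent j f - c j * f) := by
        rw [Finset.sum_sub_distrib, ← Finset.mul_sum, sum_homogeneousComponent, sub_mul, Finset.sum_mul]
      rw [this]
      exact Ideal.sum_mem _ fun j _ => hc j
    have h2 := mem_IX.1 ((hXp.mem_or_mem h1).resolve_right hfX) v hv
    rw [map_sub, map_sum, Finset.sum_eq_zero (fun j _ => hcon j), sub_zero] at h2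
    exact hu h2
  obtain ⟨j, hj⟩ := hcv
  have hfj := homogeneousComponent_isHomogeneous j f
  obtain ⟨e', u', hu'h, hu'v, hu'⟩ := hom_unit (v := v) (J := IX X ⊔ Ideal.span {homogeneousComponent j f})
    (P := IX Y) (u := c j * u) (form_sup_hom hfj) (IX_hom Y) (by rw [map_mul]; exact mul_ne_zero hj hu) (by
      intro p hp
      obtain ⟨z, hz, i, hi, hzi⟩ := Submodule.mem_sup.1 (hup p hp)
      obtain ⟨b, rfl⟩ := Ideal.mem_span_singleton'.1 hz
      have : c j * u * p = (c j * i - b * (u * homogeneousComponent j f - c j * f)) +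
          (b * u) * homogeneousComponent j f := by
        rw [mul_assoc, ← hzi]; ring
      rw [this]
      exact Ideal.add_mem _ (Ideal.mem_sup_left (Ideal.sub_mem _ (Ideal.mul_mem_left _ _ hi)
        (Ideal.mul_mem_left _ _ (hc j)))) (Ideal.mem_sup_right (Ideal.mul_mem_left _ _
          (Ideal.mem_span_singleton_self _))))
  exact ⟨j, e', _, u', hfj, hu'h, (HomI.mem_iff (IX_hom Y)).1 hfY j, hu'v,
    fun p hp => by rw [sup_comm]; exact hu' p hp⟩

end Bt
end Part7

section Part8
open MvPolynomial
namespace Bt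
set_option linter.unusedSectionVars false
set_option linter.unusedVariables false
variable {k : Type} [Field k] {n : ℕ}
attribute [local instance] MvPolynomial.gradedAlgebra

section abs
variable {S : Type} [CommRing S]

lemma mem_sup_span {I : Ideal S} {f x : S} : x ∈ Ideal.span {f} ⊔ I ↔ ∃ c, x - c * f ∈ I := by
  constructor
  · intro h
    obtain ⟨z, hz, i, hi, hzi⟩ := Submodule.mem_sup.1 h
    obtain ⟨c, rfl⟩ := Ideal.mem_span_singleton'.1 hz
    exact ⟨c, by rw [← hzi, add_sub_cancel_left]; exact hi⟩
  · rintro ⟨c, hc⟩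
    have : x = c * f + (x - c * f) := by ring
    rw [this]
    exact Ideal.add_mem _ (Ideal.mem_sup_left (Ideal.mul_mem_left _ _ (Ideal.mem_span_singleton_self f)))
      (Ideal.mem_sup_right hc)

/-- `f` generates `P` generically modulo `I`. -/
def Gen (I P : Ideal S) (f : S) : Prop :=
  f ∈ P ∧ f ∉ I ∧ ∃ u, u ∉ P ∧ ∀ p ∈ P, ∃ c, u * p - c * f ∈ I

/-- `g` has order exactly `r` with respect to `f`. -/
def OrdIs (I P : Ideal S) (f g : S) (r : ℕ) : Prop :=
  ∃ s s', s ∉ P ∧ s' ∉ P ∧ s * g - s' * f ^ r ∈ I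

lemma ordIs_exists [IsNoetherianRing S] {I P : Ideal S} (hI : I.IsPrime) (hP : P.IsPrime) (hIP : I ≤ P) {f : S}
    (hf : Gen I P f) {g : S} (hg : g ∉ I) : ∃ r, OrdIs I P f g r := by
  obtain ⟨hfP, hfI, u, hu, huP⟩ := hf
  let J : S → Ideal S := fun g =>
    { carrier := {x | ∃ t, t ∉ P ∧ ∃ c, t * x - c * g ∈ I}
      zero_mem' := ⟨1, hP.one_notMem, 0, by simp⟩
      add_mem' := by
        rintro x y ⟨t, ht, c, hc⟩ ⟨t', ht', c', hc'⟩
        refine ⟨t * t', fun h => (hP.mem_or_mem h).elim ht ht', t' * c + t * c', ?_⟩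
        have : t * t' * (x + y) - (t' * c + t * c') * g = t' * (t * x - c * g) + t * (t' * y - c' * g) := by ring
        rw [this]; exact I.add_mem (I.mul_mem_left _ hc) (I.mul_mem_left _ hc')
      smul_mem' := by
        rintro a x ⟨t, ht, c, hc⟩
        refine ⟨t, ht, a * c, ?_⟩
        have : t * (a * x) - a * c * g = a * (t * x - c * g) := by ring
        rw [smul_eq_mul, this]; exact I.mul_mem_left _ hc }
  have hgJ : ∀ g, g ∈ J g := fun g => ⟨1, hP.one_notMem, 1, by simp⟩
  have key : ∀ J' : Ideal S, ∀ g, J g = J' → g ∉ I → ∃ r, OrdIs I P f g r := by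
    intro J'
    induction J' using WellFoundedGT.induction with
    | ind J' ih =>
      rintro g rfl hg
      by_cases hgP : g ∈ P
      · obtain ⟨c, hc⟩ := huP g hgP
        have hcI : c ∉ I := by
          intro h
          have : u * g ∈ I := by
            have := I.add_mem hc (I.mul_mem_right f h)
            simpa using this
          exact (hI.mem_or_mem this).elim (fun h => hu (hIP h)) hg
        have hlt : J g < J c := by
          refine lt_of_le_of_ne ?_ ?_
          · rintro x ⟨t, ht, b, hb⟩
            refine ⟨u * t, fun h => (hP.mem_or_mem h).elim hu ht, b * f, ?_⟩
            have : u * t * x - b * f * c = u * (t * x - b * g) + b * (u * g - c * f) := by ring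
            rw [this]; exact I.add_mem (I.mul_mem_left _ hb) (I.mul_mem_left _ hc)
          · intro heq
            have : c ∈ J g := heq ▸ hgJ c
            obtain ⟨t, ht, b, hb⟩ := this
            have : (t * u - b * f) * g ∈ I := by
              have : (t * u - b * f) * g = t * (u * g - c * f) + f * (t * c - b * g) := by ring
              rw [this]; exact I.add_mem (I.mul_mem_left _ hc) (I.mul_mem_left _ hb)
            have := hIP ((hI.mem_or_mem this).resolve_right hg)
            have h2 : t * u ∈ P := by
              have := P.add_mem this (P.mul_mem_left b hfP)
              simpa using this
            exact (hP.mem_or_mem h2).elim ht hu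
        obtain ⟨r, s, s', hs, hs', h⟩ := ih _ hlt c rfl hcI
        refine ⟨r+1, s * u, s', fun h => (hP.mem_or_mem h).elim hs hu, hs', ?_⟩
        have : s * u * g - s' * f ^ (r+1) = s * (u * g - c * f) + f * (s * c - s' * f ^ r) := by ring
        rw [this]; exact I.add_mem (I.mul_mem_left _ hc) (I.mul_mem_left _ h)
      · exact ⟨0, 1, g, hP.one_notMem, hgP, by simp⟩
  exact key _ g rfl hg

lemma pow_gen {I P : Ideal S} {f u : S} (h : ∀ p ∈ P, ∃ c, u * p - c * f ∈ I) (r : ℕ) :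
    ∀ p ∈ P ^ r, ∃ c, u ^ r * p - c * f ^ r ∈ I := by
  induction r with
  | zero => intro p _; exact ⟨p, by simp⟩
  | succ r ih =>
    intro p hp
    rw [pow_succ] at hp
    refine Submodule.mul_induction_on hp ?_ ?_
    · intro a ha b hb
      obtain ⟨c, hc⟩ := ih a ha
      obtain ⟨c', hc'⟩ := h b hb
      refine ⟨c * c', ?_⟩
      have : u ^ (r+1) * (a * b) - c * c' * f ^ (r+1) =
        u * b * (u ^ r * a - c * f ^ r) + c * f ^ r * (u * b - c' * f) := by ring
      rw [this]; exact I.add_mem (I.mul_mem_left _ hc) (I.mul_mem_left _ hc')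
    · rintro x y ⟨c, hc⟩ ⟨c', hc'⟩
      refine ⟨c + c', ?_⟩
      have := I.add_mem hc hc'
      convert this using 1; ring

lemma ordIs_sSup {I P : Ideal S} (hI : I.IsPrime) (hP : P.IsPrime) (hIP : I ≤ P) {f : S}
    (hf : Gen I P f) {g : S} {r : ℕ} (h : OrdIs I P f g r) :
    sSup {r : ℕ | ∃ s, s ∉ P ∧ s * g ∈ P ^ r ⊔ I} = r := by
  obtain ⟨hfP, hfI, u, hu, huP⟩ := hf
  obtain ⟨s, s', hs, hs', hss⟩ := h
  apply IsGreatest.csSup_eq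
  constructor
  · refine ⟨s, hs, ?_⟩
    have : s * g = s' * f ^ r + (s * g - s' * f ^ r) := by ring
    rw [this]
    exact Ideal.add_mem _ (Ideal.mem_sup_left (Ideal.mul_mem_left _ _ (Ideal.pow_mem_pow hfP r)))
      (Ideal.mem_sup_right hss)
  · rintro r' ⟨t, ht, htg⟩
    by_contra hlt
    push Not at hlt
    obtain ⟨p, hp, i, hi, hpi⟩ := Submodule.mem_sup.1 htg
    obtain ⟨c, hc⟩ := pow_gen huP r' p hp
    have h1 : f ^ r * (u ^ r' * t * s' - s * c * f ^ (r' - r)) ∈ I := by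
      have e : f ^ r' = f ^ r * f ^ (r' - r) := by rw [← pow_add]; congr 1; omega
      have : f ^ r * (u ^ r' * t * s' - s * c * f ^ (r' - r)) =
        s * (u ^ r' * p - c * f ^ r') - u ^ r' * t * (s * g - s' * f ^ r) + s * u ^ r' * (t * g - p) := by
        rw [e]; ring
      rw [this]
      have h3 : t * g - p = i := by rw [← hpi]; ring
      rw [h3]
      exact I.add_mem (I.sub_mem (I.mul_mem_left _ hc) (I.mul_mem_left _ hss)) (I.mul_mem_left _ hi)
    have h2 := hIP ((hI.mem_or_mem h1).resolve_left (fun h => hfI (hI.mem_of_pow_mem _ h)))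
    have h3 : u ^ r' * t * s' ∈ P := by
      have h4 : s * c * f ^ (r' - r) ∈ P := P.mul_mem_left _ (Ideal.pow_mem_of_mem _ hfP _ (by omega))
      have := P.add_mem h2 h4
      simpa using this
    rcases hP.mem_or_mem h3 with h3 | h3
    · rcases hP.mem_or_mem h3 with h3 | h3
      · exact hu (hP.mem_of_pow_mem _ h3)
      · exact ht h3
    · exact hs' h3

lemma ordIs_mul {I P : Ideal S} (hP : P.IsPrime) {f g g' : S} {r r' : ℕ}
    (h : OrdIs I P f g r) (h' : OrdIs I P f g' r') : OrdIs I P f (g * g') (r + r') := by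
  obtain ⟨s, t, hs, ht, h1⟩ := h
  obtain ⟨s', t', hs', ht', h2⟩ := h'
  refine ⟨s * s', t * t', fun h => (hP.mem_or_mem h).elim hs hs',
    fun h => (hP.mem_or_mem h).elim ht ht', ?_⟩
  have : s * s' * (g * g') - t * t' * f ^ (r + r') = s' * g' * (s * g - t * f ^ r) +
    t * f ^ r * (s' * g' - t' * f ^ r') := by ring
  rw [this]; exact I.add_mem (I.mul_mem_left _ h1) (I.mul_mem_left _ h2)

lemma ordIs_zero_iff {I P : Ideal S} (hP : P.IsPrime) (hIP : I ≤ P) {f g : S} {r : ℕ} (hf : f ∈ P)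
    (h : OrdIs I P f g r) : r = 0 ↔ g ∉ P := by
  obtain ⟨s, t, hs, ht, h1⟩ := h
  constructor
  · rintro rfl hg
    apply ht
    have := P.sub_mem (P.mul_mem_left s hg) (hIP h1)
    simpa using this
  · intro hg
    by_contra hr
    have := P.add_mem (hIP h1) (P.mul_mem_left t (Ideal.pow_mem_of_mem P hf r (by omega)))
    rw [sub_add_cancel] at this
    exact (hP.mem_or_mem this).elim hs hg

lemma ordIs_add {I P : Ideal S} (hI : I.IsPrime) (hP : P.IsPrime) (hIP : I ≤ P) {f g g' : S} {r r' r'' : ℕ}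
    (hfP : f ∈ P) (hfI : f ∉ I)
    (h : OrdIs I P f g r) (h' : OrdIs I P f g' r') (h'' : OrdIs I P f (g + g') r'') : min r r' ≤ r'' := by
  obtain ⟨s, t, hs, ht, h1⟩ := h
  obtain ⟨s', t', hs', ht', h2⟩ := h'
  obtain ⟨s'', t'', hs'', ht'', h3⟩ := h''
  by_contra hlt
  push Not at hlt
  obtain ⟨p, rfl⟩ : ∃ p, r = r'' + (p + 1) := ⟨r - r'' - 1, by omega⟩
  obtain ⟨p', rfl⟩ : ∃ p, r' = r'' + (p + 1) := ⟨r' - r'' - 1, by omega⟩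
  have h4 : f ^ r'' * (s * s' * t'' - (s' * s'' * t * f ^ p + s * s'' * t' * f ^ p') * f) ∈ I := by
    have : f ^ r'' * (s * s' * t'' - (s' * s'' * t * f ^ p + s * s'' * t' * f ^ p') * f) =
      s' * s'' * (s * g - t * f ^ (r'' + (p+1))) + s * s'' * (s' * g' - t' * f ^ (r'' + (p' + 1)))
      - s * s' * (s'' * (g + g') - t'' * f ^ r'') := by ring
    rw [this]
    exact I.sub_mem (I.add_mem (I.mul_mem_left _ h1) (I.mul_mem_left _ h2)) (I.mul_mem_left _ h3)
  have h5 := hIP ((hI.mem_or_mem h4).resolve_left (fun h => hfI (hI.mem_of_pow_mem _ h)))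
  have h6 := P.add_mem h5 (P.mul_mem_left (s' * s'' * t * f ^ p + s * s'' * t' * f ^ p') hfP)
  rw [sub_add_cancel] at h6
  rcases hP.mem_or_mem h6 with h | h
  · exact (hP.mem_or_mem h).elim hs hs'
  · exact ht'' h
end abs
end Bt
end Part8

section Part9
open MvPolynomial
namespace Bt
set_option linter.unusedSectionVars false
set_option linter.unusedVariables false
variable {k : Type} [Field k] {n : ℕ}
attribute [local instance] MvPolynomial.gradedAlgebra

/-- Standing data: a smooth variety and a field of fractions of its homogeneous coordinate ring. -/
structure Setup {L : Type} [Field L] [Algebra k L] (X : Set (ProjPt k n)) (d : ℕ)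
    (α : MvPolynomial (Fin (n+1)) k →ₐ[k] L) : Prop where
  sm : IsSmoothVariety X d
  hd : 2 ≤ d
  ker : ∀ f, α f = 0 ↔ f ∈ IX X
  frac : ∀ φ : L, ∃ a b, α b ≠ 0 ∧ φ = α a / α b

variable {L : Type} [Field L] [Algebra k L] {X : Set (ProjPt k n)} {d : ℕ}
    {α : MvPolynomial (Fin (n+1)) k →ₐ[k] L}

open Classical in
/-- valuation of a rational function on the cone -/
noncomputable def vv (α : MvPolynomial (Fin (n+1)) k →ₐ[k] L) (X Y : Set (ProjPt k n)) (φ : L) : ℤ :=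
  if h : ∃ ab : MvPolynomial (Fin (n+1)) k × MvPolynomial (Fin (n+1)) k,
    α ab.1 ≠ 0 ∧ α ab.2 ≠ 0 ∧ φ = α ab.1 / α ab.2 then
    (ordAlong X Y h.choose.1 : ℤ) - ordAlong X Y h.choose.2 else 0

variable [IsAlgClosed k]

namespace Setup

lemma prime (H : Setup X d α) : (IX X).IsPrime := IX_prime H.sm.2.1
lemma ker_ne (H : Setup X d α) {f : MvPolynomial (Fin (n+1)) k} : α f ≠ 0 ↔ f ∉ IX X := not_congr (H.ker f)
lemma one_le (H : Setup X d α) : 1 ≤ d := by have := H.hd; omega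

lemma lt (H : Setup X d α) {Y : Set (ProjPt k n)} (hY : IsPrimeDivisorOn X d Y) : IX X < IX Y :=
  ssubset_IX hY.2.1 H.sm.1 (ne_of_not_dimGE H.sm.1 H.sm.2.1 H.sm.2.2.1 H.one_le hY)

lemma local_gen (H : Setup X d α) {Y : Set (ProjPt k n)} (hY : IsPrimeDivisorOn X d Y)
    {v : Fin (n+1) → k} (hv : v ∈ cone X) :
    ∃ (e e' : ℕ) (f u : MvPolynomial (Fin (n+1)) k), f.IsHomogeneous e ∧ u.IsHomogeneous e' ∧
      f ∈ IX Y ∧ f ∉ IX X ∧ eval v u ≠ 0 ∧ ∀ p ∈ IX Y, ∃ c, u * p - c * f ∈ IX X := by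
  obtain ⟨e, e', f, u, hf, hu, hfY, huv, hup⟩ := Bt.local_gen H.sm H.one_le hY hv
  refine ⟨e, e', f, u, hf, hu, hfY, ?_, huv, fun p hp => mem_sup_span.1 (hup p hp)⟩
  intro h
  refine (H.lt hY).not_ge fun p hp => ?_
  have h1 := hup p hp
  have : Ideal.span {f} ⊔ IX X = IX X := by
    rw [sup_eq_right, Ideal.span_singleton_le_iff_mem]; exact h
  rw [this] at h1
  exact (H.prime.mem_or_mem h1).resolve_left (fun h => huv (mem_IX.1 h v hv))

lemma gen (H : Setup X d α) {Y : Set (ProjPt k n)} (hY : IsPrimeDivisorOn X d Y) :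
    ∃ f, Gen (IX X) (IX Y) f := by
  obtain ⟨x, hx⟩ := hY.2.2.1.1
  obtain ⟨e, e', f, u, hf, hu, hfY, hfX, huv, hup⟩ := H.local_gen hY (cone_rep (hY.1 hx))
  exact ⟨f, hfY, hfX, u, fun h => huv (mem_IX.1 h _ (cone_rep hx)), hup⟩

lemma primeY {Y : Set (ProjPt k n)} (hY : IsPrimeDivisorOn X d Y) : (IX Y).IsPrime := IX_prime hY.2.2.1

lemma ordIs (H : Setup X d α) {Y : Set (ProjPt k n)} (hY : IsPrimeDivisorOn X d Y)
    {f : MvPolynomial (Fin (n+1)) k} (hf : Gen (IX X) (IX Y) f) {g : MvPolynomial (Fin (n+1)) k}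
    (hg : g ∉ IX X) : OrdIs (IX X) (IX Y) f g (ordAlong X Y g) := by
  obtain ⟨r, hr⟩ := ordIs_exists H.prime (primeY hY) (H.lt hY).le hf hg
  have := ordIs_sSup H.prime (primeY hY) (H.lt hY).le hf hr
  have h2 : ordAlong X Y g = r := this
  rw [h2]; exact hr

lemma ord_unique (H : Setup X d α) {Y : Set (ProjPt k n)} (hY : IsPrimeDivisorOn X d Y)
    {f : MvPolynomial (Fin (n+1)) k} (hf : Gen (IX X) (IX Y) f) {g : MvPolynomial (Fin (n+1)) k} {r : ℕ}
    (hr : OrdIs (IX X) (IX Y) f g r) : ordAlong X Y g = r :=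
  ordIs_sSup H.prime (primeY hY) (H.lt hY).le hf hr

lemma ord_mul (H : Setup X d α) {Y : Set (ProjPt k n)} (hY : IsPrimeDivisorOn X d Y)
    {g g' : MvPolynomial (Fin (n+1)) k} (hg : g ∉ IX X) (hg' : g' ∉ IX X) :
    ordAlong X Y (g * g') = ordAlong X Y g + ordAlong X Y g' := by
  obtain ⟨f, hf⟩ := H.gen hY
  exact H.ord_unique hY hf (ordIs_mul (primeY hY) (H.ordIs hY hf hg) (H.ordIs hY hf hg'))

lemma ord_add (H : Setup X d α) {Y : Set (ProjPt k n)} (hY : IsPrimeDivisorOn X d Y)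
    {g g' : MvPolynomial (Fin (n+1)) k} (hg : g ∉ IX X) (hg' : g' ∉ IX X) (h : g + g' ∉ IX X) :
    min (ordAlong X Y g) (ordAlong X Y g') ≤ ordAlong X Y (g + g') := by
  obtain ⟨f, hf⟩ := H.gen hY
  exact ordIs_add H.prime (primeY hY) (H.lt hY).le hf.1 hf.2.1 (H.ordIs hY hf hg) (H.ordIs hY hf hg')
    (H.ordIs hY hf h)

lemma ord_eq_zero (H : Setup X d α) {Y : Set (ProjPt k n)} (hY : IsPrimeDivisorOn X d Y)
    {g : MvPolynomial (Fin (n+1)) k} (hg : g ∉ IX X) : ordAlong X Y g = 0 ↔ g ∉ IX Y := by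
  obtain ⟨f, hf⟩ := H.gen hY
  exact ordIs_zero_iff (primeY hY) (H.lt hY).le hf.1 (H.ordIs hY hf hg)

lemma ord_congr (H : Setup X d α) {Y : Set (ProjPt k n)} (hY : IsPrimeDivisorOn X d Y)
    {g g' : MvPolynomial (Fin (n+1)) k} (hg : g ∉ IX X) (h : α g = α g') :
    ordAlong X Y g = ordAlong X Y g' := by
  obtain ⟨f, hf⟩ := H.gen hY
  obtain ⟨s, s', hs, hs', h1⟩ := H.ordIs hY hf hg
  refine (H.ord_unique hY hf ⟨s, s', hs, hs', ?_⟩).symm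
  rw [← H.ker] at h1 ⊢
  rw [map_sub, map_mul] at h1 ⊢
  rw [← h]; exact h1

/-- a local generator at a point has order one -/
lemma ord_gen (H : Setup X d α) {Y : Set (ProjPt k n)} (hY : IsPrimeDivisorOn X d Y)
    {f : MvPolynomial (Fin (n+1)) k} (hf : Gen (IX X) (IX Y) f) : ordAlong X Y f = 1 :=
  H.ord_unique hY hf ⟨1, 1, (primeY hY).one_notMem, (primeY hY).one_notMem, by simp⟩

lemma vv_frac (H : Setup X d α) {Y : Set (ProjPt k n)} (hY : IsPrimeDivisorOn X d Y)
    {a b : MvPolynomial (Fin (n+1)) k} (ha : α a ≠ 0) (hb : α b ≠ 0) :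
    vv α X Y (α a / α b) = (ordAlong X Y a : ℤ) - ordAlong X Y b := by
  have h : ∃ ab : MvPolynomial (Fin (n+1)) k × MvPolynomial (Fin (n+1)) k,
    α ab.1 ≠ 0 ∧ α ab.2 ≠ 0 ∧ α a / α b = α ab.1 / α ab.2 := ⟨(a, b), ha, hb, rfl⟩
  rw [vv, dif_pos h]
  obtain ⟨h1, h2, h3⟩ := h.choose_spec
  set a' := h.choose.1
  set b' := h.choose.2
  rw [div_eq_div_iff hb h2, ← map_mul, ← map_mul] at h3
  have h4 := H.ord_congr hY (by rw [← H.ker_ne, map_mul]; exact mul_ne_zero ha h2) h3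
  rw [H.ord_mul hY (H.ker_ne.1 ha) (H.ker_ne.1 h2), H.ord_mul hY (H.ker_ne.1 h1) (H.ker_ne.1 hb)] at h4
  have : ((ordAlong X Y a : ℤ) + ordAlong X Y b') = ordAlong X Y a' + ordAlong X Y b := by exact_mod_cast h4
  linarith

lemma frac' (H : Setup X d α) {φ : L} (hφ : φ ≠ 0) : ∃ a b, α a ≠ 0 ∧ α b ≠ 0 ∧ φ = α a / α b := by
  obtain ⟨a, b, hb, rfl⟩ := H.frac φ
  refine ⟨a, b, ?_, hb, rfl⟩
  intro h; exact hφ (by rw [h, zero_div])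

lemma ord_one (H : Setup X d α) {Y : Set (ProjPt k n)} (hY : IsPrimeDivisorOn X d Y) :
    ordAlong X Y (1 : MvPolynomial (Fin (n+1)) k) = 0 :=
  (H.ord_eq_zero hY H.prime.one_notMem).2 (primeY hY).one_notMem

lemma vv_poly (H : Setup X d α) {Y : Set (ProjPt k n)} (hY : IsPrimeDivisorOn X d Y)
    {a : MvPolynomial (Fin (n+1)) k} (ha : α a ≠ 0) : vv α X Y (α a) = ordAlong X Y a := by
  have := H.vv_frac hY ha (b := 1) (by simp)
  rw [H.ord_one hY] at this
  simpa using this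

lemma vv_mul (H : Setup X d α) {Y : Set (ProjPt k n)} (hY : IsPrimeDivisorOn X d Y) {φ ψ : L}
    (hφ : φ ≠ 0) (hψ : ψ ≠ 0) : vv α X Y (φ * ψ) = vv α X Y φ + vv α X Y ψ := by
  obtain ⟨a, b, ha, hb, rfl⟩ := H.frac' hφ
  obtain ⟨a', b', ha', hb', rfl⟩ := H.frac' hψ
  rw [div_mul_div_comm, ← map_mul, ← map_mul, H.vv_frac hY ha hb, H.vv_frac hY ha' hb',
    H.vv_frac hY (by rw [map_mul]; exact mul_ne_zero ha ha') (by rw [map_mul]; exact mul_ne_zero hb hb'),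
    H.ord_mul hY (H.ker_ne.1 ha) (H.ker_ne.1 ha'), H.ord_mul hY (H.ker_ne.1 hb) (H.ker_ne.1 hb')]
  push_cast; ring

lemma vv_one (H : Setup X d α) {Y : Set (ProjPt k n)} (hY : IsPrimeDivisorOn X d Y) :
    vv α X Y 1 = 0 := by
  have := H.vv_mul hY (one_ne_zero (α := L)) one_ne_zero
  rw [mul_one] at this; omega

lemma vv_inv (H : Setup X d α) {Y : Set (ProjPt k n)} (hY : IsPrimeDivisorOn X d Y) {φ : L}
    (hφ : φ ≠ 0) : vv α X Y φ⁻¹ = - vv α X Y φ := by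
  have := H.vv_mul hY hφ (inv_ne_zero hφ)
  rw [mul_inv_cancel₀ hφ, H.vv_one hY] at this; omega

lemma vv_div (H : Setup X d α) {Y : Set (ProjPt k n)} (hY : IsPrimeDivisorOn X d Y) {φ ψ : L}
    (hφ : φ ≠ 0) (hψ : ψ ≠ 0) : vv α X Y (φ / ψ) = vv α X Y φ - vv α X Y ψ := by
  rw [div_eq_mul_inv, H.vv_mul hY hφ (inv_ne_zero hψ), H.vv_inv hY hψ]; ring

lemma vv_pow (H : Setup X d α) {Y : Set (ProjPt k n)} (hY : IsPrimeDivisorOn X d Y) {φ : L}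
    (hφ : φ ≠ 0) (r : ℕ) : vv α X Y (φ ^ r) = r * vv α X Y φ := by
  induction r with
  | zero => simp [H.vv_one hY]
  | succ r ih => rw [pow_succ, H.vv_mul hY (pow_ne_zero _ hφ) hφ, ih]; push_cast; ring

lemma vv_zpow (H : Setup X d α) {Y : Set (ProjPt k n)} (hY : IsPrimeDivisorOn X d Y) {φ : L}
    (hφ : φ ≠ 0) (r : ℤ) : vv α X Y (φ ^ r) = r * vv α X Y φ := by
  obtain ⟨m, rfl | rfl⟩ := r.eq_nat_or_neg
  · rw [zpow_natCast, H.vv_pow hY hφ]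
  · rw [zpow_neg, H.vv_inv hY (zpow_ne_zero _ hφ), zpow_natCast, H.vv_pow hY hφ]; ring

lemma vv_prod (H : Setup X d α) {Y : Set (ProjPt k n)} (hY : IsPrimeDivisorOn X d Y) {ι : Type}
    (s : Finset ι) {φ : ι → L} (hφ : ∀ i ∈ s, φ i ≠ 0) : vv α X Y (∏ i ∈ s, φ i) = ∑ i ∈ s, vv α X Y (φ i) := by
  classical
  induction s using Finset.induction_on with
  | empty => simp [H.vv_one hY]
  | insert a s ha ih =>
    rw [Finset.prod_insert ha, Finset.sum_insert ha, H.vv_mul hY (hφ _ (Finset.mem_insert_self _ _))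
      (Finset.prod_ne_zero_iff.2 fun i hi => hφ i (Finset.mem_insert_of_mem hi)),
      ih fun i hi => hφ i (Finset.mem_insert_of_mem hi)]

lemma vv_add (H : Setup X d α) {Y : Set (ProjPt k n)} (hY : IsPrimeDivisorOn X d Y) {φ ψ : L}
    (hφ : φ ≠ 0) (hψ : ψ ≠ 0) (h : φ + ψ ≠ 0) : min (vv α X Y φ) (vv α X Y ψ) ≤ vv α X Y (φ + ψ) := by
  obtain ⟨a, b, ha, hb, rfl⟩ := H.frac' hφ
  obtain ⟨a', b', ha', hb', rfl⟩ := H.frac' hψ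
  have e : α a / α b + α a' / α b' = α (a * b' + b * a') / α (b * b') := by
    rw [div_add_div _ _ hb hb']; simp
  have e1 : α a / α b = α (a * b') / α (b * b') := by
    rw [map_mul, map_mul, mul_div_mul_right _ _ hb']
  have e2 : α a' / α b' = α (b * a') / α (b * b') := by
    rw [map_mul, map_mul, mul_div_mul_left _ _ hb]
  have hbb : α (b * b') ≠ 0 := by rw [map_mul]; exact mul_ne_zero hb hb'
  have hab : α (a * b') ≠ 0 := by rw [map_mul]; exact mul_ne_zero ha hb'
  have hba : α (b * a') ≠ 0 := by rw [map_mul]; exact mul_ne_zero hb ha'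
  have hs : α (a * b' + b * a') ≠ 0 := by
    intro h0; rw [e, h0, zero_div] at h; exact h rfl
  rw [e, e1, e2, H.vv_frac hY hab hbb, H.vv_frac hY hba hbb, H.vv_frac hY hs hbb]
  have := H.ord_add hY (H.ker_ne.1 hab) (H.ker_ne.1 hba) (H.ker_ne.1 hs)
  omega

lemma vv_neg (H : Setup X d α) {Y : Set (ProjPt k n)} (hY : IsPrimeDivisorOn X d Y) (φ : L) :
    vv α X Y (-φ) = vv α X Y φ := by
  by_cases h : φ = 0
  · rw [h, neg_zero]
  have h1 : (-1 : L) ≠ 0 := neg_ne_zero.2 one_ne_zero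
  have h2 := H.vv_mul hY h1 h1
  rw [neg_one_mul, neg_neg, H.vv_one hY] at h2
  rw [← neg_one_mul, H.vv_mul hY h1 h]; omega

lemma vv_const (H : Setup X d α) {Y : Set (ProjPt k n)} (hY : IsPrimeDivisorOn X d Y) {c : k} (hc : c ≠ 0) :
    vv α X Y (algebraMap k L c) = 0 := by
  have e : algebraMap k L c = α (C c) := by
    rw [← MvPolynomial.algebraMap_eq, AlgHom.commutes]
  have h : α (C c) ≠ 0 := by rw [← e]; simpa using hc
  rw [e, H.vv_poly hY h, Nat.cast_eq_zero, H.ord_eq_zero hY (H.ker_ne.1 h)]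
  intro h'
  exact (primeY hY).ne_top (Ideal.eq_top_of_isUnit_mem _ h' ((isUnit_iff_ne_zero.2 hc).map C))

/-- finitely many divisors on which a given form vanishes -/
lemma finite_ord (H : Setup X d α) {g : MvPolynomial (Fin (n+1)) k} {m : ℕ} (hm : g.IsHomogeneous m)
    (hg : g ∉ IX X) : {Y : {Y : Set (ProjPt k n) // IsPrimeDivisorOn X d Y} | ordAlong X Y.1 g ≠ 0}.Finite := by
  have hf := Ideal.finite_minimalPrimes_of_isNoetherianRing (MvPolynomial (Fin (n+1)) k)
    (IX X ⊔ Ideal.span {g})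
  refine Set.Finite.of_finite_image (f := fun Y => IX Y.1) (hf.subset ?_) ?_
  · rintro _ ⟨Y, hY, rfl⟩
    refine divisor_minimal H.sm.1 H.sm.2.1 H.sm.2.2.1 H.one_le Y.2 hm hg ?_
    by_contra h
    exact hY ((H.ord_eq_zero Y.2 hg).2 h)
  · intro Y _ Y' _ h
    apply Subtype.ext
    rw [← closed_eq Y.2.2.1, ← closed_eq Y'.2.2.1]
    exact congrArg ZP h

end Setup
end Bt
end Part9

section Part10
open MvPolynomial
namespace Bt
set_option linter.unusedSectionVars false
set_option linter.unusedVariables false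
variable {k : Type} [Field k] {n : ℕ}
attribute [local instance] MvPolynomial.gradedAlgebra

variable {L : Type} [Field L] [Algebra k L] {X : Set (ProjPt k n)} {d : ℕ}
    {α : MvPolynomial (Fin (n+1)) k →ₐ[k] L}

/-- regular at `v` -/
def Reg (α : MvPolynomial (Fin (n+1)) k →ₐ[k] L) (v : Fin (n+1) → k) (φ : L) : Prop :=
  ∃ a b, eval v b ≠ 0 ∧ φ = α a / α b

/-- degree zero homogeneous fractions -/
noncomputable def K0 (α : MvPolynomial (Fin (n+1)) k →ₐ[k] L) : IntermediateField k L where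
  carrier := {φ | ∃ e a b, MvPolynomial.IsHomogeneous a e ∧ MvPolynomial.IsHomogeneous b e ∧ α b ≠ 0 ∧
    φ = α a / α b}
  mul_mem' := by
    rintro _ _ ⟨e, a, b, ha, hb, hb0, rfl⟩ ⟨e', a', b', ha', hb', hb0', rfl⟩
    exact ⟨e + e', a * a', b * b', ha.mul ha', hb.mul hb', by rw [map_mul]; exact mul_ne_zero hb0 hb0',
      by rw [map_mul, map_mul, div_mul_div_comm]⟩
  add_mem' := by
    rintro _ _ ⟨e, a, b, ha, hb, hb0, rfl⟩ ⟨e', a', b', ha', hb', hb0', rfl⟩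
    exact ⟨e + e', a * b' + b * a', b * b', (ha.mul hb').add (hb.mul ha'), hb.mul hb',
      by rw [map_mul]; exact mul_ne_zero hb0 hb0', by rw [div_add_div _ _ hb0 hb0']; simp⟩
  algebraMap_mem' := by
    intro c
    exact ⟨0, C c, 1, isHomogeneous_C _ _, isHomogeneous_one _ _, by simp, by
      rw [map_one, div_one, ← MvPolynomial.algebraMap_eq, AlgHom.commutes]⟩
  inv_mem' := by
    rintro _ ⟨e, a, b, ha, hb, hb0, rfl⟩
    by_cases h : α a = 0
    · exact ⟨0, 0, 1, isHomogeneous_zero _ _ _, isHomogeneous_one _ _, by simp, by simp [h]⟩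
    · exact ⟨e, b, a, hb, ha, h, by rw [inv_div]⟩

lemma mem_K0 {φ : L} : φ ∈ K0 α ↔ ∃ e a b, MvPolynomial.IsHomogeneous a e ∧
  MvPolynomial.IsHomogeneous b e ∧ α b ≠ 0 ∧ φ = α a / α b := Iff.rfl

open Classical in
/-- evaluation at `v` -/
noncomputable def ev (α : MvPolynomial (Fin (n+1)) k →ₐ[k] L) (v : Fin (n+1) → k) (φ : L) : k :=
  if h : ∃ ab : MvPolynomial (Fin (n+1)) k × MvPolynomial (Fin (n+1)) k, eval v ab.2 ≠ 0 ∧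
    φ = α ab.1 / α ab.2 then eval v h.choose.1 / eval v h.choose.2 else 0

variable [IsAlgClosed k]
namespace Setup

lemma ne_of_eval (H : Setup X d α) {v : Fin (n+1) → k} (hv : v ∈ cone X) {b : MvPolynomial (Fin (n+1)) k}
    (hb : eval v b ≠ 0) : α b ≠ 0 := H.ker_ne.2 fun h => hb (mem_IX.1 h v hv)

lemma eval_congr (H : Setup X d α) {v : Fin (n+1) → k} (hv : v ∈ cone X) {a b : MvPolynomial (Fin (n+1)) k}
    (h : α a = α b) : eval v a = eval v b := by
  rw [← sub_eq_zero, ← map_sub] at h ⊢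
  exact mem_IX.1 ((H.ker _).1 h) v hv

lemma ev_frac (H : Setup X d α) {v : Fin (n+1) → k} (hv : v ∈ cone X) {a b : MvPolynomial (Fin (n+1)) k}
    (hb : eval v b ≠ 0) : ev α v (α a / α b) = eval v a / eval v b := by
  have h : ∃ ab : MvPolynomial (Fin (n+1)) k × MvPolynomial (Fin (n+1)) k, eval v ab.2 ≠ 0 ∧
    α a / α b = α ab.1 / α ab.2 := ⟨(a, b), hb, rfl⟩
  rw [ev, dif_pos h]
  obtain ⟨h1, h2⟩ := h.choose_spec
  rw [div_eq_div_iff (H.ne_of_eval hv hb) (H.ne_of_eval hv h1), ← map_mul, ← map_mul] at h2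
  have h3 := H.eval_congr hv h2
  rw [map_mul, map_mul] at h3
  rw [div_eq_div_iff h1 hb, h3]

lemma ev_poly (H : Setup X d α) {v : Fin (n+1) → k} (hv : v ∈ cone X) (a : MvPolynomial (Fin (n+1)) k) :
    ev α v (α a) = eval v a := by
  have := H.ev_frac hv (a := a) (b := 1) (by simp)
  simpa using this

lemma reg_poly (v : Fin (n+1) → k) (a : MvPolynomial (Fin (n+1)) k) : Reg α v (α a) :=
  ⟨a, 1, by simp, by simp⟩

lemma reg_const (v : Fin (n+1) → k) (c : k) : Reg α v (algebraMap k L c) :=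
  ⟨C c, 1, by simp, by rw [map_one, div_one, ← MvPolynomial.algebraMap_eq, AlgHom.commutes]⟩

lemma ev_const (H : Setup X d α) {v : Fin (n+1) → k} (hv : v ∈ cone X) (c : k) :
    ev α v (algebraMap k L c) = c := by
  have := H.ev_poly hv (C c)
  rwa [eval_C, ← MvPolynomial.algebraMap_eq, AlgHom.commutes] at this

lemma add_aux (H : Setup X d α) {v : Fin (n+1) → k} (hv : v ∈ cone X) {φ ψ : L} (h : Reg α v φ) (h' : Reg α v ψ) :
    Reg α v (φ + ψ) ∧ ev α v (φ + ψ) = ev α v φ + ev α v ψ := by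
  obtain ⟨a, b, hb, rfl⟩ := h
  obtain ⟨a', b', hb', rfl⟩ := h'
  have e : α a / α b + α a' / α b' = α (a * b' + b * a') / α (b * b') := by
    rw [div_add_div _ _ (H.ne_of_eval hv hb) (H.ne_of_eval hv hb')]; simp
  have hbb : eval v (b * b') ≠ 0 := by rw [map_mul]; exact mul_ne_zero hb hb'
  refine ⟨⟨_, _, hbb, e⟩, ?_⟩
  rw [e, H.ev_frac hv hbb, H.ev_frac hv hb, H.ev_frac hv hb', div_add_div _ _ hb hb']
  simp

lemma mul_aux (H : Setup X d α) {v : Fin (n+1) → k} (hv : v ∈ cone X) {φ ψ : L} (h : Reg α v φ) (h' : Reg α v ψ) :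
    Reg α v (φ * ψ) ∧ ev α v (φ * ψ) = ev α v φ * ev α v ψ := by
  obtain ⟨a, b, hb, rfl⟩ := h
  obtain ⟨a', b', hb', rfl⟩ := h'
  have e : α a / α b * (α a' / α b') = α (a * a') / α (b * b') := by
    rw [map_mul, map_mul, div_mul_div_comm]
  have hbb : eval v (b * b') ≠ 0 := by rw [map_mul]; exact mul_ne_zero hb hb'
  refine ⟨⟨_, _, hbb, e⟩, ?_⟩
  rw [e, H.ev_frac hv hbb, H.ev_frac hv hb, H.ev_frac hv hb', div_mul_div_comm]
  simp

/-- The local ring at `v` as a subalgebra. -/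
noncomputable def Ov (H : Setup X d α) {v : Fin (n+1) → k} (hv : v ∈ cone X) : Subalgebra k L where
  carrier := {φ | Reg α v φ}
  mul_mem' := fun h h' => (H.mul_aux hv h h').1
  add_mem' := fun h h' => (H.add_aux hv h h').1
  algebraMap_mem' := fun c => reg_const v c

lemma mem_Ov (H : Setup X d α) {v : Fin (n+1) → k} (hv : v ∈ cone X) {φ : L} : φ ∈ H.Ov hv ↔ Reg α v φ := Iff.rfl

/-- evaluation as algebra hom -/
noncomputable def evO (H : Setup X d α) {v : Fin (n+1) → k} (hv : v ∈ cone X) : H.Ov hv →ₐ[k] k where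
  toFun φ := ev α v φ.1
  map_one' := by
    have := H.ev_const hv 1
    simpa using this
  map_zero' := by
    have := H.ev_const hv 0
    simpa using this
  map_mul' := fun a b => (H.mul_aux hv a.2 b.2).2
  map_add' := fun a b => (H.add_aux hv a.2 b.2).2
  commutes' := fun c => H.ev_const hv c

lemma evO_apply (H : Setup X d α) {v : Fin (n+1) → k} (hv : v ∈ cone X) (φ : H.Ov hv) :
    H.evO hv φ = ev α v φ.1 := rfl

lemma reg_inv (H : Setup X d α) {v : Fin (n+1) → k} (hv : v ∈ cone X) {φ : L} (h : Reg α v φ)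
    (h0 : ev α v φ ≠ 0) : Reg α v φ⁻¹ := by
  obtain ⟨a, b, hb, rfl⟩ := h
  rw [H.ev_frac hv hb] at h0
  exact ⟨b, a, fun h => h0 (by rw [h, zero_div]), by rw [inv_div]⟩

lemma ev_inv (H : Setup X d α) {v : Fin (n+1) → k} (hv : v ∈ cone X) {φ : L} (h : Reg α v φ)
    (h0 : ev α v φ ≠ 0) : ev α v φ⁻¹ = (ev α v φ)⁻¹ := by
  obtain ⟨a, b, hb, rfl⟩ := h
  rw [H.ev_frac hv hb] at h0 ⊢
  rw [inv_div, H.ev_frac hv (fun h => h0 (by rw [h, zero_div])), inv_div]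

/-- homogeneous representation of regular degree zero functions -/
lemma hom_rep (H : Setup X d α) {v : Fin (n+1) → k} (hv : v ∈ cone X) {φ : L} (hφ : φ ∈ K0 α) (h : Reg α v φ) :
    ∃ e a b, MvPolynomial.IsHomogeneous a e ∧ MvPolynomial.IsHomogeneous b e ∧ eval v b ≠ 0 ∧
      φ = α a / α b := by
  obtain ⟨e, a, b, ha, hb, hb0, rfl⟩ := hφ
  obtain ⟨a', b', hb', heq⟩ := h
  have : ∃ e, eval v (homogeneousComponent e b') ≠ 0 := by
    by_contra hc
    push Not at hc
    apply hb'
    rw [← sum_homogeneousComponent b', map_sum]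
    exact Finset.sum_eq_zero fun i _ => hc i
  obtain ⟨i, hi⟩ := this
  refine ⟨i, homogeneousComponent i a', homogeneousComponent i b', homogeneousComponent_isHomogeneous _ _,
    homogeneousComponent_isHomogeneous _ _, hi, ?_⟩
  rw [div_eq_div_iff hb0 (H.ne_of_eval hv hb'), ← map_mul, ← map_mul, ← sub_eq_zero, ← map_sub, H.ker] at heq
  have h1 := (HomI.mem_iff (IX_hom X)).1 heq (i + e)
  rw [map_sub, mul_comm a b', comp_mul_hom ha, comp_mul_hom hb, ← H.ker, map_sub, sub_eq_zero, map_mul, map_mul] at h1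
  rw [div_eq_div_iff hb0 (H.ne_of_eval hv hi), ← h1, mul_comm]

lemma hom_quot (H : Setup X d α) {p f : MvPolynomial (Fin (n+1)) k} {i j : ℕ} (hp : p.IsHomogeneous i)
    (hf : f.IsHomogeneous j) (hpX : p ∉ IX X) {c : MvPolynomial (Fin (n+1)) k} (h : p - c * f ∈ IX X) :
    ∃ c' r, MvPolynomial.IsHomogeneous c' r ∧ i = r + j ∧ p - c' * f ∈ IX X := by
  have h1 := (HomI.mem_iff (IX_hom X)).1 h i
  rw [map_sub, comp_self hp] at h1
  by_cases hij : j ≤ i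
  · obtain ⟨r, rfl⟩ := Nat.exists_eq_add_of_le' hij
    rw [comp_mul_hom hf] at h1
    exact ⟨_, r, homogeneousComponent_isHomogeneous r c, rfl, h1⟩
  · rw [comp_mul_hom_lt hf (by omega), sub_zero] at h1
    exact absurd h1 hpX

lemma divisor_ext (H : Setup X d α) {Y Y' : Set (ProjPt k n)} (hY : IsPrimeDivisorOn X d Y)
    (hY' : IsPrimeDivisorOn X d Y') (h : IX Y ≤ IX Y') : Y = Y' := by
  obtain ⟨x, hx⟩ := hY.2.2.1.1
  obtain ⟨e, e', f, u, hf, hu, hfY, hfX, huv, hup⟩ := H.local_gen hY (cone_rep (hY.1 hx))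
  have h1 := divisor_minimal H.sm.1 H.sm.2.1 H.sm.2.2.1 H.one_le hY' hf hfX (h hfY)
  have h2 := h1.2 (y := IX Y) ⟨primeY hY, sup_le (H.lt hY).le
    ((Ideal.span_singleton_le_iff_mem _).2 hfY)⟩ h
  have h3 := le_antisymm h h2
  rw [← closed_eq hY.2.1, ← closed_eq hY'.2.1, h3]

/-- Lemma 2 -/
lemma lemma2 (H : Setup X d α) {v : Fin (n+1) → k} (hv : v ∈ cone X) {a b : MvPolynomial (Fin (n+1)) k} {i j : ℕ}
    (ha : a.IsHomogeneous i) (hb : b.IsHomogeneous j) (haX : a ∉ IX X) (hbX : b ∉ IX X)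
    (h : ∀ Y, IsPrimeDivisorOn X d Y → v ∈ cone Y → ordAlong X Y b ≤ ordAlong X Y a) :
    ∃ u c, eval v u ≠ 0 ∧ u * a - c * b ∈ IX X := by
  let J : MvPolynomial (Fin (n+1)) k → Ideal (MvPolynomial (Fin (n+1)) k) := fun g =>
    { carrier := {x | ∃ t, eval v t ≠ 0 ∧ ∃ c, t * x - c * g ∈ IX X}
      zero_mem' := ⟨1, by simp, 0, by simp⟩
      add_mem' := by
        rintro x y ⟨t, ht, c, hc⟩ ⟨t', ht', c', hc'⟩
        refine ⟨t * t', by rw [map_mul]; exact mul_ne_zero ht ht', t' * c + t * c', ?_⟩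
        have : t * t' * (x + y) - (t' * c + t * c') * g = t' * (t * x - c * g) + t * (t' * y - c' * g) := by ring
        rw [this]; exact Ideal.add_mem _ (Ideal.mul_mem_left _ _ hc) (Ideal.mul_mem_left _ _ hc')
      smul_mem' := by
        rintro a x ⟨t, ht, c, hc⟩
        refine ⟨t, ht, a * c, ?_⟩
        have : t * (a * x) - a * c * g = a * (t * x - c * g) := by ring
        rw [smul_eq_mul, this]; exact Ideal.mul_mem_left _ _ hc }
  have hgJ : ∀ g, g ∈ J g := fun g => ⟨1, by simp, 1, by simp⟩
  have key : ∀ J' : Ideal (MvPolynomial (Fin (n+1)) k), ∀ (a b : MvPolynomial (Fin (n+1)) k) (i j : ℕ),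
    J b = J' → a.IsHomogeneous i → b.IsHomogeneous j → a ∉ IX X → b ∉ IX X → 
    (∀ Y, IsPrimeDivisorOn X d Y → v ∈ cone Y → ordAlong X Y b ≤ ordAlong X Y a) →
    ∃ u c, eval v u ≠ 0 ∧ u * a - c * b ∈ IX X := by
    intro J'
    induction J' using WellFoundedGT.induction with
    | ind J' ih =>
      rintro a b i j rfl ha hb haX hbX h
      by_cases hbv : eval v b = 0
      · have hle : IX X ⊔ Ideal.span {b} ≤ mv v := sup_le (fun f hf => mem_IX.1 hf v hv)
          ((Ideal.span_singleton_le_iff_mem _).2 hbv)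
        have : (mv v).IsPrime := RingHom.ker_isPrime _
        obtain ⟨P, hP, hPv⟩ := Ideal.exists_minimalPrimes_le hle
        have : ∃ i, MvPolynomial.X i ∉ P := by
          by_contra hc
          push Not at hc
          apply hv.1
          funext i
          have := mem_mv.1 (hPv (hc i))
          simpa using this
        obtain ⟨i0, hi0⟩ := this
        obtain ⟨hY, hYP⟩ := min_divisor H.sm.1 H.sm.2.1 H.sm.2.2.1 H.one_le hb hbX hP hi0
        set Y := ZP P
        have hvY : v ∈ cone Y := (mem_cone_closed hY.2.1).2 ⟨hv.1, fun f hf => hPv (hYP ▸ hf)⟩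
        have hbY : b ∈ IX Y := by
          rw [hYP]; exact hP.1.2 (Ideal.mem_sup_right (Ideal.mem_span_singleton_self b))
        have haY : a ∈ IX Y := by
          by_contra hc
          have h1 := (H.ord_eq_zero hY haX).2 hc
          have h2 := h Y hY hvY
          exact (H.ord_eq_zero hY hbX).1 (by omega) hbY
        obtain ⟨e, e', f, u, hf, hu, hfY, hfX, huv, hup⟩ := H.local_gen hY hv
        have huX : u ∉ IX X := fun h => huv (mem_IX.1 h v hv)
        obtain ⟨c1, hc1⟩ := hup a haY
        obtain ⟨c2, hc2⟩ := hup b hbY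
        have huaX : u * a ∉ IX X := fun h => (H.prime.mem_or_mem h).elim huX haX
        have hubX : u * b ∉ IX X := fun h => (H.prime.mem_or_mem h).elim huX hbX
        obtain ⟨a', r, ha', -, h1⟩ := H.hom_quot (hu.mul ha) hf huaX hc1
        obtain ⟨b', r', hb', -, h2⟩ := H.hom_quot (hu.mul hb) hf hubX hc2
        have e1 : α (u * a) = α (a' * f) := by rw [← sub_eq_zero, ← map_sub, H.ker]; exact h1
        have e2 : α (u * b) = α (b' * f) := by rw [← sub_eq_zero, ← map_sub, H.ker]; exact h2
        have ha'X : a' ∉ IX X := by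
          intro h; apply huaX; rw [← H.ker, e1, H.ker]; exact Ideal.mul_mem_right _ _ h
        have hb'X : b' ∉ IX X := by
          intro h; apply hubX; rw [← H.ker, e2, H.ker]; exact Ideal.mul_mem_right _ _ h
        have hlt : J b < J b' := by
          refine lt_of_le_of_ne ?_ ?_
          · rintro x ⟨t, ht, z, hz⟩
            refine ⟨u * t, by rw [map_mul]; exact mul_ne_zero huv ht, z * f, ?_⟩
            have : u * t * x - z * f * b' = u * (t * x - z * b) + z * (u * b - b' * f) := by ring
            rw [this]; exact Ideal.add_mem _ (Ideal.mul_mem_left _ _ hz) (Ideal.mul_mem_left _ _ h2)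
          · intro heq
            have : b' ∈ J b := heq ▸ hgJ b'
            obtain ⟨t, ht, z, hz⟩ := this
            have : (t * u - z * f) * b ∈ IX X := by
              have : (t * u - z * f) * b = t * (u * b - b' * f) + f * (t * b' - z * b) := by ring
              rw [this]; exact Ideal.add_mem _ (Ideal.mul_mem_left _ _ h2) (Ideal.mul_mem_left _ _ hz)
            have := mem_IX.1 ((H.prime.mem_or_mem this).resolve_right hbX) v hv
            rw [map_sub, map_mul, map_mul, mem_IX.1 hfY v hvY, mul_zero, sub_zero] at this
            exact mul_ne_zero ht huv this
        obtain ⟨w, c, hw, hc⟩ := ih _ hlt a' b' r r' rfl ha' hb' ha'X hb'X (by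
          intro Y' hY' hvY'
          have h3 := h Y' hY' hvY'
          have h4 := H.ord_congr hY' huaX e1
          have h5 := H.ord_congr hY' hubX e2
          rw [H.ord_mul hY' huX haX, H.ord_mul hY' ha'X hfX] at h4
          rw [H.ord_mul hY' huX hbX, H.ord_mul hY' hb'X hfX] at h5
          omega)
        refine ⟨w * u, c * u, by rw [map_mul]; exact mul_ne_zero hw huv, ?_⟩
        have : w * u * a - c * u * b = w * (u * a - a' * f) + f * (w * a' - c * b') - c * (u * b - b' * f) := by ring
        rw [this]
        exact Ideal.sub_mem _ (Ideal.add_mem _ (Ideal.mul_mem_left _ _ h1) (Ideal.mul_mem_left _ _ hc))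
          (Ideal.mul_mem_left _ _ h2)
      · exact ⟨b, a, hbv, by rw [mul_comm, sub_self]; exact Ideal.zero_mem _⟩
  exact key _ a b i j rfl ha hb haX hbX h

lemma reg_of_vv (H : Setup X d α) {v : Fin (n+1) → k} (hv : v ∈ cone X) {φ : L} (hφ : φ ∈ K0 α) (h0 : φ ≠ 0)
    (h : ∀ Y, IsPrimeDivisorOn X d Y → v ∈ cone Y → 0 ≤ vv α X Y φ) : Reg α v φ := by
  obtain ⟨e, a, b, ha, hb, hb0, rfl⟩ := hφ
  have ha0 : α a ≠ 0 := fun h => h0 (by rw [h, zero_div])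
  obtain ⟨u, c, hu, hc⟩ := H.lemma2 hv ha hb (H.ker_ne.1 ha0) (H.ker_ne.1 hb0) (by
    intro Y hY hvY
    have := h Y hY hvY
    rw [H.vv_frac hY ha0 hb0] at this; omega)
  refine ⟨c, u, hu, ?_⟩
  rw [← H.ker, map_sub, map_mul, map_mul, sub_eq_zero] at hc
  rw [div_eq_div_iff hb0 (H.ne_of_eval hv hu), ← hc, mul_comm]

lemma vv_of_reg (H : Setup X d α) {v : Fin (n+1) → k} {Y : Set (ProjPt k n)} (hY : IsPrimeDivisorOn X d Y)
    (hv : v ∈ cone Y) {φ : L} (h0 : φ ≠ 0) (h : Reg α v φ) : 0 ≤ vv α X Y φ := by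
  obtain ⟨a, b, hb, rfl⟩ := h
  have hvX : v ∈ cone X := ⟨hv.1, hY.1 hv.2⟩
  have hb0 := H.ne_of_eval hvX hb
  rw [H.vv_frac hY (fun h => h0 (by rw [h, zero_div])) hb0,
    (H.ord_eq_zero hY (H.ker_ne.1 hb0)).2 (fun h => hb (mem_IX.1 h v hv))]
  simp

lemma vv_eq_zero (H : Setup X d α) {v : Fin (n+1) → k} {Y : Set (ProjPt k n)} (hY : IsPrimeDivisorOn X d Y)
    (hv : v ∈ cone Y) {φ : L} (h : Reg α v φ) (h0 : ev α v φ ≠ 0) : vv α X Y φ = 0 := by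
  have hvX : v ∈ cone X := ⟨hv.1, hY.1 hv.2⟩
  have hne : φ ≠ 0 := by
    rintro rfl
    apply h0
    have := H.ev_const hvX 0
    simpa using this
  have h1 := H.vv_of_reg hY hv hne h
  have h2 := H.vv_of_reg hY hv (inv_ne_zero hne) (H.reg_inv hvX h h0)
  rw [H.vv_inv hY hne] at h2
  omega

lemma ev_ne_zero (H : Setup X d α) {v : Fin (n+1) → k} (hv : v ∈ cone X) {φ : L} (hφ : φ ∈ K0 α) (h0 : φ ≠ 0)
    (h : ∀ Y, IsPrimeDivisorOn X d Y → v ∈ cone Y → vv α X Y φ = 0) : ev α v φ ≠ 0 := by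
  have h1 := H.reg_of_vv hv hφ h0 (fun Y hY hvY => (h Y hY hvY).ge)
  have h2 := H.reg_of_vv hv (inv_mem hφ) (inv_ne_zero h0) (fun Y hY hvY => by
    rw [H.vv_inv hY h0, h Y hY hvY]; simp)
  have h3 := (H.mul_aux hv h1 h2).2
  rw [mul_inv_cancel₀ h0] at h3
  have h4 := H.ev_const hv 1
  rw [map_one] at h4
  intro h5
  rw [h4, h5, zero_mul] at h3
  exact one_ne_zero h3

/-- local equation of a prime divisor -/
lemma local_eq_prime (H : Setup X d α) {v : Fin (n+1) → k} (hv : v ∈ cone X) {Y : Set (ProjPt k n)}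
    (hY : IsPrimeDivisorOn X d Y) : ∃ t ∈ K0 α, t ≠ 0 ∧ (v ∈ cone Y → vv α X Y t = 1) ∧
      ∀ Y', IsPrimeDivisorOn X d Y' → v ∈ cone Y' → Y' ≠ Y → vv α X Y' t = 0 := by
  obtain ⟨e, e', f, u, hf, hu, hfY, hfX, huv, hup⟩ := H.local_gen hY hv
  obtain ⟨i, hi⟩ : ∃ i, v i ≠ 0 := by
    by_contra hc; push Not at hc; exact hv.1 (funext hc)
  have hx0 : eval v (MvPolynomial.X i ^ e : MvPolynomial (Fin (n+1)) k) ≠ 0 := by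
    simpa using pow_ne_zero e hi
  have hb0 := H.ne_of_eval hv hx0
  have ha0 := H.ker_ne.2 hfX
  have hord : ∀ Y', IsPrimeDivisorOn X d Y' → v ∈ cone Y' → ordAlong X Y' (MvPolynomial.X i ^ e : MvPolynomial (Fin (n+1)) k) = 0 :=
    fun Y' hY' hvY' => (H.ord_eq_zero hY' (H.ker_ne.1 hb0)).2 (fun h => hx0 (mem_IX.1 h v hvY'))
  refine ⟨α f / α (MvPolynomial.X i ^ e), ⟨e, f, _, hf, ?_, hb0, rfl⟩, div_ne_zero ha0 hb0, ?_, ?_⟩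
  · have := (isHomogeneous_X k i).pow e
    simpa using this
  · intro hvY
    rw [H.vv_frac hY ha0 hb0, hord Y hY hvY, H.ord_gen hY ⟨hfY, hfX, u, fun h => huv (mem_IX.1 h v hvY), hup⟩]
    simp
  · intro Y' hY' hvY' hne
    rw [H.vv_frac hY' ha0 hb0, hord Y' hY' hvY', (H.ord_eq_zero hY' hfX).2]
    · simp
    · intro hf'
      apply hne
      refine (H.divisor_ext hY hY' fun p hp => ?_).symm
      obtain ⟨c, hc⟩ := hup p hp
      have h1 := Ideal.add_mem _ ((H.lt hY').le hc) (Ideal.mul_mem_left _ c hf')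
      rw [sub_add_cancel] at h1
      exact ((primeY hY').mem_or_mem h1).resolve_left (fun h => huv (mem_IX.1 h v hvY'))

lemma local_eq (H : Setup X d α) {v : Fin (n+1) → k} (hv : v ∈ cone X) (D : DivisorOn X d)
    (hD : HasFiniteSupport D) : ∃ t ∈ K0 α, t ≠ 0 ∧ ∀ Y : {Y : Set (ProjPt k n) // IsPrimeDivisorOn X d Y},
      v ∈ cone Y.1 → vv α X Y.1 t = D Y := by
  classical
  choose t htK ht0 ht1 ht2 using fun Y : {Y : Set (ProjPt k n) // IsPrimeDivisorOn X d Y} =>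
    H.local_eq_prime hv Y.2
  refine ⟨∏ Y ∈ hD.toFinset, t Y ^ D Y, prod_mem fun Y _ => zpow_mem (htK Y) _,
    Finset.prod_ne_zero_iff.2 fun Y _ => zpow_ne_zero _ (ht0 Y), fun Y hvY => ?_⟩
  refine (H.vv_prod Y.2 hD.toFinset (fun Z _ => zpow_ne_zero (D Z) (ht0 Z))).trans ?_
  have : ∀ Z ∈ hD.toFinset, vv α X Y.1 (t Z ^ D Z) = if Z = Y then D Y else 0 := by
    intro Z _
    rw [H.vv_zpow Y.2 (ht0 Z)]
    split_ifs with h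
    · subst h; rw [ht1 _ hvY, mul_one]
    · rw [ht2 Z Y.1 Y.2 hvY (fun h' => h (Subtype.ext h'.symm)), mul_zero]
  rw [Finset.sum_congr rfl this, Finset.sum_ite_eq']
  split_ifs with h
  · rfl
  · by_contra hne
    exact h (hD.mem_toFinset.2 (fun h0 => hne h0.symm))
end Setup
end Bt
end Part10

section Part11
open MvPolynomial
namespace Bt
set_option linter.unusedSectionVars false
set_option linter.unusedVariables false
variable {k : Type} [Field k] {n : ℕ}
attribute [local instance] MvPolynomial.gradedAlgebra


variable {L : Type} [Field L] [Algebra k L] {X : Set (ProjPt k n)} {d : ℕ}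
    {α : MvPolynomial (Fin (n+1)) k →ₐ[k] L}

/-- prime divisors -/
abbrev PD (X : Set (ProjPt k n)) (d : ℕ) : Type := {Y : Set (ProjPt k n) // IsPrimeDivisorOn X d Y}

/-- divisor with chosen local equations -/
structure Sd (X : Set (ProjPt k n)) (d : ℕ) (α : MvPolynomial (Fin (n+1)) k →ₐ[k] L)
    (D : PD X d → ℤ) (t : (Fin (n+1) → k) → L) : Prop where
  H : Setup X d α
  fin : {Y | D Y ≠ 0}.Finite
  tK : ∀ v, t v ∈ K0 α
  t0 : ∀ v, t v ≠ 0
  tv : ∀ v ∈ cone X, ∀ Y : PD X d, v ∈ cone Y.1 → vv α X Y.1 (t v) = D Y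

/-- regular at `v` as a section of `l D` -/
def RS (α : MvPolynomial (Fin (n+1)) k →ₐ[k] L) (t : (Fin (n+1) → k) → L) (v : Fin (n+1) → k) (l : ℤ) (φ : L) : Prop :=
  Reg α v (φ * t v ^ l)

/-- value at `v` of a section -/
noncomputable def val (α : MvPolynomial (Fin (n+1)) k →ₐ[k] L) (t : (Fin (n+1) → k) → L) (v : Fin (n+1) → k) (l : ℤ) (φ : L) : k :=
  ev α v (φ * t v ^ l)

/-- sections of `l D` along `B` -/
def Sec (α : MvPolynomial (Fin (n+1)) k →ₐ[k] L) (t : (Fin (n+1) → k) → L) (B : Set (ProjPt k n)) (l : ℤ) (φ : L) : Prop :=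
  φ ∈ K0 α ∧ ∀ v ∈ cone B, RS α t v l φ

variable [IsAlgClosed k] {D : PD X d → ℤ} {t : (Fin (n+1) → k) → L}

lemma Setup.exists_Sd (H : Setup X d α) (hD : {Y | D Y ≠ 0}.Finite) : ∃ t, Sd X d α D t := by
  have : ∀ v : Fin (n+1) → k, ∃ t ∈ K0 α, t ≠ 0 ∧ (v ∈ cone X → ∀ Y : PD X d, v ∈ cone Y.1 → vv α X Y.1 t = D Y) := by
    intro v
    by_cases hv : v ∈ cone X
    · obtain ⟨t, h1, h2, h3⟩ := H.local_eq hv D hD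
      exact ⟨t, h1, h2, fun _ => h3⟩
    · exact ⟨1, one_mem _, one_ne_zero, fun h => absurd h hv⟩
  choose t h1 h2 h3 using this
  exact ⟨t, H, hD, h1, h2, h3⟩

namespace Sd

lemma sub (S : Sd X d α D t) {v : Fin (n+1) → k} {Y : PD X d} (hv : v ∈ cone Y.1) : v ∈ cone X := ⟨hv.1, Y.2.1 hv.2⟩

lemma tw (S : Sd X d α D t) {v : Fin (n+1) → k} {Y : PD X d} (hv : v ∈ cone Y.1) {φ : L} (h0 : φ ≠ 0) (l : ℤ) :
    vv α X Y.1 (φ * t v ^ l) = vv α X Y.1 φ + l * D Y := by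
  rw [S.H.vv_mul Y.2 h0 (zpow_ne_zero _ (S.t0 v)), S.H.vv_zpow Y.2 (S.t0 v), S.tv v (S.sub hv) Y hv]

lemma twK (S : Sd X d α D t) {φ : L} (h : φ ∈ K0 α) (v : Fin (n+1) → k) (l : ℤ) : φ * t v ^ l ∈ K0 α :=
  mul_mem h (zpow_mem (S.tK v) l)

lemma tw0 (S : Sd X d α D t) {φ : L} (h : φ ≠ 0) (v : Fin (n+1) → k) (l : ℤ) : φ * t v ^ l ≠ 0 :=
  mul_ne_zero h (zpow_ne_zero _ (S.t0 v))

lemma rs_of (S : Sd X d α D t) {v : Fin (n+1) → k} (hv : v ∈ cone X) {φ : L} (hK : φ ∈ K0 α) (h0 : φ ≠ 0) {l : ℤ}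
    (h : ∀ Y : PD X d, v ∈ cone Y.1 → 0 ≤ vv α X Y.1 φ + l * D Y) : RS α t v l φ :=
  S.H.reg_of_vv hv (S.twK hK v l) (S.tw0 h0 v l) fun Y hY hvY => by
    rw [S.tw (Y := ⟨Y, hY⟩) hvY h0]; exact h ⟨Y, hY⟩ hvY

lemma ww_nonneg (S : Sd X d α D t) {v : Fin (n+1) → k} {Y : PD X d} (hv : v ∈ cone Y.1) {φ : L} (h0 : φ ≠ 0) {l : ℤ}
    (h : RS α t v l φ) : 0 ≤ vv α X Y.1 φ + l * D Y := by
  rw [← S.tw hv h0]; exact S.H.vv_of_reg Y.2 hv (S.tw0 h0 v l) h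

lemma ww_zero (S : Sd X d α D t) {v : Fin (n+1) → k} {Y : PD X d} (hv : v ∈ cone Y.1) {φ : L} {l : ℤ}
    (h : RS α t v l φ) (hval : val α t v l φ ≠ 0) : vv α X Y.1 φ + l * D Y = 0 := by
  by_cases h0 : φ = 0
  · exfalso; apply hval
    rw [val, h0, zero_mul]
    have := S.H.ev_const (S.sub hv) 0
    simpa using this
  rw [← S.tw hv h0]; exact S.H.vv_eq_zero Y.2 hv h hval

lemma val_ne (S : Sd X d α D t) {v : Fin (n+1) → k} (hv : v ∈ cone X) {φ : L} (hK : φ ∈ K0 α) (h0 : φ ≠ 0) {l : ℤ}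
    (h : ∀ Y : PD X d, v ∈ cone Y.1 → vv α X Y.1 φ + l * D Y = 0) : val α t v l φ ≠ 0 :=
  S.H.ev_ne_zero hv (S.twK hK v l) (S.tw0 h0 v l) fun Y hY hvY => by
    rw [S.tw (Y := ⟨Y, hY⟩) hvY h0]; exact h ⟨Y, hY⟩ hvY

lemma val_zero (S : Sd X d α D t) {v : Fin (n+1) → k} (hv : v ∈ cone X) (l : ℤ) : val α t v l 0 = 0 := by
  rw [val, zero_mul]
  have := S.H.ev_const hv 0
  simpa using this

lemma add_aux (S : Sd X d α D t) {v : Fin (n+1) → k} (hv : v ∈ cone X) {φ ψ : L} {l : ℤ} (h : RS α t v l φ) (h' : RS α t v l ψ) :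
    RS α t v l (φ + ψ) ∧ val α t v l (φ + ψ) = val α t v l φ + val α t v l ψ := by
  simp only [RS, val, add_mul]; exact S.H.add_aux hv h h'

lemma mul_aux (S : Sd X d α D t) {v : Fin (n+1) → k} (hv : v ∈ cone X) {φ ψ : L} {l l' : ℤ} (h : RS α t v l φ) (h' : RS α t v l' ψ) :
    RS α t v (l + l') (φ * ψ) ∧ val α t v (l + l') (φ * ψ) = val α t v l φ * val α t v l' ψ := by
  have : φ * ψ * t v ^ (l + l') = (φ * t v ^ l) * (ψ * t v ^ l') := by
    rw [zpow_add₀ (S.t0 v)]; ring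
  simp only [RS, val, this]; exact S.H.mul_aux hv h h'

lemma const_aux (S : Sd X d α D t) {v : Fin (n+1) → k} (hv : v ∈ cone X) (c : k) :
    RS α t v 0 (algebraMap k L c) ∧ val α t v 0 (algebraMap k L c) = c := by
  simp only [RS, val, zpow_zero, mul_one]; exact ⟨Setup.reg_const v c, S.H.ev_const hv c⟩

lemma smul_aux (S : Sd X d α D t) {v : Fin (n+1) → k} (hv : v ∈ cone X) {φ : L} {l : ℤ} (c : k) (h : RS α t v l φ) :
    RS α t v l (c • φ) ∧ val α t v l (c • φ) = c * val α t v l φ := by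
  have h1 := S.const_aux hv c
  have h2 := S.mul_aux hv h1.1 h
  rw [zero_add, h1.2, ← Algebra.smul_def] at h2; exact h2

lemma pow_aux (S : Sd X d α D t) {v : Fin (n+1) → k} (hv : v ∈ cone X) {φ : L} {l : ℤ} (h : RS α t v l φ) (r : ℕ) :
    RS α t v (r * l) (φ ^ r) ∧ val α t v (r * l) (φ ^ r) = val α t v l φ ^ r := by
  induction r with
  | zero => simpa using S.const_aux hv 1
  | succ r ih =>
    have h1 := S.mul_aux hv ih.1 h
    rw [ih.2, ← pow_succ, ← pow_succ, show (r : ℤ) * l + l = (r + 1 : ℕ) * l by push_cast; ring] at h1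
    exact h1

lemma inv_aux (S : Sd X d α D t) {v : Fin (n+1) → k} (hv : v ∈ cone X) {φ : L} {l : ℤ} (h : RS α t v l φ)
    (h0 : val α t v l φ ≠ 0) : RS α t v (-l) φ⁻¹ ∧ val α t v (-l) φ⁻¹ = (val α t v l φ)⁻¹ := by
  have : φ⁻¹ * t v ^ (-l) = (φ * t v ^ l)⁻¹ := by rw [zpow_neg, mul_inv]
  simp only [RS, val, this]; exact ⟨S.H.reg_inv hv h h0, S.H.ev_inv hv h h0⟩

lemma zero_aux (S : Sd X d α D t) {v : Fin (n+1) → k} (hv : v ∈ cone X) (l : ℤ) : RS α t v l 0 := by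
  have := Setup.reg_const (α := α) v 0
  simpa [RS] using this

lemma sum_aux (S : Sd X d α D t) {v : Fin (n+1) → k} (hv : v ∈ cone X) {ι : Type} (s : Finset ι) {φ : ι → L} {l : ℤ}
    (h : ∀ i ∈ s, RS α t v l (φ i)) :
    RS α t v l (∑ i ∈ s, φ i) ∧ val α t v l (∑ i ∈ s, φ i) = ∑ i ∈ s, val α t v l (φ i) := by
  classical
  induction s using Finset.induction_on with
  | empty => simpa using ⟨S.zero_aux hv l, S.val_zero hv l⟩
  | insert a s ha ih =>
    have h1 := ih fun i hi => h i (Finset.mem_insert_of_mem hi)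
    have h2 := S.add_aux hv (h a (Finset.mem_insert_self _ _)) h1.1
    rw [Finset.sum_insert ha, Finset.sum_insert ha, ← h1.2]; exact h2

lemma prod_aux (S : Sd X d α D t) {v : Fin (n+1) → k} (hv : v ∈ cone X) {ι : Type} (s : Finset ι) {φ : ι → L} {l : ι → ℤ}
    (h : ∀ i ∈ s, RS α t v (l i) (φ i)) :
    RS α t v (∑ i ∈ s, l i) (∏ i ∈ s, φ i) ∧ val α t v (∑ i ∈ s, l i) (∏ i ∈ s, φ i) = ∏ i ∈ s, val α t v (l i) (φ i) := by
  classical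
  induction s using Finset.induction_on with
  | empty => simpa using S.const_aux hv 1
  | insert a s ha ih =>
    have h1 := ih fun i hi => h i (Finset.mem_insert_of_mem hi)
    have h2 := S.mul_aux hv (h a (Finset.mem_insert_self _ _)) h1.1
    rw [Finset.sum_insert ha, Finset.prod_insert ha, Finset.prod_insert ha, ← h1.2]; exact h2

lemma finite_vv (S : Sd X d α D t) {φ : L} (hK : φ ∈ K0 α) (h0 : φ ≠ 0) : {Y : PD X d | vv α X Y.1 φ ≠ 0}.Finite := by
  obtain ⟨e, a, b, ha, hb, hb0, rfl⟩ := hK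
  have ha0 : α a ≠ 0 := fun h => h0 (by rw [h, zero_div])
  refine ((S.H.finite_ord ha (S.H.ker_ne.1 ha0)).union (S.H.finite_ord hb (S.H.ker_ne.1 hb0))).subset ?_
  intro Y hY
  by_contra hc
  simp only [Set.mem_union, Set.mem_ofPred_eq, not_or, not_not] at hc
  apply hY
  rw [S.H.vv_frac Y.2 ha0 hb0, hc.1, hc.2]; simp

lemma finite_ww (S : Sd X d α D t) {φ : L} (hK : φ ∈ K0 α) (h0 : φ ≠ 0) (l : ℤ) :
    {Y : PD X d | vv α X Y.1 φ + l * D Y ≠ 0}.Finite := by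
  refine ((S.finite_vv hK h0).union S.fin).subset ?_
  intro Y hY
  by_contra hc
  simp only [Set.mem_union, Set.mem_ofPred_eq, not_or, not_not] at hc
  apply hY
  rw [hc.1, hc.2]; simp

/-- a form nonvanishing at `v` but vanishing on finitely many divisors not containing `v` -/
lemma avoid_form (S : Sd X d α D t) {v : Fin (n+1) → k} (hv : v ≠ 0) {F : Set (PD X d)} (hF : F.Finite)
    (h : ∀ Y ∈ F, v ∉ cone Y.1) : ∃ q e, MvPolynomial.IsHomogeneous q e ∧ eval v q ≠ 0 ∧ ∀ Y ∈ F, q ∈ IX Y.1 := by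
  classical
  have : ∀ Y : PD X d, ∃ f e, MvPolynomial.IsHomogeneous f e ∧ (Y ∈ F → f ∈ IX Y.1 ∧ eval v f ≠ 0) := by
    intro Y
    by_cases hY : Y ∈ F
    · obtain ⟨f, h1, ⟨e, h2⟩, h3⟩ := exists_sep Y.2.2.1 hv (h Y hY)
      exact ⟨f, e, h2, fun _ => ⟨h1, h3⟩⟩
    · exact ⟨1, 0, isHomogeneous_one _ _, fun h => absurd h hY⟩
  choose f e h1 h2 using this
  refine ⟨∏ Y ∈ hF.toFinset, f Y, _, IsHomogeneous.prod _ _ e fun Y _ => h1 Y, ?_, ?_⟩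
  · rw [map_prod]; exact Finset.prod_ne_zero_iff.2 fun Y hY => (h2 Y (hF.mem_toFinset.1 hY)).2
  · intro Y hY
    rw [← Finset.mul_prod_erase _ _ (hF.mem_toFinset.2 hY)]
    exact Ideal.mul_mem_right _ _ (h2 Y hY).1

/-- `t v` is a local equation at `y` -/
def Near (α : MvPolynomial (Fin (n+1)) k →ₐ[k] L) (D : PD X d → ℤ) (t : (Fin (n+1) → k) → L) (v y : Fin (n+1) → k) : Prop :=
  ∀ Y : PD X d, y ∈ cone Y.1 → vv α X Y.1 (t v) = D Y

lemma nbhd (S : Sd X d α D t) {v : Fin (n+1) → k} (hv : v ∈ cone X) :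
    ∃ q e, MvPolynomial.IsHomogeneous q e ∧ eval v q ≠ 0 ∧ ∀ y ∈ cone X, eval y q ≠ 0 → Near α D t v y := by
  obtain ⟨q, e, h1, h2, h3⟩ := S.avoid_form hv.1 (S.finite_ww (S.tK v) (S.t0 v) (-1)) (by
    intro Y hY hvY
    apply hY
    rw [S.tv v hv Y hvY]; ring)
  refine ⟨q, e, h1, h2, fun y hy hq Y hyY => ?_⟩
  by_contra hc
  exact hq (mem_IX.1 (h3 Y (by intro h; apply hc; linarith)) y hyY)

lemma near_unit (S : Sd X d α D t) {v y : Fin (n+1) → k} (hy : y ∈ cone X) (h : Near α D t v y) (l : ℤ) :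
    RS α t y (-l) (t v ^ l) ∧ val α t y (-l) (t v ^ l) ≠ 0 := by
  have h0 := zpow_ne_zero l (S.t0 v)
  have hK := zpow_mem (S.tK v) l
  have hw : ∀ Y : PD X d, y ∈ cone Y.1 → vv α X Y.1 (t v ^ l) + (-l) * D Y = 0 := by
    intro Y hY
    rw [S.H.vv_zpow Y.2 (S.t0 v), h Y hY]; ring
  exact ⟨S.rs_of hy hK h0 fun Y hY => (hw Y hY).ge, S.val_ne hy hK h0 hw⟩

lemma near_iff (S : Sd X d α D t) {v y : Fin (n+1) → k} (hy : y ∈ cone X) (h : Near α D t v y) {l : ℤ} {φ : L} :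
    RS α t y l φ ↔ Reg α y (φ * t v ^ l) := by
  have h1 := S.near_unit hy h l
  constructor
  · intro h2
    have h3 := (S.mul_aux hy h2 h1.1).1
    rw [add_neg_cancel, RS, zpow_zero, mul_one] at h3
    exact h3
  · intro h2
    have h3 := S.inv_aux hy h1.1 h1.2
    have h4 : RS α t y 0 (φ * t v ^ l) := by rwa [RS, zpow_zero, mul_one]
    have h5 := (S.mul_aux hy h4 h3.1).1
    rw [neg_neg, zero_add, mul_assoc, mul_inv_cancel₀ (zpow_ne_zero _ (S.t0 v)), mul_one] at h5
    exact h5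

lemma near_val (S : Sd X d α D t) {v y : Fin (n+1) → k} (hy : y ∈ cone X) (h : Near α D t v y) {l : ℤ} {φ : L}
    (h2 : RS α t y l φ) : val α t y l φ = 0 ↔ ev α y (φ * t v ^ l) = 0 := by
  have h1 := S.near_unit hy h l
  have h3 := (S.mul_aux hy h2 h1.1).2
  rw [add_neg_cancel] at h3
  conv_lhs at h3 => rw [val, zpow_zero, mul_one]
  rw [h3, mul_eq_zero, or_iff_left h1.2]

/-- nonvanishing is an open condition -/
lemma open_ne (S : Sd X d α D t) {B : Set (ProjPt k n)} (hB : B ⊆ X) {v : Fin (n+1) → k} (hv : v ∈ cone X) {l : ℤ} {φ : L}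
    (hK : φ ∈ K0 α) (hr : RS α t v l φ) (hne : val α t v l φ ≠ 0) :
    ∃ q e, MvPolynomial.IsHomogeneous q e ∧ eval v q ≠ 0 ∧
      ∀ y ∈ cone X, eval y q ≠ 0 → RS α t y l φ ∧ val α t y l φ ≠ 0 := by
  obtain ⟨q, e, h1, h2, h3⟩ := S.nbhd hv
  obtain ⟨e', a, b, ha, hb, hbv, heq⟩ := S.H.hom_rep hv (S.twK hK v l) hr
  have hav : eval v a ≠ 0 := by
    intro h
    apply hne
    rw [val, heq, S.H.ev_frac hv hbv, h, zero_div]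
  refine ⟨q * (a * b), _, h1.mul (ha.mul hb), ?_, ?_⟩
  · rw [map_mul, map_mul]; exact mul_ne_zero h2 (mul_ne_zero hav hbv)
  · intro y hy hq
    rw [map_mul, map_mul] at hq
    have hqy := left_ne_zero_of_mul hq
    have hay := left_ne_zero_of_mul (right_ne_zero_of_mul hq)
    have hby := right_ne_zero_of_mul (right_ne_zero_of_mul hq)
    have hN := h3 y hy hqy
    have hR : RS α t y l φ := (S.near_iff hy hN).2 ⟨a, b, hby, heq⟩
    refine ⟨hR, ?_⟩
    rw [ne_eq, S.near_val hy hN hR, heq, S.H.ev_frac hy hby]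
    exact div_ne_zero hay hby

/-- `φ` vanishes along `B` -/
def Van (α : MvPolynomial (Fin (n+1)) k →ₐ[k] L) (t : (Fin (n+1) → k) → L) (B : Set (ProjPt k n)) (l : ℤ) (φ : L) : Prop :=
  ∀ v ∈ cone B, val α t v l φ = 0

lemma van_prime (S : Sd X d α D t) {B : Set (ProjPt k n)} (hB : B ⊆ X) (hBi : IsIrredSub B) {φ ψ : L} {l l' : ℤ}
    (hφ : Sec α t B l φ) (hψ : Sec α t B l' ψ) (h : Van α t B (l + l') (φ * ψ)) : Van α t B l φ ∨ Van α t B l' ψ := by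
  by_contra hc
  simp only [Van, not_or] at hc
  push Not at hc
  obtain ⟨⟨v, hv, hne⟩, v', hv', hne'⟩ := hc
  have hs : ∀ v, v ∈ cone B → v ∈ cone X := fun v hv => ⟨hv.1, hB hv.2⟩
  obtain ⟨q, e, -, h1, h2⟩ := S.open_ne hB (hs v hv) hφ.1 (hφ.2 v hv) hne
  obtain ⟨q', e', -, h1', h2'⟩ := S.open_ne hB (hs v' hv') hψ.1 (hψ.2 v' hv') hne'
  have hp := IX_prime hBi
  have : q * q' ∉ IX B := fun h => (hp.mem_or_mem h).elim (fun h => h1 (mem_IX.1 h v hv)) (fun h => h1' (mem_IX.1 h v' hv'))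
  rw [mem_IX] at this
  push Not at this
  obtain ⟨y, hy, hq⟩ := this
  rw [map_mul] at hq
  have h3 := h2 y (hs y hy) (left_ne_zero_of_mul hq)
  have h4 := h2' y (hs y hy) (right_ne_zero_of_mul hq)
  have h5 := (S.mul_aux (hs y hy) h3.1 h4.1).2
  rw [h y hy] at h5
  exact mul_ne_zero h3.2 h4.2 h5.symm

lemma van_divisor (S : Sd X d α D t) (Y : PD X d) {φ : L} (h0 : φ ≠ 0) {l : ℤ}
    (hφ : Sec α t Y.1 l φ) : Van α t Y.1 l φ ↔ 1 ≤ vv α X Y.1 φ + l * D Y := by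
  constructor
  · intro h
    obtain ⟨x, hx⟩ := Y.2.2.2.1.1
    have hv := cone_rep hx
    have h1 := S.ww_nonneg hv h0 (hφ.2 _ hv)
    by_contra hc
    have h2 : vv α X Y.1 φ + l * D Y = 0 := by omega
    set v := x.rep
    have hvX := S.sub hv
    obtain ⟨q, e, -, hq, h3⟩ := S.nbhd hvX
    obtain ⟨e', a, b, ha, hb, hbv, heq⟩ := S.H.hom_rep hvX (S.twK hφ.1 v l) (hφ.2 v hv)
    have hb0 := S.H.ne_of_eval hvX hbv
    have ha0 : α a ≠ 0 := fun h => S.tw0 h0 v l (by rw [heq, h, zero_div])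
    have h4 := S.tw hv h0 l
    rw [heq, S.H.vv_frac Y.2 ha0 hb0, h2, (S.H.ord_eq_zero Y.2 (S.H.ker_ne.1 hb0)).2 (fun h => hbv (mem_IX.1 h v hv))] at h4
    have h5 : a ∉ IX Y.1 := (S.H.ord_eq_zero Y.2 (S.H.ker_ne.1 ha0)).1 (by omega)
    have hp := IX_prime Y.2.2.2.1
    have : q * (a * b) ∉ IX Y.1 := fun h => (hp.mem_or_mem h).elim (fun h => hq (mem_IX.1 h v hv))
      (fun h => (hp.mem_or_mem h).elim h5 (fun h => hbv (mem_IX.1 h v hv)))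
    rw [mem_IX] at this
    push Not at this
    obtain ⟨y, hy, hqy⟩ := this
    rw [map_mul, map_mul] at hqy
    have h6 := h y hy
    have hN := h3 y (S.sub hy) (left_ne_zero_of_mul hqy)
    rw [S.near_val (S.sub hy) hN (hφ.2 y hy), heq, S.H.ev_frac (S.sub hy) (right_ne_zero_of_mul (right_ne_zero_of_mul hqy))] at h6
    exact div_ne_zero (left_ne_zero_of_mul (right_ne_zero_of_mul hqy)) (right_ne_zero_of_mul (right_ne_zero_of_mul hqy)) h6
  · intro h v hv
    by_contra hc
    have := S.ww_zero hv (hφ.2 v hv) hc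
    omega

lemma van_X (S : Sd X d α D t) {φ : L} {l : ℤ} (hφ : Sec α t X l φ) (h : Van α t X l φ) : φ = 0 := by
  by_contra h0
  obtain ⟨x, hx⟩ := S.H.sm.2.1.1
  have hv := cone_rep hx
  set v := x.rep
  obtain ⟨q, e, -, hq, h3⟩ := S.nbhd hv
  obtain ⟨e', a, b, ha, hb, hbv, heq⟩ := S.H.hom_rep hv (S.twK hφ.1 v l) (hφ.2 v hv)
  have ha0 : α a ≠ 0 := fun h => S.tw0 h0 v l (by rw [heq, h, zero_div])
  have : q * (a * b) ∉ IX X := fun h => (S.H.prime.mem_or_mem h).elim (fun h => hq (mem_IX.1 h v hv))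
      (fun h => (S.H.prime.mem_or_mem h).elim (S.H.ker_ne.1 ha0) (fun h => hbv (mem_IX.1 h v hv)))
  rw [mem_IX] at this
  push Not at this
  obtain ⟨y, hy, hqy⟩ := this
  rw [map_mul, map_mul] at hqy
  have h6 := h y hy
  have hN := h3 y hy (left_ne_zero_of_mul hqy)
  rw [S.near_val hy hN (hφ.2 y hy), heq, S.H.ev_frac hy (right_ne_zero_of_mul (right_ne_zero_of_mul hqy))] at h6
  exact div_ne_zero (left_ne_zero_of_mul (right_ne_zero_of_mul hqy)) (right_ne_zero_of_mul (right_ne_zero_of_mul hqy)) h6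

end Sd
end Bt
end Part11

section Part12
open MvPolynomial
namespace Bt
set_option linter.unusedSectionVars false
set_option linter.unusedVariables false
variable {k : Type} [Field k] {n : ℕ}
attribute [local instance] MvPolynomial.gradedAlgebra


variable {L : Type} [Field L] [Algebra k L] {X : Set (ProjPt k n)} {d : ℕ}
    {α : MvPolynomial (Fin (n+1)) k →ₐ[k] L}

/-- value vector of the sections -/
noncomputable def th (α : MvPolynomial (Fin (n+1)) k →ₐ[k] L) (t : (Fin (n+1) → k) → L) (m₀ : ℕ) {m : ℕ}
    (Θ : Fin (m+1) → L) (v : Fin (n+1) → k) : Fin (m+1) → k := fun i => val α t v m₀ (Θ i)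

/-- image of `B` -/
def WB (α : MvPolynomial (Fin (n+1)) k →ₐ[k] L) (t : (Fin (n+1) → k) → L) (m₀ : ℕ) {m : ℕ}
    (Θ : Fin (m+1) → L) (B : Set (ProjPt k n)) : Set (ProjPt k m) :=
  {y | ∃ v ∈ cone B, ∃ h : th α t m₀ Θ v ≠ 0, y = Projectivization.mk k (th α t m₀ Θ v) h}

/-- ample data -/
structure Amp {X : Set (ProjPt k n)} {d : ℕ} (α : MvPolynomial (Fin (n+1)) k →ₐ[k] L)
    (D : PD X d → ℤ) (t : (Fin (n+1) → k) → L) (m₀ : ℕ) {m : ℕ} (Θ : Fin (m+1) → L) : Prop where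
  S : Sd X d α D t
  pos : 0 < m₀
  sec : ∀ i, Sec α t X m₀ (Θ i)
  ne : ∀ v ∈ cone X, th α t m₀ Θ v ≠ 0
  psi : ∀ v ∈ cone X, ∃ (e : ℕ) (p : Fin (n+1) → MvPolynomial (Fin (m+1)) k) (c : k),
    (∀ i, (p i).IsHomogeneous e) ∧ c ≠ 0 ∧ (∀ i, eval (th α t m₀ Θ v) (p i) = c * v i) ∧
    (∀ i j, α (MvPolynomial.X i) * aeval Θ (p j) = α (MvPolynomial.X j) * aeval Θ (p i)) ∧
    ∀ y ∈ cone X, ∀ i j, y i * eval (th α t m₀ Θ y) (p j) = y j * eval (th α t m₀ Θ y) (p i)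
  closed : IsClosedSub (WB α t m₀ Θ X)

variable [IsAlgClosed k] {D : PD X d → ℤ} {t : (Fin (n+1) → k) → L}

lemma mk_cross {m : ℕ} {a b : Fin (m+1) → k} {ha : a ≠ 0} {hb : b ≠ 0}
    (h : Projectivization.mk k a ha = Projectivization.mk k b hb) : ∃ c : k, c ≠ 0 ∧ ∀ i, a i = c * b i := by
  rw [Projectivization.mk_eq_mk_iff'] at h
  obtain ⟨c, hc⟩ := h
  refine ⟨c, ?_, fun i => by rw [← hc]; rfl⟩
  rintro rfl
  exact ha (by rw [← hc, zero_smul])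

lemma eval_aeval {m : ℕ} (v : Fin (n+1) → k) (g : Fin (m+1) → MvPolynomial (Fin (n+1)) k)
    (p : MvPolynomial (Fin (m+1)) k) : eval v (aeval g p) = eval (fun j => eval v (g j)) p := by
  induction p using MvPolynomial.induction_on with
  | C a => simp
  | add p q hp hq => rw [map_add, map_add, map_add, hp, hq]
  | mul_X p i hp => rw [map_mul, map_mul, map_mul, aeval_X, eval_X, hp]

lemma hom_aeval {m e q : ℕ} {g : Fin (m+1) → MvPolynomial (Fin (n+1)) k} (hg : ∀ j, (g j).IsHomogeneous e)
    {p : MvPolynomial (Fin (m+1)) k} (hp : p.IsHomogeneous q) : (aeval g p).IsHomogeneous (e * q) :=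
  IsHomogeneous.aeval hp g hg

/-- presentation of the map -/
def Pres {m : ℕ} (X : Set (ProjPt k n)) (φ : ProjPt k n → ProjPt k m) (e : ℕ) (g : Fin (m+1) → MvPolynomial (Fin (n+1)) k) : Prop :=
  (∀ j, (g j).IsHomogeneous e) ∧ ∀ v (hv : v ∈ cone X), ∀ hgv : (fun j => MvPolynomial.eval v (g j)) ≠ 0,
        Projectivization.mk k (fun j => MvPolynomial.eval v (g j)) hgv = φ (Projectivization.mk k v hv.1)

lemma pres_of {m : ℕ} {φ : ProjPt k n → ProjPt k m} (hφ : IsMorphismOn X φ) {v : Fin (n+1) → k} (hv : v ∈ cone X) :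
    ∃ e g, Pres X φ e g ∧ ∃ j, eval v (g j) ≠ 0 := by
  obtain ⟨e, g, hg, ⟨j, hj⟩, h⟩ := hφ _ hv.2
  refine ⟨e, g, ⟨hg, fun v hv hgv => h _ hv.2 v hv.1 rfl hgv⟩, j, ?_⟩
  rwa [vanishesAt_mk (hg j) hv.1] at hj

lemma pres_cross (H : Setup X d α) {m : ℕ} {φ : ProjPt k n → ProjPt k m} {e e' : ℕ}
    {g g' : Fin (m+1) → MvPolynomial (Fin (n+1)) k} (h : Pres X φ e g) (h' : Pres X φ e' g') (i j : Fin (m+1)) :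
    α (g i) * α (g' j) = α (g j) * α (g' i) := by
  rw [← map_mul, ← map_mul, ← sub_eq_zero, ← map_sub, H.ker, mem_IX]
  intro v hv
  rw [map_sub, map_mul, map_mul, sub_eq_zero]
  by_cases h1 : (fun j => MvPolynomial.eval v (g j)) = 0
  · have h2 := congrFun h1 i
    have h3 := congrFun h1 j
    simp only [Pi.zero_apply] at h2 h3
    rw [h2, h3]; simp
  by_cases h1' : (fun j => MvPolynomial.eval v (g' j)) = 0
  · have h2 := congrFun h1' i
    have h3 := congrFun h1' j
    simp only [Pi.zero_apply] at h2 h3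
    rw [h2, h3]; simp
  obtain ⟨c, -, hc⟩ := mk_cross ((h.2 v hv h1).trans (h'.2 v hv h1').symm)
  rw [hc i, hc j]; ring

lemma map_aeval' {m : ℕ} (g : Fin (m+1) → MvPolynomial (Fin (n+1)) k) (p : MvPolynomial (Fin (m+1)) k) :
    α (aeval g p) = aeval (fun j => α (g j)) p := by
  induction p using MvPolynomial.induction_on with
  | C a => simp [MvPolynomial.algHom_C]
  | add p q hp hq => rw [map_add, map_add, map_add, hp, hq]
  | mul_X p i hp => rw [map_mul, map_mul, map_mul, aeval_X, aeval_X, hp]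

lemma Sd.exists_amp (S : Sd X d α D t) (hamp : IsAmpleDiv X d D) :
    ∃ (m₀ m : ℕ) (Θ : Fin (m+1) → L), Amp α D t m₀ Θ := by
  obtain ⟨m₀, hm₀, m, φ, X', ψ, ⟨hφ, hX', hcl, hinj, hψ, hinv⟩, ℓ, hℓ, hℓX, D', hD', e1, g1, h1, hg1, hh1, hg1X, hh1X, hlin⟩ := hamp
  have H := S.H
  have hℓ1 : ∀ (c : L) (w : Fin (m+1) → L), aeval (fun i => c * w i) ℓ = c * aeval w ℓ := fun c w => by
    rw [aeval_mul_hom hℓ, pow_one]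
  -- cross relation with ℓ
  have hcr : ∀ e e' g g', Pres X φ e g → Pres X φ e' g' → ∀ i, α (g i) * α (aeval g' ℓ) = α (aeval g ℓ) * α (g' i) := by
    intro e e' g g' h h' i
    rw [map_aeval', map_aeval', ← hℓ1, mul_comm, ← hℓ1]
    congr 1
    congr 1
    funext j
    rw [pres_cross H h h', mul_comm]
  obtain ⟨v', hv', hℓv⟩ : ∃ v', ∃ hv' : v' ∈ cone X, ∃ e g, Pres X φ e g ∧ α (aeval g ℓ) ≠ 0 := by
    have : ∃ y ∈ cone X', eval y ℓ ≠ 0 := by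
      by_contra hc
      push Not at hc
      exact hℓX (mem_IX.2 hc)
    obtain ⟨y, hy, hℓy⟩ := this
    have hy2 := hy.2
    rw [hX'] at hy2
    obtain ⟨x, hx, hxy⟩ := hy2
    obtain ⟨e, g, hg, j, hj⟩ := pres_of hφ (cone_rep hx)
    have hne : (fun j => MvPolynomial.eval x.rep (g j)) ≠ 0 := fun h => hj (congrFun h j)
    have h1 := hg.2 _ (cone_rep hx) hne
    rw [Projectivization.mk_rep, hxy] at h1
    obtain ⟨c, hc0, hc⟩ := mk_cross h1
    refine ⟨x.rep, cone_rep hx, e, g, hg, H.ne_of_eval (cone_rep hx) ?_⟩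
    rw [eval_aeval, show (fun j => eval x.rep (g j)) = c • y from funext hc, eval_smul_hom hℓ, pow_one]
    exact mul_ne_zero hc0 hℓy
  obtain ⟨e', g', hg', hg'ℓ⟩ := hℓv
  have hℓne : ∀ e g, Pres X φ e g → ∀ j, α (g j) ≠ 0 → α (aeval g ℓ) ≠ 0 := by
    intro e g hg j hj h0
    have := hcr e e' g g' hg hg' j
    rw [h0, zero_mul] at this
    exact mul_ne_zero hj hg'ℓ this
  obtain ⟨e0, g0, hg0, j0, hj0⟩ := pres_of hφ hv'
  have hg00 := H.ne_of_eval hv' hj0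
  have hl0 := hℓne e0 g0 hg0 j0 hg00
  have ha1 := H.ker_ne.2 hg1X
  have hb1 := H.ker_ne.2 hh1X
  set w : L := α g1 / α h1 with hw
  have hw0 : w ≠ 0 := div_ne_zero ha1 hb1
  have hwK : w ∈ K0 α := ⟨e1, g1, h1, hg1, hh1, hb1, rfl⟩
  have hwv : ∀ Y : PD X d, vv α X Y.1 w = m₀ * D Y - D' Y := by
    intro Y
    rw [hw, H.vv_frac Y.2 ha1 hb1]
    have h := hlin Y
    linarith
  set Θ : Fin (m+1) → L := fun i => (α (aeval g0 ℓ) * w)⁻¹ * α (g0 i) with hΘ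
  have hc0 : (α (aeval g0 ℓ) * w)⁻¹ ≠ 0 := inv_ne_zero (mul_ne_zero hl0 hw0)
  have hΘK : ∀ i, Θ i ∈ K0 α := by
    intro i
    have h2 : α (g0 i) / α (aeval g0 ℓ) ∈ K0 α := ⟨e0, _, _, hg0.1 i, by
      have := hom_aeval hg0.1 hℓ
      rwa [mul_one] at this, hl0, rfl⟩
    have h3 : Θ i = w⁻¹ * (α (g0 i) / α (aeval g0 ℓ)) := by
      simp only [hΘ, mul_inv, div_eq_mul_inv]; ring
    rw [h3]; exact mul_mem (inv_mem hwK) h2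
  have hΘg : ∀ e g, Pres X φ e g → ∀ j, α (g j) ≠ 0 → ∀ i, Θ i = α (g i) / (α (aeval g ℓ) * w) := by
    intro e g hg j hj i
    have h2 := hℓne e g hg j hj
    simp only [hΘ]
    rw [eq_div_iff (mul_ne_zero h2 hw0), inv_mul_eq_div, div_mul_eq_mul_div, div_eq_iff (mul_ne_zero hl0 hw0)]
    have h3 := hcr e0 e g0 g hg0 hg i
    linear_combination w * h3
  have hkey : ∀ v ∈ cone X, (∀ i, RS α t v m₀ (Θ i)) ∧ ∃ e g, Pres X φ e g ∧ (∃ j, eval v (g j) ≠ 0) ∧ ∃ c : k, c ≠ 0 ∧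
      ∀ i, th α t m₀ Θ v i = c * eval v (g i) := by
    intro v hv
    obtain ⟨e, g, hg, j, hj⟩ := pres_of hφ hv
    have hgj := H.ne_of_eval hv hj
    have hl := hℓne e g hg j hgj
    have e2 := hΘg e g hg j hgj
    have hΘj : Θ j ≠ 0 := by rw [e2]; exact div_ne_zero hgj (mul_ne_zero hl hw0)
    have hww : ∀ Y : PD X d, v ∈ cone Y.1 → vv α X Y.1 (Θ j) + (m₀ : ℤ) * D Y = 0 := by
      intro Y hvY
      have h2 := hD' Y e g j hg.1 (by
        rintro y hy v hv rfl hgv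
        exact hg.2 v ⟨hv, hy⟩ hgv) (fun h => hj (mem_IX.1 h v hvY))
      rw [e2, H.vv_div Y.2 hgj (mul_ne_zero hl hw0), H.vv_mul Y.2 hl hw0, hwv, H.vv_poly Y.2 hgj, H.vv_poly Y.2 hl, h2]
      ring
    have hr : RS α t v m₀ (Θ j) := S.rs_of hv (hΘK j) hΘj fun Y hY => (hww Y hY).ge
    have hvl : val α t v m₀ (Θ j) ≠ 0 := S.val_ne hv (hΘK j) hΘj hww
    have hi : ∀ i, RS α t v m₀ (Θ i) ∧ val α t v m₀ (Θ i) = eval v (g i) / eval v (g j) * val α t v m₀ (Θ j) := by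
      intro i
      have h3 : Θ i = α (g i) / α (g j) * Θ j := by
        rw [e2, e2]; field_simp
      have h4 : RS α t v 0 (α (g i) / α (g j)) := by
        rw [RS, zpow_zero, mul_one]; exact ⟨_, _, hj, rfl⟩
      have h5 := S.mul_aux hv h4 hr
      rw [zero_add, ← h3] at h5
      refine ⟨h5.1, h5.2.trans ?_⟩
      congr 1
      rw [val, zpow_zero, mul_one, H.ev_frac hv hj]
    refine ⟨fun i => (hi i).1, e, g, hg, ⟨j, hj⟩, val α t v m₀ (Θ j) / eval v (g j), div_ne_zero hvl hj, fun i => ?_⟩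
    rw [th, (hi i).2]; field_simp
  have hmk : ∀ v (hv : v ∈ cone X), ∃ h : th α t m₀ Θ v ≠ 0, Projectivization.mk k (th α t m₀ Θ v) h = φ (Projectivization.mk k v hv.1) := by
    intro v hv
    obtain ⟨-, e, g, hg, ⟨j, hj⟩, c, hc, h⟩ := hkey v hv
    have hne : (fun j => MvPolynomial.eval v (g j)) ≠ 0 := fun h => hj (congrFun h j)
    have h2 : th α t m₀ Θ v ≠ 0 := by
      intro h0
      have := h j
      rw [h0] at this
      exact mul_ne_zero hc hj this.symm
    refine ⟨h2, ?_⟩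
    rw [← hg.2 v hv hne, Projectivization.mk_eq_mk_iff']
    exact ⟨c, funext fun i => (h i).symm⟩
  refine ⟨m₀, m, Θ, S, hm₀, fun i => ⟨hΘK i, fun v hv => (hkey v hv).1 i⟩, fun v hv => (hmk v hv).choose, ?_, ?_⟩
  · intro v hv
    obtain ⟨hne, hmkv⟩ := hmk v hv
    have hφv : φ (Projectivization.mk k v hv.1) ∈ X' := by rw [hX']; exact ⟨_, hv.2, rfl⟩
    have hc2 : th α t m₀ Θ v ∈ cone X' := ⟨hne, by rw [hmkv]; exact hφv⟩
    obtain ⟨e, p, hp, j, hj⟩ := pres_of hψ hc2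
    have hpy : ∀ y ∈ cone X, (fun j => eval (th α t m₀ Θ y) (p j)) ≠ 0 → ∃ c : k, c ≠ 0 ∧ ∀ i, eval (th α t m₀ Θ y) (p i) = c * y i := by
      intro y hy h0
      obtain ⟨hne', hmky⟩ := hmk y hy
      have h2 := hp.2 _ (⟨hne', by rw [hmky, hX']; exact ⟨_, hy.2, rfl⟩⟩ : th α t m₀ Θ y ∈ cone X') h0
      rw [hmky, hinv _ hy.2] at h2
      exact mk_cross h2
    have hcross : ∀ y ∈ cone X, ∀ i j, y i * eval (th α t m₀ Θ y) (p j) = y j * eval (th α t m₀ Θ y) (p i) := by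
      intro y hy i j
      by_cases h0 : (fun j => eval (th α t m₀ Θ y) (p j)) = 0
      · have h2 := congrFun h0 i
        have h3 := congrFun h0 j
        simp only [Pi.zero_apply] at h2 h3
        rw [h2, h3]; simp
      · obtain ⟨c, -, hc⟩ := hpy y hy h0
        rw [hc, hc]; ring
    obtain ⟨c, hc, hcv⟩ := hpy v hv (fun h => hj (congrFun h j))
    refine ⟨e, p, c, hp.1, hc, hcv, ?_, hcross⟩
    intro i j
    have h3 : α ((MvPolynomial.X i * aeval g0 (p j) - MvPolynomial.X j * aeval g0 (p i)) * g0 j0) = 0 := by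
      rw [H.ker, mem_IX]
      intro y hy
      rw [map_mul, map_sub, map_mul, map_mul, eval_aeval, eval_aeval, eval_X, eval_X]
      by_cases h0 : (fun j => eval y (g0 j)) = 0
      · have := congrFun h0 j0
        simp only [Pi.zero_apply] at this
        rw [this, mul_zero]
      · obtain ⟨hne', hmky⟩ := hmk y hy
        obtain ⟨b, hb, hby⟩ := mk_cross ((hg0.2 y hy h0).trans hmky.symm)
        rw [show (fun j => eval y (g0 j)) = b • th α t m₀ Θ y from funext hby, eval_smul_hom (hp.1 i), eval_smul_hom (hp.1 j)]
        linear_combination b ^ e * eval y (g0 j0) * hcross y hy i j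
    rw [map_mul, mul_eq_zero, or_iff_left hg00, map_sub, sub_eq_zero, map_mul, map_mul, map_aeval', map_aeval'] at h3
    simp only [hΘ]
    rw [aeval_mul_hom (hp.1 i), aeval_mul_hom (hp.1 j)]
    linear_combination ((α (aeval g0 ℓ) * w)⁻¹) ^ e * h3
  · have : WB α t m₀ Θ X = X' := by
      rw [hX']
      ext y
      constructor
      · rintro ⟨v, hv, hne, rfl⟩
        exact ⟨_, hv.2, (hmk v hv).choose_spec.symm⟩
      · rintro ⟨x, hx, rfl⟩
        obtain ⟨h1, h2⟩ := hmk x.rep (cone_rep hx)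
        refine ⟨x.rep, cone_rep hx, h1, ?_⟩
        rw [h2, Projectivization.mk_rep]
    rw [this]; exact hcl

end Bt
end Part12

section Part13
open MvPolynomial
namespace Bt
set_option linter.unusedSectionVars false
set_option linter.unusedVariables false
variable {k : Type} [Field k] {n : ℕ}
attribute [local instance] MvPolynomial.gradedAlgebra

variable {L : Type} [Field L] [Algebra k L] {X : Set (ProjPt k n)} {d : ℕ}
    {α : MvPolynomial (Fin (n+1)) k →ₐ[k] L}
variable [IsAlgClosed k] {D : PD X d → ℤ} {t : (Fin (n+1) → k) → L} {m₀ m : ℕ} {Θ : Fin (m+1) → L}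

lemma qc {σ : Type} [Finite σ] {ι : Type} (h : ι → MvPolynomial σ k) : ∃ T : Finset ι, ∀ y i, eval y (h i) ≠ 0 → ∃ j ∈ T, eval y (h j) ≠ 0 := by
  classical
  have hfg : (Submodule.span (MvPolynomial σ k) (Set.range h)).FG := IsNoetherian.noetherian _
  obtain ⟨s, hs, he⟩ := (Submodule.fg_span_iff_fg_span_finset_subset _).1 hfg
  choose g hg using fun x : s => hs x.2
  refine ⟨Finset.univ.image g, fun y i hi => ?_⟩
  by_contra hc
  push Not at hc
  have h1 : h i ∈ Submodule.span (MvPolynomial σ k) (s : Set (MvPolynomial σ k)) := by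
    rw [← he]; exact Submodule.subset_span ⟨i, rfl⟩
  have h2 : Submodule.span (MvPolynomial σ k) (s : Set (MvPolynomial σ k)) ≤ RingHom.ker (eval y : MvPolynomial σ k →+* k) := by
    rw [Submodule.span_le]
    intro x hx
    have := hc (g ⟨x, hx⟩) (Finset.mem_image.2 ⟨⟨x, hx⟩, Finset.mem_univ _, rfl⟩)
    rw [hg] at this
    exact this
  exact hi (h2 h1)

namespace Amp

lemma aux (A : Amp α D t m₀ Θ) {v : Fin (n+1) → k} (hv : v ∈ cone X) {q : ℕ} {G : MvPolynomial (Fin (m+1)) k} (hG : G.IsHomogeneous q) :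
    RS α t v (q * m₀ : ℕ) (aeval Θ G) ∧ val α t v (q * m₀ : ℕ) (aeval Θ G) = eval (th α t m₀ Θ v) G := by
  have H := A.S.H
  let y : Fin (m+1) → H.Ov hv := fun i => ⟨Θ i * t v ^ (m₀ : ℤ), (A.sec i).2 v hv⟩
  have h1 : aeval Θ G * t v ^ ((q * m₀ : ℕ) : ℤ) = ((aeval y G : H.Ov hv) : L) := by
    have h2 : ((aeval y G : H.Ov hv) : L) = aeval (fun i => (y i : L)) G := 
      MvPolynomial.comp_aeval_apply (f := y) ((H.Ov hv).val) G
    rw [h2, show (fun i => (y i : L)) = fun i => (t v ^ m₀) * Θ i from funext fun i => by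
      simp [y, mul_comm], aeval_mul_hom hG, zpow_natCast, mul_comm q, pow_mul, mul_comm]
  refine ⟨?_, ?_⟩
  · rw [RS, h1]; exact (aeval y G : H.Ov hv).2
  · rw [val, h1, ← H.evO_apply hv, MvPolynomial.comp_aeval_apply, MvPolynomial.aeval_eq_eval]
    rfl

lemma inK (A : Amp α D t m₀ Θ) (G : MvPolynomial (Fin (m+1)) k) : aeval Θ G ∈ K0 α := by
  have h2 : aeval Θ G = ((aeval (fun i => (⟨Θ i, (A.sec i).1⟩ : K0 α)) G : K0 α) : L) :=
    (MvPolynomial.comp_aeval_apply (f := fun i => (⟨Θ i, (A.sec i).1⟩ : K0 α)) ((K0 α).val) G).symm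
  rw [h2]; exact Subtype.property _

lemma secG (A : Amp α D t m₀ Θ) {q : ℕ} {G : MvPolynomial (Fin (m+1)) k} (hG : G.IsHomogeneous q) :
    Sec α t X (q * m₀ : ℕ) (aeval Θ G) := ⟨A.inK G, fun v hv => (A.aux hv hG).1⟩

lemma beta_ne (A : Amp α D t m₀ Θ) {q : ℕ} {G : MvPolynomial (Fin (m+1)) k} (hG : G.IsHomogeneous q) {v : Fin (n+1) → k} (hv : v ∈ cone X)
    (h : eval (th α t m₀ Θ v) G ≠ 0) : aeval Θ G ≠ 0 := by
  intro h0
  rw [← (A.aux hv hG).2, h0, A.S.val_zero hv] at h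
  exact h rfl

lemma beta_zero (A : Amp α D t m₀ Θ) {q : ℕ} {G : MvPolynomial (Fin (m+1)) k} (hG : G.IsHomogeneous q) 
    (h : ∀ v ∈ cone X, eval (th α t m₀ Θ v) G = 0) : aeval Θ G = 0 :=
  A.S.van_X (A.secG hG) fun v hv => (A.aux hv hG).2.trans (h v hv)

lemma psi' (A : Amp α D t m₀ Θ) {v : Fin (n+1) → k} (hv : v ∈ cone X) {e : ℕ} {f : MvPolynomial (Fin (n+1)) k} (hf : f.IsHomogeneous e)
    (hfv : eval v f ≠ 0) : ∃ q G, MvPolynomial.IsHomogeneous G q ∧ eval (th α t m₀ Θ v) G ≠ 0 ∧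
      ∀ y ∈ cone X, eval y f = 0 → eval (th α t m₀ Θ y) G = 0 := by
  obtain ⟨e', p, c, hp, hc, h1, h2, h3⟩ := A.psi v hv
  refine ⟨_, _, hom_aeval hp hf, ?_, ?_⟩
  · rw [eval_aeval, show (fun j => eval (th α t m₀ Θ v) (p j)) = c • v from funext h1, eval_smul_hom hf]
    exact mul_ne_zero (pow_ne_zero _ hc) hfv
  · intro y hy h0
    obtain ⟨i, hi⟩ := Function.ne_iff.1 hy.1
    simp only [Pi.zero_apply] at hi
    rw [eval_aeval, show (fun j => eval (th α t m₀ Θ y) (p j)) = (eval (th α t m₀ Θ y) (p i) / y i) • y from funext fun j => by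
      rw [Pi.smul_apply, smul_eq_mul, div_mul_eq_mul_div, eq_div_iff hi, mul_comm, h3 y hy i j, mul_comm], eval_smul_hom hf, h0, mul_zero]

lemma fracs (A : Amp α D t m₀ Θ) {v : Fin (n+1) → k} (hv : v ∈ cone X) {φ : L} (hK : φ ∈ K0 α) (hr : Reg α v φ) :
    ∃ (e : ℕ) (p q : MvPolynomial (Fin (m+1)) k), MvPolynomial.IsHomogeneous p e ∧ MvPolynomial.IsHomogeneous q e ∧ eval (th α t m₀ Θ v) q ≠ 0 ∧ φ = aeval Θ p / aeval Θ q := by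
  obtain ⟨e, a, b, ha, hb, hbv, rfl⟩ := A.S.H.hom_rep hv hK hr
  obtain ⟨e', p, c, hp, hc, h1, h2, h3⟩ := A.psi v hv
  have hne : eval (th α t m₀ Θ v) (aeval p b) ≠ 0 := by
    rw [eval_aeval, show (fun j => eval (th α t m₀ Θ v) (p j)) = c • v from funext h1, eval_smul_hom hb]
    exact mul_ne_zero (pow_ne_zero _ hc) hbv
  refine ⟨_, aeval p a, aeval p b, hom_aeval hp ha, hom_aeval hp hb, hne, ?_⟩
  have hb0 := A.beta_ne (hom_aeval hp hb) hv hne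
  obtain ⟨i, hi⟩ := Function.ne_iff.1 hv.1
  simp only [Pi.zero_apply] at hi
  have hXi : α (MvPolynomial.X i) ≠ 0 := A.S.H.ne_of_eval hv (by rwa [eval_X])
  have h4 : ∀ f, MvPolynomial.IsHomogeneous f e → aeval Θ (aeval p f) = (aeval Θ (p i) / α (MvPolynomial.X i)) ^ e * α f := by
    intro f hf
    have h6 : α f = aeval (fun i => α (MvPolynomial.X i)) f := by
      conv_lhs => rw [← MvPolynomial.aeval_X_left_apply f]
      rw [map_aeval']
    rw [h6, ← aeval_mul_hom hf, map_aeval' (α := aeval Θ)]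
    congr 1; congr 1
    funext j
    rw [div_mul_eq_mul_div, eq_div_iff hXi, mul_comm, h2, mul_comm]
  rw [h4 _ hb] at hb0
  rw [h4 _ ha, h4 _ hb, mul_div_mul_left]
  exact left_ne_zero_of_mul hb0

lemma th_inj (A : Amp α D t m₀ Θ) {x y : Fin (n+1) → k} (hx : x ∈ cone X) (hy : y ∈ cone X) 
    (h : Projectivization.mk k x hx.1 ≠ Projectivization.mk k y hy.1) :
    ∃ ℓ : MvPolynomial (Fin (m+1)) k, ℓ.IsHomogeneous 1 ∧ eval (th α t m₀ Θ x) ℓ = 0 ∧ eval (th α t m₀ Θ y) ℓ ≠ 0 := by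
  by_contra hc
  push Not at hc
  have h0 : ∀ i j, th α t m₀ Θ x i * th α t m₀ Θ y j = th α t m₀ Θ x j * th α t m₀ Θ y i := by
    intro i j
    have h1 := hc (C (th α t m₀ Θ x i) * MvPolynomial.X j - C (th α t m₀ Θ x j) * MvPolynomial.X i)
      (((isHomogeneous_C_mul_X _ _)).sub (isHomogeneous_C_mul_X _ _)) (by
        simp; ring)
    simp at h1
    linear_combination h1
  obtain ⟨i, hi⟩ := Function.ne_iff.1 (A.ne x hx)
  simp only [Pi.zero_apply] at hi
  have h1 : th α t m₀ Θ y = (th α t m₀ Θ y i / th α t m₀ Θ x i) • th α t m₀ Θ x := by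
    funext j
    rw [Pi.smul_apply, smul_eq_mul, div_mul_eq_mul_div, eq_div_iff hi, mul_comm, h0, mul_comm]
  have hb : th α t m₀ Θ y i / th α t m₀ Θ x i ≠ 0 := by
    intro hb
    rw [hb, zero_smul] at h1
    exact A.ne y hy h1
  obtain ⟨e, p, c, hp, hc, h2, -, h3⟩ := A.psi x hx
  apply h
  obtain ⟨a, ha⟩ := Function.ne_iff.1 hy.1
  simp only [Pi.zero_apply] at ha
  generalize th α t m₀ Θ y i / th α t m₀ Θ x i = b at h1 hb
  have h6 : b ^ e * c ≠ 0 := mul_ne_zero (pow_ne_zero _ hb) hc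
  have h5 : ∀ i j, y i * x j = y j * x i := by
    intro i j
    have := h3 y hy i j
    rw [h1, eval_smul_hom (hp j), eval_smul_hom (hp i), h2, h2] at this
    apply mul_left_cancel₀ h6
    linear_combination this
  rw [Projectivization.mk_eq_mk_iff']
  refine ⟨x a / y a, funext fun j => ?_⟩
  rw [Pi.smul_apply, smul_eq_mul, div_mul_eq_mul_div, div_eq_iff ha, mul_comm, mul_comm (x j), h5]

lemma cone_WB {B : Set (ProjPt k n)} {z : Fin (m+1) → k} (hz : z ∈ cone (WB α t m₀ Θ B)) : 
    ∃ v ∈ cone B, ∃ c : k, c ≠ 0 ∧ z = c • th α t m₀ Θ v := by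
  obtain ⟨v, hv, h, h2⟩ := hz.2
  obtain ⟨c, hc, h3⟩ := mk_cross h2
  exact ⟨v, hv, c, hc, funext h3⟩

lemma th_mem (A : Amp α D t m₀ Θ) {B : Set (ProjPt k n)} (hB : B ⊆ X) {v : Fin (n+1) → k} (hv : v ∈ cone B) : 
    th α t m₀ Θ v ∈ cone (WB α t m₀ Θ B) := ⟨A.ne v ⟨hv.1, hB hv.2⟩, v, hv, A.ne v ⟨hv.1, hB hv.2⟩, rfl⟩

lemma mem_IW (A : Amp α D t m₀ Θ) {B : Set (ProjPt k n)} (hB : B ⊆ X) {q : ℕ} {G : MvPolynomial (Fin (m+1)) k} (hG : G.IsHomogeneous q) :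
    G ∈ IX (WB α t m₀ Θ B) ↔ ∀ v ∈ cone B, eval (th α t m₀ Θ v) G = 0 := by
  rw [mem_IX]
  constructor
  · exact fun h v hv => h _ (A.th_mem hB hv)
  · intro h z hz
    obtain ⟨v, hv, c, hc, rfl⟩ := cone_WB hz
    rw [eval_smul_hom hG, h v hv, mul_zero]

lemma WB_closed (A : Amp α D t m₀ Θ) {B : Set (ProjPt k n)} (hB : B ⊆ X) (hBc : IsClosedSub B) : IsClosedSub (WB α t m₀ Θ B) := by
  have h0 : WB α t m₀ Θ B ⊆ WB α t m₀ Θ X := fun z ⟨v, hv, h⟩ => ⟨v, ⟨hv.1, hB hv.2⟩, h⟩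
  have : WB α t m₀ Θ B = ZP (IX (WB α t m₀ Θ B)) := by
    apply Set.Subset.antisymm (subset_ZP_IX _)
    intro z hz
    have h1 := ZP_anti (IX_anti h0) hz
    rw [closed_eq A.closed] at h1
    obtain ⟨x, hx, hne, rfl⟩ := h1
    by_cases hxB : x ∈ cone B
    · exact ⟨x, hxB, hne, rfl⟩
    exfalso
    obtain ⟨f, hf, ⟨e, hfe⟩, hfx⟩ := exists_sep hBc hx.1 hxB
    obtain ⟨q, G, hG, h3, h4⟩ := A.psi' hx hfe hfx
    have h5 : G ∈ IX (WB α t m₀ Θ B) := (A.mem_IW hB hG).2 fun v hv => h4 v ⟨hv.1, hB hv.2⟩ (mem_IX.1 hf v hv)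
    exact h3 ((vanishesAt_mk hG hne).1 (hz G h5))
  rw [this]
  exact isClosed_ZP (IX_hom _)

lemma WB_irred (A : Amp α D t m₀ Θ) {B : Set (ProjPt k n)} (hB : B ⊆ X) (hBi : IsIrredSub B) : IsIrredSub (WB α t m₀ Θ B) := by
  refine ⟨?_, ?_⟩
  · obtain ⟨x, hx⟩ := hBi.1
    have := A.th_mem hB (cone_rep hx)
    exact ⟨_, this.2⟩
  · intro C₁ C₂ h1 h2 h12
    by_contra hc
    push Not at hc
    have key : ∀ Z, IsClosedSub Z → ¬ (WB α t m₀ Θ B ⊆ Z) → ∃ f ∈ IX Z, ∃ q, MvPolynomial.IsHomogeneous f q ∧ ∃ v ∈ cone B, eval (th α t m₀ Θ v) f ≠ 0 := by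
      intro Z hZ hn
      obtain ⟨z, ⟨v, hv, hne, rfl⟩, hz⟩ := Set.not_subset.1 hn
      obtain ⟨f, hf, ⟨q, hq⟩, h⟩ := exists_sep hZ hne (fun h => hz h.2)
      exact ⟨f, hf, q, hq, v, hv, h⟩
    obtain ⟨f, hf, q, hq, v, hv, hfv⟩ := key C₁ h1 hc.1
    obtain ⟨f', hf', q', hq', v', hv', hfv'⟩ := key C₂ h2 hc.2
    have hs : ∀ {q G}, MvPolynomial.IsHomogeneous G q → Sec α t B (q * m₀ : ℕ) (aeval Θ G) := fun hG => ⟨A.inK _, fun v hv => (A.aux ⟨hv.1, hB hv.2⟩ hG).1⟩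
    have h3 := A.S.van_prime hB hBi (hs hq) (hs hq') (by
      intro v hv
      have hvX : v ∈ cone X := ⟨hv.1, hB hv.2⟩
      rw [(A.S.mul_aux hvX (A.aux hvX hq).1 (A.aux hvX hq').1).2, (A.aux hvX hq).2, (A.aux hvX hq').2]
      have hm := A.th_mem hB hv
      rcases h12 hm.2 with h | h
      · rw [mem_IX.1 hf _ ⟨hm.1, h⟩, zero_mul]
      · rw [mem_IX.1 hf' _ ⟨hm.1, h⟩, mul_zero])
    rcases h3 with h | h
    · exact hfv (((A.aux ⟨hv.1, hB hv.2⟩ hq).2).symm.trans (h v hv))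
    · exact hfv' (((A.aux ⟨hv'.1, hB hv'.2⟩ hq').2).symm.trans (h v' hv'))

end Amp
end Bt
end Part13

section Part14
open MvPolynomial
namespace Bt
set_option linter.unusedSectionVars false
set_option linter.unusedVariables false
variable {k : Type} [Field k] {n : ℕ}
attribute [local instance] MvPolynomial.gradedAlgebra

variable {L : Type} [Field L] [Algebra k L] {X : Set (ProjPt k n)} {d : ℕ}
    {α : MvPolynomial (Fin (n+1)) k →ₐ[k] L}
variable [IsAlgClosed k] {D : PD X d → ℤ} {t : (Fin (n+1) → k) → L} {m₀ m : ℕ} {Θ : Fin (m+1) → L}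

namespace Amp

lemma theta_pow (A : Amp α D t m₀ Θ) {v : Fin (n+1) → k} (hv : v ∈ cone X) (q : ℕ) :
    ∃ φ, Sec α t X (q * m₀ : ℕ) φ ∧ val α t v (q * m₀ : ℕ) φ ≠ 0 := by
  obtain ⟨i, hi⟩ := Function.ne_iff.1 (A.ne v hv)
  simp only [Pi.zero_apply] at hi
  have hG : (MvPolynomial.X i ^ q : MvPolynomial (Fin (m+1)) k).IsHomogeneous q := by
    have := (isHomogeneous_X k i).pow q
    rwa [one_mul] at this
  refine ⟨_, A.secG hG, ?_⟩
  rw [(A.aux hv hG).2, map_pow, eval_X]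
  exact pow_ne_zero _ hi

lemma bpf_pt (A : Amp α D t m₀ Θ) {v : Fin (n+1) → k} (hv : v ∈ cone X) (r : ℕ) : 
    ∃ (q : ℕ) (φ : L), Sec α t X (r + q * m₀ : ℕ) φ ∧ val α t v (r + q * m₀ : ℕ) φ ≠ 0 := by
  have S := A.S
  set ψ : L := t v ^ (-(r : ℤ)) with hψ
  have hψ0 : ψ ≠ 0 := zpow_ne_zero _ (S.t0 v)
  have hψK : ψ ∈ K0 α := zpow_mem (S.tK v) _
  have h1 : ψ * t v ^ (r : ℤ) = algebraMap k L 1 := by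
    rw [hψ, ← zpow_add₀ (S.t0 v), neg_add_cancel, zpow_zero, map_one]
  have hr : RS α t v r ψ := by rw [RS, h1]; exact Setup.reg_const v 1
  have hval : val α t v r ψ = 1 := by rw [val, h1, S.H.ev_const hv]
  have hF := S.finite_ww hψK hψ0 r
  have hFv : ∀ Y ∈ {Y : PD X d | vv α X Y.1 ψ + r * D Y ≠ 0}, v ∉ cone Y.1 := by
    intro Y hY hvY
    exact hY (S.ww_zero hvY hr (by rw [hval]; exact one_ne_zero))
  obtain ⟨f, e, hf, hfv, hfY⟩ := S.avoid_form hv.1 hF hFv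
  obtain ⟨q, G, hG, hGv, hGY⟩ := A.psi' hv hf hfv
  obtain ⟨N, hN⟩ : ∃ N : ℕ, ∀ Y ∈ {Y : PD X d | vv α X Y.1 ψ + r * D Y ≠ 0}, 0 ≤ vv α X Y.1 ψ + r * D Y + N := by
    obtain ⟨M, hM⟩ := (hF.image (fun Y => (-(vv α X Y.1 ψ + r * D Y)).toNat)).bddAbove
    refine ⟨M, fun Y hY => ?_⟩
    have := hM ⟨Y, hY, rfl⟩
    simp only at this
    omega
  have hGN : (G ^ N).IsHomogeneous (q * N) := hG.pow N
  have hG0 := A.beta_ne hG hv hGv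
  have hGN0 : aeval Θ (G ^ N) ≠ 0 := by rw [map_pow]; exact pow_ne_zero _ hG0
  refine ⟨q * N, ψ * aeval Θ (G ^ N), ⟨mul_mem hψK (A.inK _), fun y hy => ?_⟩, ?_⟩
  · apply S.rs_of hy (mul_mem hψK (A.inK _)) (mul_ne_zero hψ0 hGN0)
    intro Y hyY
    rw [S.H.vv_mul Y.2 hψ0 hGN0]
    have h2 : 0 ≤ vv α X Y.1 (aeval Θ (G ^ N)) + (q * N * m₀ : ℕ) * D Y := S.ww_nonneg hyY hGN0 (A.aux hy hGN).1
    by_cases hY : Y ∈ {Y : PD X d | vv α X Y.1 ψ + r * D Y ≠ 0}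
    · have h3 : 1 ≤ vv α X Y.1 (aeval Θ G) + (q * m₀ : ℕ) * D Y := by
        rw [← S.van_divisor Y hG0 ⟨A.inK _, fun v hv => (A.aux (S.sub hv) hG).1⟩]
        intro y hy
        rw [(A.aux (S.sub hy) hG).2]
        exact hGY y (S.sub hy) (mem_IX.1 (hfY Y hY) y hy)
      have h4 := hN Y hY
      rw [map_pow, S.H.vv_pow Y.2 hG0]
      have h5 : (N : ℤ) ≤ N * (vv α X Y.1 (aeval Θ G) + (q * m₀ : ℕ) * D Y) := by nlinarith
      push_cast at h5 ⊢
      nlinarith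
    · simp only [Set.mem_ofPred_eq, not_not] at hY
      push_cast at h2 ⊢
      linarith
  · push_cast
    have := (S.mul_aux hv hr (A.aux hv hGN).1).2
    push_cast at this
    rw [this, hval, one_mul]
    have := (A.aux hv hGN).2
    push_cast at this
    rw [this, map_pow]
    exact pow_ne_zero _ hGv

lemma bpf_r (A : Amp α D t m₀ Θ) (r : ℕ) : ∃ Q : ℕ, ∀ q ≥ Q, ∀ v ∈ cone X,
    ∃ φ : L, Sec α t X (r + q * m₀ : ℕ) φ ∧ val α t v (r + q * m₀ : ℕ) φ ≠ 0 := by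
  have key : ∀ h : {h : MvPolynomial (Fin (n+1)) k // ∃ (q : ℕ) (φ : L), Sec α t X (r + q * m₀ : ℕ) φ ∧ ∀ y ∈ cone X, eval y h ≠ 0 → val α t y (r + q * m₀ : ℕ) φ ≠ 0},
    ∃ (q : ℕ), ∃ (φ : L), Sec α t X (r + q * m₀ : ℕ) φ ∧ ∀ y ∈ cone X, eval y h.1 ≠ 0 → val α t y (r + q * m₀ : ℕ) φ ≠ 0 := fun h => h.2
  choose q hq using key
  obtain ⟨T, hT⟩ := qc (fun h : {h : MvPolynomial (Fin (n+1)) k // ∃ (q : ℕ) (φ : L), Sec α t X (r + q * m₀ : ℕ) φ ∧ ∀ y ∈ cone X, eval y h ≠ 0 → val α t y (r + q * m₀ : ℕ) φ ≠ 0} => h.1)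
  refine ⟨T.sup q, fun q' hq' v hvX => ?_⟩
  obtain ⟨q0, φ0, hs0, hv0⟩ := A.bpf_pt hvX r
  obtain ⟨h0, e, he, hev, hy⟩ := A.S.open_ne (le_refl X) hvX hs0.1 (hs0.2 _ hvX) hv0
  obtain ⟨j, hj, hjv⟩ := hT v ⟨h0, q0, φ0, hs0, fun y hyX hne => (hy y hyX hne).2⟩ hev
  obtain ⟨φ, hs, hφ⟩ := hq j
  have h1 : q j ≤ q' := (Finset.le_sup hj).trans hq'
  obtain ⟨p, rfl⟩ := Nat.exists_eq_add_of_le h1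
  obtain ⟨χ, hχ, hχv⟩ := A.theta_pow hvX p
  have e1 : ((r + (q j + p) * m₀ : ℕ) : ℤ) = (r + q j * m₀ : ℕ) + (p * m₀ : ℕ) := by push_cast; ring
  refine ⟨φ * χ, ⟨mul_mem hs.1 hχ.1, fun y hy => ?_⟩, ?_⟩
  · rw [e1]
    exact (A.S.mul_aux hy (hs.2 y hy) (hχ.2 y hy)).1
  · rw [e1, (A.S.mul_aux hvX (hs.2 v hvX) (hχ.2 v hvX)).2]
    exact mul_ne_zero (hφ v hvX hjv) hχv

lemma bpf (A : Amp α D t m₀ Θ) : ∃ N : ℕ, ∀ l ≥ N, ∀ v ∈ cone X,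
    ∃ φ : L, Sec α t X (l : ℕ) φ ∧ val α t v (l : ℕ) φ ≠ 0 := by
  choose Q hQ using A.bpf_r
  refine ⟨(Finset.range m₀).sup Q * m₀, fun l hl v hv => ?_⟩
  have h1 : l % m₀ < m₀ := Nat.mod_lt _ A.pos
  have h2 := hQ (l % m₀) (l / m₀) (by
    have h3 : Q (l % m₀) ≤ (Finset.range m₀).sup Q := Finset.le_sup (Finset.mem_range.2 h1)
    exact h3.trans ((Nat.le_div_iff_mul_le A.pos).2 hl)) v hv
  rwa [show l % m₀ + l / m₀ * m₀ = l by rw [mul_comm]; exact Nat.mod_add_div _ _] at h2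

end Amp
end Bt
end Part14

section Part15
open MvPolynomial
namespace Bt
set_option linter.unusedSectionVars false
set_option linter.unusedVariables false
variable {k : Type} [Field k] {n : ℕ}
attribute [local instance] MvPolynomial.gradedAlgebra

variable {L : Type} [Field L] [Algebra k L] {X : Set (ProjPt k n)} {d : ℕ}
    {α : MvPolynomial (Fin (n+1)) k →ₐ[k] L}
variable [IsAlgClosed k] {D : PD X d → ℤ} {t : (Fin (n+1) → k) → L} {m₀ m : ℕ} {Θ : Fin (m+1) → L}

lemma norm_den [CharZero k] (Q : Type) [CommRing Q] [IsDomain Q] [Algebra k Q] [Algebra.FiniteType k Q] :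
    ∃ δ : Q, δ ≠ 0 ∧ ∀ x : FractionRing Q, IsIntegral Q x → ∃ y : Q, algebraMap Q (FractionRing Q) δ * x = algebraMap Q (FractionRing Q) y := by
  obtain ⟨s, g, hinj, hfin⟩ := exists_finite_inj_algHom_of_fg k Q
  let _ : Algebra (MvPolynomial (Fin s) k) Q := g.toRingHom.toAlgebra
  have : FaithfulSMul (MvPolynomial (Fin s) k) Q := (faithfulSMul_iff_algebraMap_injective _ _).2 hinj
  have : Module.Finite (MvPolynomial (Fin s) k) Q := hfin
  let _ := FractionRing.liftAlgebra (MvPolynomial (Fin s) k) (FractionRing Q)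
  have : FiniteDimensional (FractionRing (MvPolynomial (Fin s) k)) (FractionRing Q) := inferInstance
  have : CharZero (MvPolynomial (Fin s) k) := inferInstance
  have : CharZero (FractionRing (MvPolynomial (Fin s) k)) := inferInstance
  have : Module.Finite (MvPolynomial (Fin s) k) (integralClosure (MvPolynomial (Fin s) k) (FractionRing Q)) :=
    IsIntegralClosure.finite (MvPolynomial (Fin s) k) (FractionRing (MvPolynomial (Fin s) k)) (FractionRing Q) _
  have hfg : (Subalgebra.toSubmodule (integralClosure (MvPolynomial (Fin s) k) (FractionRing Q))).FG := by
    rw [← Module.Finite.iff_fg]; exact this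
  obtain ⟨S, hS⟩ := hfg
  obtain ⟨b, hb⟩ := IsLocalization.exist_integer_multiples_of_finset (nonZeroDivisors Q) S
  refine ⟨b, nonZeroDivisors.ne_zero b.2, fun x hx => ?_⟩
  have hx' : IsIntegral (MvPolynomial (Fin s) k) x := isIntegral_trans x hx
  have h1 : x ∈ Submodule.span (MvPolynomial (Fin s) k) (S : Set (FractionRing Q)) := by
    rw [hS]; exact hx'
  refine Submodule.span_induction (p := fun x _ => ∃ y : Q, algebraMap Q (FractionRing Q) b * x = algebraMap Q (FractionRing Q) y) ?_ ?_ ?_ ?_ h1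
  · intro x hx
    obtain ⟨y, hy⟩ := hb x hx
    refine ⟨y, ?_⟩
    rw [hy, Algebra.smul_def]
  · exact ⟨0, by simp⟩
  · rintro x y _ _ ⟨a, ha⟩ ⟨c, hc⟩
    exact ⟨a + c, by rw [mul_add, ha, hc, map_add]⟩
  · rintro r x _ ⟨a, ha⟩
    exact ⟨r • a, by rw [mul_smul_comm, ha, Algebra.smul_def r a, map_mul, Algebra.smul_def, ← IsScalarTower.algebraMap_apply]⟩

/-- homogeneous quotient -/
lemma hom_div {I : Ideal (MvPolynomial (Fin (n+1)) k)} (hI : HomI I) {u b g : MvPolynomial (Fin (n+1)) k} {i j : ℕ}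
    (hu : u.IsHomogeneous (i+j)) (hb : b.IsHomogeneous j) (h : u - g * b ∈ I) : 
    u - homogeneousComponent i g * b ∈ I := by
  have h1 := hI _ h (i+j)
  rwa [map_sub, comp_self hu, comp_mul_hom hb] at h1

lemma conductor [CharZero k] {W : Set (ProjPt k n)} (hWc : IsClosedSub W) (hWi : IsIrredSub W) :
    ∃ (Δ : ℕ) (δ : MvPolynomial (Fin (n+1)) k), δ.IsHomogeneous Δ ∧ δ ∉ IX W ∧
      ∀ (c b : MvPolynomial (Fin (n+1)) k) (j q : ℕ), c.IsHomogeneous (q + j) → b.IsHomogeneous j → b ∉ IX W →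
        (∀ v ∈ cone W, ∃ b' c', eval v b' ≠ 0 ∧ b' * c - c' * b ∈ IX W) →
        ∃ g, MvPolynomial.IsHomogeneous g (Δ + q) ∧ δ * c - g * b ∈ IX W := by
  have : Infinite k := IsAlgClosed.instInfinite
  have hP := IX_prime hWi
  obtain ⟨Q, _, _, mk, hmks, hmk, hdom, hft⟩ : ∃ (Q : Type) (_ : CommRing Q) (_ : Algebra k Q) (mk : MvPolynomial (Fin (n+1)) k →ₐ[k] Q),
      Function.Surjective mk ∧ (∀ f, mk f = 0 ↔ f ∈ IX W) ∧ IsDomain Q ∧ Algebra.FiniteType k Q :=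
    ⟨MvPolynomial (Fin (n+1)) k ⧸ IX W, inferInstance, inferInstance, Ideal.Quotient.mkₐ k (IX W), Ideal.Quotient.mkₐ_surjective k _,
      fun f => Ideal.Quotient.eq_zero_iff_mem, (Ideal.Quotient.isDomain_iff_prime _).2 hP,
      Algebra.FiniteType.of_surjective (Ideal.Quotient.mkₐ k (IX W)) (Ideal.Quotient.mkₐ_surjective k _)⟩
  obtain ⟨δ', hδ', hden⟩ := norm_den (k := k) Q
  obtain ⟨δ0, rfl⟩ := hmks δ'
  rw [ne_eq, hmk] at hδ'
  obtain ⟨Δ, hΔ⟩ : ∃ Δ, homogeneousComponent Δ δ0 ∉ IX W := by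
    by_contra hc
    push Not at hc
    apply hδ'
    rw [← sum_homogeneousComponent δ0]
    exact Ideal.sum_mem _ fun i _ => hc i
  refine ⟨Δ, _, homogeneousComponent_isHomogeneous Δ δ0, hΔ, ?_⟩
  intro c b j q hc hb hbW hreg
  let J : Ideal (MvPolynomial (Fin (n+1)) k) := 
    Submodule.comap (LinearMap.mulRight (MvPolynomial (Fin (n+1)) k) c) (Ideal.span {b} ⊔ IX W)
  have hJ : ∀ u, u ∈ J ↔ ∃ g, u * c - g * b ∈ IX W := by
    intro u
    constructor
    · intro hu
      have hu : u * c ∈ Ideal.span {b} ⊔ IX W := hu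
      obtain ⟨y, hy, z, hz, h⟩ := Submodule.mem_sup.1 hu
      obtain ⟨g, rfl⟩ := Ideal.mem_span_singleton'.1 hy
      exact ⟨g, by rw [← h]; simpa using hz⟩
    · rintro ⟨g, hg⟩
      change u * c ∈ Ideal.span {b} ⊔ IX W
      rw [show u * c = g * b + (u * c - g * b) by ring]
      exact Submodule.add_mem_sup (Ideal.mem_span_singleton'.2 ⟨g, rfl⟩) hg
  obtain ⟨M, hM⟩ := irr_pow (J := J) (by
    intro v hv hg
    by_cases hvW : v ∈ cone W
    · obtain ⟨b', c', h1, h2⟩ := hreg v hvW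
      exact h1 (hg b' ((hJ _).2 ⟨c', h2⟩))
    · obtain ⟨f, hf, -, hfv⟩ := exists_sep hWc hv hvW
      exact hfv (hg f ((hJ _).2 ⟨0, by simpa using (IX W).mul_mem_right c hf⟩)))
  -- the module
  let F := FractionRing Q
  let ι : Q →+* F := algebraMap Q F
  have hι : Function.Injective ι := IsFractionRing.injective Q F
  have hb0 : ι (mk b) ≠ 0 := by
    rw [ne_eq, map_eq_zero_iff _ hι, hmk]; exact hbW
  let gens : Set F := {x | ∃ i, M ≤ i ∧ ∃ u, MvPolynomial.IsHomogeneous u i ∧ x = ι (mk u)}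
  let IM : Ideal Q := Ideal.span {x | ∃ i, M ≤ i ∧ ∃ u, MvPolynomial.IsHomogeneous u i ∧ x = mk u}
  have hNoeth : IsNoetherianRing Q := by
    exact isNoetherianRing_of_surjective _ _ mk.toRingHom hmks
  let N : Submodule Q F := Submodule.map (Algebra.linearMap Q F) IM
  have hNfg : N.FG := Submodule.FG.map _ (IsNoetherian.noetherian IM)
  obtain ⟨i0, hi0⟩ := exists_X_notMem hWi.1
  have hNbot : N ≠ ⊥ := by
    intro h
    have h1 : ι (mk (MvPolynomial.X i0 ^ M)) ∈ N := by
      refine ⟨_, Ideal.subset_span ⟨M, le_rfl, MvPolynomial.X i0 ^ M, ?_, rfl⟩, rfl⟩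
      have := (isHomogeneous_X k i0).pow M
      rwa [one_mul] at this
    rw [h, Submodule.mem_bot, map_eq_zero_iff _ hι, hmk] at h1
    exact hi0 (hP.mem_of_pow_mem _ h1)
  have hintg : IsIntegral Q (ι (mk c) / ι (mk b)) := by
    apply isIntegral_of_smul_mem_submodule N hNbot hNfg
    rintro _ ⟨x, hx, rfl⟩
    refine Submodule.span_induction (p := fun x _ => (ι (mk c) / ι (mk b)) • (Algebra.linearMap Q F x) ∈ N) ?_ ?_ ?_ ?_ hx
    · rintro _ ⟨i, hi, u, hu, rfl⟩
      obtain ⟨g, hg⟩ := (hJ u).1 (hM i hi u hu)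
      have h2 := hom_div (i := i + q) (IX_hom W) (by
        have := hu.mul hc
        rwa [← add_assoc] at this) hb hg
      rw [← hmk, map_sub, sub_eq_zero, map_mul, map_mul] at h2
      refine ⟨mk (homogeneousComponent (i+q) g), Ideal.subset_span ⟨i+q, by omega, _, homogeneousComponent_isHomogeneous _ _, rfl⟩, ?_⟩
      change ι (mk (homogeneousComponent (i+q) g)) = (ι (mk c) / ι (mk b)) • ι (mk u)
      rw [smul_eq_mul, div_mul_eq_mul_div, eq_div_iff hb0, ← map_mul ι, ← h2, map_mul ι, mul_comm]
    · rw [map_zero, smul_zero]; exact N.zero_mem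
    · intro x y _ _ h1 h2
      rw [map_add, smul_add]; exact N.add_mem h1 h2
    · intro a x _ h1
      rw [map_smul, smul_comm]; exact N.smul_mem _ h1
  obtain ⟨y, hy⟩ := hden _ hintg
  obtain ⟨g, rfl⟩ := hmks y
  have h1 : δ0 * c - g * b ∈ IX W := by
    rw [← hmk, map_sub, sub_eq_zero, map_mul, map_mul]
    apply hι
    rw [map_mul, map_mul]
    change ι (mk δ0) * (ι (mk c) / ι (mk b)) = ι (mk g) at hy
    rw [← hy, mul_assoc, div_mul_cancel₀ _ hb0]
  have h2 := IX_hom W _ h1 (Δ + (q + j))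
  rw [map_sub, comp_mul_hom hc, ← add_assoc, comp_mul_hom hb] at h2
  exact ⟨_, homogeneousComponent_isHomogeneous _ _, h2⟩

end Bt
end Part15

section Part16
open MvPolynomial
namespace Bt
set_option linter.unusedSectionVars false
set_option linter.unusedVariables false
variable {k : Type} [Field k] {n : ℕ}
attribute [local instance] MvPolynomial.gradedAlgebra

variable {L : Type} [Field L] [Algebra k L] {X : Set (ProjPt k n)} {d : ℕ}
    {α : MvPolynomial (Fin (n+1)) k →ₐ[k] L}
variable [IsAlgClosed k] {D : PD X d → ℤ} {t : (Fin (n+1) → k) → L} {m₀ m : ℕ} {Θ : Fin (m+1) → L}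


lemma K0_poly {f : L} (hf : f ∈ K0 α) (P : Polynomial k) : Polynomial.aeval f P ∈ K0 α := by
  induction P using Polynomial.induction_on' with
  | add p q hp hq => rw [map_add]; exact add_mem hp hq
  | monomial i a =>
    rw [Polynomial.aeval_monomial, ← Algebra.smul_def]
    exact (K0 α).smul_mem (pow_mem hf i)

namespace Amp

lemma pres (A : Amp α D t m₀ Θ) {v : Fin (n+1) → k} (hv : v ∈ cone X) {q : ℕ} {φ : L} (hK : φ ∈ K0 α)
    (hr : RS α t v (q * m₀ : ℕ) φ) : ∃ (e : ℕ) (c b : MvPolynomial (Fin (m+1)) k), c.IsHomogeneous (q + e) ∧ b.IsHomogeneous e ∧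
      eval (th α t m₀ Θ v) b ≠ 0 ∧ φ * aeval Θ b = aeval Θ c := by
  obtain ⟨j, hj⟩ := Function.ne_iff.1 (A.ne v hv)
  have hX : (MvPolynomial.X j ^ q : MvPolynomial (Fin (m+1)) k).IsHomogeneous q := by
    have := (isHomogeneous_X k j).pow q
    rwa [one_mul] at this
  have hXv : eval (th α t m₀ Θ v) (MvPolynomial.X j ^ q) ≠ 0 := by
    rw [map_pow, eval_X]; exact pow_ne_zero _ hj
  have h1 := A.aux hv hX
  have hne := A.beta_ne hX hv hXv
  have h2 := A.S.inv_aux hv h1.1 (by rw [h1.2]; exact hXv)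
  have h3 := (A.S.mul_aux hv hr h2.1).1
  rw [add_neg_cancel] at h3
  have h4 : Reg α v (φ * (aeval Θ (MvPolynomial.X j ^ q : MvPolynomial (Fin (m+1)) k))⁻¹) := by
    have : Reg α v (φ * (aeval Θ (MvPolynomial.X j ^ q : MvPolynomial (Fin (m+1)) k))⁻¹ * t v ^ (0:ℤ)) := h3
    rwa [zpow_zero, mul_one] at this
  obtain ⟨e, p, r, hp, hr', hrv, h5⟩ := A.fracs hv (mul_mem hK (inv_mem (A.inK _))) h4
  have hrne := A.beta_ne hr' hv hrv
  refine ⟨e, MvPolynomial.X j ^ q * p, r, hX.mul hp, hr', hrv, ?_⟩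
  rw [map_mul]
  field_simp at h5
  rw [h5]

lemma pres_val (A : Amp α D t m₀ Θ) {v : Fin (n+1) → k} (hv : v ∈ cone X) {q e : ℕ} {φ : L} 
    (hr : RS α t v (q * m₀ : ℕ) φ) {c b : MvPolynomial (Fin (m+1)) k} (hc : c.IsHomogeneous (q + e)) (hb : b.IsHomogeneous e)
    (h : φ * aeval Θ b = aeval Θ c) : val α t v (q * m₀ : ℕ) φ * eval (th α t m₀ Θ v) b = eval (th α t m₀ Θ v) c := by
  rw [← (A.aux hv hb).2, ← (A.S.mul_aux hv hr (A.aux hv hb).1).2, h, ← (A.aux hv hc).2]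
  congr 1; push_cast; ring

lemma cond [CharZero k] (A : Amp α D t m₀ Θ) {B : Set (ProjPt k n)} (hB : B ⊆ X) (hBc : IsClosedSub B) (hBi : IsIrredSub B) :
    ∃ (Δ : ℕ) (δ : MvPolynomial (Fin (m+1)) k), δ.IsHomogeneous Δ ∧ δ ∉ IX (WB α t m₀ Θ B) ∧
      ∀ (q : ℕ) (φ : L), Sec α t B (q * m₀ : ℕ) φ → ∃ G : MvPolynomial (Fin (m+1)) k, G.IsHomogeneous (Δ + q) ∧
        ∀ v ∈ cone B, eval (th α t m₀ Θ v) δ * val α t v (q * m₀ : ℕ) φ = eval (th α t m₀ Θ v) G := by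
  have : Infinite k := IsAlgClosed.instInfinite
  have hWi := A.WB_irred hB hBi
  have hP := IX_prime hWi
  have hs : ∀ v, v ∈ cone B → v ∈ cone X := fun v hv => ⟨hv.1, hB hv.2⟩
  obtain ⟨Δ, δ, hδ, hδW, hcon⟩ := conductor (A.WB_closed hB hBc) hWi
  refine ⟨Δ, δ, hδ, hδW, fun q φ hφ => ?_⟩
  obtain ⟨x, hx⟩ := hBi.1
  have hv0 := cone_rep hx
  obtain ⟨v0, hv0⟩ : ∃ v0, v0 ∈ cone _ := ⟨_, hv0⟩
  obtain ⟨e, c, b, hc, hb, hbv, hpr⟩ := A.pres (hs v0 hv0) hφ.1 (hφ.2 v0 hv0)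
  have hbW : b ∉ IX (WB α t m₀ Θ B) := fun h => hbv (mem_IX.1 h _ (A.th_mem hB hv0))
  have cross : ∀ (e' : ℕ) (c' b' : MvPolynomial (Fin (m+1)) k), c'.IsHomogeneous (q + e') → b'.IsHomogeneous e' →
      φ * aeval Θ b' = aeval Θ c' → b' * c - c' * b ∈ IX (WB α t m₀ Θ B) := by
    intro e' c' b' hc' hb' hpr'
    have hh : (b' * c - c' * b).IsHomogeneous (q + e' + e) := by
      refine IsHomogeneous.sub ?_ (hc'.mul hb)
      have := hb'.mul hc
      rwa [show e' + (q + e) = q + e' + e by ring] at this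
    rw [A.mem_IW hB hh]
    intro y hy
    rw [map_sub, map_mul, map_mul, ← A.pres_val (hs y hy) (hφ.2 y hy) hc hb hpr, ← A.pres_val (hs y hy) (hφ.2 y hy) hc' hb' hpr']
    ring
  obtain ⟨g, hg, hgW⟩ := hcon c b e q hc hb hbW (by
    intro z hz
    obtain ⟨v, hv, a, ha, rfl⟩ := cone_WB hz
    obtain ⟨e', c', b', hc', hb', hbv', hpr'⟩ := A.pres (hs v hv) hφ.1 (hφ.2 v hv)
    refine ⟨b', c', ?_, cross e' c' b' hc' hb' hpr'⟩
    rw [eval_smul_hom hb']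
    exact mul_ne_zero (pow_ne_zero _ ha) hbv')
  refine ⟨g, hg, fun v hv => ?_⟩
  obtain ⟨e', c', b', hc', hb', hbv', hpr'⟩ := A.pres (hs v hv) hφ.1 (hφ.2 v hv)
  have h1 := cross e' c' b' hc' hb' hpr'
  have h2 : b * (δ * c' - g * b') ∈ IX (WB α t m₀ Θ B) := by
    rw [show b * (δ * c' - g * b') = b' * (δ * c - g * b) - δ * (b' * c - c' * b) by ring]
    exact Ideal.sub_mem _ (Ideal.mul_mem_left _ _ hgW) (Ideal.mul_mem_left _ _ h1)
  have h3 := mem_IX.1 ((hP.mem_or_mem h2).resolve_left hbW) _ (A.th_mem hB hv)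
  rw [map_sub, map_mul, map_mul, ← A.pres_val (hs v hv) (hφ.2 v hv) hc' hb' hpr', ← mul_assoc, ← sub_mul] at h3
  exact sub_eq_zero.1 ((mul_eq_zero.1 h3).resolve_right hbv')

lemma poly_aux (A : Amp α D t m₀ Θ) {v : Fin (n+1) → k} (hv : v ∈ cone X) {f : L} (hf : RS α t v 0 f) (P : Polynomial k) :
    RS α t v 0 (Polynomial.aeval f P) ∧ val α t v 0 (Polynomial.aeval f P) = P.eval (val α t v 0 f) := by
  induction P using Polynomial.induction_on' with
  | add p q hp hq =>
    have := A.S.add_aux hv hp.1 hq.1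
    rw [map_add, Polynomial.eval_add, ← hp.2, ← hq.2]; exact this
  | monomial i a =>
    have h1 := A.S.pow_aux hv hf i
    rw [mul_zero] at h1
    have h2 := A.S.smul_aux hv a h1.1
    rw [Polynomial.aeval_monomial, Polynomial.eval_monomial, ← Algebra.smul_def]
    refine ⟨h2.1, ?_⟩
    rw [h2.2, h1.2]

lemma root_van (A : Amp α D t m₀ Θ) {B : Set (ProjPt k n)} (hB : B ⊆ X) (hBi : IsIrredSub B) {f : L} (hf : Sec α t B 0 f) :
    ∀ (r : ℕ) (P : Polynomial k), P ≠ 0 → P.natDegree = r → (∀ v ∈ cone B, P.eval (val α t v 0 f) = 0) →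
      ∃ c : k, ∀ v ∈ cone B, val α t v 0 f = c := by
  have hs : ∀ v, v ∈ cone B → v ∈ cone X := fun v hv => ⟨hv.1, hB hv.2⟩
  have hsec : ∀ P : Polynomial k, Sec α t B 0 (Polynomial.aeval f P) := fun P => by
    refine ⟨?_, fun v hv => (A.poly_aux (hs v hv) (hf.2 v hv) P).1⟩
    exact K0_poly hf.1 P
  intro r
  induction r with
  | zero =>
    intro P hP h0 h
    obtain ⟨x, hx⟩ := hBi.1
    have hv0 := cone_rep hx
    obtain ⟨v0, hv0⟩ : ∃ v0, v0 ∈ cone B := ⟨_, hv0⟩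
    have := h v0 hv0
    rw [Polynomial.eq_C_of_natDegree_eq_zero h0, Polynomial.eval_C] at this
    exfalso; apply hP; rw [Polynomial.eq_C_of_natDegree_eq_zero h0, this, Polynomial.C_0]
  | succ r ih =>
    intro P hP h0 h
    obtain ⟨c, hc⟩ := IsAlgClosed.exists_root P (by
      intro h1
      rw [Polynomial.degree_eq_natDegree hP, h0] at h1
      exact absurd h1 (by exact_mod_cast Nat.succ_ne_zero r))
    obtain ⟨Q, rfl⟩ := Polynomial.dvd_iff_isRoot.2 hc
    have hQ : Q ≠ 0 := right_ne_zero_of_mul hP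
    have hdeg : Q.natDegree = r := by
      rw [Polynomial.natDegree_mul (Polynomial.X_sub_C_ne_zero c) hQ, Polynomial.natDegree_X_sub_C] at h0
      omega
    have hv := A.S.van_prime hB hBi (hsec (Polynomial.X - Polynomial.C c)) (hsec Q) (by
      intro v hv
      rw [add_zero, ← map_mul, (A.poly_aux (hs v hv) (hf.2 v hv) _).2]
      exact h v hv)
    rcases hv with hv | hv
    · refine ⟨c, fun v hv' => ?_⟩
      have := hv v hv'
      rw [(A.poly_aux (hs v hv') (hf.2 v hv') _).2] at this
      simpa [sub_eq_zero] using this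
    · refine ih Q hQ hdeg fun v hv' => ?_
      have := hv v hv'
      rwa [(A.poly_aux (hs v hv') (hf.2 v hv') _).2] at this

lemma const_of_sec [CharZero k] (A : Amp α D t m₀ Θ) {B : Set (ProjPt k n)} (hB : B ⊆ X) (hBc : IsClosedSub B) (hBi : IsIrredSub B)
    {f : L} (hf : Sec α t B 0 f) : ∃ c : k, ∀ v ∈ cone B, val α t v 0 f = c := by
  have hs : ∀ v, v ∈ cone B → v ∈ cone X := fun v hv => ⟨hv.1, hB hv.2⟩
  have : Infinite k := IsAlgClosed.instInfinite
  obtain ⟨Δ, δ, hδ, hδW, hcon⟩ := A.cond hB hBc hBi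
  have hpw : ∀ i : ℕ, Sec α t B ((0 * m₀ : ℕ) : ℤ) (f ^ i) := fun i =>
    ⟨pow_mem hf.1 i, fun v hv => by
      have := (A.S.pow_aux (hs v hv) (hf.2 v hv) i).1
      rw [mul_zero] at this; simpa using this⟩
  choose G hG hGv using fun i => hcon 0 (f ^ i) (hpw i)
  have hfin : Module.Finite k (homogeneousSubmodule (Fin (m+1)) k Δ) := Module.Finite.iff_fg.2 (homogeneousSubmodule_fg _ _ Δ)
  have hdep := Module.Finite.not_linearIndependent_of_infinite (R := k) (fun i : ℕ => (⟨G i, hG i⟩ : homogeneousSubmodule (Fin (m+1)) k Δ))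
  rw [linearIndependent_iff] at hdep
  push Not at hdep
  obtain ⟨l, hl, hl0⟩ := hdep
  have hsum : ∑ i ∈ l.support, l i • G i = 0 := by
    have := congrArg Subtype.val hl
    rw [Finsupp.linearCombination_apply, Finsupp.sum] at this
    simpa using this
  let P : Polynomial k := ∑ i ∈ l.support, Polynomial.monomial i (l i)
  have hP : P ≠ 0 := by
    intro h
    apply hl0
    ext i
    have := congrArg (fun p => Polynomial.coeff p i) h
    simp only [P, Polynomial.finset_sum_coeff, Polynomial.coeff_monomial, Polynomial.coeff_zero, Finset.sum_ite_eq', Finsupp.mem_support_iff] at this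
    by_cases hi : l i = 0
    · exact hi
    · simpa [hi] using this
  have hδP : ∀ v ∈ cone B, eval (th α t m₀ Θ v) δ * P.eval (val α t v 0 f) = 0 := by
    intro v hv
    simp only [P, Polynomial.eval_finset_sum, Polynomial.eval_monomial]
    have h1 := congrArg (eval (th α t m₀ Θ v)) hsum
    rw [map_sum, map_zero] at h1
    rw [← h1, Finset.mul_sum]
    refine Finset.sum_congr rfl fun i _ => ?_
    rw [MvPolynomial.smul_eval, ← hGv i v hv]
    have := (A.S.pow_aux (hs v hv) (hf.2 v hv) i).2
    rw [mul_zero] at this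
    rw [zero_mul, Nat.cast_zero, this]; ring
  have hPs : Sec α t B 0 (Polynomial.aeval f P) := by
    refine ⟨?_, fun v hv => (A.poly_aux (hs v hv) (hf.2 v hv) P).1⟩
    exact K0_poly hf.1 P
  have hδs : Sec α t B (Δ * m₀ : ℕ) (aeval Θ δ) := ⟨A.inK _, fun v hv => (A.secG hδ).2 v (hs v hv)⟩
  rcases A.S.van_prime hB hBi hδs hPs (fun v hv => by
      rw [(A.S.mul_aux (hs v hv) (hδs.2 v hv) (hPs.2 v hv)).2, (A.aux (hs v hv) hδ).2, (A.poly_aux (hs v hv) (hf.2 v hv) P).2]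
      exact hδP v hv) with h | h
  · exact absurd ((A.mem_IW hB hδ).2 fun v hv => by rw [← (A.aux (hs v hv) hδ).2]; exact h v hv) hδW
  · exact A.root_van hB hBi hf _ P hP rfl fun v hv => by
      rw [← (A.poly_aux (hs v hv) (hf.2 v hv) P).2]; exact h v hv

lemma neg_van [CharZero k] (A : Amp α D t m₀ Θ) {B : Set (ProjPt k n)} (hB : B ⊆ X) (hBc : IsClosedSub B) (hBi : IsIrredSub B)
    {x x' : Fin (n+1) → k} (hx : x ∈ cone B) (hx' : x' ∈ cone B) (hne : Projectivization.mk k x hx.1 ≠ Projectivization.mk k x' hx'.1)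
    {q : ℕ} (hq : 0 < q) {φ : L} (hφ : Sec α t B (-(q * m₀ : ℕ)) φ) : Sd.Van α t B (-(q * m₀ : ℕ)) φ := by
  have hs : ∀ v, v ∈ cone B → v ∈ cone X := fun v hv => ⟨hv.1, hB hv.2⟩
  obtain ⟨ℓ, hℓ, h1, h2⟩ := A.th_inj (hs x hx) (hs x' hx') hne
  have hℓq : (ℓ ^ q).IsHomogeneous q := by
    have := hℓ.pow q
    rwa [one_mul] at this
  have hℓs : Sec α t B (q * m₀ : ℕ) (aeval Θ (ℓ ^ q)) := ⟨A.inK _, fun v hv => (A.secG hℓq).2 v (hs v hv)⟩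
  have hm : ∀ v ∈ cone B, RS α t v 0 (φ * aeval Θ (ℓ ^ q)) ∧ val α t v 0 (φ * aeval Θ (ℓ ^ q)) = 
      val α t v (-(q * m₀ : ℕ)) φ * eval (th α t m₀ Θ v) (ℓ ^ q) := fun v hv => by
    have := A.S.mul_aux (hs v hv) (hφ.2 v hv) (hℓs.2 v hv)
    rw [neg_add_cancel] at this
    rw [← (A.aux (hs v hv) hℓq).2]
    exact this
  obtain ⟨c, hc⟩ := A.const_of_sec hB hBc hBi (f := φ * aeval Θ (ℓ ^ q)) ⟨mul_mem hφ.1 (A.inK _), fun v hv => (hm v hv).1⟩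
  have hc0 : c = 0 := by
    rw [← hc x hx, (hm x hx).2, map_pow, h1, zero_pow hq.ne', mul_zero]
  refine (A.S.van_prime hB hBi hφ hℓs fun v hv => ?_).resolve_right fun h => ?_
  · rw [neg_add_cancel, hc v hv, hc0]
  · have := h x' hx'
    rw [(A.aux (hs x' hx') hℓq).2, map_pow] at this
    exact pow_ne_zero _ h2 this

/-- the space of sections -/
noncomputable def VS (A : Amp α D t m₀ Θ) (l : ℤ) : Submodule k L where
  carrier := {φ | Sec α t X l φ}
  zero_mem' := ⟨zero_mem _, fun v hv => A.S.zero_aux hv l⟩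
  add_mem' := fun ha hb => ⟨add_mem ha.1 hb.1, fun v hv => (A.S.add_aux hv (ha.2 v hv) (hb.2 v hv)).1⟩
  smul_mem' := fun c _ ha => ⟨(K0 α).smul_mem ha.1, fun v hv => (A.S.smul_aux hv c (ha.2 v hv)).1⟩

lemma mem_VS (A : Amp α D t m₀ Θ) {l : ℤ} {φ : L} : φ ∈ A.VS l ↔ Sec α t X l φ := Iff.rfl

lemma nonempty_cone (A : Amp α D t m₀ Θ) : ∃ v, v ∈ cone X := by
  obtain ⟨x, hx⟩ := A.S.H.sm.2.1.1
  have hv0 := cone_rep hx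
  obtain ⟨v0, hv0⟩ : ∃ v0, v0 ∈ cone _ := ⟨_, hv0⟩
  exact ⟨v0, hv0⟩

lemma VS_fg [CharZero k] (A : Amp α D t m₀ Θ) (l : ℕ) : (A.VS l).FG := by
  obtain ⟨N, hN⟩ := A.bpf
  obtain ⟨v0, hv0⟩ := A.nonempty_cone
  have hle : N + l ≤ (N + l) * m₀ := Nat.le_mul_of_pos_right _ A.pos
  obtain ⟨l', hl'⟩ : ∃ l', (N + l) * m₀ = l + l' := ⟨(N+l) * m₀ - l, by omega⟩
  obtain ⟨τ, hτ, hτv⟩ := hN l' (by omega) v0 hv0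
  have hτ0 : τ ≠ 0 := by
    rintro rfl
    exact hτv (A.S.val_zero hv0 _)
  obtain ⟨Δ, δ, hδ, hδW, hcon⟩ := A.cond le_rfl A.S.H.sm.1 A.S.H.sm.2.1
  have hδ0 : aeval Θ δ ≠ 0 := by
    intro h
    apply hδW
    rw [A.mem_IW le_rfl hδ]
    intro v hv
    rw [← (A.aux hv hδ).2, h, A.S.val_zero hv]
  let T : MvPolynomial (Fin (m+1)) k →ₗ[k] L := (LinearMap.mulLeft k (aeval Θ δ * τ)⁻¹).comp (aeval Θ).toLinearMap
  have hle : A.VS l ≤ (homogeneousSubmodule (Fin (m+1)) k (Δ + (N + l))).map T := by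
    intro φ hφ
    have h1 : Sec α t X ((N + l) * m₀ : ℕ) (φ * τ) := ⟨mul_mem hφ.1 hτ.1, fun v hv => by
      rw [hl', Nat.cast_add]; exact (A.S.mul_aux hv (hφ.2 v hv) (hτ.2 v hv)).1⟩
    obtain ⟨G, hG, hGv⟩ := hcon _ _ h1
    refine ⟨G, hG, ?_⟩
    have hdiff : aeval Θ δ * (φ * τ) + (-1 : k) • aeval Θ G = 0 := by
      have hh : ∀ v ∈ cone X, RS α t v ((Δ + (N + l)) * m₀ : ℕ) (aeval Θ δ * (φ * τ)) ∧ 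
          val α t v ((Δ + (N + l)) * m₀ : ℕ) (aeval Θ δ * (φ * τ)) = eval (th α t m₀ Θ v) G := fun v hv => by
        have := A.S.mul_aux hv (A.aux hv hδ).1 (h1.2 v hv)
        rw [(A.aux hv hδ).2, hGv v hv, ← Nat.cast_add, ← add_mul] at this
        exact this
      have hh2 : ∀ v ∈ cone X, _ := fun v hv => A.S.add_aux hv (hh v hv).1 (A.S.smul_aux hv (-1 : k) (A.aux hv hG).1).1
      refine A.S.van_X ⟨add_mem (mul_mem (A.inK _) h1.1) ((K0 α).smul_mem (A.inK _)), fun v hv => (hh2 v hv).1⟩ fun v hv => ?_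
      rw [(hh2 v hv).2, (hh v hv).2, (A.S.smul_aux hv (-1 : k) (A.aux hv hG).1).2, (A.aux hv hG).2]; ring
    have h3 : aeval Θ G = aeval Θ δ * (φ * τ) := by
      rw [neg_one_smul, ← sub_eq_add_neg, sub_eq_zero] at hdiff; exact hdiff.symm
    change (aeval Θ δ * τ)⁻¹ * aeval Θ G = φ
    rw [h3]; field_simp
  exact Submodule.FG.of_le (Submodule.FG.map _ (homogeneousSubmodule_fg _ _ _)) hle

end Amp
end Bt
end Part16

section Part17
open MvPolynomial
namespace Bt
set_option linter.unusedSectionVars false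
set_option linter.unusedVariables false
variable {k : Type} [Field k] {n : ℕ}
attribute [local instance] MvPolynomial.gradedAlgebra

variable {L : Type} [Field L] [Algebra k L] {X : Set (ProjPt k n)} {d : ℕ}
    {α : MvPolynomial (Fin (n+1)) k →ₐ[k] L}
variable [IsAlgClosed k] {D : PD X d → ℤ} {t : (Fin (n+1) → k) → L} {m₀ m : ℕ} {Θ : Fin (m+1) → L}


lemma grad_sum {ι : Type} (s : Finset ι) (f : ι → MvPolynomial (Fin (n+1)) k) (v : Fin (n+1) → k) :
    gradientAt (∑ i ∈ s, f i) v = ∑ i ∈ s, gradientAt (f i) v := by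
  funext j; simp [gradientAt, Finset.sum_apply]

lemma grad_smul (c : k) (f : MvPolynomial (Fin (n+1)) k) (v : Fin (n+1) → k) :
    gradientAt (c • f) v = c • gradientAt f v := by
  funext j; simp [gradientAt]

lemma grad_sub (f g : MvPolynomial (Fin (n+1)) k) (v : Fin (n+1) → k) :
    gradientAt (f - g) v = gradientAt f v - gradientAt g v := by
  funext j; simp [gradientAt]

lemma grad_mem_Nv {h : MvPolynomial (Fin (n+1)) k} (hh : h ∈ IX X) (v : Fin (n+1) → k) : gradientAt h v ∈ Nv X v := by
  have : gradientAt h v = ∑ i ∈ Finset.range (h.totalDegree + 1), gradientAt (homogeneousComponent i h) v := by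
    rw [← grad_sum, sum_homogeneousComponent]
  rw [this]
  refine Submodule.sum_mem _ fun i _ => Submodule.subset_span ⟨_, mem_homV.2 ⟨⟨i, homogeneousComponent_isHomogeneous i h⟩, IX_hom X _ hh i⟩, rfl⟩

/-- one-jet evaluation -/
noncomputable def Ej (v u : Fin (n+1) → k) : MvPolynomial (Fin (n+1)) k →ₐ[k] DualNumber k :=
  aeval (fun i => (TrivSqZeroExt.inl (v i) + TrivSqZeroExt.inr (u i) : DualNumber k))

lemma Ej_fst (v u : Fin (n+1) → k) (f : MvPolynomial (Fin (n+1)) k) : (Ej v u f).fst = eval v f := by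
  have : ((TrivSqZeroExt.fstHom k k k).comp (Ej v u)) = MvPolynomial.aeval v := by
    apply MvPolynomial.algHom_ext
    intro i
    simp [Ej]
  have h2 := DFunLike.congr_fun this f
  rw [MvPolynomial.aeval_eq_eval] at h2
  exact h2

lemma Ej_snd (v u : Fin (n+1) → k) (f : MvPolynomial (Fin (n+1)) k) : (Ej v u f).snd = gradientAt f v ⬝ᵥ u := by
  induction f using MvPolynomial.induction_on with
  | C a => 
    rw [grad_C, zero_dotProduct]
    have : Ej v u (C a) = algebraMap k (DualNumber k) a := (Ej v u).commutes a
    rw [this]; rfl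
  | add p q hp hq => rw [map_add, TrivSqZeroExt.snd_add, hp, hq, grad_add, add_dotProduct]
  | mul_X p i hp =>
    rw [map_mul, TrivSqZeroExt.snd_mul, hp, Ej_fst, Ej_fst, grad_mul_X, add_dotProduct, smul_dotProduct, smul_dotProduct, eval_X]
    simp [Ej]; ring

/-- tangent vectors of the cone -/
def Perp (X : Set (ProjPt k n)) (v u : Fin (n+1) → k) : Prop := ∀ w ∈ Nv X v, w ⬝ᵥ u = 0

def Jet (α : MvPolynomial (Fin (n+1)) k →ₐ[k] L) (v u : Fin (n+1) → k) (φ : L) (r : DualNumber k) : Prop :=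
  ∃ a b, eval v b ≠ 0 ∧ φ = α a / α b ∧ Ej v u a = r * Ej v u b

lemma Ej_unit {v u : Fin (n+1) → k} {b : MvPolynomial (Fin (n+1)) k} (hb : eval v b ≠ 0) : IsUnit (Ej v u b) := by
  rw [TrivSqZeroExt.isUnit_iff_isUnit_fst, Ej_fst]; exact hb.isUnit

lemma unit_of {r : DualNumber k} (h : r.fst ≠ 0) : IsUnit r := TrivSqZeroExt.isUnit_iff_isUnit_fst.2 h.isUnit

namespace Setup

lemma Ej_congr (H : Setup X d α) {v u : Fin (n+1) → k} (hv : v ∈ cone X) (hu : Perp X v u) {a b : MvPolynomial (Fin (n+1)) k}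
    (h : α a = α b) : Ej v u a = Ej v u b := by
  have h1 : a - b ∈ IX X := by rw [← H.ker, map_sub, h, sub_self]
  rw [← sub_eq_zero, ← map_sub]
  apply TrivSqZeroExt.ext
  · rw [Ej_fst, TrivSqZeroExt.fst_zero]; exact mem_IX.1 h1 v hv
  · rw [Ej_snd, TrivSqZeroExt.snd_zero]; exact hu _ (grad_mem_Nv h1 v)

lemma jet_unique (H : Setup X d α) {v u : Fin (n+1) → k} (hv : v ∈ cone X) (hu : Perp X v u) {φ : L} {r s : DualNumber k}
    (h : Jet α v u φ r) (h' : Jet α v u φ s) : r = s := by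
  obtain ⟨a, b, hb, e1, e2⟩ := h
  obtain ⟨a', b', hb', e1', e2'⟩ := h'
  have h1 : α (a * b') = α (a' * b) := by
    rw [map_mul, map_mul, ← div_eq_div_iff (H.ne_of_eval hv hb) (H.ne_of_eval hv hb'), ← e1, ← e1']
  have h2 := H.Ej_congr hv hu h1
  rw [map_mul, map_mul, e2, e2'] at h2
  apply ((Ej_unit (u := u) hb).mul (Ej_unit (u := u) hb')).mul_right_cancel
  linear_combination h2

lemma jet_mul (H : Setup X d α) {v u : Fin (n+1) → k} (hv : v ∈ cone X) {φ ψ : L} {r s : DualNumber k}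
    (h : Jet α v u φ r) (h' : Jet α v u ψ s) : Jet α v u (φ * ψ) (r * s) := by
  obtain ⟨a, b, hb, e1, e2⟩ := h
  obtain ⟨a', b', hb', e1', e2'⟩ := h'
  refine ⟨a * a', b * b', by rw [map_mul]; exact mul_ne_zero hb hb', ?_, ?_⟩
  · rw [e1, e1', map_mul, map_mul, div_mul_div_comm]
  · rw [map_mul, map_mul, e2, e2']; ring

lemma jet_add (H : Setup X d α) {v u : Fin (n+1) → k} (hv : v ∈ cone X) {φ ψ : L} {r s : DualNumber k}
    (h : Jet α v u φ r) (h' : Jet α v u ψ s) : Jet α v u (φ + ψ) (r + s) := by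
  obtain ⟨a, b, hb, e1, e2⟩ := h
  obtain ⟨a', b', hb', e1', e2'⟩ := h'
  refine ⟨a * b' + b * a', b * b', by rw [map_mul]; exact mul_ne_zero hb hb', ?_, ?_⟩
  · rw [e1, e1', map_add, map_mul, map_mul, map_mul, div_add_div _ _ (H.ne_of_eval hv hb) (H.ne_of_eval hv hb')]
  · rw [map_add, map_mul, map_mul, map_mul, e2, e2']; ring

lemma jet_const (H : Setup X d α) (v u : Fin (n+1) → k) (c : k) : Jet α v u (algebraMap k L c) (algebraMap k (DualNumber k) c) := by
  refine ⟨C c, 1, by simp, ?_, ?_⟩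
  · rw [map_one, div_one]; exact (α.commutes c).symm
  · rw [map_one, mul_one]; exact (Ej v u).commutes c

lemma jet_fst (H : Setup X d α) {v u : Fin (n+1) → k} (hv : v ∈ cone X) {φ : L} {r : DualNumber k}
    (h : Jet α v u φ r) : r.fst = ev α v φ := by
  obtain ⟨a, b, hb, e1, e2⟩ := h
  rw [e1, H.ev_frac hv hb, eq_div_iff hb, ← Ej_fst v u b, ← Ej_fst v u a, e2, TrivSqZeroExt.fst_mul]

lemma exists_jet (H : Setup X d α) {v u : Fin (n+1) → k} (hv : v ∈ cone X) {φ : L} (h : Reg α v φ) : ∃ r, Jet α v u φ r := by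
  obtain ⟨a, b, hb, e1⟩ := h
  obtain ⟨c, hc⟩ := (Ej_unit (u := u) hb).exists_left_inv
  exact ⟨Ej v u a * c, a, b, hb, e1, by rw [mul_assoc, hc, mul_one]⟩

lemma jet_pow (H : Setup X d α) {v u : Fin (n+1) → k} (hv : v ∈ cone X) {φ : L} {r : DualNumber k}
    (h : Jet α v u φ r) (i : ℕ) : Jet α v u (φ ^ i) (r ^ i) := by
  induction i with
  | zero => 
    have := H.jet_const v u 1
    rw [pow_zero, pow_zero]
    rwa [map_one, map_one] at this
  | succ i ih => rw [pow_succ, pow_succ]; exact H.jet_mul hv ih h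

lemma jet_sum (H : Setup X d α) {v u : Fin (n+1) → k} (hv : v ∈ cone X) {ι : Type} (s : Finset ι) {φ : ι → L} {r : ι → DualNumber k}
    (h : ∀ i ∈ s, Jet α v u (φ i) (r i)) : Jet α v u (∑ i ∈ s, φ i) (∑ i ∈ s, r i) := by
  classical
  induction s using Finset.induction_on with
  | empty =>
    have := H.jet_const v u 0
    rwa [map_zero, map_zero] at this
  | insert a s ha ih =>
    rw [Finset.sum_insert ha, Finset.sum_insert ha]
    exact H.jet_add hv (h a (Finset.mem_insert_self a s)) (ih fun i hi => h i (Finset.mem_insert_of_mem hi))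

lemma jet_prod (H : Setup X d α) {v u : Fin (n+1) → k} (hv : v ∈ cone X) {ι : Type} (s : Finset ι) {φ : ι → L} {r : ι → DualNumber k}
    (h : ∀ i ∈ s, Jet α v u (φ i) (r i)) : Jet α v u (∏ i ∈ s, φ i) (∏ i ∈ s, r i) := by
  classical
  induction s using Finset.induction_on with
  | empty =>
    have := H.jet_const v u 1
    rwa [map_one, map_one] at this
  | insert a s ha ih =>
    rw [Finset.prod_insert ha, Finset.prod_insert ha]
    exact H.jet_mul hv (h a (Finset.mem_insert_self a s)) (ih fun i hi => h i (Finset.mem_insert_of_mem hi))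

/-- `aeval` of a polynomial has the expected jet -/
lemma jet_aeval (H : Setup X d α) {v u : Fin (n+1) → k} (hv : v ∈ cone X) {φ : Fin (m+1) → L} {r : Fin (m+1) → DualNumber k}
    (h : ∀ i, Jet α v u (φ i) (r i)) (p : MvPolynomial (Fin (m+1)) k) : Jet α v u (aeval φ p) (aeval r p) := by
  induction p using MvPolynomial.induction_on with
  | C a => 
    rw [← MvPolynomial.algebraMap_eq, AlgHom.commutes, AlgHom.commutes]; exact H.jet_const v u a
  | add p q hp hq => rw [map_add, map_add]; exact H.jet_add hv hp hq
  | mul_X p i hp => rw [map_mul, map_mul, aeval_X, aeval_X]; exact H.jet_mul hv hp (h i)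

end Setup

lemma aeval_tw (A : Amp α D t m₀ Θ) {v : Fin (n+1) → k} {e : ℕ} {p : MvPolynomial (Fin (m+1)) k} (hp : p.IsHomogeneous e) :
    aeval (fun i => t v ^ (m₀:ℤ) * Θ i) p = (t v ^ (m₀:ℤ)) ^ e * aeval Θ p := by
  exact aeval_mul_hom hp Θ _

namespace Amp

lemma jet_line (A : Amp α D t m₀ Θ) {v u : Fin (n+1) → k} (hv : v ∈ cone X) (hu : Perp X v u) (κ : DualNumber k)
    (h : ∀ i, Jet α v u (t v ^ (m₀:ℤ) * Θ i) (κ * algebraMap k (DualNumber k) (th α t m₀ Θ v i))) : ∃ c : k, u = c • v := by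
  have H := A.S.H
  have hκ : IsUnit κ := by
    apply unit_of
    intro h0
    obtain ⟨j, hj⟩ := Function.ne_iff.1 (A.ne v hv)
    apply hj
    have := H.jet_fst hv (h j)
    rw [TrivSqZeroExt.fst_mul, h0, zero_mul] at this
    change val α t v m₀ (Θ j) = 0
    rw [val, mul_comm]; exact this.symm
  have hform : ∀ (e : ℕ) (p : MvPolynomial (Fin (m+1)) k), p.IsHomogeneous e →
      Jet α v u ((t v ^ (m₀:ℤ)) ^ e * aeval Θ p) (κ ^ e * algebraMap k (DualNumber k) (eval (th α t m₀ Θ v) p)) := by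
    intro e p hp
    have h1 := H.jet_aeval hv h p
    rw [aeval_tw A hp, aeval_mul_hom hp] at h1
    convert h1 using 2
    rw [← MvPolynomial.aeval_eq_eval]
    exact (MvPolynomial.comp_aeval_apply (th α t m₀ Θ v) (Algebra.ofId k (DualNumber k)) p)
  have hconst : ∀ φ ∈ K0 α, Reg α v φ → ∃ c : k, Jet α v u φ (algebraMap k (DualNumber k) c) := by
    intro φ hK hr
    obtain ⟨e, p, q, hp, hq, hqv, rfl⟩ := A.fracs hv hK hr
    refine ⟨eval (th α t m₀ Θ v) p / eval (th α t m₀ Θ v) q, ?_⟩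
    obtain ⟨r, hr'⟩ := H.exists_jet (u := u) hv hr
    have h1 := H.jet_mul hv hr' (hform e q hq)
    have h2 : aeval Θ p / aeval Θ q * ((t v ^ (m₀:ℤ)) ^ e * aeval Θ q) = (t v ^ (m₀:ℤ)) ^ e * aeval Θ p := by
      have := A.beta_ne hq hv hqv
      field_simp
    rw [h2] at h1
    have h3 := H.jet_unique hv hu h1 (hform e p hp)
    convert hr'
    have hun : IsUnit (κ ^ e * algebraMap k (DualNumber k) (eval (th α t m₀ Θ v) q)) := 
      (hκ.pow e).mul (hqv.isUnit.map (algebraMap k (DualNumber k)))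
    apply hun.mul_right_cancel
    rw [h3]
    have h4 : algebraMap k (DualNumber k) (eval (th α t m₀ Θ v) p) = algebraMap k (DualNumber k) (eval (th α t m₀ Θ v) p / eval (th α t m₀ Θ v) q) * algebraMap k (DualNumber k) (eval (th α t m₀ Θ v) q) := by
      rw [← map_mul, div_mul_cancel₀ _ hqv]
    rw [h4]; ring
  apply prop_of_vperp hv.1
  intro a ha
  obtain ⟨j, hj⟩ := Function.ne_iff.1 hv.1
  have hjv : eval v (MvPolynomial.X j) ≠ 0 := by rw [eval_X]; exact hj
  have hne := H.ne_of_eval hv hjv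
  obtain ⟨c, hc⟩ := hconst (α (lin a) / α (MvPolynomial.X j)) (mem_K0.2 ⟨1, lin a, MvPolynomial.X j, lin_hom a, isHomogeneous_X k j, hne, rfl⟩)
    ⟨_, _, hjv, rfl⟩
  obtain ⟨r, hr⟩ := H.exists_jet (u := u) hv (⟨lin a, MvPolynomial.X j, hjv, rfl⟩ : Reg α v (α (lin a) / α (MvPolynomial.X j)))
  have hX : Jet α v u (α (MvPolynomial.X j)) (Ej v u (MvPolynomial.X j)) := ⟨MvPolynomial.X j, 1, by simp, by simp, by simp⟩
  have hl : Jet α v u (α (lin a)) (Ej v u (lin a)) := ⟨lin a, 1, by simp, by simp, by simp⟩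
  have h5 := H.jet_mul hv hc hX
  rw [div_mul_cancel₀ _ hne] at h5
  have h6 := H.jet_unique hv hu h5 hl
  have h7 := congrArg TrivSqZeroExt.fst h6
  have h8 := congrArg TrivSqZeroExt.snd h6
  rw [TrivSqZeroExt.fst_mul, Ej_fst, Ej_fst, eval_lin, mem_vperp.1 ha, eval_X] at h7
  have hc0 : c = 0 := (mul_eq_zero.1 h7).resolve_right hj
  rw [hc0, map_zero, zero_mul, Ej_snd, grad_lin] at h8
  exact h8.symm

end Amp
end Bt
end Part17

section Part18
open MvPolynomial
namespace Bt
set_option linter.unusedSectionVars false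
set_option linter.unusedVariables false
variable {k : Type} [Field k] {n : ℕ}
attribute [local instance] MvPolynomial.gradedAlgebra

variable {L : Type} [Field L] [Algebra k L] {X : Set (ProjPt k n)} {d : ℕ}
    {α : MvPolynomial (Fin (n+1)) k →ₐ[k] L}
variable [IsAlgClosed k] {D : PD X d → ℤ} {t : (Fin (n+1) → k) → L} {m₀ m : ℕ} {Θ : Fin (m+1) → L}


lemma common_den {ι : Type} [Fintype ι] (M : Submonoid (MvPolynomial (Fin (n+1)) k)) (hM : ∀ b ∈ M, α b ≠ 0) (φ : ι → L)
    (h : ∀ i, ∃ e a b, MvPolynomial.IsHomogeneous a e ∧ MvPolynomial.IsHomogeneous b e ∧ b ∈ M ∧ φ i = α a / α b) :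
    ∃ (e : ℕ) (a : ι → MvPolynomial (Fin (n+1)) k) (b : MvPolynomial (Fin (n+1)) k),
      (∀ i, (a i).IsHomogeneous e) ∧ b.IsHomogeneous e ∧ b ∈ M ∧ ∀ i, φ i = α (a i) / α b := by
  classical
  choose e a b ha hb hbM hφ using h
  refine ⟨∑ i, e i, fun i => a i * ∏ j ∈ Finset.univ.erase i, b j, ∏ j, b j, ?_, ?_, ?_, ?_⟩
  · intro i
    rw [← Finset.add_sum_erase _ _ (Finset.mem_univ i)]
    exact (ha i).mul (MvPolynomial.IsHomogeneous.prod _ _ _ fun j _ => hb j)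
  · exact MvPolynomial.IsHomogeneous.prod _ _ _ fun j _ => hb j
  · exact Submonoid.prod_mem _ fun j _ => hbM j
  · intro i
    rw [hφ i, ← Finset.mul_prod_erase _ _ (Finset.mem_univ i), map_mul, map_mul, mul_div_mul_right]
    exact hM _ (Submonoid.prod_mem _ fun j _ => hbM j)

/-- denominators nonvanishing at `v` -/
def denv (v : Fin (n+1) → k) : Submonoid (MvPolynomial (Fin (n+1)) k) where
  carrier := {b | eval v b ≠ 0}
  one_mem' := by simp
  mul_mem' := by
    intro a b ha hb
    change eval v (a * b) ≠ 0
    rw [map_mul]; exact mul_ne_zero ha hb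

def den (α : MvPolynomial (Fin (n+1)) k →ₐ[k] L) : Submonoid (MvPolynomial (Fin (n+1)) k) where
  carrier := {b | α b ≠ 0}
  one_mem' := by simp
  mul_mem' := by
    intro a b ha hb
    change α (a * b) ≠ 0
    rw [map_mul]; exact mul_ne_zero ha hb

namespace Setup

lemma transc (H : Setup X d α) {j : Fin (n+1)} (hj : α (MvPolynomial.X j) ≠ 0) : Transcendental (K0 α) (α (MvPolynomial.X j)) := by
  rw [transcendental_iff]
  intro P hP
  obtain ⟨e, a, b, ha, hb, hbM, hφ⟩ := common_den (den α) (fun b hb => hb) (fun i : Fin (P.natDegree + 1) => ((P.coeff i : K0 α) : L))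
    (fun i => by
      obtain ⟨e, a, b, h1, h2, h3, h4⟩ := mem_K0.1 (P.coeff i).2
      exact ⟨e, a, b, h1, h2, h3, h4⟩)
  have hb0 : α b ≠ 0 := hbM
  have h1 : ∑ i : Fin (P.natDegree + 1), a i * MvPolynomial.X j ^ (i:ℕ) ∈ IX X := by
    rw [← H.ker, map_sum]
    rw [Polynomial.aeval_eq_sum_range, Finset.sum_range] at hP
    have := congrArg (fun z => z * α b) hP
    rw [zero_mul] at this
    rw [← this, Finset.sum_mul]
    apply Finset.sum_congr rfl
    intro i _
    rw [Algebra.smul_def, map_mul, map_pow]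
    change _ = ((P.coeff i : K0 α) : L) * _ * _
    rw [hφ i]; field_simp
  have h2 : ∀ i : Fin (P.natDegree + 1), a i * MvPolynomial.X j ^ (i:ℕ) ∈ IX X := by
    intro i
    have h3 := IX_hom X _ h1 (e + i)
    rw [map_sum, Finset.sum_eq_single i] at h3
    · rwa [comp_self] at h3
      have := (ha i).mul ((isHomogeneous_X k j).pow (i:ℕ))
      rwa [one_mul] at this
    · intro i' _ hne
      rw [homogeneousComponent_of_mem (n := e + i') , if_neg]
      · intro h; apply hne; apply Fin.ext; omega
      · have := (ha i').mul ((isHomogeneous_X k j).pow (i':ℕ))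
        rwa [one_mul] at this
    · simp
  apply Polynomial.ext
  intro i
  by_cases hi : i ≤ P.natDegree
  · have h3 := h2 ⟨i, by omega⟩
    rw [← H.ker, map_mul, map_pow] at h3
    have h4 := (mul_eq_zero.1 h3).resolve_right (pow_ne_zero _ hj)
    have h5 := hφ ⟨i, by omega⟩
    rw [h4, zero_div] at h5
    rw [Polynomial.coeff_zero]; exact Subtype.ext h5
  · rw [Polynomial.coeff_eq_zero_of_natDegree_lt (by omega), Polynomial.coeff_zero]

lemma trdeg_L (H : Setup X d α) : Algebra.trdeg k L ≤ (d + 1 : ℕ) := by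
  obtain ⟨l, hl⟩ := exists_linear_system H.sm.1 H.sm.2.2.1.2
  have hf := finite_of_empty α.rangeRestrict α.rangeRestrict_surjective (I := IX X) (fun f => by
    rw [← H.ker, ← Subtype.coe_inj]; rfl) (IX_hom X) l (disjoint_zer H.sm.1 hl)
  have h1 := trdeg_le_of_integral _ hf.to_isIntegral
  have h2 : Algebra.IsAlgebraic α.range L := by
    constructor
    intro φ
    obtain ⟨a, b, hb, rfl⟩ := H.frac φ
    refine ⟨Polynomial.C ⟨α b, b, rfl⟩ * Polynomial.X - Polynomial.C ⟨α a, a, rfl⟩, ?_, ?_⟩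
    · intro h
      have := congrArg (fun p => Polynomial.coeff p 1) h
      simp at this
      exact hb (congrArg Subtype.val this)
    · rw [map_sub, map_mul, Polynomial.aeval_C, Polynomial.aeval_C, Polynomial.aeval_X]
      change α b * (α a / α b) - α a = 0
      field_simp; ring
  have h3 := trdeg_add_eq k α.range (A := L)
  rw [trdeg_eq_zero (R := α.range) (A := L), add_zero] at h3
  rw [← h3]; exact h1

lemma trdeg_K0 (H : Setup X d α) : Algebra.trdeg k (K0 α) ≤ d := by
  obtain ⟨j, hj⟩ : ∃ j, α (MvPolynomial.X j) ≠ 0 := by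
    obtain ⟨x, hx⟩ := H.sm.2.1.1
    have hv := cone_rep hx
    obtain ⟨j, hj⟩ := Function.ne_iff.1 hv.1
    exact ⟨j, H.ne_of_eval hv (by rw [eval_X]; exact hj)⟩
  have h1 := trdeg_add_eq k (K0 α) (A := L)
  have h2 : (1 : Cardinal) ≤ Algebra.trdeg (K0 α) L := by
    have := (algebraicIndependent_unique_type_iff (ι := Unit) (x := fun _ => α (MvPolynomial.X j))).2 (H.transc hj)
    simpa using this.cardinalMk_le_trdeg
  have h3 := H.trdeg_L
  rw [← h1] at h3
  have h4 : Algebra.trdeg k (K0 α) + 1 ≤ (d:Cardinal) + 1 := by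
    refine (add_le_add_right h2 _).trans (h3.trans ?_)
    push_cast; rfl
  exact Cardinal.add_one_le_add_one_iff.1 h4

end Setup
end Bt
end Part18

section Part19
open MvPolynomial
namespace Bt
set_option linter.unusedSectionVars false
set_option linter.unusedVariables false
variable {k : Type} [Field k] {n : ℕ}
attribute [local instance] MvPolynomial.gradedAlgebra

variable {L : Type} [Field L] [Algebra k L] {X : Set (ProjPt k n)} {d : ℕ}
    {α : MvPolynomial (Fin (n+1)) k →ₐ[k] L}
variable [IsAlgClosed k] {D : PD X d → ℤ} {t : (Fin (n+1) → k) → L} {m₀ m : ℕ} {Θ : Fin (m+1) → L}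


lemma Setup.dep (H : Setup X d α) {M : ℕ} (J : Fin (d+1) → Fin (M+1)) (hJ : Function.Injective J)
    (R : Fin (d+1) → Fin (M+1) → K0 α) : ∃ p : MvPolynomial (Fin (M+1)) k, p ≠ 0 ∧
    ∀ c : Fin (M+1) → L, (∀ j, c (J j) = ∑ l : {l // l ∉ Set.range J}, (R j l.1 : L) * c l.1) → aeval c p = 0 := by
  classical
  let T := {l : Fin (M+1) // l ∉ Set.range J}
  have hcard : Fintype.card T + (d + 1) = M + 1 := by
    have h1 := Fintype.card_subtype_compl (fun l : Fin (M+1) => l ∈ Set.range J)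
    have h2 : Fintype.card {l : Fin (M+1) // l ∈ Set.range J} = d + 1 := by
      have := Set.card_range_of_injective hJ
      rw [Fintype.card_fin] at this
      exact (Fintype.card_congr (Equiv.refl _)).trans this
    rw [h2, Fintype.card_fin] at h1
    have h3 : d + 1 ≤ M + 1 := by
      have := Fintype.card_le_of_injective J hJ
      simpa using this
    change Fintype.card {l : Fin (M+1) // ¬ l ∈ Set.range J} + (d+1) = M + 1
    omega
  let Cc : Fin (M+1) → MvPolynomial T (K0 α) := fun l =>
    if h : l ∈ Set.range J then ∑ l' : T, C (R h.choose l'.1) * MvPolynomial.X l' else MvPolynomial.X ⟨l, h⟩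
  have hnot : ¬ AlgebraicIndependent k Cc := by
    intro h
    have h1 := h.cardinalMk_le_trdeg
    rw [← trdeg_add_eq k (K0 α) (A := MvPolynomial T (K0 α)), MvPolynomial.trdeg_of_isDomain] at h1
    simp only [Cardinal.mk_fintype, Fintype.card_fin, Cardinal.lift_natCast] at h1
    have h2 : ((M + 1 : ℕ) : Cardinal) ≤ (d + Fintype.card T : ℕ) := by
      refine h1.trans ?_
      push_cast
      exact add_le_add_left H.trdeg_K0 _
    have := Nat.cast_le.1 h2
    omega
  rw [algebraicIndependent_iff] at hnot
  push Not at hnot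
  obtain ⟨p, hp, hp0⟩ := hnot
  refine ⟨p, hp0, ?_⟩
  intro c hc
  have h1 := congrArg ((aeval (R := K0 α) (fun l : T => c l.1)).restrictScalars k) hp
  rw [MvPolynomial.comp_aeval_apply, map_zero] at h1
  rw [← h1]
  congr 2
  funext l
  by_cases h : l ∈ Set.range J
  · have h2 : Cc l = ∑ l' : T, C (R h.choose l'.1) * MvPolynomial.X l' := dif_pos h
    rw [h2]
    conv_lhs => rw [← h.choose_spec, hc]
    rw [map_sum]
    apply Finset.sum_congr rfl
    intro l' _
    simp only [AlgHom.restrictScalars_apply, map_mul, MvPolynomial.aeval_X]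
    rw [← MvPolynomial.algebraMap_eq, AlgHom.commutes]; rfl
  · have h2 : Cc l = MvPolynomial.X ⟨l, h⟩ := dif_neg h
    rw [h2]; simp

section det
variable {σ : Type} [Fintype σ] [DecidableEq σ] (ε : σ ≃ Fin (n+1))

/-- matrix of derivatives -/
noncomputable def Pm (col : σ → MvPolynomial (Fin (n+1)) k) : Matrix σ σ (MvPolynomial (Fin (n+1)) k) :=
  fun s s' => pderiv (ε s') (col s)

lemma Pm_hom {col : σ → MvPolynomial (Fin (n+1)) k} {deg : σ → ℕ} (h : ∀ s, (col s).IsHomogeneous (deg s)) :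
    (Pm ε col).det.IsHomogeneous (∑ s, (deg s - 1)) := by
  rw [Matrix.det_apply]
  refine MvPolynomial.IsHomogeneous.sum _ _ _ fun τ _ => ?_
  have : (∏ i, Pm ε col (τ i) i).IsHomogeneous (∑ s, (deg s - 1)) := by
    rw [← Equiv.sum_comp τ]
    exact MvPolynomial.IsHomogeneous.prod _ _ _ fun i _ => (h (τ i)).pderiv
  have h2 := (homogeneousSubmodule (Fin (n+1)) k (∑ s, (deg s - 1)))
  rcases Int.units_eq_one_or (Equiv.Perm.sign τ) with h3 | h3
  · rw [h3, one_smul]; exact this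
  · rw [h3]; simp only [Units.neg_smul, one_smul]; exact this.neg

/-- evaluated matrix -/
noncomputable def Gm (g : σ → Fin (n+1) → k) : Matrix σ σ k := fun s s' => g s (ε s')

lemma eval_Pm (y : Fin (n+1) → k) (col : σ → MvPolynomial (Fin (n+1)) k) :
    eval y (Pm ε col).det = (Gm ε fun s => gradientAt (col s) y).det := by
  rw [RingHom.map_det]; rfl

lemma Gm_update (g : σ → Fin (n+1) → k) (s : σ) (w : Fin (n+1) → k) :
    Gm ε (Function.update g s w) = (Gm ε g).updateRow s (w ∘ ε) := by
  ext i j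
  by_cases h : i = s
  · subst h; simp [Gm]
  · simp [Gm, h]

lemma Gm_indep (g : σ → Fin (n+1) → k) : (Gm ε g).det ≠ 0 ↔ LinearIndependent k g := by
  have h1 : Matrix.row (Gm ε g) = (LinearEquiv.funCongrLeft k k ε) ∘ g := rfl
  rw [← isUnit_iff_ne_zero, ← Matrix.isUnit_iff_isUnit_det, ← Matrix.linearIndependent_rows_iff_isUnit, h1]
  exact LinearMap.linearIndependent_iff_of_injOn _ (by exact (LinearEquiv.funCongrLeft k k ε).injective.injOn)

/-- Cramer functional -/
noncomputable def Cf (g : σ → Fin (n+1) → k) (s : σ) : (Fin (n+1) → k) →ₗ[k] k :=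
  (LinearMap.proj s ∘ₗ (Matrix.cramer (Gm ε g).transpose)) ∘ₗ (LinearEquiv.funCongrLeft k k ε).toLinearMap

lemma Cf_apply (g : σ → Fin (n+1) → k) (s : σ) (w : Fin (n+1) → k) : Cf ε g s w = (Gm ε (Function.update g s w)).det := by
  rw [Gm_update, ← Matrix.cramer_transpose_apply]; rfl

lemma Cf_self (g : σ → Fin (n+1) → k) (s : σ) : Cf ε g s (g s) = (Gm ε g).det := by
  rw [Cf_apply, Function.update_eq_self]

lemma Cf_ne (g : σ → Fin (n+1) → k) {s s' : σ} (h : s ≠ s') : Cf ε g s (g s') = 0 := by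
  rw [Cf_apply]
  apply Matrix.det_zero_of_row_eq h
  funext j
  simp [Gm, h.symm]

end det
end Bt
end Part19

section Part20
open MvPolynomial
namespace Bt
set_option linter.unusedSectionVars false
set_option linter.unusedVariables false
variable {k : Type} [Field k] {n : ℕ}
attribute [local instance] MvPolynomial.gradedAlgebra

variable {L : Type} [Field L] [Algebra k L] {X : Set (ProjPt k n)} {d : ℕ}
    {α : MvPolynomial (Fin (n+1)) k →ₐ[k] L}
variable [IsAlgClosed k] {D : PD X d → ℤ} {t : (Fin (n+1) → k) → L} {m₀ m : ℕ} {Θ : Fin (m+1) → L}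


lemma choose_rows {V : Type} [AddCommGroup V] [Module k V] [FiniteDimensional k V] (S : Set V) {ι : Type} (a : ι → V)
    (hsp : ⊤ ≤ Submodule.span k S ⊔ Submodule.span k (Set.range a)) {r q : ℕ} (hr : Module.finrank k (Submodule.span k S) = r)
    (hq : Module.finrank k V = r + q) :
    ∃ (h : Fin r → V) (J : Fin q → ι), (∀ i, h i ∈ S) ∧ LinearIndependent k (Sum.elim h (a ∘ J)) := by
  subst hr
  obtain ⟨h, hh, hspan, hli⟩ := Submodule.exists_fun_fin_finrank_span_eq k S
  obtain ⟨N, hN⟩ : ∃ N, N = Submodule.span k S := ⟨_, rfl⟩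
  rw [← hN] at hsp hq
  have hq' : Module.finrank k (V ⧸ N) = q := by
    have := N.finrank_quotient_add_finrank
    omega
  have htop : Submodule.span k (Set.range (N.mkQ ∘ a)) = ⊤ := by
    rw [Set.range_comp, ← Submodule.map_span, eq_top_iff]
    intro x _
    obtain ⟨y, rfl⟩ := N.mkQ_surjective x
    obtain ⟨z, hz, w, hw, rfl⟩ := Submodule.mem_sup.1 (hsp (Submodule.mem_top (x := y)))
    refine ⟨w, hw, ?_⟩
    rw [map_add, Submodule.mkQ_apply N z, (Submodule.Quotient.mk_eq_zero N).2 hz, zero_add]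
  have hfr : Module.finrank k (Submodule.span k (Set.range (N.mkQ ∘ a))) = q := by
    rw [htop, finrank_top]; exact hq'
  obtain ⟨f, hf, hfli⟩ : ∃ f : Fin q → V ⧸ N, (∀ i, f i ∈ Set.range (N.mkQ ∘ a)) ∧ LinearIndependent k f := by
    obtain ⟨f, hf, -, hfli⟩ := Submodule.exists_fun_fin_finrank_span_eq k (Set.range (N.mkQ ∘ a))
    rw [← hfr]; exact ⟨f, hf, hfli⟩
  choose J hJ using hf
  refine ⟨h, J, hh, ?_⟩
  have h1 : LinearIndependent k (fun i => (⟨h i, by rw [hN]; exact Submodule.subset_span (hh i)⟩ : N)) := by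
    apply LinearIndependent.of_comp N.subtype
    exact hli
  have h2 : LinearIndependent k (Submodule.Quotient.mk (p := N) ∘ (a ∘ J)) := by
    convert hfli using 1
    funext i; exact hJ i
  exact LinearIndependent.sumElim_of_quotient h1 _ h2

namespace Setup

lemma bert_lin (H : Setup X d α) {M e : ℕ} {a : Fin (M+1) → MvPolynomial (Fin (n+1)) k} (ha : ∀ i, (a i).IsHomogeneous e)
    {v : Fin (n+1) → k} (hv : v ∈ cone X)
    (hsp : ⊤ ≤ Nv X v ⊔ Submodule.span k (Set.range fun i => gradientAt (a i) v)) :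
    ∃ F r, MvPolynomial.IsHomogeneous F r ∧ eval v F ≠ 0 ∧ ∃ p : MvPolynomial (Fin (M+1)) k, p ≠ 0 ∧
      ∀ y ∈ cone X, eval y F ≠ 0 → ∀ c : Fin (M+1) → k, ∑ i, c i • gradientAt (a i) y ∈ Nv X y → eval c p = 0 := by
  classical
  have hdn := dim_le_n H.sm.1 H.sm.2.1 H.sm.2.2.1
  obtain ⟨g, J, hg, hli⟩ := choose_rows _ (fun i => gradientAt (a i) v) hsp (r := n - d) (q := d + 1) (finrank_Nv H.sm.2.2.2 hv)
    (by rw [Module.finrank_fin_fun]; omega)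
  choose h hh hgh using hg
  choose hdeg hIX using fun i => mem_homV.1 (hh i)
  choose deg hdeg using hdeg
  let col : Fin (n-d) ⊕ Fin (d+1) → MvPolynomial (Fin (n+1)) k := Sum.elim h (a ∘ J)
  let dg : Fin (n-d) ⊕ Fin (d+1) → ℕ := Sum.elim deg (fun _ => e)
  have hcol : ∀ s, (col s).IsHomogeneous (dg s) := by
    rintro (s | s)
    · exact hdeg s
    · exact ha _
  let ε : Fin (n-d) ⊕ Fin (d+1) ≃ Fin (n+1) := finSumFinEquiv.trans (finCongr (by omega))
  let Δ := (Pm ε col).det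
  let Δ' : Fin (d+1) → Fin (M+1) → MvPolynomial (Fin (n+1)) k := fun j l => (Pm ε (Function.update col (Sum.inr j) (a l))).det
  have hΔ : Δ.IsHomogeneous (∑ s, (dg s - 1)) := Pm_hom ε hcol
  have hΔ' : ∀ j l, (Δ' j l).IsHomogeneous (∑ s, (dg s - 1)) := by
    intro j l
    apply Pm_hom ε
    intro s
    by_cases hs : s = Sum.inr j
    · subst hs; rw [Function.update_self]; exact ha l
    · rw [Function.update_of_ne hs]; exact hcol s
  have hΔv : eval v Δ ≠ 0 := by
    rw [eval_Pm, Gm_indep]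
    have : (fun s => gradientAt (col s) v) = Sum.elim g ((fun i => gradientAt (a i) v) ∘ J) := by
      funext s
      rcases s with s | s
      · exact (hgh s).symm
      · rfl
    rw [this]; exact hli
  have hJ : Function.Injective J := by
    have h1 := hli.injective
    intro i j hij
    have : (Sum.inr i : Fin (n-d) ⊕ Fin (d+1)) = Sum.inr j := h1 (by simp [hij])
    exact Sum.inr_injective this
  have hΔ0 : α Δ ≠ 0 := H.ne_of_eval hv hΔv
  obtain ⟨p, hp, hpc⟩ := H.dep J hJ (fun j l => ⟨α (-Δ' j l) / α Δ, mem_K0.2 ⟨_, -Δ' j l, Δ, (hΔ' j l).neg, hΔ, hΔ0, rfl⟩⟩)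
  refine ⟨Δ, _, hΔ, hΔv, p, hp, ?_⟩
  intro y hy hΔy c hc
  set gr : Fin (n-d) ⊕ Fin (d+1) → Fin (n+1) → k := fun s => gradientAt (col s) y with hgr
  have hgli : LinearIndependent k gr := by rw [← Gm_indep ε, ← eval_Pm]; exact hΔy
  have hN : Submodule.span k (Set.range fun i => gradientAt (h i) y) = Nv X y := by
    apply Submodule.eq_of_le_of_finrank_eq
    · rw [Submodule.span_le]
      rintro _ ⟨i, rfl⟩
      exact grad_mem_Nv (hIX i) y
    · have h1 : LinearIndependent k (fun i => gradientAt (h i) y) := hgli.comp Sum.inl Sum.inl_injective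
      rw [finrank_span_eq_card h1, Fintype.card_fin, finrank_Nv H.sm.2.2.2 hy]
  have hrel : ∀ j, ∑ l, c l * eval y (Δ' j l) = 0 := by
    intro j
    have h1 : Nv X y ≤ LinearMap.ker (Cf ε gr (Sum.inr j)) := by
      rw [← hN, Submodule.span_le]
      rintro _ ⟨i, rfl⟩
      exact Cf_ne ε gr (s' := Sum.inl i) (by simp)
    have h2 := h1 hc
    rw [LinearMap.mem_ker, map_sum] at h2
    rw [← h2]
    apply Finset.sum_congr rfl
    intro l _
    rw [map_smul, smul_eq_mul, Cf_apply, eval_Pm]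
    congr 3
    funext s
    by_cases hs : s = Sum.inr j
    · subst hs; rw [Function.update_self, Function.update_self]
    · rw [Function.update_of_ne hs, Function.update_of_ne hs]
  have hJJ : ∀ j j', eval y (Δ' j (J j')) = if j = j' then eval y Δ else 0 := by
    intro j j'
    have h1 : eval y (Δ' j (J j')) = Cf ε gr (Sum.inr j) (gr (Sum.inr j')) := by
      rw [Cf_apply, eval_Pm]
      congr 2
      funext s
      by_cases hs : s = Sum.inr j
      · subst hs; rw [Function.update_self, Function.update_self]; rfl
      · rw [Function.update_of_ne hs, Function.update_of_ne hs]
    rw [h1]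
    split_ifs with h2
    · subst h2; rw [Cf_self, eval_Pm]
    · exact Cf_ne ε gr (by simpa using h2)
  have hcJ : ∀ j, c (J j) * eval y Δ = - ∑ l : {l // l ∉ Set.range J}, c l.1 * eval y (Δ' j l.1) := by
    intro j
    rw [eq_neg_iff_add_eq_zero, ← hrel j]
    rw [← Fintype.sum_subtype_add_sum_subtype (fun l => l ∈ Set.range J)]
    congr 1
    have h5 : ∑ j', c (J j') * eval y (Δ' j (J j')) = c (J j) * eval y Δ := by
      simp only [hJJ]
      simp
    rw [← h5]
    have h6 : ∀ inst : Fintype {l // l ∈ Set.range J}, ∑ j', c (J j') * eval y (Δ' j (J j')) =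
        ∑ i : {l // l ∈ Set.range J}, c i.1 * eval y (Δ' j i.1) := by
      intro inst
      exact Finset.sum_bij (fun j' _ => (⟨J j', j', rfl⟩ : {l // l ∈ Set.range J})) (fun _ _ => Finset.mem_univ _)
        (fun a _ b _ h => hJ (Subtype.ext_iff.1 h)) (fun b _ => by obtain ⟨_, j', rfl⟩ := b; exact ⟨j', Finset.mem_univ _, rfl⟩) (fun _ _ => rfl)
    exact h6 _
  -- the lift
  let cb : Fin (M+1) → L := fun l => if hl : ∃ j, J j = l then 
    ∑ l : {l // l ∉ Set.range J}, (α (-Δ' hl.choose l.1) / α Δ) * algebraMap k L (c l.1) else algebraMap k L (c l)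
  have hcb1 : ∀ l : {l // l ∉ Set.range J}, cb l.1 = algebraMap k L (c l.1) := fun l => dif_neg l.2
  have hcb2 : ∀ j, cb (J j) = ∑ l : {l // l ∉ Set.range J}, (α (-Δ' j l.1) / α Δ) * cb l.1 := by
    intro j
    have hl : ∃ j', J j' = J j := ⟨j, rfl⟩
    have h1 : cb (J j) = ∑ l : {l // l ∉ Set.range J}, (α (-Δ' hl.choose l.1) / α Δ) * algebraMap k L (c l.1) := dif_pos hl
    rw [h1, hJ hl.choose_spec]
    exact Finset.sum_congr rfl fun l _ => by rw [hcb1]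
  have hz := hpc cb hcb2
  have hO1 : ∀ (j) (l : {l // l ∉ Set.range J}), Reg α y (α (-Δ' j l.1) / α Δ) := fun j l => ⟨_, _, hΔy, rfl⟩
  have hO : ∀ l, Reg α y (cb l) ∧ ev α y (cb l) = c l := by
    intro l
    by_cases hl : ∃ j, J j = l
    · obtain ⟨j, rfl⟩ := hl
      let z : {l // l ∉ Set.range J} → H.Ov hy := fun l => ⟨α (-Δ' j l.1) / α Δ, hO1 j l⟩ * algebraMap k _ (c l.1)
      have h1 : cb (J j) = ((∑ l, z l : H.Ov hy) : L) := by
        rw [hcb2, AddSubmonoidClass.coe_finsetSum]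
        exact Finset.sum_congr rfl fun l _ => by rw [hcb1]; rfl
      refine ⟨by rw [h1]; exact (∑ l, z l : H.Ov hy).2, ?_⟩
      rw [h1, ← H.evO_apply hy, map_sum]
      have h2 : ∀ l : {l // l ∉ Set.range J}, H.evO hy (z l) = -eval y (Δ' j l.1) / eval y Δ * c l.1 := by
        intro l
        rw [map_mul, AlgHom.commutes, H.evO_apply hy]
        change ev α y (α (-Δ' j l.1) / α Δ) * _ = _
        rw [H.ev_frac hy hΔy, map_neg]; rfl
      simp only [h2]
      have h3 := hcJ j
      rw [← Finset.sum_neg_distrib] at h3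
      apply mul_right_cancel₀ hΔy
      rw [h3, Finset.sum_mul]
      apply Finset.sum_congr rfl
      intro l _
      field_simp
    · have : cb l = algebraMap k L (c l) := dif_neg hl
      rw [this]; exact ⟨reg_const y _, H.ev_const hy _⟩
  have h1 : aeval (fun l => (⟨cb l, (hO l).1⟩ : H.Ov hy)) p = 0 := by
    apply Subtype.ext
    have := MvPolynomial.comp_aeval_apply (fun l => (⟨cb l, (hO l).1⟩ : H.Ov hy)) (H.Ov hy).val p
    exact this.trans hz
  have h2 := congrArg (H.evO hy) h1
  rw [MvPolynomial.comp_aeval_apply, map_zero] at h2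
  rw [← h2, ← MvPolynomial.aeval_eq_eval]
  congr 2
  funext l
  rw [H.evO_apply hy]; exact (hO l).2.symm

end Setup
end Bt
end Part20

section Part21
open MvPolynomial
namespace Bt
set_option linter.unusedSectionVars false
set_option linter.unusedVariables false
variable {k : Type} [Field k] {n : ℕ}
attribute [local instance] MvPolynomial.gradedAlgebra

variable {L : Type} [Field L] [Algebra k L] {X : Set (ProjPt k n)} {d : ℕ}
    {α : MvPolynomial (Fin (n+1)) k →ₐ[k] L}
variable [IsAlgClosed k] {D : PD X d → ℤ} {t : (Fin (n+1) → k) → L} {m₀ m : ℕ} {Θ : Fin (m+1) → L}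

lemma mem_of_perp {N : Submodule k (Fin (n+1) → k)} {x : Fin (n+1) → k}
    (h : ∀ u, (∀ w ∈ N, w ⬝ᵥ u = 0) → x ⬝ᵥ u = 0) : x ∈ N := by
  by_contra hx
  obtain ⟨f, hf, hN⟩ := Submodule.exists_le_ker_of_notMem hx
  have hfu : ∀ w, f w = w ⬝ᵥ (fun i => f (Pi.single i 1)) := by
    intro w
    conv_lhs => rw [← Finset.univ_sum_single w]
    rw [map_sum]
    apply Finset.sum_congr rfl
    intro i _
    have : (Pi.single i (w i) : Fin (n+1) → k) = w i • Pi.single i 1 := by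
      rw [← Pi.single_smul, smul_eq_mul, mul_one]
    rw [this, map_smul, smul_eq_mul]
  apply hf
  rw [hfu]
  apply h
  intro w hw
  rw [← hfu]; exact hN hw

/-- the divisor of the section `φ` is singular at `y` -/
def Bad (α : MvPolynomial (Fin (n+1)) k →ₐ[k] L) (t : (Fin (n+1) → k) → L) (X : Set (ProjPt k n)) (y : Fin (n+1) → k) (l : ℤ) (φ : L) : Prop :=
  ∀ u, Perp X y u → Jet α y u (φ * t y ^ l) 0

lemma Setup.jet_frac (H : Setup X d α) {v u : Fin (n+1) → k} (hv : v ∈ cone X) (hu : Perp X v u) {a b : MvPolynomial (Fin (n+1)) k}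
    (hb : eval v b ≠ 0) {r : DualNumber k} (h : Jet α v u (α a / α b) r) : Ej v u a = r * Ej v u b := by
  obtain ⟨s, hs⟩ := (Ej_unit (u := u) hb).exists_left_inv
  have h1 : Jet α v u (α a / α b) (Ej v u a * s) := ⟨a, b, hb, rfl, by rw [mul_assoc, hs, mul_one]⟩
  rw [H.jet_unique hv hu h h1, mul_assoc, hs, mul_one]

lemma Sd.bad_near (S : Sd X d α D t) {v y : Fin (n+1) → k} (hy : y ∈ cone X) (hn : Sd.Near α D t v y) {l : ℤ} {φ : L}
    (h : Bad α t X y l φ) {u : Fin (n+1) → k} (hu : Perp X y u) : Jet α y u (φ * t v ^ l) 0 := by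
  obtain ⟨r, hr⟩ := S.H.exists_jet (u := u) hy (S.near_unit hy hn l).1
  have h1 := S.H.jet_mul hy (h u hu) hr
  rw [zero_mul] at h1
  convert h1 using 1
  have := S.t0 y
  rw [zpow_neg]
  field_simp

lemma Sd.bad_grad (S : Sd X d α D t) {v y : Fin (n+1) → k} (hy : y ∈ cone X) (hn : Sd.Near α D t v y) {l : ℤ} {φ : L}
    (h : Bad α t X y l φ) {a b : MvPolynomial (Fin (n+1)) k} (hb : eval y b ≠ 0) (hab : φ * t v ^ l = α a / α b) :
    gradientAt a y ∈ Nv X y := by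
  apply mem_of_perp
  intro u hu
  have h1 := S.bad_near hy hn h (u := u) hu
  rw [hab] at h1
  rw [← Ej_snd, S.H.jet_frac hy hu hb h1, zero_mul]; rfl

lemma Sd.chart (S : Sd X d α D t) {v : Fin (n+1) → k} (hv : v ∈ cone X) {M : ℕ} {l : ℤ} {φ : Fin (M+1) → L} (hφ : ∀ i, Sec α t X l (φ i)) :
    ∃ (e : ℕ) (a : Fin (M+1) → MvPolynomial (Fin (n+1)) k) (b : MvPolynomial (Fin (n+1)) k), (∀ i, (a i).IsHomogeneous e) ∧ b.IsHomogeneous e ∧ 0 < e ∧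
      eval v b ≠ 0 ∧ (∀ i, φ i * t v ^ l = α (a i) / α b) ∧ ∃ F r, MvPolynomial.IsHomogeneous F r ∧ eval v F ≠ 0 ∧
      ∀ y ∈ cone X, eval y F ≠ 0 → ∀ c : Fin (M+1) → k, Bad α t X y l (∑ i, c i • φ i) → ∑ i, c i • gradientAt (a i) y ∈ Nv X y := by
  obtain ⟨e, a, b, ha, hb, hbv, hab⟩ := common_den (denv v) (fun b hb => S.H.ne_of_eval hv hb) (fun i => φ i * t v ^ l) (fun i => by
    obtain ⟨e, a, b, h1, h2, h3, h4⟩ := S.H.hom_rep hv (S.twK (hφ i).1 v l) ((hφ i).2 v hv)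
    exact ⟨e, a, b, h1, h2, h3, h4⟩)
  have hbv : eval v b ≠ 0 := hbv
  obtain ⟨j, hj⟩ : ∃ j, v j ≠ 0 := Function.ne_iff.1 hv.1
  obtain ⟨q, r, hq, hqv, hnear⟩ := S.nbhd hv
  have hjv : eval v (b * MvPolynomial.X j) ≠ 0 := by
    rw [map_mul, eval_X]; exact mul_ne_zero hbv hj
  have hab' : ∀ i, φ i * t v ^ l = α (a i * MvPolynomial.X j) / α (b * MvPolynomial.X j) := by
    intro i
    have : α (MvPolynomial.X j) ≠ 0 := S.H.ne_of_eval hv (by rw [eval_X]; exact hj)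
    rw [hab, map_mul, map_mul, mul_div_mul_right _ _ this]
  refine ⟨e + 1, fun i => a i * MvPolynomial.X j, b * MvPolynomial.X j, fun i => (ha i).mul (isHomogeneous_X k j), hb.mul (isHomogeneous_X k j),
    Nat.succ_pos _, hjv, hab', b * MvPolynomial.X j * q, _, (hb.mul (isHomogeneous_X k j)).mul hq, by rw [map_mul]; exact mul_ne_zero hjv hqv, ?_⟩
  intro y hy hF c hbad
  rw [map_mul] at hF
  have h1 := S.bad_grad hy (hnear y hy (right_ne_zero_of_mul hF)) hbad (a := ∑ i, c i • (a i * MvPolynomial.X j)) (left_ne_zero_of_mul hF) (by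
    rw [map_sum, Finset.sum_mul, Finset.sum_div]
    apply Finset.sum_congr rfl
    intro i _
    rw [map_smul, smul_mul_assoc, hab', smul_div_assoc])
  rw [grad_sum] at h1
  simpa only [grad_smul] using h1

lemma Amp.jet_line' (A : Amp α D t m₀ Θ) {v u : Fin (n+1) → k} (hv : v ∈ cone X) (hu : Perp X v u) {l : ℤ} {φ : L} (hr : RS α t v l φ)
    (hne : val α t v l φ ≠ 0) (κ : DualNumber k)
    (h : ∀ i, Jet α v u (φ * Θ i * t v ^ (l + m₀)) (κ * algebraMap k (DualNumber k) (th α t m₀ Θ v i))) : ∃ c : k, u = c • v := by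
  have H := A.S.H
  obtain ⟨ρ, hρ⟩ := H.exists_jet (u := u) hv hr
  have hρ1 : ρ.fst ≠ 0 := by rw [H.jet_fst hv hρ]; exact hne
  obtain ⟨s, hs⟩ := (unit_of hρ1).exists_left_inv
  apply A.jet_line hv hu (s * κ)
  intro i
  obtain ⟨r, hri⟩ := H.exists_jet (u := u) hv ((A.sec i).2 v hv)
  have h1 := H.jet_mul hv hρ hri
  have h2 := H.jet_unique hv hu (h i) (r := _) (s := ρ * r) (by
    convert h1 using 1
    rw [zpow_add₀ (A.S.t0 v)]; ring)
  rw [mul_assoc, h2, ← mul_assoc, hs, one_mul]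
  convert hri using 1
  rw [mul_comm]

end Bt
end Part21

section Part22
open MvPolynomial
namespace Bt
set_option linter.unusedSectionVars false
set_option linter.unusedVariables false
variable {k : Type} [Field k] {n : ℕ}
attribute [local instance] MvPolynomial.gradedAlgebra

variable {L : Type} [Field L] [Algebra k L] {X : Set (ProjPt k n)} {d : ℕ}
    {α : MvPolynomial (Fin (n+1)) k →ₐ[k] L}
variable [IsAlgClosed k] {D : PD X d → ℤ} {t : (Fin (n+1) → k) → L} {m₀ m : ℕ} {Θ : Fin (m+1) → L}

namespace Amp

lemma lin_aux (A : Amp α D t m₀ Θ) {G : MvPolynomial (Fin (m+1)) k} (hG : G.IsHomogeneous 1) : Sec α t X m₀ (aeval Θ G) ∧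
    ∀ v ∈ cone X, val α t v m₀ (aeval Θ G) = eval (th α t m₀ Θ v) G := by
  have h1 := A.secG hG
  have h2 := fun v (hv : v ∈ cone X) => (A.aux hv hG).2
  rw [one_mul] at h1
  simp only [one_mul] at h2
  exact ⟨h1, h2⟩

lemma sec_mul (A : Amp α D t m₀ Θ) {l l' : ℤ} {φ ψ : L} (h : Sec α t X l φ) (h' : Sec α t X l' ψ) : Sec α t X (l + l') (φ * ψ) :=
  ⟨mul_mem h.1 h'.1, fun v hv => (A.S.mul_aux hv (h.2 v hv) (h'.2 v hv)).1⟩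

variable {M e : ℕ} {l : ℤ} {p0 : Fin (n+1) → k} {φ : Fin (M+1) → L} 
  {a : Fin (M+1) → MvPolynomial (Fin (n+1)) k} {b : MvPolynomial (Fin (n+1)) k}

/-- A base of the sections vanishing at a point -/
structure Sys (A : Amp α D t m₀ Θ) (p0 : Fin (n+1) → k) (l : ℤ) {M : ℕ} (φ : Fin (M+1) → L) : Prop where
  hp : p0 ∈ cone X
  sec : ∀ i, Sec α t X (l + m₀ + m₀) (φ i)
  val : ∀ i, val α t p0 (l + m₀ + m₀) (φ i) = 0
  gen : ∀ ψ, Sec α t X (l + m₀ + m₀) ψ → Bt.val α t p0 (l + m₀ + m₀) ψ = 0 → ∃ c : Fin (M+1) → k, ψ = ∑ i, c i • φ i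
  bpf : ∀ v ∈ cone X, ∃ s, Sec α t X l s ∧ Bt.val α t v l s ≠ 0

lemma span_at [CharZero k] (A : Amp α D t m₀ Θ) (Q : Sys A p0 l φ) {v : Fin (n+1) → k} (hv : v ∈ cone X)
    (hne : Projectivization.mk k p0 Q.hp.1 ≠ Projectivization.mk k v hv.1) (ha : ∀ i, (a i).IsHomogeneous e) (hb : b.IsHomogeneous e) (he : 0 < e)
    (hbv : eval v b ≠ 0) (hab : ∀ i, φ i * t v ^ (l + m₀ + m₀) = α (a i) / α b) :
    ⊤ ≤ Nv X v ⊔ Submodule.span k (Set.range fun i => gradientAt (a i) v) := by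
  have H := A.S.H
  obtain ⟨s, hs, hsv⟩ := Q.bpf v hv
  obtain ⟨ℓ, hℓ, hℓ0, hℓv⟩ := A.th_inj Q.hp hv hne
  obtain ⟨hℓs, hℓval⟩ := A.lin_aux hℓ
  intro x _
  apply mem_of_perp
  intro u hu
  have hu1 : Perp X v u := fun w hw => hu w (Submodule.mem_sup_left hw)
  have hu2 : ∀ i, gradientAt (a i) v ⬝ᵥ u = 0 := fun i => hu _ (Submodule.mem_sup_right (Submodule.subset_span ⟨i, rfl⟩))
  have he0 : (e : k) ≠ 0 := by exact_mod_cast he.ne'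
  obtain ⟨c₀, hc₀⟩ : ∃ c₀, c₀ = (gradientAt b v ⬝ᵥ u) / (e * eval v b) := ⟨_, rfl⟩
  have hu' : Perp X v (u - c₀ • v) := by
    intro w hw
    rw [dotProduct_sub, dotProduct_smul, hu1 w hw, mem_vperp.1 (Nv_le hv hw), smul_zero, sub_zero]
  have hEb : Ej v (u - c₀ • v) b = algebraMap k _ (eval v b) := by
    apply TrivSqZeroExt.ext
    · rw [Ej_fst]; rfl
    · rw [Ej_snd, dotProduct_sub, dotProduct_smul, euler hb, hc₀, smul_eq_mul, div_mul_cancel₀ _ (mul_ne_zero he0 hbv), sub_self]; rfl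
  let κ : DualNumber k := TrivSqZeroExt.inl 1 + TrivSqZeroExt.inr (-(c₀ * e))
  have hEa : ∀ i, Ej v (u - c₀ • v) (a i) = κ * algebraMap k _ (eval v (a i)) := by
    intro i
    apply TrivSqZeroExt.ext
    · rw [Ej_fst, TrivSqZeroExt.fst_mul]
      change _ = (1 + 0) * eval v (a i)
      ring
    · rw [Ej_snd, TrivSqZeroExt.snd_mul, dotProduct_sub, dotProduct_smul, euler (ha i), hu2 i]
      change _ = (1 + 0) * (0 : k) + (0 + -(c₀ * e)) * eval v (a i)
      rw [smul_eq_mul]; ring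
  have key : ∀ ψ, Sec α t X (l + m₀ + m₀) ψ → val α t p0 (l + m₀ + m₀) ψ = 0 →
      Jet α v (u - c₀ • v) (ψ * t v ^ (l + m₀ + m₀)) (κ * algebraMap k _ (val α t v (l + m₀ + m₀) ψ)) := by
    intro ψ h1 h2
    obtain ⟨c, rfl⟩ := Q.gen ψ h1 h2
    have h3 : (∑ i, c i • φ i) * t v ^ (l + m₀ + m₀) = α (∑ i, c i • a i) / α b := by
      rw [map_sum, Finset.sum_mul, Finset.sum_div]
      apply Finset.sum_congr rfl
      intro i _
      rw [map_smul, smul_mul_assoc, hab, smul_div_assoc]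
    refine ⟨_, b, hbv, h3, ?_⟩
    rw [val, h3, H.ev_frac hv hbv, hEb, mul_assoc, ← map_mul, div_mul_cancel₀ _ hbv, map_sum, map_sum, map_sum, Finset.mul_sum]
    apply Finset.sum_congr rfl
    intro i _
    rw [map_smul, hEa, smul_eval, map_mul, Algebra.smul_def]; ring
  obtain ⟨hsl, hslv⟩ := A.S.mul_aux hv (hs.2 v hv) (hℓs.2 v hv)
  have hslv' : val α t v (l + m₀) (s * aeval Θ ℓ) ≠ 0 := by
    rw [hslv, hℓval v hv]; exact mul_ne_zero hsv hℓv
  obtain ⟨c, hc⟩ := A.jet_line' hv hu' hsl hslv' (κ * algebraMap k _ (val α t v (l + m₀) (s * aeval Θ ℓ))) (by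
    intro i
    have h1 := key (s * aeval Θ ℓ * Θ i) (A.sec_mul (A.sec_mul hs hℓs) (A.sec i)) (by
      rw [(A.S.mul_aux Q.hp (A.S.mul_aux Q.hp (hs.2 _ Q.hp) (hℓs.2 _ Q.hp)).1 ((A.sec i).2 _ Q.hp)).2,
        (A.S.mul_aux Q.hp (hs.2 _ Q.hp) (hℓs.2 _ Q.hp)).2, hℓval _ Q.hp, hℓ0, mul_zero, zero_mul])
    rw [(A.S.mul_aux hv hsl ((A.sec i).2 _ hv)).2, map_mul, ← mul_assoc] at h1
    exact h1)
  have huc : u = (c + c₀) • v := by rw [add_smul, ← hc, sub_add_cancel]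
  -- some `a i` does not vanish
  obtain ⟨j, hj⟩ : ∃ j, th α t m₀ Θ v j ≠ 0 := Function.ne_iff.1 (A.ne v hv)
  obtain ⟨i, hi⟩ : ∃ i, eval v (a i) ≠ 0 := by
    by_contra hc0
    push Not at hc0
    obtain ⟨c', hc'⟩ := Q.gen (s * aeval Θ ℓ * Θ j) (A.sec_mul (A.sec_mul hs hℓs) (A.sec j)) (by
      rw [(A.S.mul_aux Q.hp (A.S.mul_aux Q.hp (hs.2 _ Q.hp) (hℓs.2 _ Q.hp)).1 ((A.sec j).2 _ Q.hp)).2,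
        (A.S.mul_aux Q.hp (hs.2 _ Q.hp) (hℓs.2 _ Q.hp)).2, hℓval _ Q.hp, hℓ0, mul_zero, zero_mul])
    have h1 : val α t v (l + m₀ + m₀) (s * aeval Θ ℓ * Θ j) ≠ 0 := by
      rw [(A.S.mul_aux hv hsl ((A.sec j).2 _ hv)).2]
      exact mul_ne_zero hslv' hj
    apply h1
    rw [hc', (A.S.sum_aux hv _ fun i _ => (A.S.smul_aux hv (c' i) ((Q.sec i).2 v hv)).1).2]
    apply Finset.sum_eq_zero
    intro i _
    rw [(A.S.smul_aux hv (c' i) ((Q.sec i).2 v hv)).2, val, hab, H.ev_frac hv hbv, hc0, zero_div, mul_zero]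
  have h1 := hu2 i
  rw [huc, dotProduct_smul, euler (ha i), smul_eq_mul] at h1
  rw [huc, (mul_eq_zero.1 h1).resolve_right (mul_ne_zero he0 hi), zero_smul, dotProduct_zero]

lemma nonzero_at (A : Amp α D t m₀ Θ) (Q : Sys A p0 l φ) 
    (hbv : eval p0 b ≠ 0) (hab : ∀ i, φ i * t p0 ^ (l + m₀ + m₀) = α (a i) / α b) :
    ∃ i, gradientAt (a i) p0 ∉ Nv X p0 := by
  have H := A.S.H
  have hv := Q.hp
  by_contra hcon
  push Not at hcon
  obtain ⟨s, hs, hsv⟩ := Q.bpf p0 hv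
  have ha0 : ∀ i, eval p0 (a i) = 0 := by
    intro i
    have := Q.val i
    rw [Bt.val, hab, H.ev_frac hv hbv] at this
    exact (div_eq_zero_iff.1 this).resolve_right hbv
  obtain ⟨j, hj⟩ : ∃ j, th α t m₀ Θ p0 j ≠ 0 := Function.ne_iff.1 (A.ne p0 hv)
  have hline : ∀ u, Perp X p0 u → ∃ c : k, u = c • p0 := by
    intro u hu
    have key : ∀ ψ, Sec α t X (l + m₀ + m₀) ψ → Bt.val α t p0 (l + m₀ + m₀) ψ = 0 →
        Jet α p0 u (ψ * t p0 ^ (l + m₀ + m₀)) 0 := by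
      intro ψ h1 h2
      obtain ⟨c, rfl⟩ := Q.gen ψ h1 h2
      refine ⟨∑ i, c i • a i, b, hbv, ?_, ?_⟩
      · rw [map_sum, Finset.sum_mul, Finset.sum_div]
        apply Finset.sum_congr rfl
        intro i _
        rw [map_smul, smul_mul_assoc, hab, smul_div_assoc]
      · rw [zero_mul, map_sum]
        apply Finset.sum_eq_zero
        intro i _
        have : Ej p0 u (a i) = 0 := by
          apply TrivSqZeroExt.ext
          · rw [Ej_fst, ha0]; rfl
          · rw [Ej_snd, hu _ (hcon i)]; rfl
        rw [map_smul, this, smul_zero]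
    obtain ⟨hsl, hslv⟩ := A.S.mul_aux hv (hs.2 p0 hv) ((A.sec j).2 p0 hv)
    have hslv' : Bt.val α t p0 (l + m₀) (s * Θ j) ≠ 0 := by
      rw [hslv]; exact mul_ne_zero hsv hj
    obtain ⟨r, hr⟩ := H.exists_jet (u := u) hv (A.S.mul_aux hv hsl ((A.sec j).2 p0 hv)).1
    apply A.jet_line' hv hu hsl hslv' (r * algebraMap k _ (th α t m₀ Θ p0 j)⁻¹)
    intro i
    obtain ⟨x, hx⟩ : ∃ x, x = -((th α t m₀ Θ p0 j)⁻¹ * th α t m₀ Θ p0 i) := ⟨_, rfl⟩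
    have hi := A.S.mul_aux hv hsl ((A.sec i).2 p0 hv)
    have hjj := A.S.mul_aux hv hsl ((A.sec j).2 p0 hv)
    have hxj := A.S.smul_aux hv x hjj.1
    have hsec : ∀ i, Sec α t X (l + m₀ + m₀) (s * Θ j * Θ i) := fun i => A.sec_mul (A.sec_mul hs (A.sec j)) (A.sec i)
    have h1 := key (s * Θ j * Θ i + x • (s * Θ j * Θ j)) ⟨add_mem (hsec i).1 (by rw [Algebra.smul_def]; exact mul_mem (algebraMap_mem _ x) (hsec j).1),
      fun v hv => (A.S.add_aux hv ((hsec i).2 v hv) (A.S.smul_aux hv x ((hsec j).2 v hv)).1).1⟩ (by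
        rw [(A.S.add_aux hv hi.1 hxj.1).2, hxj.2, hi.2, hjj.2]
        change _ * th α t m₀ Θ p0 i + x * (_ * th α t m₀ Θ p0 j) = 0
        rw [hx]; field_simp; ring)
    have h2 := H.jet_add hv h1 (H.jet_mul hv (H.jet_const p0 u (-x)) hr)
    convert h2 using 1
    · rw [Algebra.smul_def, map_neg]; ring
    · rw [hx, neg_neg, map_mul]; ring
  have hdn := dim_le_n H.sm.1 H.sm.2.1 H.sm.2.2.1
  obtain ⟨i, hi⟩ : ∃ i, p0 i ≠ 0 := Function.ne_iff.1 hv.1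
  have htop : (⊤ : Submodule k (Fin (n+1) → k)) ≤ Nv X p0 ⊔ Submodule.span k {Pi.single i 1} := by
    intro x _
    apply mem_of_perp
    intro u hu
    obtain ⟨c, rfl⟩ := hline u fun w hw => hu w (Submodule.mem_sup_left hw)
    have := hu _ (Submodule.mem_sup_right (Submodule.mem_span_singleton_self _))
    rw [dotProduct_smul, single_one_dotProduct, smul_eq_mul] at this
    rw [(mul_eq_zero.1 this).resolve_right hi, zero_smul, dotProduct_zero]
  have h1 := Submodule.finrank_mono htop
  have h2 := Submodule.finrank_add_le_finrank_add_finrank (Nv X p0) (Submodule.span k {(Pi.single i 1 : Fin (n+1) → k)})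
  have h3 := finrank_span_singleton (K := k) (v := (Pi.single i 1 : Fin (n+1) → k)) (by simp)
  rw [finrank_top, Module.finrank_fin_fun] at h1
  rw [finrank_Nv H.sm.2.2.2 hv, h3] at h2
  have := H.hd
  omega

end Amp
end Bt
end Part22

section Part23
open MvPolynomial
namespace Bt
set_option linter.unusedSectionVars false
set_option linter.unusedVariables false
variable {k : Type} [Field k] {n : ℕ}
attribute [local instance] MvPolynomial.gradedAlgebra

variable {L : Type} [Field L] [Algebra k L] {X : Set (ProjPt k n)} {d : ℕ}
    {α : MvPolynomial (Fin (n+1)) k →ₐ[k] L}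
variable [IsAlgClosed k] {D : PD X d → ℤ} {t : (Fin (n+1) → k) → L} {m₀ m : ℕ} {Θ : Fin (m+1) → L}

lemma grad_pt {f : MvPolynomial (Fin (n+1)) k} {e : ℕ} (hf : f.IsHomogeneous e) (c : k) (v : Fin (n+1) → k) :
    gradientAt f (c • v) = c ^ (e - 1) • gradientAt f v := by
  funext j
  exact eval_smul_hom (hf.pderiv (i := j)) v c

lemma Nv_smul (c : k) (v : Fin (n+1) → k) : Nv X (c • v) ≤ Nv X v := by
  apply Submodule.span_le.2
  rintro _ ⟨h, hh, rfl⟩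
  obtain ⟨⟨e, he⟩, h2⟩ := hh
  rw [grad_pt he]
  exact Submodule.smul_mem _ _ (Submodule.subset_span ⟨h, ⟨⟨e, he⟩, h2⟩, rfl⟩)

namespace Amp
variable {M : ℕ} {l : ℤ} {p0 : Fin (n+1) → k} {φ : Fin (M+1) → L} 

lemma bert_pt (A : Amp α D t m₀ Θ) (Q : Sys A p0 l φ) : ∃ p : MvPolynomial (Fin (M+1)) k, p ≠ 0 ∧
    ∀ y ∈ cone X, (∃ x : k, y = x • p0) → ∀ c : Fin (M+1) → k, Bad α t X y (l + m₀ + m₀) (∑ i, c i • φ i) → eval c p = 0 := by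
  obtain ⟨e, a, b, ha, hb, he, hbv, hab, F, r, hF, hFv, hbad⟩ := A.S.chart Q.hp Q.sec
  obtain ⟨i, hi⟩ := A.nonzero_at Q hbv hab
  obtain ⟨f, hf, hN⟩ := Submodule.exists_le_ker_of_notMem hi
  refine ⟨∑ i, C (f (gradientAt (a i) p0)) * MvPolynomial.X i, ?_, ?_⟩
  · intro h0
    have h1 := congrArg (eval (Pi.single i (1:k))) h0
    rw [map_sum, map_zero, Finset.sum_eq_single i] at h1
    · rw [map_mul, eval_C, eval_X, Pi.single_eq_same, mul_one] at h1; exact hf h1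
    · intro j _ hj
      rw [map_mul, eval_X, Pi.single_eq_of_ne hj, mul_zero]
    · intro h; exact absurd (Finset.mem_univ _) h
  · rintro y hy ⟨x, rfl⟩ c hc
    have hx : x ≠ 0 := by rintro rfl; exact hy.1 (zero_smul _ _)
    have h1 := hbad _ hy (by rw [eval_smul_hom hF]; exact mul_ne_zero (pow_ne_zero _ hx) hFv) c hc
    have h2 := hN (Nv_smul _ _ h1)
    simp only [grad_pt (ha _)] at h2
    rw [LinearMap.mem_ker, map_sum] at h2
    have h3 : x ^ (e - 1) * eval c (∑ i, C (f (gradientAt (a i) p0)) * MvPolynomial.X i) = 0 := by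
      rw [← h2, map_sum, Finset.mul_sum]
      apply Finset.sum_congr rfl
      intro i _
      rw [map_smul, map_smul, map_mul, eval_C, eval_X, smul_eq_mul, smul_eq_mul]; ring
    exact (mul_eq_zero.1 h3).resolve_left (pow_ne_zero _ hx)

lemma bert_ne [CharZero k] (A : Amp α D t m₀ Θ) (Q : Sys A p0 l φ) {v : Fin (n+1) → k} (hv : v ∈ cone X) (hne : ¬ ∃ x : k, v = x • p0) :
    ∃ F, eval v F ≠ 0 ∧ ∃ p : MvPolynomial (Fin (M+1)) k, p ≠ 0 ∧
    ∀ y ∈ cone X, eval y F ≠ 0 → ∀ c : Fin (M+1) → k, Bad α t X y (l + m₀ + m₀) (∑ i, c i • φ i) → eval c p = 0 := by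
  obtain ⟨e, a, b, ha, hb, he, hbv, hab, F, r, hF, hFv, hbad⟩ := A.S.chart hv Q.sec
  have h1 := A.span_at Q hv (by
    intro h
    obtain ⟨x, hx⟩ := (Projectivization.mk_eq_mk_iff' k _ _ _ _).1 h.symm
    exact hne ⟨x, hx.symm⟩) ha hb he hbv hab
  obtain ⟨F', r', hF', hFv', p, hp, hpc⟩ := A.S.H.bert_lin ha hv h1
  refine ⟨F * F', by rw [map_mul]; exact mul_ne_zero hFv hFv', p, hp, ?_⟩
  intro y hy hFy c hc
  rw [map_mul] at hFy
  exact hpc y hy (right_ne_zero_of_mul hFy) c (hbad y hy (left_ne_zero_of_mul hFy) c hc)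

lemma bertini [CharZero k] (A : Amp α D t m₀ Θ) (Q : Sys A p0 l φ) : ∃ p : MvPolynomial (Fin (M+1)) k, p ≠ 0 ∧
    ∀ c : Fin (M+1) → k, eval c p ≠ 0 → ∀ y ∈ cone X, ¬ Bad α t X y (l + m₀ + m₀) (∑ i, c i • φ i) := by
  classical
  obtain ⟨T, hT⟩ := qc (fun F : {F : MvPolynomial (Fin (n+1)) k // ∃ p : MvPolynomial (Fin (M+1)) k, p ≠ 0 ∧
    ∀ y ∈ cone X, eval y F ≠ 0 → ∀ c : Fin (M+1) → k, Bad α t X y (l + m₀ + m₀) (∑ i, c i • φ i) → eval c p = 0} => F.1)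
  obtain ⟨p₀, hp₀, hp₀c⟩ := A.bert_pt Q
  let pp : {F : MvPolynomial (Fin (n+1)) k // ∃ p : MvPolynomial (Fin (M+1)) k, p ≠ 0 ∧
    ∀ y ∈ cone X, eval y F ≠ 0 → ∀ c : Fin (M+1) → k, Bad α t X y (l + m₀ + m₀) (∑ i, c i • φ i) → eval c p = 0} → 
      MvPolynomial (Fin (M+1)) k := fun F => F.2.choose
  refine ⟨p₀ * ∏ F ∈ T, pp F, mul_ne_zero hp₀ (Finset.prod_ne_zero_iff.2 fun F _ => F.2.choose_spec.1), ?_⟩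
  intro c hc y hy hbad
  rw [map_mul, map_prod] at hc
  by_cases h : ∃ x : k, y = x • p0
  · exact left_ne_zero_of_mul hc (hp₀c y hy h c hbad)
  · obtain ⟨F, hFy, hF⟩ := A.bert_ne Q hy h
    obtain ⟨j, hj, hjy⟩ := hT y ⟨F, hF⟩ hFy
    exact Finset.prod_ne_zero_iff.1 (right_ne_zero_of_mul hc) j hj (j.2.choose_spec.2 y hy hjy c hbad)

end Amp
end Bt
end Part23

section Part24
open MvPolynomial
namespace Bt
set_option linter.unusedSectionVars false
set_option linter.unusedVariables false
variable {k : Type} [Field k] {n : ℕ}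
attribute [local instance] MvPolynomial.gradedAlgebra

variable {L : Type} [Field L] [Algebra k L] {X : Set (ProjPt k n)} {d : ℕ}
    {α : MvPolynomial (Fin (n+1)) k →ₐ[k] L}
variable [IsAlgClosed k] {D : PD X d → ℤ} {t : (Fin (n+1) → k) → L} {m₀ m : ℕ} {Θ : Fin (m+1) → L}

namespace Sd
variable {N : ℤ} {s : L} 

lemma bad_of (S : Sd X d α D t) {v : Fin (n+1) → k} (hv : v ∈ cone X) {f g h : L} (hf : Reg α v f) (hg : Reg α v g) (hh : Reg α v h)
    (hf0 : ev α v f = 0) (hg0 : ev α v g = 0) (hs : s * t v ^ N = f * g * h) : Bad α t X v N s := by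
  intro u hu
  obtain ⟨r1, hr1⟩ := S.H.exists_jet (u := u) hv hf
  obtain ⟨r2, hr2⟩ := S.H.exists_jet (u := u) hv hg
  obtain ⟨r3, hr3⟩ := S.H.exists_jet (u := u) hv hh
  have h1 := S.H.jet_mul hv (S.H.jet_mul hv hr1 hr2) hr3
  rw [← hs] at h1
  have e1 := S.H.jet_fst hv hr1
  have e2 := S.H.jet_fst hv hr2
  rw [hf0] at e1; rw [hg0] at e2
  have h0 : r1 * r2 = 0 := by
    apply TrivSqZeroExt.ext
    · rw [TrivSqZeroExt.fst_mul, e1, zero_mul]; rfl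
    · rw [TrivSqZeroExt.snd_mul, e1, e2, zero_smul, MulOpposite.op_zero, zero_smul, zero_add]; rfl
  rwa [h0, zero_mul] at h1

lemma eq_reg (S : Sd X d α D t) {v : Fin (n+1) → k} (hv : v ∈ cone X) {Y : PD X d} (hY : v ∈ cone Y.1) : 
    ∃ τ ∈ K0 α, τ ≠ 0 ∧ Reg α v τ ∧ ev α v τ = 0 ∧ vv α X Y.1 τ = 1 ∧ ∀ Y' : PD X d, v ∈ cone Y'.1 → Y' ≠ Y → vv α X Y'.1 τ = 0 := by
  obtain ⟨τ, h1, h2, h3, h4⟩ := S.H.local_eq_prime hv Y.2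
  have hr : Reg α v τ := by
    apply S.H.reg_of_vv hv h1 h2
    intro Y' hY' hvY'
    by_cases h : Y' = Y.1
    · rw [h, h3 hY]; norm_num
    · rw [h4 Y' hY' hvY' h]
  refine ⟨τ, h1, h2, hr, ?_, h3 hY, fun Y' h h' => h4 _ Y'.2 h fun hc => h' (Subtype.ext hc)⟩
  by_contra h0
  have := S.H.vv_eq_zero Y.2 hY hr h0
  rw [h3 hY] at this
  exact one_ne_zero this

/-- at a good point there is only one component, of multiplicity one -/
lemma one_comp (S : Sd X d α D t) (hs : Sec α t X N s) (hs0 : s ≠ 0) {v : Fin (n+1) → k} (hv : v ∈ cone X) (hb : ¬ Bad α t X v N s)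
    {Y : PD X d} (hY : v ∈ cone Y.1) (hw : 1 ≤ vv α X Y.1 s + N * D Y) : vv α X Y.1 s + N * D Y = 1 ∧ 
      ∀ Y' : PD X d, v ∈ cone Y'.1 → Y' ≠ Y → vv α X Y'.1 s + N * D Y' = 0 := by
  obtain ⟨τ, h1, h2, h3, h4, h5, h6⟩ := S.eq_reg hv hY
  have hst := S.twK hs.1 v N
  have hst0 := S.tw0 hs0 v N
  have hww : ∀ Y' : PD X d, v ∈ cone Y'.1 → 0 ≤ vv α X Y'.1 s + N * D Y' := fun Y' h => S.ww_nonneg h hs0 (hs.2 v hv)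
  constructor
  · by_contra hne
    apply hb
    refine S.bad_of hv h3 h3 (h := s * t v ^ N / (τ * τ)) ?_ h4 h4 (by field_simp)
    refine S.H.reg_of_vv hv (div_mem hst (mul_mem h1 h1)) (div_ne_zero hst0 (mul_ne_zero h2 h2)) ?_
    intro Y' hY' hvY'
    rw [S.H.vv_div hY' hst0 (mul_ne_zero h2 h2), S.H.vv_mul hY' h2 h2, S.tw (Y := ⟨Y', hY'⟩) hvY' hs0 N]
    change 0 ≤ vv α X Y' s + N * D ⟨Y', hY'⟩ - (vv α X Y' τ + vv α X Y' τ)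
    by_cases h : (⟨Y', hY'⟩ : PD X d) = Y
    · subst h
      have h5' : vv α X Y' τ = 1 := h5
      have : 1 ≤ vv α X Y' s + N * D ⟨Y', hY'⟩ := hw
      have : vv α X Y' s + N * D ⟨Y', hY'⟩ ≠ 1 := hne
      omega
    · have h6' : vv α X Y' τ = 0 := h6 ⟨Y', hY'⟩ hvY' h
      have : 0 ≤ vv α X Y' s + N * D ⟨Y', hY'⟩ := hww ⟨Y', hY'⟩ hvY'
      rw [h6']; omega
  · intro Y1 hvY1 hne
    by_contra hne0
    apply hb
    obtain ⟨τ', h1', h2', h3', h4', h5', h6'⟩ := S.eq_reg hv hvY1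
    refine S.bad_of hv h3 h3' (h := s * t v ^ N / (τ * τ')) ?_ h4 h4' (by field_simp)
    refine S.H.reg_of_vv hv (div_mem hst (mul_mem h1 h1')) (div_ne_zero hst0 (mul_ne_zero h2 h2')) ?_
    intro Y' hY' hvY'
    rw [S.H.vv_div hY' hst0 (mul_ne_zero h2 h2'), S.H.vv_mul hY' h2 h2', S.tw (Y := ⟨Y', hY'⟩) hvY' hs0 N]
    change 0 ≤ vv α X Y' s + N * D ⟨Y', hY'⟩ - (vv α X Y' τ + vv α X Y' τ')
    have h0 : 0 ≤ vv α X Y' s + N * D ⟨Y', hY'⟩ := hww ⟨Y', hY'⟩ hvY'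
    by_cases h : (⟨Y', hY'⟩ : PD X d) = Y
    · have e1 : vv α X Y' τ' = 0 := h6' ⟨Y', hY'⟩ hvY' (by rw [h]; exact hne.symm)
      rw [e1]
      subst h
      have e2 : vv α X Y' τ = 1 := h5
      have : 1 ≤ vv α X Y' s + N * D ⟨Y', hY'⟩ := hw
      omega
    · have e1 : vv α X Y' τ = 0 := h6 ⟨Y', hY'⟩ hvY' h
      rw [e1]
      by_cases h' : (⟨Y', hY'⟩ : PD X d) = Y1
      · subst h'
        have e2 : vv α X Y' τ' = 1 := h5'
        have : vv α X Y' s + N * D ⟨Y', hY'⟩ ≠ 0 := hne0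
        omega
      · have e2 : vv α X Y' τ' = 0 := h6' ⟨Y', hY'⟩ hvY' h'
        omega

lemma smooth_comp (S : Sd X d α D t) (hs : Sec α t X N s) (hs0 : s ≠ 0) {v : Fin (n+1) → k} (hb : ¬ Bad α t X v N s)
    {Y : PD X d} (hY : v ∈ cone Y.1) (hw : 1 ≤ vv α X Y.1 s + N * D Y) : Module.finrank k (Nv Y.1 v) = n - (d - 1) := by
  have hv := S.sub hY
  obtain ⟨e, e', f, u, hf, hu, hfY, hfX, huv, hgen⟩ := S.H.local_gen Y.2 hv
  have hfv := mem_IX.1 hfY v hY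
  have hle : Nv X v ≤ Nv Y.1 v := by
    apply Submodule.span_le.2
    rintro _ ⟨h, hh, rfl⟩
    exact grad_mem_Nv (IX_anti Y.2.1 (mem_homV.1 hh).2) v
  have hN : Nv Y.1 v = Nv X v ⊔ Submodule.span k {gradientAt f v} := by
    apply le_antisymm
    · apply Submodule.span_le.2
      rintro _ ⟨h, hh, rfl⟩
      have hhY := (mem_homV.1 hh).2
      obtain ⟨c, hc⟩ := hgen h hhY
      have h1 := grad_mem_Nv hc v
      rw [grad_sub, grad_mul, grad_mul, hfv, mem_IX.1 hhY v hY, zero_smul, zero_smul, add_zero, add_zero] at h1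
      have h2 : gradientAt h v = (eval v u)⁻¹ • (eval v u • gradientAt h v - eval v c • gradientAt f v) + ((eval v u)⁻¹ * eval v c) • gradientAt f v := by
        rw [smul_sub, smul_smul, inv_mul_cancel₀ huv, one_smul, smul_smul, sub_add_cancel]
      rw [h2]
      exact Submodule.add_mem _ (Submodule.mem_sup_left (Submodule.smul_mem _ _ h1))
        (Submodule.mem_sup_right (Submodule.smul_mem _ _ (Submodule.mem_span_singleton_self _)))
    · apply sup_le hle
      rw [Submodule.span_singleton_le_iff_mem]
      exact grad_mem_Nv hfY v
  have hnot : gradientAt f v ∉ Nv X v := by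
    intro hmem
    apply hb
    intro w hwp
    obtain ⟨a, b, hbv, hab⟩ := hs.2 v hv
    have hst0 := S.tw0 hs0 v N
    have hb0 : α b ≠ 0 := S.H.ne_of_eval hv hbv
    have ha0 : α a ≠ 0 := by rintro h; rw [h, zero_div] at hab; exact hst0 hab
    have h1 := S.tw hY hs0 N
    rw [hab, S.H.vv_frac Y.2 ha0 hb0, (S.H.ord_eq_zero Y.2 (S.H.ker_ne.1 hb0)).2 (fun h => hbv (mem_IX.1 h v hY))] at h1
    have haY : a ∈ IX Y.1 := by
      by_contra h
      rw [(S.H.ord_eq_zero Y.2 (S.H.ker_ne.1 ha0)).2 h] at h1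
      simp at h1; omega
    obtain ⟨c, hc⟩ := hgen a haY
    have hu0 : α u ≠ 0 := S.H.ne_of_eval hv huv
    have h2 : α u * α a = α c * α f := by
      rw [← sub_eq_zero, ← map_mul, ← map_mul, ← map_sub]; exact (S.H.ker _).2 hc
    refine ⟨c * f, u * b, by rw [map_mul]; exact mul_ne_zero huv hbv, ?_, ?_⟩
    · rw [hab, map_mul, map_mul, ← h2, mul_div_mul_left _ _ hu0]
    · have : Ej v w f = 0 := by
        apply TrivSqZeroExt.ext
        · rw [Ej_fst, hfv]; rfl
        · rw [Ej_snd, hwp _ hmem]; rfl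
      rw [map_mul, this, mul_zero, zero_mul]
  have hdn := dim_le_n S.H.sm.1 S.H.sm.2.1 S.H.sm.2.2.1
  have hd := S.H.hd
  have hfr := finrank_Nv S.H.sm.2.2.2 hv
  have h1 := Submodule.finrank_lt_finrank_of_lt (s := Nv X v) (t := Nv Y.1 v) (lt_of_le_of_ne hle fun h => hnot (h ▸ grad_mem_Nv hfY v))
  have h2 := Submodule.finrank_add_le_finrank_add_finrank (Nv X v) (Submodule.span k {gradientAt f v})
  have h3 := finrank_span_singleton (K := k) (v := gradientAt f v) (fun h => hnot (h ▸ zero_mem _))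
  rw [← hN] at h2
  omega

end Sd
end Bt
end Part24

section Part25
open MvPolynomial
namespace Bt
set_option linter.unusedSectionVars false
set_option linter.unusedVariables false
variable {k : Type} [Field k] {n : ℕ}
attribute [local instance] MvPolynomial.gradedAlgebra

variable {L : Type} [Field L] [Algebra k L] {X : Set (ProjPt k n)} {d : ℕ}
    {α : MvPolynomial (Fin (n+1)) k →ₐ[k] L}
variable [IsAlgClosed k] {D : PD X d → ℤ} {t : (Fin (n+1) → k) → L} {m₀ m : ℕ} {Θ : Fin (m+1) → L}

lemma Setup.vv_sum (H : Setup X d α) {Y : Set (ProjPt k n)} (hY : IsPrimeDivisorOn X d Y) {ι : Type} (s : Finset ι) {f : ι → L} {C : ℤ}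
    (h : ∀ i ∈ s, f i = 0 ∨ C ≤ vv α X Y (f i)) : ∑ i ∈ s, f i = 0 ∨ C ≤ vv α X Y (∑ i ∈ s, f i) := by
  classical
  induction s using Finset.induction_on with
  | empty => simp
  | insert a s ha ih =>
    rw [Finset.sum_insert ha]
    have h1 := h a (Finset.mem_insert_self _ _)
    have h2 := ih fun i hi => h i (Finset.mem_insert_of_mem hi)
    by_cases e1 : f a = 0
    · rw [e1, zero_add]; exact h2
    by_cases e2 : ∑ i ∈ s, f i = 0
    · rw [e2, add_zero]; exact h1
    by_cases e3 : f a + ∑ i ∈ s, f i = 0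
    · exact Or.inl e3
    exact Or.inr ((le_min (h1.resolve_left e1) (h2.resolve_left e2)).trans (H.vv_add hY e1 e2 e3))

lemma Sd.pd_cone (S : Sd X d α D t) (Y : PD X d) : ∃ v, v ∈ cone Y.1 := by
  obtain ⟨x, hx⟩ := Y.2.2.2.1.1
  exact ⟨_, cone_rep hx⟩

namespace Amp

lemma lift [CharZero k] (A : Amp α D t m₀ Θ) {B : Set (ProjPt k n)} (hB : B ⊆ X) (hBc : IsClosedSub B) (hBi : IsIrredSub B) (Y1 : PD X d)
    {e : ℕ} {τ : L} (hτ : Sec α t X e τ) (hτv : ¬ Sd.Van α t B e τ) :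
    ∃ C : ℤ, ∀ (l : ℤ) (q : ℕ) (φ : L), l + e = (q * m₀ : ℕ) → Sec α t B l φ →
      ∃ ψ, Sec α t B l ψ ∧ Sd.Van α t B l (φ - ψ) ∧ (ψ = 0 ∨ C ≤ vv α X Y1.1 ψ + l * D Y1) := by
  classical
  obtain ⟨Δ, δ, hδ, hδ', hcond⟩ := A.cond hB hBc hBi
  have hBX : ∀ {v}, v ∈ cone B → v ∈ cone X := fun ⟨h, h'⟩ => ⟨h, hB h'⟩
  let P : MvPolynomial (Fin (m+1)) k → ℕ → ℤ → L → Prop := fun G q l φ => l + e = (q * m₀ : ℕ) ∧ Sec α t B l φ ∧ G.IsHomogeneous (Δ + q) ∧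
    ∀ v ∈ cone B, eval (th α t m₀ Θ v) δ * (val α t v l φ * val α t v e τ) = eval (th α t m₀ Θ v) G
  have hP : ∀ (l : ℤ) (q : ℕ) φ, l + e = (q * m₀ : ℕ) → Sec α t B l φ → ∃ G, P G q l φ := by
    intro l q φ hl hφ
    obtain ⟨G, h1, h2⟩ := hcond q (φ * τ) ⟨mul_mem hφ.1 hτ.1, fun v hv => by
      rw [← hl]; exact (A.S.mul_aux (hBX hv) (hφ.2 v hv) (hτ.2 v (hBX hv))).1⟩
    refine ⟨G, hl, hφ, h1, fun v hv => ?_⟩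
    rw [← h2 v hv, ← hl, (A.S.mul_aux (hBX hv) (hφ.2 v hv) (hτ.2 v (hBX hv))).2]
  obtain ⟨T, hT, hspan⟩ := Submodule.fg_span_iff_fg_span_finset_subset {G | ∃ q l φ, P G q l φ} |>.1
    (IsNoetherian.noetherian (Submodule.span (MvPolynomial (Fin (m+1)) k) {G | ∃ q l φ, P G q l φ}))
  have hT' : ∀ g, g ∈ T → ∃ q l φ, P g q l φ := fun g hg => hT hg
  choose! qf lf φf hf using hT'
  obtain ⟨C, hC⟩ := (T.image fun g => vv α X Y1.1 (φf g) + lf g * D Y1).bddBelow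
  refine ⟨C, fun l q φ hl hφ => ?_⟩
  obtain ⟨G, hG⟩ := hP l q φ hl hφ
  have hGT : G ∈ Submodule.span (MvPolynomial (Fin (m+1)) k) (T : Set (MvPolynomial (Fin (m+1)) k)) := by
    rw [← hspan]; exact Submodule.subset_span ⟨q, l, φ, hG⟩
  obtain ⟨f, -, hfG⟩ := Submodule.mem_span_finset.1 hGT
  obtain ⟨R, hR⟩ : ∃ R : MvPolynomial (Fin (m+1)) k → MvPolynomial (Fin (m+1)) k,
    ∀ g, R g = if qf g ≤ q then homogeneousComponent (q - qf g) (f g) else 0 := ⟨_, fun g => rfl⟩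
  have hRG : ∑ g ∈ T, R g * g = G := by
    have h1 : homogeneousComponent (Δ + q) G = G := by
      rw [homogeneousComponent_of_mem (n := Δ + q) hG.2.2.1, if_pos rfl]
    rw [← h1, ← hfG, map_sum]
    apply Finset.sum_congr rfl
    intro g hg
    rw [hR, smul_eq_mul]
    split_ifs with h
    · rw [show Δ + q = (q - qf g) + (Δ + qf g) by omega, comp_mul_hom (hf g hg).2.2.1]
    · rw [zero_mul, comp_mul_hom_lt (hf g hg).2.2.1 (by omega)]
  have hterm : ∀ g ∈ T, (R g = 0) ∨ ((R g).IsHomogeneous (q - qf g) ∧ ((q - qf g) * m₀ : ℕ) + lf g = l) := by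
    intro g hg
    rw [hR]
    split_ifs with h
    · refine Or.inr ⟨homogeneousComponent_isHomogeneous _ _, ?_⟩
      have h1 := (hf g hg).1
      zify [h] at h1 hl ⊢
      linarith
    · exact Or.inl rfl
  have hsec : ∀ g ∈ T, ∀ v ∈ cone B, RS α t v l (aeval Θ (R g) * φf g) ∧
      val α t v l (aeval Θ (R g) * φf g) = eval (th α t m₀ Θ v) (R g) * val α t v (lf g) (φf g) := by
    intro g hg v hv
    rcases hterm g hg with h | ⟨h, h'⟩
    · rw [h, map_zero, zero_mul, map_zero, zero_mul]
      exact ⟨A.S.zero_aux (hBX hv) l, A.S.val_zero (hBX hv) l⟩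
    · rw [← h', ← (A.aux (hBX hv) h).2]
      exact A.S.mul_aux (hBX hv) (A.aux (hBX hv) h).1 ((hf g hg).2.1.2 v hv)
  have hK : ∀ g ∈ T, aeval Θ (R g) * φf g ∈ K0 α := by
    intro g hg
    rcases hterm g hg with h | ⟨h, h'⟩
    · rw [h, map_zero, zero_mul]; exact zero_mem _
    · exact mul_mem (A.secG h).1 (hf g hg).2.1.1
  obtain ⟨ψ, hψ⟩ : ∃ ψ, ψ = ∑ g ∈ T, aeval Θ (R g) * φf g := ⟨_, rfl⟩
  have hψs : Sec α t B l ψ := by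
    rw [hψ]
    exact ⟨sum_mem hK, fun v hv => (A.S.sum_aux (hBX hv) T fun g hg => (hsec g hg v hv).1).1⟩
  have hψv : ∀ v ∈ cone B, val α t v l ψ = ∑ g ∈ T, eval (th α t m₀ Θ v) (R g) * val α t v (lf g) (φf g) := by
    intro v hv
    rw [hψ, (A.S.sum_aux (hBX hv) T fun g hg => (hsec g hg v hv).1).2]
    exact Finset.sum_congr rfl fun g hg => (hsec g hg v hv).2
  have hneg : ∀ v ∈ cone B, RS α t v l ((-1 : k) • ψ) ∧ val α t v l ((-1 : k) • ψ) = -1 * val α t v l ψ := 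
    fun v hv => A.S.smul_aux (hBX hv) _ (hψs.2 v hv)
  have hsub : φ - ψ = φ + (-1 : k) • ψ := by rw [neg_smul, one_smul, sub_eq_add_neg]
  have hds : Sec α t B l (φ - ψ) := ⟨sub_mem hφ.1 hψs.1, fun v hv => by
    rw [hsub]; exact (A.S.add_aux (hBX hv) (hφ.2 v hv) (hneg v hv).1).1⟩
  refine ⟨ψ, hψs, ?_, ?_⟩
  · have hδs : Sec α t B (Δ * m₀ : ℕ) (aeval Θ δ) := ⟨(A.secG hδ).1, fun v hv => (A.aux (hBX hv) hδ).1⟩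
    have hτs : Sec α t B e τ := ⟨hτ.1, fun v hv => hτ.2 v (hBX hv)⟩
    have hdτ : Sec α t B (l + e) ((φ - ψ) * τ) := ⟨mul_mem hds.1 hτ.1, fun v hv => 
      (A.S.mul_aux (hBX hv) (hds.2 v hv) (hτs.2 v hv)).1⟩
    have hvan : Sd.Van α t B ((Δ * m₀ : ℕ) + (l + e)) (aeval Θ δ * ((φ - ψ) * τ)) := by
      intro v hv
      rw [(A.S.mul_aux (hBX hv) (hδs.2 v hv) (hdτ.2 v hv)).2, (A.S.mul_aux (hBX hv) (hds.2 v hv) (hτs.2 v hv)).2, (A.aux (hBX hv) hδ).2,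
        hsub, (A.S.add_aux (hBX hv) (hφ.2 v hv) (hneg v hv).1).2, (hneg v hv).2, hψv v hv]
      have h1 := hG.2.2.2 v hv
      rw [← hRG, map_sum] at h1
      have h2 : ∑ g ∈ T, eval (th α t m₀ Θ v) (R g * g) = 
          eval (th α t m₀ Θ v) δ * ((∑ g ∈ T, eval (th α t m₀ Θ v) (R g) * val α t v (lf g) (φf g)) * val α t v e τ) := by
        rw [Finset.sum_mul, Finset.mul_sum]
        apply Finset.sum_congr rfl
        intro g hg
        rw [map_mul, ← (hf g hg).2.2.2 v hv]; ring
      rw [h2] at h1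
      linear_combination h1 - 0
    rcases A.S.van_prime hB hBi hδs hdτ hvan with h | h
    · refine absurd ((A.mem_IW hB hδ).2 fun v hv => ?_) hδ'
      rw [← (A.aux (hBX hv) hδ).2]; exact h v hv
    · exact (A.S.van_prime hB hBi hds hτs h).resolve_right hτv
  · rw [hψ]
    have := A.S.H.vv_sum Y1.2 T (f := fun g => aeval Θ (R g) * φf g) (C := C - l * D Y1) (by
      intro g hg
      by_cases h0 : aeval Θ (R g) = 0
      · left; rw [h0, zero_mul]
      by_cases h1 : φf g = 0
      · left; rw [h1, mul_zero]
      right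
      rw [A.S.H.vv_mul Y1.2 h0 h1]
      rcases hterm g hg with h | ⟨h, h'⟩
      · exact absurd (by rw [h, map_zero]) h0
      obtain ⟨v, hv⟩ := A.S.pd_cone Y1
      have h2 := A.S.ww_nonneg hv h0 (A.aux (A.S.sub hv) h).1
      have h3 : C ≤ vv α X Y1.1 (φf g) + lf g * D Y1 := hC (Finset.mem_coe.2 (Finset.mem_image_of_mem _ hg))
      have h4 : l * D Y1 = (((q - qf g) * m₀ : ℕ) : ℤ) * D Y1 + lf g * D Y1 := by rw [← h', add_mul]
      generalize (((q - qf g) * m₀ : ℕ) : ℤ) * D Y1 = x at *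
      linarith)
    rcases this with h | h
    · exact Or.inl h
    · right; linarith

end Amp
end Bt
end Part25

section Part26
open MvPolynomial
namespace Bt
set_option linter.unusedSectionVars false
set_option linter.unusedVariables false
variable {k : Type} [Field k] {n : ℕ}
attribute [local instance] MvPolynomial.gradedAlgebra

variable {L : Type} [Field L] [Algebra k L] {X : Set (ProjPt k n)} {d : ℕ}
    {α : MvPolynomial (Fin (n+1)) k →ₐ[k] L}
variable [IsAlgClosed k] {D : PD X d → ℤ} {t : (Fin (n+1) → k) → L} {m₀ m : ℕ} {Θ : Fin (m+1) → L}

lemma Sd.two_pts (S : Sd X d α D t) (Y : PD X d) : ∃ x x', ∃ (hx : x ∈ cone Y.1) (hx' : x' ∈ cone Y.1),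
    Projectivization.mk k x hx.1 ≠ Projectivization.mk k x' hx'.1 := by
  obtain ⟨c, hc, hc'⟩ := Y.2.2.2.2.1
  have hd := S.H.hd
  have hlt : c 0 < c (Fin.last _) := hc (by rw [Fin.lt_def]; simp; omega)
  obtain ⟨p, hp⟩ := (hc' 0).2.2.1
  obtain ⟨q, hq, hq'⟩ := Set.exists_of_ssubset hlt
  have h1 := (hc' 0).1 hp
  have h2 := (hc' _).1 hq
  refine ⟨p.rep, q.rep, cone_rep h1, cone_rep h2, ?_⟩
  rw [Projectivization.mk_rep, Projectivization.mk_rep]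
  rintro rfl
  exact hq' hp

/-- two components -/
structure Irr (α : MvPolynomial (Fin (n+1)) k →ₐ[k] L) (D : PD X d → ℤ) (t : (Fin (n+1) → k) → L) (N : ℤ) (s : L) (Y0 Y1 : PD X d) : Prop where
  sec : Sec α t X N s
  s0 : s ≠ 0
  good : ∀ y ∈ cone X, ¬ Bad α t X y N s
  w0 : 1 ≤ vv α X Y0.1 s + N * D Y0
  w1 : 1 ≤ vv α X Y1.1 s + N * D Y1
  ne : Y1 ≠ Y0
  pos : 0 < N

namespace Amp
variable {N l : ℤ} {s φ : L} {Y0 Y1 : PD X d}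

lemma dv (A : Amp α D t m₀ Θ) (I : Irr α D t N s Y0 Y1) (hφ : Sec α t Y0.1 l φ) (h0 : φ ≠ 0) (hv : Sd.Van α t Y0.1 l φ) :
    Sec α t Y0.1 (l - N) (φ / s) ∧ ∀ Y : PD X d, vv α X Y.1 (φ / s) + (l - N) * D Y = (vv α X Y.1 φ + l * D Y) - (vv α X Y.1 s + N * D Y) := by
  have hw : ∀ Y : PD X d, vv α X Y.1 (φ / s) + (l - N) * D Y = (vv α X Y.1 φ + l * D Y) - (vv α X Y.1 s + N * D Y) := by
    intro Y
    rw [A.S.H.vv_div Y.2 h0 I.s0]; ring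
  refine ⟨⟨div_mem hφ.1 I.sec.1, fun v hvY => A.S.rs_of (A.S.sub hvY) (div_mem hφ.1 I.sec.1) (div_ne_zero h0 I.s0) fun Y hY => ?_⟩, hw⟩
  rw [hw]
  obtain ⟨h1, h2⟩ := A.S.one_comp I.sec I.s0 (A.S.sub hvY) (I.good v (A.S.sub hvY)) hvY I.w0
  by_cases h : Y = Y0
  · subst h
    have := (A.S.van_divisor Y h0 hφ).1 hv
    linarith
  · rw [h2 Y hY h]
    have := A.S.ww_nonneg hY h0 (hφ.2 v hvY)
    linarith

lemma neg_zero [CharZero k] (A : Amp α D t m₀ Θ) (I : Irr α D t N s Y0 Y1) (hl : l < 0) (hφ : Sec α t Y0.1 l φ) : φ = 0 := by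
  have key : ∀ (b : ℕ) (l : ℤ) (φ : L), l < 0 → Sec α t Y0.1 l φ → φ ≠ 0 → vv α X Y0.1 φ + l * D Y0 < b → False := by
    intro b
    induction b with
    | zero =>
      intro l φ hl hφ h0 hb
      obtain ⟨v, hv⟩ := A.S.pd_cone Y0
      have := A.S.ww_nonneg hv h0 (hφ.2 v hv)
      push_cast at hb
      linarith
    | succ b ih =>
      intro l φ hl hφ h0 hb
      obtain ⟨x, x', hx, hx', hne⟩ := A.S.two_pts Y0
      have hq : (-((( -l).toNat * m₀ : ℕ) : ℤ)) = (m₀ : ℤ) * l := by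
        push_cast
        rw [Int.toNat_of_nonneg (by omega)]; ring
      have hvan := A.neg_van Y0.2.1 Y0.2.2.1 Y0.2.2.2.1 hx hx' hne (q := (-l).toNat) (by omega) (φ := φ ^ m₀) (by
        rw [hq]
        exact ⟨pow_mem hφ.1 _, fun v hv => (A.S.pow_aux (A.S.sub hv) (hφ.2 v hv) m₀).1⟩)
      have hvan' : Sd.Van α t Y0.1 l φ := by
        intro v hv
        have h1 := hvan v hv
        rw [hq, (A.S.pow_aux (A.S.sub hv) (hφ.2 v hv) m₀).2] at h1
        exact pow_eq_zero_iff A.pos.ne' |>.1 h1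
      obtain ⟨h1, h2⟩ := A.dv I hφ h0 hvan'
      refine ih (l - N) (φ / s) (by linarith [I.pos]) h1 (div_ne_zero h0 I.s0) ?_
      rw [h2]
      have := I.w0
      push_cast at hb
      linarith
  by_contra h0
  obtain ⟨v, hv⟩ := A.S.pd_cone Y0
  exact key ((vv α X Y0.1 φ + l * D Y0).toNat + 1) l φ hl hφ h0 (by push_cast; have := Int.self_le_toNat (vv α X Y0.1 φ + l * D Y0); linarith)

lemma bdd [CharZero k] (A : Amp α D t m₀ Θ) (I : Irr α D t N s Y0 Y1) : ∃ C : ℤ, ∀ (l : ℤ) (φ : L), Sec α t Y0.1 l φ → φ ≠ 0 → 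
    C ≤ vv α X Y1.1 φ + l * D Y1 := by
  obtain ⟨N0, hN0⟩ := A.bpf
  obtain ⟨v, hv⟩ := A.S.pd_cone Y0
  have h1 : ∀ i : ℕ, ∃ C : ℤ, ∀ (l : ℤ) (q : ℕ) (φ : L), l + (N0 + i : ℕ) = (q * m₀ : ℕ) → Sec α t Y0.1 l φ →
      ∃ ψ, Sec α t Y0.1 l ψ ∧ Sd.Van α t Y0.1 l (φ - ψ) ∧ (ψ = 0 ∨ C ≤ vv α X Y1.1 ψ + l * D Y1) := by
    intro i
    obtain ⟨τ, h1, h2⟩ := hN0 (N0 + i) (by omega) v (A.S.sub hv)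
    exact A.lift Y0.2.1 Y0.2.2.1 Y0.2.2.2.1 Y1 h1 fun h => h2 (h v hv)
  choose Cf hCf using h1
  obtain ⟨C, hC⟩ := ((Finset.range m₀).image Cf).bddBelow
  have key : ∀ (b : ℕ) (l : ℤ) (φ : L), l < b → Sec α t Y0.1 l φ → φ ≠ 0 → C ≤ vv α X Y1.1 φ + l * D Y1 := by
    intro b
    induction b with
    | zero => 
      intro l φ hl hφ h0
      exact absurd (A.neg_zero I (by simpa using hl) hφ) h0
    | succ b ih =>
      intro l φ hl hφ h0
      by_cases hl0 : l < 0
      · exact absurd (A.neg_zero I hl0 hφ) h0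
      have hm := A.pos
      obtain ⟨i, q, hi, hq⟩ : ∃ i q : ℕ, i < m₀ ∧ l + (N0 + i : ℕ) = (q * m₀ : ℕ) := by
        obtain ⟨a, ha⟩ := Int.eq_ofNat_of_zero_le (not_lt.1 hl0)
        have h2 := Nat.div_add_mod (a + N0) m₀
        have h3 := Nat.mod_lt (a + N0) hm
        by_cases h4 : (a + N0) % m₀ = 0
        · refine ⟨0, (a + N0) / m₀, hm, ?_⟩
          rw [ha]; norm_cast; rw [mul_comm]; omega
        · refine ⟨m₀ - (a + N0) % m₀, (a + N0) / m₀ + 1, by omega, ?_⟩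
          rw [ha]; norm_cast; rw [add_mul, mul_comm]; omega
      obtain ⟨ψ, h1, h2, h3⟩ := hCf i l q φ hq hφ
      have hC' : C ≤ Cf i := hC (Finset.mem_coe.2 (Finset.mem_image_of_mem _ (Finset.mem_range.2 hi)))
      have h3' : ψ = 0 ∨ C ≤ vv α X Y1.1 ψ + l * D Y1 := h3.imp id hC'.trans
      by_cases h4 : φ - ψ = 0
      · rw [sub_eq_zero] at h4
        subst h4
        exact h3'.resolve_left h0
      have hs : Sec α t Y0.1 l (φ - ψ) := ⟨sub_mem hφ.1 h1.1, fun v hv => by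
        have := (A.S.smul_aux (A.S.sub hv) (-1 : k) (h1.2 v hv)).1
        rw [neg_smul, one_smul] at this
        rw [sub_eq_add_neg]
        exact (A.S.add_aux (A.S.sub hv) (hφ.2 v hv) this).1⟩
      obtain ⟨h5, h6⟩ := A.dv I hs h4 h2
      have h7 := ih _ _ (by push_cast at hl; linarith [I.pos]) h5 (div_ne_zero h4 I.s0)
      rw [h6] at h7
      have h8 := I.w1
      by_cases h9 : ψ = 0
      · rw [h9, sub_zero] at h7
        linarith
      have h10 := A.S.H.vv_add Y1.2 h4 h9 (by rwa [sub_add_cancel])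
      rw [sub_add_cancel] at h10
      have h11 := h3'.resolve_left h9
      rcases min_le_iff.1 h10 with h | h <;> linarith
  exact ⟨C, fun l φ hφ h0 => key (l.toNat + 1) l φ (by push_cast; have := Int.self_le_toNat l; linarith) hφ h0⟩

lemma irr_false [CharZero k] (A : Amp α D t m₀ Θ) (I : Irr α D t N s Y0 Y1) : False := by
  obtain ⟨C, hC⟩ := A.bdd I
  obtain ⟨v, hv⟩ := A.S.pd_cone Y1
  have hv0 : v ∉ cone Y0.1 := by
    intro h
    have := (A.S.one_comp I.sec I.s0 (A.S.sub h) (I.good v (A.S.sub h)) h I.w0).2 Y1 hv I.ne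
    have := I.w1
    linarith
  obtain ⟨f, hf, ⟨e, hfe⟩, hfv⟩ := exists_sep Y0.2.2.1 hv.1 hv0
  obtain ⟨q, G, hG, hGv, hG0⟩ := A.psi' (A.S.sub hv) hfe hfv
  have h1 := A.aux (A.S.sub hv) hG
  have hne : val α t v (q * m₀ : ℕ) (aeval Θ G) ≠ 0 := by rw [h1.2]; exact hGv
  have h0 : aeval Θ G ≠ 0 := by
    intro h
    rw [h, A.S.val_zero (A.S.sub hv)] at hne
    exact hne rfl
  have hw := A.S.ww_zero hv h1.1 hne
  obtain ⟨h2, h3⟩ := A.dv I (l := (q * m₀ : ℕ)) (φ := aeval Θ G) ⟨(A.secG hG).1, fun y hy => (A.aux (A.S.sub hy) hG).1⟩ h0 (by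
    intro y hy
    rw [(A.aux (A.S.sub hy) hG).2]
    exact hG0 y (A.S.sub hy) (mem_IX.1 hf y hy))
  have h3' := h3 Y1
  rw [hw] at h3'
  have hx0 := div_ne_zero h0 I.s0
  generalize aeval Θ G / s = x at h2 h3' hx0
  generalize ((q * m₀ : ℕ) : ℤ) - N = j at h2 h3'
  have h4 := hC (((C.natAbs + 1 : ℕ) : ℤ) * j) (x ^ (C.natAbs + 1)) ⟨pow_mem h2.1 _, fun y hy => (A.S.pow_aux (A.S.sub hy) (h2.2 y hy) _).1⟩ (pow_ne_zero _ hx0)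
  rw [A.S.H.vv_pow Y1.2 hx0, mul_assoc, ← mul_add, h3'] at h4
  have h5 := I.w1
  have h6 : (((C.natAbs + 1 : ℕ) : ℤ)) * (0 - (vv α X Y1.1 s + N * D Y1)) ≤ ((C.natAbs + 1 : ℕ) : ℤ) * (-1) :=
    mul_le_mul_of_nonneg_left (by linarith) (by positivity)
  push_cast at h4 h6
  have := neg_abs_le C
  linarith

end Amp
end Bt
end Part26

section Part27
open MvPolynomial
namespace Bt
set_option linter.unusedSectionVars false
set_option linter.unusedVariables false
variable {k : Type} [Field k] {n : ℕ}
attribute [local instance] MvPolynomial.gradedAlgebra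

variable {L : Type} [Field L] [Algebra k L] {X : Set (ProjPt k n)} {d : ℕ}
    {α : MvPolynomial (Fin (n+1)) k →ₐ[k] L}
variable [IsAlgClosed k] {D : PD X d → ℤ} {t : (Fin (n+1) → k) → L} {m₀ m : ℕ} {Θ : Fin (m+1) → L}

lemma exists_setup {X : Set (ProjPt k n)} {d : ℕ} (hd : 2 ≤ d) (hX : IsSmoothVariety X d) : 
    ∃ (L : Type) (_ : Field L) (_ : Algebra k L) (α : MvPolynomial (Fin (n+1)) k →ₐ[k] L), Setup X d α := by
  have hp := IX_prime hX.2.1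
  refine ⟨FractionRing (MvPolynomial (Fin (n+1)) k ⧸ IX X), inferInstance, inferInstance, 
    (IsScalarTower.toAlgHom k (MvPolynomial (Fin (n+1)) k ⧸ IX X) (FractionRing (MvPolynomial (Fin (n+1)) k ⧸ IX X))).comp
      (Ideal.Quotient.mkₐ k (IX X)), hX, hd, ?_, ?_⟩
  · intro f
    rw [AlgHom.comp_apply, IsScalarTower.coe_toAlgHom', FaithfulSMul.algebraMap_eq_zero_iff, Ideal.Quotient.mkₐ_eq_mk, Ideal.Quotient.eq_zero_iff_mem]
  · intro φ
    obtain ⟨a, b, hb, rfl⟩ := IsFractionRing.div_surjective (A := MvPolynomial (Fin (n+1)) k ⧸ IX X) φ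
    obtain ⟨a, rfl⟩ := Ideal.Quotient.mk_surjective a
    obtain ⟨b, rfl⟩ := Ideal.Quotient.mk_surjective b
    refine ⟨a, b, ?_, rfl⟩
    rw [AlgHom.comp_apply, IsScalarTower.coe_toAlgHom']
    exact (FaithfulSMul.algebraMap_eq_zero_iff _ _).not.2 (nonZeroDivisors.ne_zero hb)

lemma Sd.bad_zero (S : Sd X d α D t) (y : Fin (n+1) → k) (l : ℤ) : Bad α t X y l 0 := by
  intro u _
  have := S.H.jet_const y u 0
  simpa using this

namespace Amp

lemma one_member [CharZero k] (A : Amp α D t m₀ Θ) {N : ℤ} (hN : 0 < N) {s : L} (hs : Sec α t X N s) (hs0 : s ≠ 0)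
    (hg : ∀ y ∈ cone X, ¬ Bad α t X y N s) {p0 : Fin (n+1) → k} (hp : p0 ∈ cone X) (hv : val α t p0 N s = 0) :
    ∃ Y₀ : PD X d, vv α X Y₀.1 s + N * D Y₀ = 1 ∧ (∀ Y : PD X d, Y ≠ Y₀ → vv α X Y.1 s + N * D Y = 0) ∧
      ∀ x ∈ Y₀.1, SmoothPtAt Y₀.1 (d - 1) x := by
  have h1 : ∃ Y : PD X d, p0 ∈ cone Y.1 ∧ vv α X Y.1 s + N * D Y ≠ 0 := by
    by_contra hc
    push Not at hc
    exact A.S.val_ne hp hs.1 hs0 hc hv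
  have hnn : ∀ Y : PD X d, 0 ≤ vv α X Y.1 s + N * D Y := by
    intro Y
    obtain ⟨v, hv⟩ := A.S.pd_cone Y
    exact A.S.ww_nonneg hv hs0 (hs.2 v (A.S.sub hv))
  obtain ⟨Y₀, hpY, hw⟩ := h1
  have hw1 : 1 ≤ vv α X Y₀.1 s + N * D Y₀ := by have := hnn Y₀; omega
  refine ⟨Y₀, (A.S.one_comp hs hs0 hp (hg p0 hp) hpY hw1).1, ?_, ?_⟩
  · intro Y hY
    by_contra h
    exact A.irr_false (N := N) (s := s) (Y0 := Y₀) (Y1 := Y) ⟨hs, hs0, hg, hw1, by have := hnn Y; omega, hY, hN⟩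
  · rintro x hx v hv rfl
    have hvY : v ∈ cone Y₀.1 := ⟨hv, hx⟩
    exact A.S.smooth_comp hs hs0 (hg v (A.S.sub hvY)) hvY hw1

lemma exists_sys [CharZero k] (A : Amp α D t m₀ Θ) {p0 : Fin (n+1) → k} (hp : p0 ∈ cone X) {nn l : ℕ} (hl : nn = l + m₀ + m₀)
    (hb : ∀ v ∈ cone X, ∃ s, Sec α t X l s ∧ val α t v l s ≠ 0) : ∃ (M : ℕ) (φ : Fin (M+1) → L), Sys A p0 l φ := by
  let V : Submodule k L := 
    { carrier := {φ | Sec α t X nn φ ∧ val α t p0 nn φ = 0}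
      zero_mem' := ⟨(A.VS nn).zero_mem, A.S.val_zero hp _⟩
      add_mem' := fun {a b} ha hb => ⟨(A.VS nn).add_mem ha.1 hb.1, by
        rw [(A.S.add_aux hp (ha.1.2 p0 hp) (hb.1.2 p0 hp)).2, ha.2, hb.2, add_zero]⟩
      smul_mem' := fun c a ha => ⟨(A.VS nn).smul_mem c ha.1, by
        rw [(A.S.smul_aux hp c (ha.1.2 p0 hp)).2, ha.2, mul_zero]⟩ }
  have hV : V ≤ A.VS nn := fun φ h => h.1
  obtain ⟨M, f, hf⟩ := Submodule.fg_iff_exists_fin_generating_family.1 (Submodule.FG.of_le (A.VS_fg nn) hV)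
  have hfV : ∀ i, f i ∈ V := fun i => by rw [← hf]; exact Submodule.subset_span ⟨i, rfl⟩
  have hn : (l : ℤ) + m₀ + m₀ = (nn : ℤ) := by rw [hl]; push_cast; ring
  have hφ : ∀ i : Fin (M+1), (Fin.cons 0 f : Fin (M+1) → L) i ∈ V := by
    intro i
    refine Fin.cases ?_ (fun j => ?_) i
    · rw [Fin.cons_zero]; exact V.zero_mem
    · rw [Fin.cons_succ]; exact hfV j
  refine ⟨M, Fin.cons 0 f, hp, fun i => ?_, fun i => ?_, ?_, hb⟩
  · rw [hn]; exact (hφ i).1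
  · rw [hn]; exact (hφ i).2
  · intro ψ h1 h2
    rw [hn] at h1 h2
    have h3 : ψ ∈ V := ⟨h1, h2⟩
    rw [← hf, Submodule.mem_span_range_iff_exists_fun] at h3
    obtain ⟨c, hc⟩ := h3
    refine ⟨Fin.cons 0 c, ?_⟩
    rw [Fin.sum_univ_succ]
    simp [hc]

end Amp

lemma closedZ {M : ℕ} (p : MvPolynomial (Fin (M+1)) k) : IsZClosed k {c : Fin (M+1) → k | ∀ r : k, eval (r • c) p = 0} := by
  refine ⟨Set.range fun (r : k) (c : Fin (M+1) → k) => eval (r • c) p, ?_, ?_⟩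
  · rintro _ ⟨r, rfl⟩
    refine ⟨M + 1, fun i => r • LinearMap.proj i, p, funext fun c => ?_⟩
    have h : (fun i => (r • (LinearMap.proj i : (Fin (M+1) → k) →ₗ[k] k)) c) = r • c := funext fun i => rfl
    rw [h]
  · ext c
    rw [Set.mem_ofPred_eq, Set.mem_ofPred_eq, Set.forall_mem_range]

set_option maxHeartbeats 1000000 in
theorem final [CharZero k] (X : Set (ProjPt k n)) (d : ℕ) (hd : 2 ≤ d) (hX : IsSmoothVariety X d)
    (D : DivisorOn X d) (hfin : HasFiniteSupport D) (hamp : IsAmpleDiv X d D) :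
    ∃ n₀ : ℕ, 0 < n₀ ∧ ∀ nn : ℕ, n₀ ≤ nn → ∀ P0 ∈ X,
      ∃ (m e : ℕ) (g : Fin (m+1) → MvPolynomial (Fin (n+1)) k)
        (h : MvPolynomial (Fin (n+1)) k),
        (∀ i, (g i).IsHomogeneous e) ∧ h.IsHomogeneous e ∧ h ∉ IX X ∧
        (∀ E : DivisorOn X d,
          (HasFiniteSupport E ∧ EffectiveDiv E ∧
              LinEquivDiv E (fun Y => (nn : ℤ) * D Y) ∧ DivThrough E P0) ↔
          (∃ c : Fin (m+1) → k, (∑ i, c i • g i) ∉ IX X ∧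
            E = fun Y => ((ordAlong X Y.1 (∑ i, c i • g i) : ℤ) -
                (ordAlong X Y.1 h : ℤ)) + (nn : ℤ) * D Y)) ∧
        ∃ Z : Set (Fin (m+1) → k), IsZClosed k Z ∧ IsCone k Z ∧
          (∃ c : Fin (m+1) → k, (∑ i, c i • g i) ∉ IX X ∧ c ∉ Z) ∧
          (∀ c : Fin (m+1) → k, (∑ i, c i • g i) ∉ IX X → c ∉ Z →
            ∃ Y₀ : {Y : Set (ProjPt k n) // IsPrimeDivisorOn X d Y},
              (((ordAlong X Y₀.1 (∑ i, c i • g i) : ℤ) -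
                  (ordAlong X Y₀.1 h : ℤ)) + (nn : ℤ) * D Y₀ = 1) ∧
              (∀ Y, Y ≠ Y₀ → ((ordAlong X Y.1 (∑ i, c i • g i) : ℤ) -
                  (ordAlong X Y.1 h : ℤ)) + (nn : ℤ) * D Y = 0) ∧
              (∀ x ∈ Y₀.1, SmoothPtAt Y₀.1 (d - 1) x)) := by
  obtain ⟨L, _, _, α, H⟩ := exists_setup hd hX
  obtain ⟨t, S⟩ := H.exists_Sd (D := D) hfin
  obtain ⟨m₀, m, Θ, A⟩ := S.exists_amp hamp
  obtain ⟨N0, hN0⟩ := A.bpf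
  refine ⟨N0 + m₀ + m₀ + 1, by omega, fun nn hnn P0 hP0 => ?_⟩
  have hp := cone_rep hP0
  obtain ⟨l, hl⟩ : ∃ l, nn = l + m₀ + m₀ := ⟨nn - m₀ - m₀, by omega⟩
  obtain ⟨M, φ, Q⟩ := A.exists_sys hp hl (hN0 l (by omega))
  obtain ⟨p, hp0, hpc⟩ := A.bertini Q
  have hn : (l : ℤ) + m₀ + m₀ = (nn : ℤ) := by rw [hl]; push_cast; ring
  have Qs := Q.sec
  have Qv := Q.val
  have Qg := Q.gen
  rw [hn] at Qs Qv Qg hpc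
  obtain ⟨e, g, h, hg, hh, hhM, hφ⟩ := common_den (α := α) (den α) (fun b hb => hb) φ (fun i => by
    obtain ⟨e, a, b, h1, h2, h3, h4⟩ := mem_K0.1 (Qs i).1
    exact ⟨e, a, b, h1, h2, h3, h4⟩)
  have hh0 : α h ≠ 0 := hhM
  have hsum : ∀ c : Fin (M+1) → k, ∑ i, c i • φ i = α (∑ i, c i • g i) / α h := by
    intro c
    rw [map_sum, Finset.sum_div]
    apply Finset.sum_congr rfl
    intro i _
    rw [hφ i, map_smul, smul_div_assoc]
  have hssec : ∀ c : Fin (M+1) → k, Sec α t X nn (∑ i, c i • φ i) := fun c => 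
    (A.VS nn).sum_mem fun i _ => (A.VS nn).smul_mem _ (Qs i)
  have hsval : ∀ c : Fin (M+1) → k, val α t P0.rep nn (∑ i, c i • φ i) = 0 := by
    intro c
    rw [(A.S.sum_aux hp Finset.univ fun i _ => (A.S.smul_aux hp (c i) ((Qs i).2 _ hp)).1).2]
    apply Finset.sum_eq_zero
    intro i _
    rw [(A.S.smul_aux hp (c i) ((Qs i).2 _ hp)).2, Qv i, mul_zero]
  have hne : ∀ c : Fin (M+1) → k, (∑ i, c i • g i) ∉ IX X ↔ ∑ i, c i • φ i ≠ 0 := by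
    intro c
    rw [hsum, ← H.ker_ne, div_ne_zero_iff]
    exact ⟨fun h => ⟨h, hh0⟩, fun h => h.1⟩
  have hww : ∀ c : Fin (M+1) → k, (∑ i, c i • g i) ∉ IX X → ∀ Y : PD X d, 
      vv α X Y.1 (∑ i, c i • φ i) = (ordAlong X Y.1 (∑ i, c i • g i) : ℤ) - (ordAlong X Y.1 h : ℤ) := by
    intro c hc Y
    rw [hsum, H.vv_frac Y.2 (H.ker_ne.2 hc) hh0]
  obtain ⟨v0, hv0⟩ := A.nonempty_cone
  have hne' : ∀ c, eval c p ≠ 0 → ∑ i, c i • φ i ≠ 0 := by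
    intro c hc h0
    have := hpc c hc v0 hv0
    rw [h0] at this
    exact this (S.bad_zero _ _)
  refine ⟨M, e, g, h, hg, hh, H.ker_ne.1 hh0, ?_, {c | ∀ r : k, eval (r • c) p = 0}, ?_, ?_, ?_, ?_⟩
  · intro E
    constructor
    · rintro ⟨-, hE, ⟨e', a, b, ha, hb, ha0, hb0, hE'⟩, Y, hY, hPY⟩
      have ha1 := H.ker_ne.2 ha0
      have hb1 := H.ker_ne.2 hb0
      have hψ0 : α a / α b ≠ 0 := div_ne_zero ha1 hb1
      have hK : α a / α b ∈ K0 α := mem_K0.2 ⟨e', a, b, ha, hb, hb1, rfl⟩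
      have hw : ∀ Y : PD X d, vv α X Y.1 (α a / α b) + nn * D Y = E Y := by
        intro Y
        have := hE' Y
        rw [H.vv_frac Y.2 ha1 hb1]
        linarith
      have hs : Sec α t X nn (α a / α b) := ⟨hK, fun v hv => S.rs_of hv hK hψ0 fun Y _ => by rw [hw]; exact hE Y⟩
      obtain ⟨c, hc⟩ := Qg _ hs (by
        by_contra hc
        apply hY
        rw [← hw]
        exact S.ww_zero (cone_rep hPY) (hs.2 _ hp) hc)
      have hcn := (hne c).2 (by rw [← hc]; exact hψ0)
      refine ⟨c, hcn, funext fun Y => ?_⟩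
      rw [← hww c hcn Y, ← hc]
      exact (hw Y).symm
    · rintro ⟨c, hc, rfl⟩
      have h0 := (hne c).1 hc
      have e1 : (fun Y : PD X d => ((ordAlong X Y.1 (∑ i, c i • g i) : ℤ) - (ordAlong X Y.1 h : ℤ)) + (nn : ℤ) * D Y)
        = fun Y : PD X d => vv α X Y.1 (∑ i, c i • φ i) + (nn : ℤ) * D Y := funext fun Y => by rw [hww c hc Y]
      refine ⟨?_, ?_, ⟨e, _, h, ?_, hh, hc, H.ker_ne.1 hh0, fun Y => by ring⟩, ?_⟩
      · rw [e1]; exact S.finite_ww (hssec c).1 h0 nn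
      · rw [e1]
        intro Y
        obtain ⟨v, hv⟩ := S.pd_cone Y
        exact S.ww_nonneg hv h0 ((hssec c).2 v (S.sub hv))
      · exact MvPolynomial.IsHomogeneous.sum _ _ _ fun i _ => by
          rw [MvPolynomial.smul_eq_C_mul]; simpa using (isHomogeneous_C _ (c i)).mul (hg i)
      · rw [e1]
        by_contra hcon
        refine S.val_ne hp (hssec c).1 h0 (fun Y hY => ?_) (hsval c)
        by_contra hz
        refine hcon ⟨Y, hz, ?_⟩
        have := (mem_cone_mk P0.rep_nonzero).1 hY
        rwa [Projectivization.mk_rep] at this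
  · exact closedZ p
  · intro c w hw r
    rw [smul_smul]
    exact hw _
  · obtain ⟨c, hc⟩ : ∃ c, eval c p ≠ 0 := by
      by_contra hcon
      push Not at hcon
      exact hp0 (MvPolynomial.funext fun c => by rw [hcon, map_zero])
    refine ⟨c, (hne c).2 (hne' c hc), fun h => hc ?_⟩
    have := h 1
    rwa [one_smul] at this
  · intro c hc hcZ
    rw [Set.mem_ofPred_eq] at hcZ
    push Not at hcZ
    obtain ⟨r, hr⟩ := hcZ
    have h0 := hne' _ hr
    have e2 : ∑ i, (r • c) i • φ i = algebraMap k L r * ∑ i, c i • φ i := by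
      rw [← Algebra.smul_def, Finset.smul_sum]
      exact Finset.sum_congr rfl fun i _ => by rw [Pi.smul_apply, smul_eq_mul, mul_smul]
    obtain ⟨Y₀, h1, h2, h3⟩ := A.one_member (N := nn) (by omega) (hssec _) h0 (hpc _ hr) hp (hsval _)
    have hr0 : r ≠ 0 := by
      rintro rfl
      rw [e2, map_zero, zero_mul] at h0
      exact h0 rfl
    have h4 : ∀ Y : PD X d, vv α X Y.1 (∑ i, (r • c) i • φ i) = (ordAlong X Y.1 (∑ i, c i • g i) : ℤ) - (ordAlong X Y.1 h : ℤ) := by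
      intro Y
      rw [e2, H.vv_mul Y.2 (by simpa using hr0) ((hne c).1 hc), H.vv_const Y.2 hr0, zero_add, hww c hc Y]
    refine ⟨Y₀, ?_, fun Y hY => ?_, h3⟩
    · rw [← h4]; exact h1
    · rw [← h4]; exact h2 Y hY

end Bt
end Part27

/-- **Bertini for linear systems of ample divisors through a point.**
Let `X` be an irreducible smooth projective variety of dimension `d ≥ 2` over an
algebraically closed field of characteristic zero and `D` an ample divisor on `X`.  Then
there is `n₀ > 0` such that for all `n ≥ n₀` and every closed point `P0 ∈ X`, a general
member of `|nD|_{P0}` (the linear system of effective divisors in `|nD|` passing through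
`P0`) is irreducible and smooth.  The linear system is presented by forms `g i / h`; the
members of `|nD|_{P0}` are exactly the divisors `div(∑ cᵢ gᵢ) − div(h) + nD`, and for all
coefficient vectors `c` outside a proper Zariski-closed cone the corresponding member is a
prime divisor with multiplicity one whose support is smooth. -/
theorem general_member_of_ample_system_through_point_irreducible_smooth
    {k : Type} [Field k] [IsAlgClosed k] [CharZero k] {n : ℕ}
    (X : Set (ProjPt k n)) (d : ℕ) (hd : 2 ≤ d) (hX : IsSmoothVariety X d)
    (D : DivisorOn X d) (hfin : HasFiniteSupport D) (hamp : IsAmpleDiv X d D) :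
    ∃ n₀ : ℕ, 0 < n₀ ∧ ∀ nn : ℕ, n₀ ≤ nn → ∀ P0 ∈ X,
      ∃ (m e : ℕ) (g : Fin (m+1) → MvPolynomial (Fin (n+1)) k)
        (h : MvPolynomial (Fin (n+1)) k),
        (∀ i, (g i).IsHomogeneous e) ∧ h.IsHomogeneous e ∧ h ∉ vanishingIdeal X ∧
        (∀ E : DivisorOn X d,
          (HasFiniteSupport E ∧ EffectiveDiv E ∧
              LinEquivDiv E (fun Y => (nn : ℤ) * D Y) ∧ DivThrough E P0) ↔
          (∃ c : Fin (m+1) → k, (∑ i, c i • g i) ∉ vanishingIdeal X ∧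
            E = fun Y => ((ordAlong X Y.1 (∑ i, c i • g i) : ℤ) -
                (ordAlong X Y.1 h : ℤ)) + (nn : ℤ) * D Y)) ∧
        ∃ Z : Set (Fin (m+1) → k), IsZClosed k Z ∧ IsCone k Z ∧
          (∃ c : Fin (m+1) → k, (∑ i, c i • g i) ∉ vanishingIdeal X ∧ c ∉ Z) ∧
          (∀ c : Fin (m+1) → k, (∑ i, c i • g i) ∉ vanishingIdeal X → c ∉ Z →
            ∃ Y₀ : {Y : Set (ProjPt k n) // IsPrimeDivisorOn X d Y},
              (((ordAlong X Y₀.1 (∑ i, c i • g i) : ℤ) -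
                  (ordAlong X Y₀.1 h : ℤ)) + (nn : ℤ) * D Y₀ = 1) ∧
              (∀ Y, Y ≠ Y₀ → ((ordAlong X Y.1 (∑ i, c i • g i) : ℤ) -
                  (ordAlong X Y.1 h : ℤ)) + (nn : ℤ) * D Y = 0) ∧
              (∀ x ∈ Y₀.1, SmoothPtAt Y₀.1 (d - 1) x)) := by
  exact Bt.final X d hd hX D hfin hamp
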